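/- Let 0 < n < d be integers, V₀ ∈ G(d, d−n), s > 0, and K = K(V₀, s) ⊂ ℝ^d. Let c₀ > 0 and let μ be a Borel measure on ℝ^d satisfying μ(B(x,r)) ≤ c₀ rⁿ for all x ∈ ℝ^d and r > 0. Then sup_{ε>0} ∫ |R^n_ε μ(x)|² dμ(x) ≤ C ( μ(ℝ^d) + ∬_{x−y ∈ K} |x−y|^{−n} dμ(x) dμ(y) ), where C depends only on d, n, c₀, and s. -/

import Mathlib

open MeasureTheory Measure Set Filter Metric
open scoped ENNReal Real Topology Classical

/-- The cone `K(V,t) = {x : dist(x,V) < t|x|}` around a subset `V` of a normed space. -/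
def coneK {E : Type*} [NormedAddCommGroup E] (V : Set E) (t : ℝ) : Set E :=
  {x | Metric.infDist x V < t * ‖x‖}

/-! ### Sums against weights of polynomial growth -/

lemma sum_le_geometric {ι : Type*} (Y : Finset ι) (f : ι → ℝ) (k : ι → ℕ) (A q : ℝ)
    (hq0 : 0 ≤ q) (hq1 : q < 1) (hA : 0 ≤ A)
    (hf : ∀ j, ∑ y ∈ Y with k y = j, f y ≤ A * q ^ j) :
    ∑ y ∈ Y, f y ≤ A * (1 - q)⁻¹ := by
  have h1 : ∑ y ∈ Y, f y = ∑ j ∈ Y.image k, ∑ y ∈ Y with k y = j, f y :=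
    (Finset.sum_fiberwise_of_maps_to (fun y hy => Finset.mem_image_of_mem k hy) f).symm
  rw [h1]
  calc ∑ j ∈ Y.image k, ∑ y ∈ Y with k y = j, f y ≤ ∑ j ∈ Y.image k, A * q ^ j :=
        Finset.sum_le_sum fun j _ => hf j
    _ = A * ∑ j ∈ Y.image k, q ^ j := by rw [Finset.mul_sum]
    _ ≤ A * (1 - q)⁻¹ := by
        gcongr
        rw [← tsum_geometric_of_lt_one hq0 hq1]
        exact (summable_geometric_of_lt_one hq0 hq1).sum_le_tsum _ (fun i _ => by positivity)

/-- A weighted family whose mass in the sublevel sets of `D` grows like the `n`-th power. -/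
lemma sum_le_of_growth_ge {ι : Type*} (Y : Finset ι) (m D : ι → ℝ) (n : ℕ) (c t a : ℝ)
    (hm : ∀ y ∈ Y, 0 ≤ m y) (ha : 0 < a) (ht : 0 < t) (hc : 0 ≤ c)
    (hg : ∀ u, 0 < u → ∑ y ∈ Y with D y ≤ u, m y ≤ c * u ^ n) :
    ∑ y ∈ Y with t ≤ D y, m y * ((D y ^ n)⁻¹ * D y ^ (-a)) ≤
      2 ^ n * (1 - 2 ^ (-a))⁻¹ * c * t ^ (-a) := by
  have hk : ∀ y, ∃ k : ℕ, t ≤ D y → 2 ^ k * t ≤ D y ∧ D y ≤ 2 ^ (k + 1) * t := by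
    intro y
    by_cases h : t ≤ D y
    · obtain ⟨k, h1, h2⟩ := exists_nat_pow_near (x := D y / t) (y := 2)
        ((one_le_div ht).2 h) one_lt_two
      refine ⟨k, fun _ => ⟨(le_div_iff₀ ht).1 h1, ((div_lt_iff₀ ht).1 h2).le⟩⟩
    · exact ⟨0, fun h' => absurd h' h⟩
  choose k hk using hk
  have hq : (2 : ℝ) ^ (-a) < 1 := Real.rpow_lt_one_of_one_lt_of_neg one_lt_two (by linarith)
  have := sum_le_geometric (Y.filter fun y => t ≤ D y)
    (fun y => m y * ((D y ^ n)⁻¹ * D y ^ (-a))) k (2 ^ n * c * t ^ (-a)) (2 ^ (-a))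
    (by positivity) hq (by positivity) ?_
  · refine this.trans (le_of_eq (by ring))
  intro j
  have hpos : (0 : ℝ) < 2 ^ j * t := by positivity
  calc ∑ y ∈ (Y.filter fun y => t ≤ D y) with k y = j, m y * ((D y ^ n)⁻¹ * D y ^ (-a))
      ≤ ∑ y ∈ (Y.filter fun y => t ≤ D y) with k y = j,
          m y * (((2 ^ j * t) ^ n)⁻¹ * (2 ^ j * t) ^ (-a)) := by
        refine Finset.sum_le_sum fun y hy => ?_
        simp only [Finset.mem_filter] at hy
        have h1 := (hk y hy.1.2).1
        rw [hy.2] at h1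
        have h3 : D y ^ (-a) ≤ (2 ^ j * t) ^ (-a) :=
          Real.rpow_le_rpow_of_nonpos hpos h1 (by linarith)
        have h4 : 0 ≤ D y ^ (-a) := Real.rpow_nonneg (hpos.le.trans h1) _
        have := hm y hy.1.1
        gcongr
    _ = (∑ y ∈ (Y.filter fun y => t ≤ D y) with k y = j, m y) *
          (((2 ^ j * t) ^ n)⁻¹ * (2 ^ j * t) ^ (-a)) := by rw [Finset.sum_mul]
    _ ≤ (c * (2 ^ (j + 1) * t) ^ n) * (((2 ^ j * t) ^ n)⁻¹ * (2 ^ j * t) ^ (-a)) := by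
        gcongr
        refine le_trans (Finset.sum_le_sum_of_subset_of_nonneg ?_ ?_)
          (hg (2 ^ (j + 1) * t) (by positivity))
        · intro y hy
          simp only [Finset.mem_filter] at hy ⊢
          refine ⟨hy.1.1, ?_⟩
          have := (hk y hy.1.2).2
          rwa [hy.2] at this
        · intro y hy _
          exact hm y (Finset.mem_filter.1 hy).1
    _ = 2 ^ n * c * t ^ (-a) * (2 ^ (-a)) ^ j := by
        rw [Real.mul_rpow (by positivity) ht.le, ← Real.rpow_natCast 2 j,
          ← Real.rpow_mul (by norm_num),
          ← Real.rpow_natCast (2 ^ (-a)) j, ← Real.rpow_mul (by norm_num), mul_comm (j : ℝ) (-a),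
          Real.rpow_natCast, pow_succ]
        field_simp
        rw [mul_right_comm, mul_pow]
        ring

lemma sum_le_of_growth_le {ι : Type*} (Y : Finset ι) (m D : ι → ℝ) (n : ℕ) (c t b : ℝ)
    (hm : ∀ y ∈ Y, 0 ≤ m y) (hD : ∀ y ∈ Y, 0 < D y) (hb : 0 < b) (ht : 0 < t) (hc : 0 ≤ c)
    (hg : ∀ u, 0 < u → ∑ y ∈ Y with D y ≤ u, m y ≤ c * u ^ n) :
    ∑ y ∈ Y with D y ≤ t, m y * ((D y ^ n)⁻¹ * D y ^ b) ≤
      2 ^ n * (1 - 2 ^ (-b))⁻¹ * c * t ^ b := by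
  have hk : ∀ y, ∃ k : ℕ, y ∈ Y → D y ≤ t → t ≤ 2 ^ (k + 1) * D y ∧ 2 ^ k * D y ≤ t := by
    intro y
    by_cases h : y ∈ Y ∧ D y ≤ t
    · obtain ⟨k, h1, h2⟩ := exists_nat_pow_near (x := t / D y) (y := 2)
        ((one_le_div (hD y h.1)).2 h.2) one_lt_two
      refine ⟨k, fun _ _ => ⟨((div_lt_iff₀ (hD y h.1)).1 h2).le, (le_div_iff₀ (hD y h.1)).1 h1⟩⟩
    · exact ⟨0, fun h' h'' => absurd ⟨h', h''⟩ h⟩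
  choose k hk using hk
  have hq : (2 : ℝ) ^ (-b) < 1 := Real.rpow_lt_one_of_one_lt_of_neg one_lt_two (by linarith)
  have := sum_le_geometric (Y.filter fun y => D y ≤ t)
    (fun y => m y * ((D y ^ n)⁻¹ * D y ^ b)) k (2 ^ n * c * t ^ b) (2 ^ (-b))
    (by positivity) hq (by positivity) ?_
  · refine this.trans (le_of_eq (by ring))
  intro j
  have hpos : (0 : ℝ) < t / 2 ^ j := by positivity
  calc ∑ y ∈ (Y.filter fun y => D y ≤ t) with k y = j, m y * ((D y ^ n)⁻¹ * D y ^ b)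
      ≤ ∑ y ∈ (Y.filter fun y => D y ≤ t) with k y = j,
          m y * (((t / 2 ^ (j + 1)) ^ n)⁻¹ * (t / 2 ^ j) ^ b) := by
        refine Finset.sum_le_sum fun y hy => ?_
        simp only [Finset.mem_filter] at hy
        obtain ⟨h1, h2⟩ := hk y hy.1.1 hy.1.2
        rw [hy.2] at h1 h2
        have hDp := hD y hy.1.1
        have h1' : t / 2 ^ (j + 1) ≤ D y := by rw [div_le_iff₀ (by positivity)]; linarith
        have h2' : D y ≤ t / 2 ^ j := by rw [le_div_iff₀ (by positivity)]; linarith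
        have := hm y hy.1.1
        gcongr
    _ = (∑ y ∈ (Y.filter fun y => D y ≤ t) with k y = j, m y) *
          (((t / 2 ^ (j + 1)) ^ n)⁻¹ * (t / 2 ^ j) ^ b) := by rw [Finset.sum_mul]
    _ ≤ (c * (t / 2 ^ j) ^ n) * (((t / 2 ^ (j + 1)) ^ n)⁻¹ * (t / 2 ^ j) ^ b) := by
        gcongr
        refine le_trans (Finset.sum_le_sum_of_subset_of_nonneg ?_ ?_)
          (hg (t / 2 ^ j) (by positivity))
        · intro y hy
          simp only [Finset.mem_filter] at hy ⊢
          refine ⟨hy.1.1, ?_⟩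
          have := (hk y hy.1.1 hy.1.2).2
          rw [hy.2] at this
          rw [le_div_iff₀ (by positivity)]; linarith
        · intro y hy _
          exact hm y (Finset.mem_filter.1 hy).1
    _ = 2 ^ n * c * t ^ b * (2 ^ (-b)) ^ j := by
        rw [Real.div_rpow ht.le (by positivity), ← Real.rpow_natCast 2 j,
          ← Real.rpow_mul (by norm_num),
          ← Real.rpow_natCast (2 ^ (-b)) j, ← Real.rpow_mul (by norm_num), mul_comm (j : ℝ) b,
          neg_mul, Real.rpow_neg (by norm_num) (b * j),
          Real.rpow_natCast, pow_succ]
        field_simp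
        rw [mul_assoc, ← mul_pow]
        congr 2
        field_simp

section Growth

variable {ι : Type*} (Y : Finset ι) (m D : ι → ℝ) (n : ℕ) (c : ℝ)

lemma growth_tail (hm : ∀ y ∈ Y, 0 ≤ m y) (hc : 0 ≤ c)
    (hg : ∀ u, 0 < u → ∑ y ∈ Y with D y ≤ u, m y ≤ c * u ^ n) {t : ℝ} (ht : 0 < t) :
    ∑ y ∈ Y with t ≤ D y, m y * (D y ^ (n + 1))⁻¹ ≤ 2 ^ (n + 1) * c * t⁻¹ := by
  have h := sum_le_of_growth_ge Y m D n c t 1 hm one_pos ht hc hg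
  refine le_trans (le_of_eq ?_) (h.trans (le_of_eq ?_))
  · refine Finset.sum_congr rfl fun y _ => ?_
    rw [Real.rpow_neg_one, pow_succ, mul_inv]
  · rw [Real.rpow_neg_one, Real.rpow_neg_one]
    ring

lemma growth_ball (hm : ∀ y ∈ Y, 0 ≤ m y) (hD : ∀ y ∈ Y, 0 < D y) (hc : 0 ≤ c)
    (hg : ∀ u, 0 < u → ∑ y ∈ Y with D y ≤ u, m y ≤ c * u ^ n) {t : ℝ} (ht : 0 < t) :
    ∑ y ∈ Y with D y ≤ t, m y * ((D y ^ n)⁻¹ * D y) ≤ 2 ^ (n + 1) * c * t := by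
  have h := sum_le_of_growth_le Y m D n c t 1 hm hD one_pos ht hc hg
  refine le_trans (le_of_eq ?_) (h.trans (le_of_eq ?_))
  · refine Finset.sum_congr rfl fun y _ => ?_
    rw [Real.rpow_one]
  · rw [Real.rpow_neg_one, Real.rpow_one]
    ring

lemma inv_one_sub_rpow_neg_half_le : (1 - (2 : ℝ) ^ (-(1 / 2 : ℝ)))⁻¹ ≤ 4 := by
  have h0 : (2 : ℝ) ^ (-(1 / 2 : ℝ)) ≤ 3 / 4 := by
    rw [Real.rpow_neg (by norm_num), ← Real.sqrt_eq_rpow,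
      inv_le_comm₀ (by positivity) (by norm_num)]
    exact Real.le_sqrt_of_sq_le (by norm_num)
  rw [inv_le_comm₀ (by linarith) (by norm_num)]
  linarith

lemma growth_ball_sqrt (hm : ∀ y ∈ Y, 0 ≤ m y) (hD : ∀ y ∈ Y, 0 < D y) (hc : 0 ≤ c)
    (hg : ∀ u, 0 < u → ∑ y ∈ Y with D y ≤ u, m y ≤ c * u ^ n) {t : ℝ} (ht : 0 < t) :
    ∑ y ∈ Y with D y ≤ t, m y * ((D y ^ n)⁻¹ * √(D y)) ≤ 2 ^ (n + 2) * c * √t := by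
  have h := sum_le_of_growth_le Y m D n c t (1 / 2) hm hD one_half_pos ht hc hg
  simp only [← Real.sqrt_eq_rpow] at h
  refine h.trans ?_
  rw [pow_add]
  have := inv_one_sub_rpow_neg_half_le
  have h4 : (2 : ℝ) ^ 2 = 4 := by norm_num
  rw [h4]
  gcongr

lemma growth_annulus (hm : ∀ y ∈ Y, 0 ≤ m y) (hc : 0 ≤ c)
    (hg : ∀ u, 0 < u → ∑ y ∈ Y with D y ≤ u, m y ≤ c * u ^ n) {t T : ℝ} (ht : 0 < t) :
    ∑ y ∈ Y with t ≤ D y ∧ D y ≤ T, m y * (D y ^ n)⁻¹ ≤ 2 ^ (n + 2) * c * √(T / t) := by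
  have h := sum_le_of_growth_ge Y m D n c t (1 / 2) hm one_half_pos ht hc hg
  have h5 : (2 : ℝ) ^ n * (1 - 2 ^ (-(1 / 2) : ℝ))⁻¹ * c * t ^ (-(1 / 2) : ℝ) ≤
      2 ^ (n + 2) * c * (√t)⁻¹ := by
    rw [pow_add, Real.rpow_neg ht.le, ← Real.sqrt_eq_rpow]
    have := inv_one_sub_rpow_neg_half_le
    have h4 : (2 : ℝ) ^ 2 = 4 := by norm_num
    rw [h4]
    gcongr
  have h6 : ∑ y ∈ Y with t ≤ D y ∧ D y ≤ T, m y * (D y ^ n)⁻¹ ≤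
      ∑ y ∈ Y with t ≤ D y, √T * (m y * ((D y ^ n)⁻¹ * D y ^ (-(1 / 2) : ℝ))) := by
    refine le_trans (Finset.sum_le_sum (g := fun y => √T * (m y * ((D y ^ n)⁻¹ *
      D y ^ (-(1 / 2) : ℝ)))) fun y hy => ?_)
      (Finset.sum_le_sum_of_subset_of_nonneg ?_ ?_)
    · simp only [Finset.mem_filter] at hy
      have hDy : 0 < D y := ht.trans_le hy.2.1
      have := hm y hy.1
      rw [Real.rpow_neg hDy.le, ← Real.sqrt_eq_rpow]
      have h7 : 1 ≤ √T * (√(D y))⁻¹ := by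
        rw [← div_eq_mul_inv, one_le_div (by positivity)]
        exact Real.sqrt_le_sqrt hy.2.2
      calc m y * (D y ^ n)⁻¹ ≤ (m y * (D y ^ n)⁻¹) * (√T * (√(D y))⁻¹) :=
            le_mul_of_one_le_right (by positivity) h7
        _ = _ := by ring
    · intro y hy
      simp only [Finset.mem_filter] at hy ⊢
      exact ⟨hy.1, hy.2.1⟩
    · intro y hy _
      simp only [Finset.mem_filter] at hy
      have := hm y hy.1
      have hDy : 0 < D y := ht.trans_le hy.2
      positivity
  rw [← Finset.mul_sum] at h6
  refine h6.trans ?_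
  calc √T * _ ≤ √T * (2 ^ (n + 2) * c * (√t)⁻¹) := by gcongr; exact h.trans h5
    _ = 2 ^ (n + 2) * c * √(T / t) := by rw [Real.sqrt_div' _ ht.le]; ring

end Growth

/-! ### Regularised kernels on finite weighted sets -/

section Kernel

variable {E : Type*} [NormedAddCommGroup E]

/-- Distance between `x` and `y`, regularised by a scale function `ρ`. -/
noncomputable def sep (ρ : E → ℝ) (x y : E) : ℝ := max ‖x - y‖ (ρ x + ρ y)

/-- Admissible scale functions: positive and `1`-Lipschitz. -/
structure IsScale (ρ : E → ℝ) : Prop where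
  pos : ∀ x, 0 < ρ x
  lip : ∀ x y, ρ x ≤ ρ y + ‖x - y‖

/-- The weighted set `(X, m)` has `n`-dimensional growth with constant `c`, down to scale `ρ`. -/
def Growth (n : ℕ) (c : ℝ) (ρ : E → ℝ) (m : E → ℝ) (X : Finset E) : Prop :=
  ∀ x ∈ X, ∀ u, 0 < u → ∑ y ∈ X with sep ρ x y ≤ u, m y ≤ c * u ^ n

variable {ρ ρ' : E → ℝ} {m : E → ℝ} {X Y : Finset E} {n : ℕ} {c : ℝ}

lemma sep_comm (ρ : E → ℝ) (x y : E) : sep ρ x y = sep ρ y x := by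
  rw [sep, sep, norm_sub_rev, add_comm]

lemma norm_le_sep (ρ : E → ℝ) (x y : E) : ‖x - y‖ ≤ sep ρ x y := le_max_left _ _

lemma add_le_sep (ρ : E → ℝ) (x y : E) : ρ x + ρ y ≤ sep ρ x y := le_max_right _ _

lemma left_le_sep (h : ∀ x, 0 < ρ x) (x y : E) : ρ x ≤ sep ρ x y :=
  (by linarith [h y] : ρ x ≤ ρ x + ρ y).trans (add_le_sep _ _ _)

lemma sep_pos (h : ∀ x, 0 < ρ x) (x y : E) : 0 < sep ρ x y :=
  (h x).trans_le (left_le_sep h x y)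

lemma sep_triangle (h : ∀ x, 0 < ρ x) (x y z : E) : sep ρ x z ≤ sep ρ x y + sep ρ y z := by
  refine max_le ?_ ?_
  · have := norm_sub_le_norm_sub_add_norm_sub x y z
    linarith [norm_le_sep ρ x y, norm_le_sep ρ y z]
  · linarith [add_le_sep ρ x y, add_le_sep ρ y z, h y]

lemma IsScale.sep_le (h : IsScale ρ) (x y z : E) : sep ρ x z ≤ sep ρ y z + ‖x - y‖ := by
  refine max_le ?_ ?_
  · have := norm_sub_le_norm_sub_add_norm_sub x y z
    linarith [norm_le_sep ρ y z]
  · linarith [add_le_sep ρ y z, h.lip x y]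

lemma sep_mono (h : ∀ x, ρ x ≤ ρ' x) (x y : E) : sep ρ x y ≤ sep ρ' x y :=
  max_le_max le_rfl (add_le_add (h x) (h y))

lemma Growth.subset (h : Growth n c ρ m X) (hm : ∀ x, 0 ≤ m x) (hY : Y ⊆ X) :
    Growth n c ρ m Y := fun x hx u hu =>
  (Finset.sum_le_sum_of_subset_of_nonneg (Finset.filter_subset_filter _ hY)
    fun y _ _ => hm y).trans (h x (hY hx) u hu)

lemma Growth.mono (h : Growth n c ρ m X) (hm : ∀ x, 0 ≤ m x) (hρ : ∀ x, ρ x ≤ ρ' x) :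
    Growth n c ρ' m X := fun x hx u hu =>
  (Finset.sum_le_sum_of_subset_of_nonneg (Finset.monotone_filter_right _
    fun y _ hy => (sep_mono hρ x y).trans hy)
    fun y _ _ => hm y).trans (h x hx u hu)

lemma Growth.tail (h : Growth n 1 ρ m X) (hm : ∀ x, 0 ≤ m x) {x : E} (hx : x ∈ X)
    {t : ℝ} (ht : 0 < t) :
    ∑ y ∈ X with t ≤ sep ρ x y, m y * (sep ρ x y ^ (n + 1))⁻¹ ≤ 2 ^ (n + 1) * t⁻¹ := by
  have := growth_tail X m (sep ρ x) n 1 (fun y _ => hm y) zero_le_one (h x hx) ht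
  rwa [mul_one] at this

lemma Growth.ball (h : Growth n 1 ρ m X) (hm : ∀ x, 0 ≤ m x) (hρ : ∀ x, 0 < ρ x) {x : E}
    (hx : x ∈ X) {t : ℝ} (ht : 0 < t) :
    ∑ y ∈ X with sep ρ x y ≤ t, m y * ((sep ρ x y ^ n)⁻¹ * sep ρ x y) ≤ 2 ^ (n + 1) * t := by
  have := growth_ball X m (sep ρ x) n 1 (fun y _ => hm y) (fun y _ => sep_pos hρ x y)
    zero_le_one (h x hx) ht
  rwa [mul_one] at this

lemma Growth.ball_sqrt (h : Growth n 1 ρ m X) (hm : ∀ x, 0 ≤ m x) (hρ : ∀ x, 0 < ρ x) {x : E}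
    (hx : x ∈ X) {t : ℝ} (ht : 0 < t) :
    ∑ y ∈ X with sep ρ x y ≤ t, m y * ((sep ρ x y ^ n)⁻¹ * √(sep ρ x y)) ≤
      2 ^ (n + 2) * √t := by
  have := growth_ball_sqrt X m (sep ρ x) n 1 (fun y _ => hm y) (fun y _ => sep_pos hρ x y)
    zero_le_one (h x hx) ht
  rwa [mul_one] at this

lemma Growth.annulus (h : Growth n 1 ρ m X) (hm : ∀ x, 0 ≤ m x) {x : E}
    (hx : x ∈ X) {t T : ℝ} (ht : 0 < t) :
    ∑ y ∈ X with t ≤ sep ρ x y ∧ sep ρ x y ≤ T, m y * (sep ρ x y ^ n)⁻¹ ≤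
      2 ^ (n + 2) * √(T / t) := by
  have := growth_annulus X m (sep ρ x) n 1 (fun y _ => hm y) zero_le_one (h x hx) (T := T) ht
  rwa [mul_one] at this

lemma Growth.sum_le (h : Growth n 1 ρ m X) (hm : ∀ x, 0 ≤ m x) (hρ : ∀ x, 0 < ρ x) {x : E}
    (hx : x ∈ X) : ∑ y ∈ X, m y * (sep ρ x y ^ (n + 1))⁻¹ ≤ 2 ^ (n + 1) * (ρ x)⁻¹ := by
  have := h.tail hm hx (hρ x)
  rwa [Finset.filter_true_of_mem fun y _ => left_le_sep hρ x y] at this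

lemma Growth.sum_le_right (h : Growth n 1 ρ m X) (hm : ∀ x, 0 ≤ m x) (hρ : ∀ x, 0 < ρ x)
    {x : E} (hx : x ∈ X) : ∑ y ∈ X, m y * (sep ρ y x ^ (n + 1))⁻¹ ≤ 2 ^ (n + 1) * (ρ x)⁻¹ := by
  simpa only [sep_comm ρ _ x] using h.sum_le hm hρ hx

/-- The potential of `m ρ` against the kernel `sep ^ -(n+1)`. -/
noncomputable def spot (n : ℕ) (ρ m : E → ℝ) (X : Finset E) (x : E) : ℝ :=
  ∑ y ∈ X, m y * (ρ y * (sep ρ x y ^ (n + 1))⁻¹)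

lemma spot_pair (hρ : ∀ x, 0 < ρ x) (x y z : E) (hle : sep ρ x y ≤ sep ρ x z) :
    (ρ y * (sep ρ x y ^ (n + 1))⁻¹) * (ρ z * (sep ρ x z ^ (n + 1))⁻¹) ≤
      2 ^ (n + 1) * (ρ y * (sep ρ x y ^ (n + 1))⁻¹ * (ρ z * (sep ρ y z ^ (n + 1))⁻¹)) := by
  have h1 : sep ρ y z ≤ 2 * sep ρ x z := by
    have := sep_triangle hρ y x z
    rw [sep_comm ρ y x] at this
    linarith
  have hxz := sep_pos hρ x z
  have hyz := sep_pos hρ y z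
  have hxy := sep_pos hρ x y
  have h2 : (sep ρ x z ^ (n + 1))⁻¹ ≤ 2 ^ (n + 1) * (sep ρ y z ^ (n + 1))⁻¹ := by
    rw [← div_eq_mul_inv, ← div_pow, ← inv_pow]
    gcongr
    rw [inv_eq_one_div, div_le_div_iff₀ hxz hyz]
    linarith
  have hy := hρ y
  have hz := hρ z
  calc _ ≤ (ρ y * (sep ρ x y ^ (n + 1))⁻¹) * (ρ z * (2 ^ (n + 1) * (sep ρ y z ^ (n + 1))⁻¹)) := by
        gcongr
    _ = _ := by ring

lemma sum_spot_sq_le (h : Growth n 1 ρ m X) (hm : ∀ x, 0 ≤ m x) (hρ : ∀ x, 0 < ρ x) :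
    ∑ x ∈ X, m x * spot n ρ m X x ^ 2 ≤ 2 ^ (3 * n + 4) * ∑ x ∈ X, m x := by
  set T : E → E → E → ℝ := fun x y z =>
    m x * m y * m z * (ρ y * (sep ρ x y ^ (n + 1))⁻¹ * (ρ z * (sep ρ y z ^ (n + 1))⁻¹)) with hT
  have hTnn : ∀ x y z, 0 ≤ T x y z := fun x y z => by
    have := hm x
    have := hm y
    have := hm z
    have := hρ y
    have := hρ z
    have := sep_pos hρ x y
    have := sep_pos hρ y z
    positivity
  have hpt : ∀ x y z, m x * ((m y * (ρ y * (sep ρ x y ^ (n + 1))⁻¹)) *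
      (m z * (ρ z * (sep ρ x z ^ (n + 1))⁻¹))) ≤ 2 ^ (n + 1) * (T x y z + T x z y) := by
    intro x y z
    have hmm : 0 ≤ m x * m y * m z := mul_nonneg (mul_nonneg (hm x) (hm y)) (hm z)
    rcases le_total (sep ρ x y) (sep ρ x z) with hle | hle
    · have := mul_le_mul_of_nonneg_left (spot_pair (n := n) hρ x y z hle) hmm
      have h2 : 0 ≤ (2 : ℝ) ^ (n + 1) * T x z y := mul_nonneg (by positivity) (hTnn x z y)
      calc _ = m x * m y * m z * ((ρ y * (sep ρ x y ^ (n + 1))⁻¹) *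
              (ρ z * (sep ρ x z ^ (n + 1))⁻¹)) := by ring
        _ ≤ _ := this
        _ = 2 ^ (n + 1) * T x y z := by simp only [hT]; ring
        _ ≤ _ := by linarith
    · have := mul_le_mul_of_nonneg_left (spot_pair (n := n) hρ x z y hle) hmm
      have h2 : 0 ≤ (2 : ℝ) ^ (n + 1) * T x y z := mul_nonneg (by positivity) (hTnn x y z)
      calc _ = m x * m y * m z * ((ρ z * (sep ρ x z ^ (n + 1))⁻¹) *
              (ρ y * (sep ρ x y ^ (n + 1))⁻¹)) := by ring
        _ ≤ _ := this
        _ = 2 ^ (n + 1) * T x z y := by simp only [hT]; ring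
        _ ≤ _ := by linarith
  have hsum : ∑ x ∈ X, ∑ y ∈ X, ∑ z ∈ X, T x y z ≤ 2 ^ (2 * n + 2) * ∑ z ∈ X, m z := by
    calc ∑ x ∈ X, ∑ y ∈ X, ∑ z ∈ X, T x y z
        = ∑ z ∈ X, ∑ y ∈ X, ∑ x ∈ X, T x y z := by
          rw [Finset.sum_congr rfl fun x _ => Finset.sum_comm, Finset.sum_comm]
          exact Finset.sum_congr rfl fun z _ => Finset.sum_comm
      _ = ∑ z ∈ X, ∑ y ∈ X, (m y * m z * ρ y * (ρ z * (sep ρ y z ^ (n + 1))⁻¹)) *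
            ∑ x ∈ X, m x * (sep ρ x y ^ (n + 1))⁻¹ := by
          refine Finset.sum_congr rfl fun z _ => Finset.sum_congr rfl fun y _ => ?_
          rw [Finset.mul_sum]
          refine Finset.sum_congr rfl fun x _ => ?_
          simp only [hT]
          ring
      _ ≤ ∑ z ∈ X, ∑ y ∈ X, (m y * m z * ρ y * (ρ z * (sep ρ y z ^ (n + 1))⁻¹)) *
            (2 ^ (n + 1) * (ρ y)⁻¹) := by
          refine Finset.sum_le_sum fun z _ => Finset.sum_le_sum fun y hy => ?_
          have := hm y
          have := hm z
          have := hρ y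
          have := hρ z
          have := sep_pos hρ y z
          gcongr
          exact h.sum_le_right hm hρ hy
      _ = ∑ z ∈ X, (2 ^ (n + 1) * m z * ρ z) * ∑ y ∈ X, m y * (sep ρ y z ^ (n + 1))⁻¹ := by
          refine Finset.sum_congr rfl fun z _ => ?_
          rw [Finset.mul_sum]
          refine Finset.sum_congr rfl fun y _ => ?_
          have := (hρ y).ne'
          field_simp
      _ ≤ ∑ z ∈ X, (2 ^ (n + 1) * m z * ρ z) * (2 ^ (n + 1) * (ρ z)⁻¹) := by
          refine Finset.sum_le_sum fun z hz => ?_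
          have := hm z
          have := hρ z
          gcongr
          exact h.sum_le_right hm hρ hz
      _ = 2 ^ (2 * n + 2) * ∑ z ∈ X, m z := by
          rw [Finset.mul_sum]
          refine Finset.sum_congr rfl fun z _ => ?_
          have := (hρ z).ne'
          field_simp
          ring
  calc ∑ x ∈ X, m x * spot n ρ m X x ^ 2
      = ∑ x ∈ X, ∑ y ∈ X, ∑ z ∈ X, m x * ((m y * (ρ y * (sep ρ x y ^ (n + 1))⁻¹)) *
          (m z * (ρ z * (sep ρ x z ^ (n + 1))⁻¹))) := by
        refine Finset.sum_congr rfl fun x _ => ?_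
        rw [spot, sq, Finset.sum_mul_sum, Finset.mul_sum]
        refine Finset.sum_congr rfl fun y _ => ?_
        rw [Finset.mul_sum]
    _ ≤ ∑ x ∈ X, ∑ y ∈ X, ∑ z ∈ X, 2 ^ (n + 1) * (T x y z + T x z y) :=
        Finset.sum_le_sum fun x _ => Finset.sum_le_sum fun y _ => Finset.sum_le_sum fun z _ =>
          hpt x y z
    _ = 2 ^ (n + 1) * (∑ x ∈ X, ∑ y ∈ X, ∑ z ∈ X, T x y z +
          ∑ x ∈ X, ∑ y ∈ X, ∑ z ∈ X, T x y z) := by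
        have : ∀ x, ∑ y ∈ X, ∑ z ∈ X, T x z y = ∑ y ∈ X, ∑ z ∈ X, T x y z := fun x =>
          Finset.sum_comm
        simp only [← Finset.mul_sum, Finset.sum_add_distrib, this]
    _ ≤ 2 ^ (n + 1) * (2 ^ (2 * n + 2) * ∑ z ∈ X, m z + 2 ^ (2 * n + 2) * ∑ z ∈ X, m z) := by
        gcongr
    _ = 2 ^ (3 * n + 4) * ∑ x ∈ X, m x := by ring

end Kernel

/-! ### Random partitions adapted to a scale function -/

lemma monotone_floor_cast : Monotone fun t : ℝ => (⌊t⌋ : ℝ) := fun _ _ h =>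
  Int.cast_le.2 (Int.floor_mono h)

lemma integral_floor_add (a : ℝ) : ∫ u in (0 : ℝ)..1, (⌊a + u⌋ : ℝ) = a := by
  have h1 : ∫ u in (0 : ℝ)..1, (⌊a + u⌋ : ℝ) = ∫ t in a..(a + 1), (⌊t⌋ : ℝ) := by
    have := intervalIntegral.integral_comp_add_left (a := 0) (b := 1) (fun t : ℝ => (⌊t⌋ : ℝ)) a
    simpa using this
  have hfl : ∀ p q : ℝ, IntervalIntegrable (fun t : ℝ => (⌊t⌋ : ℝ)) volume p q := fun p q =>
    monotone_floor_cast.intervalIntegrable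
  have hid : ∀ p q : ℝ, IntervalIntegrable (fun t : ℝ => t) volume p q := fun p q =>
    continuous_id.intervalIntegrable p q
  have hfr : ∀ p q : ℝ, ∫ t in p..q, Int.fract t =
      (∫ t in p..q, t) - ∫ t in p..q, (⌊t⌋ : ℝ) := fun p q => by
    rw [← intervalIntegral.integral_sub (hid p q) (hfl p q)]
    rfl
  have hper : ∫ t in a..(a + 1), Int.fract t = ∫ t in (0 : ℝ)..(0 + 1), Int.fract t :=
    Function.Periodic.intervalIntegral_add_eq (fun x => Int.fract_add_one x) a 0
  have h0 : ∫ t in (0 : ℝ)..(0 + 1), (⌊t⌋ : ℝ) = 0 := by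
    have hae : ∀ᵐ t : ℝ, t ∈ Set.uIoc (0 : ℝ) (0 + 1) → (⌊t⌋ : ℝ) = 0 := by
      have : ∀ᵐ t : ℝ, t ≠ 1 := by simp [ae_iff]
      filter_upwards [this] with t ht h
      rw [zero_add, Set.uIoc_of_le zero_le_one] at h
      exact_mod_cast Int.floor_eq_zero_iff.2 ⟨h.1.le, lt_of_le_of_ne h.2 ht⟩
    rw [intervalIntegral.integral_congr_ae hae]
    simp
  have e1 := hfr a (a + 1)
  have e2 := hfr 0 (0 + 1)
  rw [integral_id] at e1 e2
  rw [h0] at e2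
  rw [hper, e2] at e1
  rw [h1]
  linarith

lemma exists_shift_sum_le {κ : Type*} (s : Finset κ) (w a b : κ → ℝ) (hw : ∀ i ∈ s, 0 ≤ w i) :
    ∃ u ∈ Icc (0 : ℝ) 1, ∑ i ∈ s, (if ⌊a i + u⌋ ≠ ⌊b i + u⌋ then w i else 0) ≤
      ∑ i ∈ s, w i * |a i - b i| := by
  have h_int : ∀ a : ℝ, IntegrableOn (fun u : ℝ => (⌊a + u⌋ : ℝ)) (Icc 0 1) := fun a => by
    have : Monotone fun u : ℝ => (⌊a + u⌋ : ℝ) := fun x y h =>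
      monotone_floor_cast (by linarith : a + x ≤ a + y)
    exact (this.monotoneOn _).integrableOn_isCompact isCompact_Icc
  have hval : ∀ a : ℝ, ∫ u in Icc (0 : ℝ) 1, (⌊a + u⌋ : ℝ) = a := fun a => by
    rw [integral_Icc_eq_integral_Ioc, ← intervalIntegral.integral_of_le zero_le_one,
      integral_floor_add]
  set f : ℝ → ℝ := fun u => ∑ i ∈ s, w i * ((⌊max (a i) (b i) + u⌋ : ℝ) - ⌊min (a i) (b i) + u⌋)
    with hf
  have hterm : ∀ i, IntegrableOn (fun u : ℝ => w i *
      ((⌊max (a i) (b i) + u⌋ : ℝ) - ⌊min (a i) (b i) + u⌋)) (Icc 0 1) := fun i =>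
    ((h_int _).sub (h_int _)).const_mul _
  have hfint : IntegrableOn f (Icc 0 1) := integrable_finsetSum _ fun i _ => hterm i
  obtain ⟨u, hu, hle⟩ := exists_le_setAverage (μ := volume) (s := Icc (0 : ℝ) 1) (f := f)
    (by simp) (by simp) hfint
  refine ⟨u, hu, le_trans (Finset.sum_le_sum fun i hi => ?_) (hle.trans (le_of_eq ?_))⟩
  · have hmono : ⌊min (a i) (b i) + u⌋ ≤ ⌊max (a i) (b i) + u⌋ :=
      Int.floor_mono (by linarith [min_le_max (a := a i) (b := b i)])
    have hwi := hw i hi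
    split_ifs with h
    · have hne : ⌊min (a i) (b i) + u⌋ ≠ ⌊max (a i) (b i) + u⌋ := by
        rcases le_total (a i) (b i) with h' | h'
        · rw [min_eq_left h', max_eq_right h']
          exact h
        · rw [min_eq_right h', max_eq_left h']
          exact h.symm
      have h1 : ⌊min (a i) (b i) + u⌋ + 1 ≤ ⌊max (a i) (b i) + u⌋ :=
        Int.add_one_le_iff.2 (lt_of_le_of_ne hmono hne)
      have h2 : (1 : ℝ) ≤ (⌊max (a i) (b i) + u⌋ : ℝ) - ⌊min (a i) (b i) + u⌋ := by
        have : ((⌊min (a i) (b i) + u⌋ + 1 : ℤ) : ℝ) ≤ (⌊max (a i) (b i) + u⌋ : ℝ) := by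
          exact_mod_cast h1
        push_cast at this
        linarith
      exact le_mul_of_one_le_right hwi h2
    · have : ((⌊min (a i) (b i) + u⌋ : ℤ) : ℝ) ≤ (⌊max (a i) (b i) + u⌋ : ℝ) := by
        exact_mod_cast hmono
      exact mul_nonneg hwi (by linarith)
  · rw [setAverage_eq]
    simp only [Real.volume_real_Icc, sub_zero, max_eq_left zero_le_one, inv_one, one_smul]
    rw [hf]
    beta_reduce
    rw [integral_finsetSum _ fun i _ => hterm i]
    refine Finset.sum_congr rfl fun i _ => ?_
    rw [integral_const_mul, integral_sub (h_int _) (h_int _), hval, hval, max_sub_min_eq_abs']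

section Partition

variable {d : ℕ}

/-- The cell of `x` in the grid of mesh `exp (k x) / l` shifted by `v`. -/
noncomputable def gridCell (l : ℝ) (k : EuclideanSpace ℝ (Fin d) → ℤ) (v : Fin d → ℝ)
    (x : EuclideanSpace ℝ (Fin d)) : ℤ × (Fin d → ℤ) :=
  (k x, fun j => ⌊x j * (l * Real.exp (-(k x))) + v j⌋)

lemma norm_le_sum_abs (x : EuclideanSpace ℝ (Fin d)) : ‖x‖ ≤ ∑ j, |x j| := by
  rw [EuclideanSpace.norm_eq, Real.sqrt_le_iff]
  refine ⟨Finset.sum_nonneg fun j _ => abs_nonneg _, ?_⟩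
  simp only [Real.norm_eq_abs]
  exact Finset.sum_sq_le_sq_sum_of_nonneg fun j _ => abs_nonneg _

lemma abs_apply_le_norm (x : EuclideanSpace ℝ (Fin d)) (j : Fin d) : |x j| ≤ ‖x‖ := by
  rw [← Real.norm_eq_abs]
  exact PiLp.norm_apply_le x j

variable {ρ : EuclideanSpace ℝ (Fin d) → ℝ}

lemma exp_level_bounds (hρ : ∀ x, 0 < ρ x) {u : ℝ} (hu : u ∈ Icc (0 : ℝ) 1)
    (x : EuclideanSpace ℝ (Fin d)) :
    ρ x ≤ 3 * Real.exp (⌊Real.log (ρ x) + u⌋) ∧ Real.exp (⌊Real.log (ρ x) + u⌋) ≤ 3 * ρ x := by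
  have he : Real.exp 1 ≤ 3 := by linarith [Real.exp_one_lt_d9]
  have h1 := Int.floor_le (Real.log (ρ x) + u)
  have h2 := Int.lt_floor_add_one (Real.log (ρ x) + u)
  have hx := Real.exp_log (hρ x)
  constructor
  · calc ρ x = Real.exp (Real.log (ρ x)) := hx.symm
      _ ≤ Real.exp (1 + ⌊Real.log (ρ x) + u⌋) := Real.exp_le_exp.2 (by linarith [hu.1])
      _ = Real.exp 1 * Real.exp (⌊Real.log (ρ x) + u⌋) := Real.exp_add _ _
      _ ≤ _ := by gcongr
  · calc Real.exp (⌊Real.log (ρ x) + u⌋) ≤ Real.exp (1 + Real.log (ρ x)) :=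
          Real.exp_le_exp.2 (by linarith [hu.2])
      _ = Real.exp 1 * ρ x := by rw [Real.exp_add, hx]
      _ ≤ _ := by gcongr; exact (hρ x).le

lemma norm_sub_le_of_gridCell_eq {l : ℝ} (hl : 0 < l) (k : EuclideanSpace ℝ (Fin d) → ℤ)
    (v : Fin d → ℝ) {x y : EuclideanSpace ℝ (Fin d)} (h : gridCell l k v x = gridCell l k v y) :
    ‖x - y‖ ≤ d * (Real.exp (k x) / l) := by
  simp only [gridCell, Prod.mk.injEq] at h
  obtain ⟨hk, hc⟩ := h
  refine (norm_le_sum_abs _).trans ?_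
  calc ∑ j, |(x - y) j| ≤ ∑ _j : Fin d, Real.exp (k x) / l := by
        refine Finset.sum_le_sum fun j _ => ?_
        have hj := congrFun hc j
        simp only [← hk] at hj
        have := Int.abs_sub_lt_one_of_floor_eq_floor hj
        rw [add_sub_add_right_eq_sub, ← sub_mul, abs_mul,
          abs_of_pos (by positivity : 0 < l * Real.exp (-(k x))),
          Real.exp_neg] at this
        rw [PiLp.sub_apply, le_div_iff₀ hl]
        have hp := Real.exp_pos (k x)
        have h3 : |x j - y j| * l = |x j - y j| * (l * (Real.exp (k x))⁻¹) * Real.exp (k x) := by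
          field_simp
        rw [h3]
        exact (mul_le_mul_of_nonneg_right this.le hp.le).trans (by rw [one_mul])
    _ = _ := by simp

/-- Cardinality bound for families of cells of comparable size near a given point. -/
noncomputable def packConst (d : ℕ) (A : ℕ) : ℕ :=
  (2 * (A + 3) + 1) * (2 * (90 * (d + 1) * A ^ 2 + 1) + 1) ^ d

lemma card_le_of_injOn_gridCell (hρ : ∀ x, 0 < ρ x) {u : ℝ} (hu : u ∈ Icc (0 : ℝ) 1)
    (v : Fin d → ℝ) (A : ℕ) (hA : 0 < A) (F : Finset (EuclideanSpace ℝ (Fin d)))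
    (x : EuclideanSpace ℝ (Fin d)) (h1 : ∀ z ∈ F, ‖z - x‖ ≤ A * ρ x)
    (h2 : ∀ z ∈ F, ρ x ≤ A * ρ z) (h3 : ∀ z ∈ F, ρ z ≤ A * ρ x)
    (hinj : Set.InjOn (gridCell (30 * (d + 1)) (fun z => ⌊Real.log (ρ z) + u⌋) v) F) :
    F.card ≤ packConst d A := by
  set k : EuclideanSpace ℝ (Fin d) → ℤ := fun z => ⌊Real.log (ρ z) + u⌋ with hk
  set l : ℝ := 30 * (d + 1) with hl
  have hl0 : 0 < l := by positivity
  have hA' : (0 : ℝ) < A := by exact_mod_cast hA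
  set N : ℕ := 90 * (d + 1) * A ^ 2 + 1 with hN
  set f : EuclideanSpace ℝ (Fin d) → ℤ × (Fin d → ℤ) := fun z =>
    (k z - ⌊Real.log (ρ x)⌋, fun j => ⌊z j * (l * Real.exp (-(k z))) + v j⌋ -
      ⌊x j * (l * Real.exp (-(k z))) + v j⌋) with hf
  have hmaps : ∀ z ∈ F, f z ∈ Finset.Icc (-((A + 3 : ℕ) : ℤ)) ((A + 3 : ℕ) : ℤ) ×ˢ
      Fintype.piFinset (fun _ : Fin d => Finset.Icc (-(N : ℤ)) (N : ℤ)) := by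
    intro z hz
    rw [Finset.mem_product]
    refine ⟨?_, ?_⟩
    · have hlz : Real.log (ρ z) ≤ A + Real.log (ρ x) := by
        have := Real.log_le_log (hρ z) (h3 z hz)
        rw [Real.log_mul hA'.ne' (hρ x).ne'] at this
        linarith [Real.log_le_sub_one_of_pos hA']
      have hlx : Real.log (ρ x) ≤ A + Real.log (ρ z) := by
        have := Real.log_le_log (hρ x) (h2 z hz)
        rw [Real.log_mul hA'.ne' (hρ z).ne'] at this
        linarith [Real.log_le_sub_one_of_pos hA']
      have e1 := Int.floor_le (Real.log (ρ x))
      have e2 := Int.lt_floor_add_one (Real.log (ρ x))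
      have e3 := Int.floor_le (Real.log (ρ z) + u)
      have e4 := Int.lt_floor_add_one (Real.log (ρ z) + u)
      simp only [hf, hk, Finset.mem_Icc]
      constructor
      · have : (-((A + 3 : ℕ) : ℤ) : ℝ) ≤ ((⌊Real.log (ρ z) + u⌋ - ⌊Real.log (ρ x)⌋ : ℤ) : ℝ) := by
          push_cast
          linarith [hu.1]
        exact_mod_cast this
      · have : ((⌊Real.log (ρ z) + u⌋ - ⌊Real.log (ρ x)⌋ : ℤ) : ℝ) ≤ (((A + 3 : ℕ) : ℤ) : ℝ) := by
          push_cast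
          linarith [hu.2]
        exact_mod_cast this
    · rw [Fintype.mem_piFinset]
      intro j
      have hexp := (exp_level_bounds hρ hu z).1
      have hp := Real.exp_pos (k z)
      have hzx : |z j * (l * Real.exp (-(k z))) - x j * (l * Real.exp (-(k z)))| ≤
          90 * (d + 1) * A ^ 2 := by
        rw [← sub_mul, abs_mul, abs_of_pos (by positivity : 0 < l * Real.exp (-(k z))),
          Real.exp_neg]
        have h4 : |z j - x j| ≤ A * (A * (3 * Real.exp (k z))) := by
          calc |z j - x j| ≤ ‖z - x‖ := by simpa using abs_apply_le_norm (z - x) j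
            _ ≤ A * ρ x := h1 z hz
            _ ≤ A * (A * ρ z) := by gcongr; exact h2 z hz
            _ ≤ _ := by gcongr
        calc |z j - x j| * (l * (Real.exp (k z))⁻¹)
            ≤ A * (A * (3 * Real.exp (k z))) * (l * (Real.exp (k z))⁻¹) := by gcongr
          _ = _ := by rw [hl]; field_simp; ring
      rw [abs_le] at hzx
      have e1 := Int.floor_le (z j * (l * Real.exp (-(k z))) + v j)
      have e2 := Int.lt_floor_add_one (z j * (l * Real.exp (-(k z))) + v j)
      have e3 := Int.floor_le (x j * (l * Real.exp (-(k z))) + v j)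
      have e4 := Int.lt_floor_add_one (x j * (l * Real.exp (-(k z))) + v j)
      simp only [hf, Finset.mem_Icc]
      constructor
      · have : (-(N : ℤ) : ℝ) ≤ ((⌊z j * (l * Real.exp (-(k z))) + v j⌋ -
            ⌊x j * (l * Real.exp (-(k z))) + v j⌋ : ℤ) : ℝ) := by
          rw [hN]
          push_cast
          linarith
        exact_mod_cast this
      · have : ((⌊z j * (l * Real.exp (-(k z))) + v j⌋ -
            ⌊x j * (l * Real.exp (-(k z))) + v j⌋ : ℤ) : ℝ) ≤ ((N : ℤ) : ℝ) := by
          rw [hN]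
          push_cast
          linarith
        exact_mod_cast this
  have hinjf : Set.InjOn f F := by
    intro y hy z hz hyz
    refine hinj hy hz ?_
    simp only [hf, Prod.mk.injEq, sub_left_inj] at hyz
    obtain ⟨hk1, hc⟩ := hyz
    simp only [gridCell, Prod.mk.injEq]
    refine ⟨hk1, funext fun j => ?_⟩
    have := congrFun hc j
    simp only [← hk1] at this ⊢
    exact sub_left_injective this
  have := Finset.card_le_card_of_injOn f hmaps hinjf
  refine this.trans (le_of_eq ?_)
  rw [Finset.card_product, Fintype.card_piFinset, Int.card_Icc, Int.card_Icc, packConst]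
  simp only [Finset.prod_const, Finset.card_univ, Fintype.card_fin]
  congr 1
  · omega
  · congr 1
    omega

lemma abs_log_sub_log_le {a b t : ℝ} (ha : 0 < a) (hab : |a - b| ≤ t) (hb : a / 2 ≤ b) :
    |Real.log a - Real.log b| ≤ 2 * (t / a) := by
  have hb0 : 0 < b := by linarith
  have ht : 0 ≤ t := (abs_nonneg _).trans hab
  rw [abs_le] at hab ⊢
  constructor
  · have := Real.log_le_sub_one_of_pos (div_pos hb0 ha)
    rw [Real.log_div hb0.ne' ha.ne'] at this
    have h2 : b / a - 1 ≤ t / a := by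
      rw [div_sub_one ha.ne']
      gcongr
      linarith
    have : 0 ≤ t / a := by positivity
    linarith
  · have := Real.log_le_sub_one_of_pos (div_pos ha hb0)
    rw [Real.log_div ha.ne' hb0.ne'] at this
    have h2 : a / b - 1 ≤ 2 * (t / a) := by
      rw [div_sub_one hb0.ne', ← mul_div_assoc, div_le_div_iff₀ hb0 ha]
      nlinarith
    linarith

/-- Low-boundary partition at scale `ρ`: cells have diameter `≤ ρ / 10`, few pairs are cut, and
comparable cells are packed. -/
lemma exists_partition (hρ : IsScale ρ) (X : Finset (EuclideanSpace ℝ (Fin d)))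
    (w : EuclideanSpace ℝ (Fin d) → EuclideanSpace ℝ (Fin d) → ℝ) (hw : ∀ x z, 0 ≤ w x z)
    (hws : ∀ x z, w x z ≠ 0 → ‖x - z‖ ≤ ρ x / 2) :
    ∃ c : EuclideanSpace ℝ (Fin d) → ℤ × (Fin d → ℤ),
      (∀ x z, c x = c z → ‖x - z‖ ≤ ρ x / 10) ∧
      (∑ x ∈ X, ∑ z ∈ X, (if c x ≠ c z then w x z else 0) ≤
        (2 + 90 * d * (d + 1)) * ∑ x ∈ X, ∑ z ∈ X, w x z * (‖x - z‖ / ρ x)) ∧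
      (∀ (A : ℕ), 0 < A → ∀ (F : Finset (EuclideanSpace ℝ (Fin d)))
        (x : EuclideanSpace ℝ (Fin d)), (∀ z ∈ F, ‖z - x‖ ≤ A * ρ x) →
        (∀ z ∈ F, ρ x ≤ A * ρ z) → (∀ z ∈ F, ρ z ≤ A * ρ x) → Set.InjOn c F →
        F.card ≤ packConst d A) := by
  set l : ℝ := 30 * (d + 1) with hl
  have hl0 : 0 < l := by positivity
  simp only [← Finset.sum_product']
  obtain ⟨u, hu, hu'⟩ := exists_shift_sum_le (X ×ˢ X) (fun p => w p.1 p.2)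
    (fun p => Real.log (ρ p.1)) (fun p => Real.log (ρ p.2)) fun p _ => hw _ _
  set k : EuclideanSpace ℝ (Fin d) → ℤ := fun z => ⌊Real.log (ρ z) + u⌋ with hk
  have hv : ∀ j : Fin d, ∃ v : ℝ, ∑ p ∈ X ×ˢ X,
      (if ⌊p.1 j * (l * Real.exp (-(k p.1))) + v⌋ ≠ ⌊p.2 j * (l * Real.exp (-(k p.2))) + v⌋
        then (if k p.1 = k p.2 then w p.1 p.2 else 0) else 0) ≤
      ∑ p ∈ X ×ˢ X, 3 * l * (w p.1 p.2 * (‖p.1 - p.2‖ / ρ p.1)) := fun j => by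
    obtain ⟨v, -, hv⟩ := exists_shift_sum_le (X ×ˢ X)
      (fun p => if k p.1 = k p.2 then w p.1 p.2 else 0)
      (fun p => p.1 j * (l * Real.exp (-(k p.1)))) (fun p => p.2 j * (l * Real.exp (-(k p.2))))
      fun p _ => by split_ifs; exacts [hw _ _, le_rfl]
    refine ⟨v, hv.trans (Finset.sum_le_sum fun p _ => ?_)⟩
    have hw0 := hw p.1 p.2
    have hρ0 := hρ.pos p.1
    split_ifs with h
    · rw [← h, ← sub_mul, abs_mul, abs_of_pos (by positivity : 0 < l * Real.exp (-(k p.1))),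
        Real.exp_neg]
      have h5 : (Real.exp (k p.1))⁻¹ ≤ 3 / ρ p.1 := by
        rw [inv_eq_one_div, div_le_div_iff₀ (Real.exp_pos _) hρ0]
        linarith [(exp_level_bounds hρ.pos hu p.1).1]
      have h6 : |p.1 j - p.2 j| ≤ ‖p.1 - p.2‖ := by simpa using abs_apply_le_norm (p.1 - p.2) j
      calc w p.1 p.2 * (|p.1 j - p.2 j| * (l * (Real.exp (k p.1))⁻¹))
          ≤ w p.1 p.2 * (‖p.1 - p.2‖ * (l * (3 / ρ p.1))) := by gcongr
        _ = _ := by ring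
    · rw [zero_mul]
      positivity
  choose v hv using hv
  refine ⟨gridCell l k v, fun x z h => ?_, ?_, fun A hA F x h1 h2 h3 h4 =>
    card_le_of_injOn_gridCell hρ.pos hu v A hA F x h1 h2 h3 h4⟩
  · refine (norm_sub_le_of_gridCell_eq hl0 k v h).trans ?_
    have := (exp_level_bounds hρ.pos hu x).2
    rw [← mul_div_assoc, div_le_div_iff₀ hl0 (by norm_num), hl]
    have hx := hρ.pos x
    have hd : (0 : ℝ) ≤ d := Nat.cast_nonneg _
    calc (d : ℝ) * Real.exp (k x) * 10 ≤ d * (3 * ρ x) * 10 := by gcongr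
      _ ≤ ρ x * (30 * (d + 1)) := by nlinarith
  · have hcut : ∀ p : EuclideanSpace ℝ (Fin d) × EuclideanSpace ℝ (Fin d),
        (if gridCell l k v p.1 ≠ gridCell l k v p.2 then w p.1 p.2 else 0) ≤
        (if k p.1 ≠ k p.2 then w p.1 p.2 else 0) + ∑ j, 
        (if ⌊p.1 j * (l * Real.exp (-(k p.1))) + v j⌋ ≠ ⌊p.2 j * (l * Real.exp (-(k p.2))) + v j⌋
        then (if k p.1 = k p.2 then w p.1 p.2 else 0) else 0) := by
      intro p
      have hw0 := hw p.1 p.2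
      have hnn : ∀ j, 0 ≤ (if ⌊p.1 j * (l * Real.exp (-(k p.1))) + v j⌋ ≠
          ⌊p.2 j * (l * Real.exp (-(k p.2))) + v j⌋
          then (if k p.1 = k p.2 then w p.1 p.2 else 0) else 0) := fun j => by
        split_ifs <;> first | exact hw0 | exact le_rfl
      by_cases hkp : k p.1 = k p.2
      · by_cases hc : gridCell l k v p.1 = gridCell l k v p.2
        · rw [if_neg (by simpa using hc)]
          refine add_nonneg ?_ (Finset.sum_nonneg fun j _ => hnn j)
          split_ifs <;> first | exact hw0 | exact le_rfl
        · obtain ⟨j, hj⟩ : ∃ j, ⌊p.1 j * (l * Real.exp (-(k p.1))) + v j⌋ ≠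
              ⌊p.2 j * (l * Real.exp (-(k p.2))) + v j⌋ := by
            by_contra hcon
            push Not at hcon
            exact hc (Prod.ext hkp (funext hcon))
          have := Finset.single_le_sum (fun j _ => hnn j) (Finset.mem_univ j)
          rw [if_pos hj, if_pos hkp] at this
          rw [if_pos hc, if_neg (by simpa using hkp), zero_add]
          simpa only [if_pos hkp] using this
      · rw [if_pos hkp]
        have h7 := Finset.sum_nonneg fun j (_ : j ∈ Finset.univ) => hnn j
        by_cases hc : gridCell l k v p.1 ≠ gridCell l k v p.2
        · rw [if_pos hc]
          linarith
        · rw [if_neg hc]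
          linarith
    refine (Finset.sum_le_sum fun p _ => hcut p).trans ?_
    rw [Finset.sum_add_distrib, Finset.sum_comm]
    have hB := Finset.sum_le_sum fun j (_ : j ∈ (Finset.univ : Finset (Fin d))) => hv j
    have hA : ∑ p ∈ X ×ˢ X, (if k p.1 ≠ k p.2 then w p.1 p.2 else 0) ≤
        ∑ p ∈ X ×ˢ X, 2 * (w p.1 p.2 * (‖p.1 - p.2‖ / ρ p.1)) := by
      refine hu'.trans (Finset.sum_le_sum fun p _ => ?_)
      by_cases hw0 : w p.1 p.2 = 0
      · simp [hw0]
      · have h8 := hws _ _ hw0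
        have h9 := hρ.lip p.1 p.2
        have h10 := hρ.lip p.2 p.1
        rw [norm_sub_rev] at h10
        have := abs_log_sub_log_le (hρ.pos p.1) (b := ρ p.2) (t := ‖p.1 - p.2‖)
          (abs_le.2 ⟨by linarith, by linarith⟩) (by linarith)
        calc _ ≤ w p.1 p.2 * (2 * (‖p.1 - p.2‖ / ρ p.1)) :=
              mul_le_mul_of_nonneg_left this (hw _ _)
          _ = _ := by ring
    rw [Finset.sum_const, Finset.card_univ, Fintype.card_fin, nsmul_eq_mul] at hB
    rw [← Finset.mul_sum] at hA hB
    refine (add_le_add hA hB).trans (le_of_eq ?_)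
    rw [hl]
    ring

end Partition

/-! ### Splitting the Riesz energy along a partition -/

set_option linter.unusedSectionVars false

section Split

variable {E : Type*} [NormedAddCommGroup E] [InnerProductSpace ℝ E]

/-- The regularised Riesz kernel. -/
noncomputable def rk (n : ℕ) (ρ : E → ℝ) (x y : E) : E := (sep ρ x y ^ (n + 1))⁻¹ • (x - y)

/-- The regularised Riesz transform of the weighted set `(X, m)`. -/
noncomputable def riesz (n : ℕ) (ρ m : E → ℝ) (X : Finset E) (x : E) : E :=
  ∑ y ∈ X, m y • rk n ρ x y

/-- The Riesz energy of the weighted set `(X, m)`. -/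
noncomputable def rieszEnergy (n : ℕ) (ρ m : E → ℝ) (X : Finset E) : ℝ :=
  ∑ x ∈ X, m x * ‖riesz n ρ m X x‖ ^ 2

variable {ρ ρ' : E → ℝ} {m : E → ℝ} {X : Finset E} {n : ℕ} {ι : Type*} {c : E → ι}

lemma rk_antisymm (n : ℕ) (ρ : E → ℝ) (x y : E) : rk n ρ x y = -rk n ρ y x := by
  rw [rk, rk, sep_comm, ← smul_neg, neg_sub]

lemma norm_rk (hρ : ∀ x, 0 < ρ x) (x y : E) :
    ‖rk n ρ x y‖ = (sep ρ x y ^ (n + 1))⁻¹ * ‖x - y‖ := by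
  rw [rk, norm_smul, norm_inv, norm_pow, Real.norm_of_nonneg (sep_pos hρ x y).le]

lemma norm_rk_le (hρ : ∀ x, 0 < ρ x) (x y : E) : ‖rk n ρ x y‖ ≤ (sep ρ x y ^ n)⁻¹ := by
  rw [norm_rk hρ, pow_succ, mul_inv, mul_assoc]
  have := sep_pos hρ x y
  refine mul_le_of_le_one_right (by positivity) ?_
  rw [inv_mul_le_iff₀ this, mul_one]
  exact norm_le_sep ρ x y

lemma norm_rk_sub_rk_le (hρ : IsScale ρ) (x y z : E) (h : 4 * ‖x - y‖ ≤ sep ρ x z) :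
    ‖rk n ρ x z - rk n ρ y z‖ ≤ (n + 2) * 2 ^ (n + 1) * ‖x - y‖ * (sep ρ x z ^ (n + 1))⁻¹ := by
  set a := sep ρ x z with ha
  set b := sep ρ y z with hb
  have ha0 : 0 < a := sep_pos hρ.pos x z
  have hb0 : 0 < b := sep_pos hρ.pos y z
  have h1 : a ≤ b + ‖x - y‖ := hρ.sep_le x y z
  have h2 : b ≤ a + ‖x - y‖ := by simpa [norm_sub_rev] using hρ.sep_le y x z
  have hyz : ‖y - z‖ ≤ b := norm_le_sep ρ y z
  have hab : a ≤ 2 * b := by linarith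
  have hba : b ≤ 2 * a := by linarith
  have hdecomp : rk n ρ x z - rk n ρ y z = (a ^ (n + 1))⁻¹ • (x - y) +
      ((a ^ (n + 1))⁻¹ - (b ^ (n + 1))⁻¹) • (y - z) := by
    rw [rk, rk, ← ha, ← hb, sub_smul, add_sub, ← smul_add, sub_add_sub_cancel]
  have hdiff : |(a ^ (n + 1))⁻¹ - (b ^ (n + 1))⁻¹| * b ≤
      (n + 1) * 2 ^ (n + 1) * ‖x - y‖ * (a ^ (n + 1))⁻¹ := by
    have h3 : |b ^ (n + 1) - a ^ (n + 1)| ≤ ‖x - y‖ * (n + 1) * (2 * b) ^ n := by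
      have := abs_pow_sub_pow_le b a (n + 1)
      rw [abs_of_pos ha0, abs_of_pos hb0, Nat.add_sub_cancel] at this
      refine this.trans ?_
      push_cast
      have h4 : |b - a| ≤ ‖x - y‖ := abs_le.2 ⟨by linarith, by linarith⟩
      have h5 : max b a ≤ 2 * b := max_le (by linarith) hab
      have h6 : 0 ≤ max b a := hb0.le.trans (le_max_left _ _)
      gcongr
    rw [inv_sub_inv (by positivity) (by positivity), abs_div, abs_mul,
      abs_of_pos (by positivity : 0 < a ^ (n + 1)), abs_of_pos (by positivity : 0 < b ^ (n + 1))]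
    calc |b ^ (n + 1) - a ^ (n + 1)| / (a ^ (n + 1) * b ^ (n + 1)) * b
        ≤ ‖x - y‖ * (n + 1) * (2 * b) ^ n / (a ^ (n + 1) * b ^ (n + 1)) * b := by gcongr
      _ = (n + 1) * 2 ^ n * ‖x - y‖ * (a ^ (n + 1))⁻¹ := by
          rw [mul_pow, pow_succ b n]
          field_simp
      _ ≤ _ := by gcongr <;> norm_num
  rw [hdecomp]
  calc _ ≤ ‖(a ^ (n + 1))⁻¹ • (x - y)‖ + ‖((a ^ (n + 1))⁻¹ - (b ^ (n + 1))⁻¹) • (y - z)‖ :=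
        norm_add_le _ _
    _ ≤ (a ^ (n + 1))⁻¹ * ‖x - y‖ + |(a ^ (n + 1))⁻¹ - (b ^ (n + 1))⁻¹| * b := by
        rw [norm_smul, norm_smul, Real.norm_of_nonneg (by positivity), Real.norm_eq_abs]
        gcongr
    _ ≤ (a ^ (n + 1))⁻¹ * ‖x - y‖ + (n + 1) * 2 ^ (n + 1) * ‖x - y‖ * (a ^ (n + 1))⁻¹ := by
        gcongr
    _ ≤ 2 ^ (n + 1) * ((a ^ (n + 1))⁻¹ * ‖x - y‖) +
          (n + 1) * 2 ^ (n + 1) * ‖x - y‖ * (a ^ (n + 1))⁻¹ := by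
        have h6 : (1 : ℝ) ≤ 2 ^ (n + 1) := one_le_pow₀ (by norm_num)
        have h7 : 0 ≤ (a ^ (n + 1))⁻¹ * ‖x - y‖ := by positivity
        linarith [le_mul_of_one_le_left h7 h6]
    _ = _ := by ring

/-- The boundary potential of the partition `c` at scale `ρ'`. -/
noncomputable def cutPot (n : ℕ) (ρ ρ' m : E → ℝ) (c : E → ι) (X : Finset E) (x : E) : ℝ :=
  ∑ z ∈ X with c z ≠ c x ∧ ‖x - z‖ ≤ ρ' x, m z * ((sep ρ x z ^ n)⁻¹ * √(ρ' x / sep ρ x z))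

lemma sep_le_of_norm_le (hρ : IsScale ρ) {x y : E} {t : ℝ} (h1 : ρ x ≤ t)
    (h : ‖x - y‖ ≤ t) : sep ρ x y ≤ 3 * t := by
  have := hρ.lip y x
  rw [norm_sub_rev] at this
  exact max_le (by linarith [norm_nonneg (x - y)]) (by linarith)

lemma cutPot_nonneg (hm : ∀ x, 0 ≤ m x) (hρ : ∀ x, 0 < ρ x) (x : E) :
    0 ≤ cutPot n ρ ρ' m c X x :=
  Finset.sum_nonneg fun y _ => mul_nonneg (hm y)
    (mul_nonneg (inv_nonneg.2 (pow_nonneg (sep_pos hρ x y).le _)) (Real.sqrt_nonneg _))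

lemma sum_cut_le_cutPot (hm : ∀ x, 0 ≤ m x) (hρ : IsScale ρ)
    (hle : ∀ x, ρ x ≤ ρ' x) (x : E) :
    ∑ z ∈ X with c z ≠ c x ∧ ‖x - z‖ ≤ ρ' x, m z * (sep ρ x z ^ n)⁻¹ ≤
      2 * cutPot n ρ ρ' m c X x := by
  rw [cutPot, Finset.mul_sum]
  refine Finset.sum_le_sum fun z hz => ?_
  simp only [Finset.mem_filter] at hz
  have hD := sep_pos hρ.pos x z
  have h3 := sep_le_of_norm_le hρ (hle x) hz.2.2
  have h4 : 1 ≤ 2 * √(ρ' x / sep ρ x z) := by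
    have : (1 / 2 : ℝ) ≤ √(ρ' x / sep ρ x z) := by
      apply Real.le_sqrt_of_sq_le
      rw [le_div_iff₀ hD]
      linarith
    linarith
  have := hm z
  calc _ ≤ (m z * (sep ρ x z ^ n)⁻¹) * (2 * √(ρ' x / sep ρ x z)) :=
        le_mul_of_one_le_right (by positivity) h4
    _ = _ := by ring

lemma sum_cut_sq_le (hG : Growth n 1 ρ m X) (hm : ∀ x, 0 ≤ m x) (hρ : IsScale ρ)
    (hρ' : ∀ x, 0 < ρ' x) (hle : ∀ x, ρ x ≤ ρ' x) {x : E} (hx : x ∈ X) :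
    (∑ z ∈ X with c z ≠ c x ∧ ‖x - z‖ ≤ ρ' x, m z * (sep ρ x z ^ n)⁻¹) ^ 2 ≤
      2 ^ (n + 4) * cutPot n ρ ρ' m c X x := by
  set Z := X.filter fun z => c z ≠ c x ∧ ‖x - z‖ ≤ ρ' x with hZ
  set f : E → ℝ := fun z => m z * (sep ρ x z ^ n)⁻¹ with hf
  have hD := fun z => sep_pos hρ.pos x z
  have hfnn : ∀ z, 0 ≤ f z := fun z => by have := hm z; have := hD z; positivity
  have h1 : ∀ y ∈ Z, ∑ z ∈ Z with sep ρ x y ≤ sep ρ x z, f z ≤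
      2 ^ (n + 2) * (2 * √(ρ' x / sep ρ x y)) := by
    intro y hy
    have h2 := hG.annulus hm hx (T := 3 * ρ' x) (hD y)
    refine (Finset.sum_le_sum_of_subset_of_nonneg ?_ fun z _ _ => hfnn z).trans (h2.trans ?_)
    · intro z hz
      simp only [hZ, Finset.mem_filter] at hz ⊢
      exact ⟨hz.1.1, hz.2, sep_le_of_norm_le hρ (hle x) hz.1.2.2⟩
    · gcongr
      rw [show (2 : ℝ) = √4 by rw [show (4 : ℝ) = 2 ^ 2 by norm_num]; simp,
        ← Real.sqrt_mul (by norm_num)]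
      apply Real.sqrt_le_sqrt
      have := hρ' x
      have := hD y
      rw [mul_div_assoc]
      gcongr
      norm_num
  rw [sq, Finset.sum_mul_sum]
  calc ∑ y ∈ Z, ∑ z ∈ Z, f y * f z
      ≤ ∑ y ∈ Z, ∑ z ∈ Z, ((if sep ρ x y ≤ sep ρ x z then f y * f z else 0) +
          (if sep ρ x z ≤ sep ρ x y then f z * f y else 0)) := by
        refine Finset.sum_le_sum fun y _ => Finset.sum_le_sum fun z _ => ?_
        have h5 := mul_nonneg (hfnn y) (hfnn z)
        have h6 := mul_nonneg (hfnn z) (hfnn y)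
        rcases le_total (sep ρ x y) (sep ρ x z) with h | h
        · rw [if_pos h]
          split_ifs <;> linarith
        · rw [if_pos h, mul_comm (f z)]
          split_ifs <;> linarith
    _ = 2 * ∑ y ∈ Z, ∑ z ∈ Z, (if sep ρ x y ≤ sep ρ x z then f y * f z else 0) := by
        simp only [Finset.sum_add_distrib]
        rw [Finset.sum_comm (f := fun y z => if sep ρ x z ≤ sep ρ x y then f z * f y else 0)]
        ring
    _ = 2 * ∑ y ∈ Z, f y * ∑ z ∈ Z with sep ρ x y ≤ sep ρ x z, f z := by
        congr 1
        refine Finset.sum_congr rfl fun y _ => ?_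
        rw [Finset.mul_sum, Finset.sum_filter (s := Z)]
    _ ≤ 2 * ∑ y ∈ Z, f y * (2 ^ (n + 2) * (2 * √(ρ' x / sep ρ x y))) := by
        gcongr with y hy
        · exact hfnn y
        · exact h1 y hy
    _ = 2 ^ (n + 4) * cutPot n ρ ρ' m c X x := by
        rw [cutPot, ← hZ, Finset.mul_sum, Finset.mul_sum]
        refine Finset.sum_congr rfl fun y _ => ?_
        simp only [hf]
        ring

lemma norm_rk_sub_rk_scale_le (hρ : ∀ x, 0 < ρ x) (hρ' : IsScale ρ') (hle : ∀ x, ρ x ≤ ρ' x)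
    {x y : E} (h : ρ' x ≤ ‖x - y‖) :
    ‖rk n ρ x y - rk n ρ' x y‖ ≤ 3 ^ n * ((ρ' x + ρ' y) * (sep ρ' x y ^ (n + 1))⁻¹) := by
  have hD := sep_pos hρ x y
  have hD' := sep_pos hρ'.pos x y
  have hx := hρ'.pos x
  have hy := hρ'.pos y
  have hDD := sep_mono hle x y
  rcases le_total (ρ' x + ρ' y) ‖x - y‖ with h1 | h1
  · have e1 : sep ρ' x y = ‖x - y‖ := max_eq_left h1
    have e2 : sep ρ x y = ‖x - y‖ := max_eq_left (by linarith [hle x, hle y])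
    rw [rk, rk, e1, e2, sub_self, norm_zero]
    positivity
  · have e1 : sep ρ' x y = ρ' x + ρ' y := max_eq_right h1
    have hxy : 0 < ‖x - y‖ := hx.trans_le h
    have h2 : sep ρ' x y ≤ 3 * ‖x - y‖ := by
      have := hρ'.lip y x
      rw [norm_sub_rev] at this
      linarith
    have h3 : ‖rk n ρ x y - rk n ρ' x y‖ ≤ (sep ρ x y ^ (n + 1))⁻¹ * ‖x - y‖ := by
      rw [rk, rk, ← sub_smul, norm_smul, Real.norm_eq_abs]
      gcongr
      have h4 : (sep ρ' x y ^ (n + 1))⁻¹ ≤ (sep ρ x y ^ (n + 1))⁻¹ := by gcongr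
      have h5 : 0 < (sep ρ' x y ^ (n + 1))⁻¹ := by positivity
      rw [abs_of_nonneg (by linarith)]
      linarith
    refine h3.trans ?_
    rw [← e1]
    calc (sep ρ x y ^ (n + 1))⁻¹ * ‖x - y‖ ≤ (‖x - y‖ ^ (n + 1))⁻¹ * ‖x - y‖ := by
          gcongr
          exact norm_le_sep ρ x y
      _ = (‖x - y‖ ^ n)⁻¹ := by rw [pow_succ]; field_simp
      _ ≤ ((sep ρ' x y / 3) ^ n)⁻¹ := by gcongr; linarith
      _ = _ := by rw [div_pow, pow_succ (sep ρ' x y) n]; field_simp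

/-- The part of the Riesz transform at `x` coming from other cells. -/
noncomputable def offRiesz (n : ℕ) (ρ m : E → ℝ) (c : E → ι) (X : Finset E) (x : E) : E :=
  ∑ y ∈ X with c y ≠ c x, m y • rk n ρ x y

lemma norm_offRiesz_sub_le (hG : Growth n 1 ρ m X) (hm : ∀ x, 0 ≤ m x) (hρ : IsScale ρ)
    (hρ' : IsScale ρ') (hle : ∀ x, ρ x ≤ ρ' x)
    (hc : ∀ x z, c x = c z → ‖x - z‖ ≤ ρ' x / 10) {x : E} (hx : x ∈ X) :
    ‖offRiesz n ρ m c X x - riesz n ρ' m X x‖ ≤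
      (3 ^ n + 1) * 2 ^ (n + 1) + 3 ^ n * spot n ρ' m X x +
        ∑ z ∈ X with c z ≠ c x ∧ ‖x - z‖ ≤ ρ' x, m z * (sep ρ x z ^ n)⁻¹ := by
  have hG' : Growth n 1 ρ' m X := hG.mono hm hle
  have hxp := hρ'.pos x
  have hpt : ∀ y, ‖(if c y ≠ c x then m y • rk n ρ x y else 0) - m y • rk n ρ' x y‖ ≤
      (3 ^ n + 1) * ρ' x * (m y * (sep ρ' x y ^ (n + 1))⁻¹) +
      3 ^ n * (m y * (ρ' y * (sep ρ' x y ^ (n + 1))⁻¹)) +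
      (if c y ≠ c x ∧ ‖x - y‖ ≤ ρ' x then m y * (sep ρ x y ^ n)⁻¹ else 0) := by
    intro y
    have hmy := hm y
    have hy := hρ'.pos y
    have hD' := sep_pos hρ'.pos x y
    have hD := sep_pos hρ.pos x y
    have hK' : ‖x - y‖ ≤ ρ' x → ‖m y • rk n ρ' x y‖ ≤
        ρ' x * (m y * (sep ρ' x y ^ (n + 1))⁻¹) := fun h => by
      rw [norm_smul, Real.norm_of_nonneg hmy, norm_rk hρ'.pos]
      calc m y * ((sep ρ' x y ^ (n + 1))⁻¹ * ‖x - y‖)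
          ≤ m y * ((sep ρ' x y ^ (n + 1))⁻¹ * ρ' x) := by gcongr
        _ = _ := by ring
    have hB : 0 ≤ ρ' x * (m y * (sep ρ' x y ^ (n + 1))⁻¹) := by positivity
    have hB3 : 0 ≤ 3 ^ n * (ρ' x * (m y * (sep ρ' x y ^ (n + 1))⁻¹)) := by positivity
    have hS : 0 ≤ 3 ^ n * (m y * (ρ' y * (sep ρ' x y ^ (n + 1))⁻¹)) := by positivity
    by_cases hcy : c y = c x
    · rw [if_neg (by simpa using hcy), if_neg (by simp [hcy]), zero_sub, norm_neg]
      have := hK' (by linarith [hc x y hcy.symm])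
      linarith
    · rw [if_pos hcy]
      by_cases hxy : ‖x - y‖ ≤ ρ' x
      · rw [if_pos ⟨hcy, hxy⟩]
        have h1 : ‖m y • rk n ρ x y‖ ≤ m y * (sep ρ x y ^ n)⁻¹ := by
          rw [norm_smul, Real.norm_of_nonneg hmy]
          gcongr
          exact norm_rk_le hρ.pos x y
        have := norm_sub_le (m y • rk n ρ x y) (m y • rk n ρ' x y)
        have := hK' hxy
        linarith
      · rw [if_neg (by tauto)]
        have h2 := norm_rk_sub_rk_scale_le (n := n) hρ.pos hρ' hle (not_le.1 hxy).le
        rw [← smul_sub, norm_smul, Real.norm_of_nonneg hmy]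
        have := mul_le_mul_of_nonneg_left h2 hmy
        linarith
  rw [offRiesz, riesz, Finset.sum_filter, ← Finset.sum_sub_distrib]
  refine (norm_sum_le _ _).trans ((Finset.sum_le_sum fun y _ => hpt y).trans ?_)
  rw [Finset.sum_add_distrib, Finset.sum_add_distrib, ← Finset.mul_sum, ← Finset.mul_sum,
    ← Finset.sum_filter]
  have h3 := hG'.sum_le hm hρ'.pos hx
  have h4 : (3 ^ n + 1) * ρ' x * ∑ y ∈ X, m y * (sep ρ' x y ^ (n + 1))⁻¹ ≤
      (3 ^ n + 1) * 2 ^ (n + 1) := by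
    calc _ ≤ (3 ^ n + 1) * ρ' x * (2 ^ (n + 1) * (ρ' x)⁻¹) := by gcongr
      _ = _ := by field_simp
  rw [spot]
  linarith

end Split

section Cross

variable {E : Type*} [NormedAddCommGroup E] [InnerProductSpace ℝ E]
variable {ρ ρ' : E → ℝ} {m : E → ℝ} {X : Finset E} {n : ℕ} {ι : Type*} {c : E → ι}

/-- Kernel differences at far away points, same cell versus another cell. -/
noncomputable def crossFar (n : ℕ) (ρ ρ' : E → ℝ) (x y z : E) : ℝ :=
  if ρ' x < ‖x - z‖ then ((sep ρ x y ^ n)⁻¹ * sep ρ x y) * (sep ρ x z ^ (n + 1))⁻¹ else 0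

/-- Kernel differences at moderately distant points. -/
noncomputable def crossMid (n : ℕ) (ρ ρ' : E → ℝ) (x y z : E) : ℝ :=
  if ‖x - z‖ ≤ ρ' x ∧ sep ρ x y ≤ 3 * sep ρ x z then
    ((sep ρ x y ^ n)⁻¹ * sep ρ x y) * (sep ρ x z ^ (n + 1))⁻¹ else 0

/-- Kernel differences at close points. -/
noncomputable def crossNear (n : ℕ) (ρ ρ' : E → ℝ) (x y z : E) : ℝ :=
  if ‖x - z‖ ≤ ρ' x ∧ sep ρ x z ≤ 5 * sep ρ x y then
    (sep ρ x y ^ n)⁻¹ * (sep ρ x z ^ n)⁻¹ else 0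

lemma crossFar_nonneg (hρ : ∀ x, 0 < ρ x) (x y z : E) : 0 ≤ crossFar n ρ ρ' x y z := by
  have := sep_pos hρ x y
  have := sep_pos hρ x z
  rw [crossFar]
  split_ifs <;> positivity

lemma crossMid_nonneg (hρ : ∀ x, 0 < ρ x) (x y z : E) : 0 ≤ crossMid n ρ ρ' x y z := by
  have := sep_pos hρ x y
  have := sep_pos hρ x z
  rw [crossMid]
  split_ifs <;> positivity

lemma crossNear_nonneg (hρ : ∀ x, 0 < ρ x) (x y z : E) : 0 ≤ crossNear n ρ ρ' x y z := by
  have := sep_pos hρ x y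
  have := sep_pos hρ x z
  rw [crossNear]
  split_ifs <;> positivity

lemma norm_rk_mul_norm_sub_le (hρ : IsScale ρ) (hρ' : IsScale ρ')
    (hc : ∀ x z, c x = c z → ‖x - z‖ ≤ ρ' x / 10) {x y : E} (h : c y = c x) (z : E) :
    ‖rk n ρ x y‖ * ‖rk n ρ x z - rk n ρ y z‖ ≤
      (n + 2) * 2 ^ (n + 1) * (crossFar n ρ ρ' x y z + crossMid n ρ ρ' x y z) +
        (crossNear n ρ ρ' x y z + crossNear n ρ ρ' y x z) := by
  have n1 := crossFar_nonneg (n := n) (ρ' := ρ') hρ.pos x y z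
  have n2 := crossMid_nonneg (n := n) (ρ' := ρ') hρ.pos x y z
  have n3 := crossNear_nonneg (n := n) (ρ' := ρ') hρ.pos x y z
  have n4 := crossNear_nonneg (n := n) (ρ' := ρ') hρ.pos y x z
  have hxy0 := sep_pos hρ.pos x y
  have hxz0 := sep_pos hρ.pos x z
  have hyz0 := sep_pos hρ.pos y z
  have hxx := hρ'.pos x
  have hyy := hρ'.pos y
  have hd := hc x y h.symm
  have hlip := hρ'.lip x y
  rcases le_total (4 * ‖x - y‖) (sep ρ x z) with h4 | h4
  · have h5 := norm_rk_sub_rk_le (n := n) hρ x y z h4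
    have h6 := norm_rk_le (n := n) hρ.pos x y
    have h7 : ‖rk n ρ x y‖ * ‖rk n ρ x z - rk n ρ y z‖ ≤ (n + 2) * 2 ^ (n + 1) *
        (((sep ρ x y ^ n)⁻¹ * sep ρ x y) * (sep ρ x z ^ (n + 1))⁻¹) := by
      calc _ ≤ (sep ρ x y ^ n)⁻¹ * ((n + 2) * 2 ^ (n + 1) * ‖x - y‖ * (sep ρ x z ^ (n + 1))⁻¹) := by
            gcongr
        _ ≤ (sep ρ x y ^ n)⁻¹ * ((n + 2) * 2 ^ (n + 1) * sep ρ x y * (sep ρ x z ^ (n + 1))⁻¹) := by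
            gcongr
            exact norm_le_sep ρ x y
        _ = _ := by ring
    have h8 : ((sep ρ x y ^ n)⁻¹ * sep ρ x y) * (sep ρ x z ^ (n + 1))⁻¹ ≤
        crossFar n ρ ρ' x y z + crossMid n ρ ρ' x y z := by
      by_cases hf : ρ' x < ‖x - z‖
      · rw [crossFar, if_pos hf]
        linarith
      · have h9 : sep ρ x y ≤ 3 * sep ρ x z :=
          sep_le_of_norm_le hρ (left_le_sep hρ.pos x z) (by linarith [norm_nonneg (x - y)])
        have h10 : crossMid n ρ ρ' x y z =
          ((sep ρ x y ^ n)⁻¹ * sep ρ x y) * (sep ρ x z ^ (n + 1))⁻¹ := if_pos ⟨not_lt.1 hf, h9⟩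
        linarith
    have h11 : (0 : ℝ) ≤ (n + 2) * 2 ^ (n + 1) := by positivity
    linarith [mul_le_mul_of_nonneg_left h8 h11]
  · have h5 := norm_sub_le (rk n ρ x z) (rk n ρ y z)
    have h6 := norm_rk_le (n := n) hρ.pos x y
    have h7 := norm_rk_le (n := n) hρ.pos x z
    have h8 := norm_rk_le (n := n) hρ.pos y z
    have hxz := norm_le_sep ρ x z
    have hxysep := norm_le_sep ρ x y
    have hyzt := norm_sub_le_norm_sub_add_norm_sub y x z
    rw [norm_sub_rev y x] at hyzt
    have h9 : sep ρ y z ≤ 5 * sep ρ y x := by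
      have := hρ.sep_le y x z
      rw [norm_sub_rev] at this
      rw [sep_comm ρ y x]
      linarith
    have h10 : crossNear n ρ ρ' x y z = (sep ρ x y ^ n)⁻¹ * (sep ρ x z ^ n)⁻¹ :=
      if_pos ⟨by linarith, by linarith⟩
    have h11 : crossNear n ρ ρ' y x z = (sep ρ x y ^ n)⁻¹ * (sep ρ y z ^ n)⁻¹ := by
      rw [crossNear, if_pos ⟨by linarith, h9⟩, sep_comm ρ y x]
    have h12 : (0 : ℝ) ≤ (n + 2) * 2 ^ (n + 1) * (crossFar n ρ ρ' x y z + crossMid n ρ ρ' x y z) :=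
      by positivity
    calc _ ≤ (sep ρ x y ^ n)⁻¹ * ((sep ρ x z ^ n)⁻¹ + (sep ρ y z ^ n)⁻¹) := by
          gcongr
          linarith
      _ ≤ _ := by rw [h10, h11]; linarith

lemma sum_crossFar_le (hG : Growth n 1 ρ m X) (hm : ∀ x, 0 ≤ m x) (hρ : IsScale ρ)
    (hρ' : IsScale ρ') (hle : ∀ x, ρ x ≤ ρ' x)
    (hc : ∀ x z, c x = c z → ‖x - z‖ ≤ ρ' x / 10) {x : E} (hx : x ∈ X) :
    ∑ y ∈ X with c y = c x, ∑ z ∈ X with c z ≠ c x, m y * m z * crossFar n ρ ρ' x y z ≤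
      3 * 4 ^ (n + 1) := by
  have hxx := hρ'.pos x
  have hD := fun y => sep_pos hρ.pos x y
  have h1 : ∑ y ∈ X with c y = c x, m y * ((sep ρ x y ^ n)⁻¹ * sep ρ x y) ≤
      2 ^ (n + 1) * (3 * ρ' x) := by
    refine (Finset.sum_le_sum_of_subset_of_nonneg ?_ fun y _ _ => ?_).trans
      (hG.ball hm hρ.pos hx (by positivity : 0 < 3 * ρ' x))
    · intro y hy
      simp only [Finset.mem_filter] at hy ⊢
      exact ⟨hy.1, sep_le_of_norm_le hρ (hle x) (by linarith [hc x y hy.2.symm])⟩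
    · have := hm y
      have := hD y
      positivity
  have h2 : ∑ z ∈ X with c z ≠ c x, m z * (if ρ' x < ‖x - z‖ then (sep ρ x z ^ (n + 1))⁻¹ else 0) ≤
      2 ^ (n + 1) * (ρ' x)⁻¹ := by
    refine le_trans ?_ (hG.tail hm hx hxx)
    rw [Finset.sum_filter, Finset.sum_filter]
    refine Finset.sum_le_sum fun z _ => ?_
    have h0 : 0 ≤ m z * (sep ρ x z ^ (n + 1))⁻¹ := by
      have := hm z
      have := hD z
      positivity
    by_cases h : ρ' x < ‖x - z‖
    · rw [if_pos h, if_pos (h.le.trans (norm_le_sep ρ x z))]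
      split_ifs <;> linarith
    · rw [if_neg h, mul_zero]
      split_ifs <;> linarith
  have h0 : 0 ≤ ∑ z ∈ X with c z ≠ c x,
      m z * (if ρ' x < ‖x - z‖ then (sep ρ x z ^ (n + 1))⁻¹ else 0) :=
    Finset.sum_nonneg fun z _ => mul_nonneg (hm z) (by
      have := hD z
      split_ifs <;> positivity)
  calc _ = (∑ y ∈ X with c y = c x, m y * ((sep ρ x y ^ n)⁻¹ * sep ρ x y)) *
        ∑ z ∈ X with c z ≠ c x, m z * (if ρ' x < ‖x - z‖ then (sep ρ x z ^ (n + 1))⁻¹ else 0) := by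
        rw [Finset.sum_mul_sum]
        refine Finset.sum_congr rfl fun y _ => Finset.sum_congr rfl fun z _ => ?_
        rw [crossFar]
        split_ifs <;> ring
    _ ≤ 2 ^ (n + 1) * (3 * ρ' x) * (2 ^ (n + 1) * (ρ' x)⁻¹) := by gcongr
    _ = 3 * 4 ^ (n + 1) := by
        rw [show (4 : ℝ) = 2 * 2 by norm_num, mul_pow]; field_simp

lemma sum_crossMid_le (hG : Growth n 1 ρ m X) (hm : ∀ x, 0 ≤ m x) (hρ : IsScale ρ)
    (hρ' : IsScale ρ') (hle : ∀ x, ρ x ≤ ρ' x) {x : E} (hx : x ∈ X) :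
    ∑ y ∈ X with c y = c x, ∑ z ∈ X with c z ≠ c x, m y * m z * crossMid n ρ ρ' x y z ≤
      12 * 2 ^ n * (2 * cutPot n ρ ρ' m c X x) / 2 := by
  have hD := fun y => sep_pos hρ.pos x y
  rw [Finset.sum_comm]
  have h1 : ∀ z ∈ X.filter (fun z => c z ≠ c x), ∑ y ∈ X with c y = c x,
      m y * m z * crossMid n ρ ρ' x y z ≤
      if ‖x - z‖ ≤ ρ' x then 6 * 2 ^ n * (m z * (sep ρ x z ^ n)⁻¹) else 0 := by
    intro z _
    have hmz := hm z
    have hDz := hD z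
    split_ifs with h
    · have h2 := hG.ball hm hρ.pos hx (by positivity : 0 < 3 * sep ρ x z)
      calc ∑ y ∈ X with c y = c x, m y * m z * crossMid n ρ ρ' x y z
          ≤ ∑ y ∈ X, m y * m z * crossMid n ρ ρ' x y z :=
            Finset.sum_le_sum_of_subset_of_nonneg (Finset.filter_subset _ _) fun y _ _ =>
              mul_nonneg (mul_nonneg (hm y) hmz) (crossMid_nonneg hρ.pos x y z)
        _ = m z * (sep ρ x z ^ (n + 1))⁻¹ * ∑ y ∈ X with sep ρ x y ≤ 3 * sep ρ x z,
              m y * ((sep ρ x y ^ n)⁻¹ * sep ρ x y) := by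
            rw [Finset.mul_sum, Finset.sum_filter]
            refine Finset.sum_congr rfl fun y _ => ?_
            rw [crossMid]
            by_cases h3 : sep ρ x y ≤ 3 * sep ρ x z
            · rw [if_pos ⟨h, h3⟩, if_pos h3]
              ring
            · rw [if_neg (by tauto), if_neg h3, mul_zero]
        _ ≤ m z * (sep ρ x z ^ (n + 1))⁻¹ * (2 ^ (n + 1) * (3 * sep ρ x z)) := by gcongr
        _ = _ := by rw [pow_succ (sep ρ x z), pow_succ 2 n]; field_simp; ring
    · refine le_of_eq (Finset.sum_eq_zero fun y _ => ?_)
      rw [crossMid, if_neg (by tauto), mul_zero]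
  refine (Finset.sum_le_sum h1).trans ?_
  rw [← Finset.sum_filter, Finset.filter_filter, ← Finset.mul_sum]
  have := sum_cut_le_cutPot (n := n) (c := c) (X := X) hm hρ hle x
  have h5 : (0 : ℝ) ≤ 6 * 2 ^ n := by positivity
  linarith [mul_le_mul_of_nonneg_left this h5]

lemma sum_crossNear_le (hG : Growth n 1 ρ m X) (hm : ∀ x, 0 ≤ m x) (hρ : IsScale ρ)
    (hρ' : IsScale ρ') (hle : ∀ x, ρ x ≤ ρ' x)
    (hc : ∀ x z, c x = c z → ‖x - z‖ ≤ ρ' x / 10) {x : E} (hx : x ∈ X) :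
    ∑ y ∈ X with c y = c x, ∑ z ∈ X with c z ≠ c x, m y * m z * crossNear n ρ ρ' x y z ≤
      2 ^ (n + 4) * cutPot n ρ ρ' m c X x := by
  have hD := fun y => sep_pos hρ.pos x y
  have hxx := hρ'.pos x
  rw [Finset.sum_comm]
  have h1 : ∀ z ∈ X.filter (fun z => c z ≠ c x), ∑ y ∈ X with c y = c x,
      m y * m z * crossNear n ρ ρ' x y z ≤
      if ‖x - z‖ ≤ ρ' x then 2 ^ (n + 4) * (m z * ((sep ρ x z ^ n)⁻¹ * √(ρ' x / sep ρ x z)))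
        else 0 := by
    intro z _
    have hmz := hm z
    have hDz := hD z
    split_ifs with h
    · have h2 := hG.annulus hm hx (T := 3 * ρ' x) (by positivity : 0 < sep ρ x z / 5)
      calc ∑ y ∈ X with c y = c x, m y * m z * crossNear n ρ ρ' x y z
          ≤ ∑ y ∈ X with sep ρ x z / 5 ≤ sep ρ x y ∧ sep ρ x y ≤ 3 * ρ' x,
              m z * (sep ρ x z ^ n)⁻¹ * (m y * (sep ρ x y ^ n)⁻¹) := by
            rw [Finset.sum_filter, Finset.sum_filter]
            refine Finset.sum_le_sum fun y _ => ?_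
            have h0 : 0 ≤ m z * (sep ρ x z ^ n)⁻¹ * (m y * (sep ρ x y ^ n)⁻¹) := by
              have := hm y
              have := hD y
              positivity
            by_cases hcy : c y = c x
            · have h6 : sep ρ x y ≤ 3 * ρ' x :=
                sep_le_of_norm_le hρ (hle x) (by linarith [hc x y hcy.symm])
              rw [if_pos hcy, crossNear]
              by_cases h7 : sep ρ x z ≤ 5 * sep ρ x y
              · rw [if_pos ⟨h, h7⟩, if_pos ⟨by linarith, h6⟩]
                exact le_of_eq (by ring)
              · rw [if_neg (by tauto), mul_zero]
                split_ifs <;> linarith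
            · rw [if_neg hcy]
              split_ifs <;> linarith
        _ = m z * (sep ρ x z ^ n)⁻¹ * ∑ y ∈ X with sep ρ x z / 5 ≤ sep ρ x y ∧
              sep ρ x y ≤ 3 * ρ' x, m y * (sep ρ x y ^ n)⁻¹ := by rw [Finset.mul_sum]
        _ ≤ m z * (sep ρ x z ^ n)⁻¹ * (2 ^ (n + 2) * √(3 * ρ' x / (sep ρ x z / 5))) := by gcongr
        _ ≤ m z * (sep ρ x z ^ n)⁻¹ * (2 ^ (n + 2) * (4 * √(ρ' x / sep ρ x z))) := by
            gcongr
            rw [show (4 : ℝ) = √16 by rw [show (16 : ℝ) = 4 ^ 2 by norm_num]; simp,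
              ← Real.sqrt_mul (by norm_num)]
            apply Real.sqrt_le_sqrt
            rw [div_div_eq_mul_div, ← mul_div_assoc]
            gcongr ?_ / _
            linarith
        _ = _ := by rw [pow_add, pow_add]; ring
    · refine le_of_eq (Finset.sum_eq_zero fun y _ => ?_)
      rw [crossNear, if_neg (by tauto), mul_zero]
  refine (Finset.sum_le_sum h1).trans ?_
  rw [← Finset.sum_filter, Finset.filter_filter, ← Finset.mul_sum, cutPot]

end Cross

section Split

variable {E : Type*} [NormedAddCommGroup E] [InnerProductSpace ℝ E]
variable {ρ ρ' : E → ℝ} {m : E → ℝ} {X : Finset E} {n : ℕ} {ι : Type*} {c : E → ι}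

lemma sum_fiber_swap (f : E → E → ℝ) :
    ∑ x ∈ X, ∑ y ∈ X with c y = c x, f x y = ∑ x ∈ X, ∑ y ∈ X with c y = c x, f y x := by
  refine Finset.sum_comm' fun x y => ?_
  simp only [Finset.mem_filter]
  exact ⟨fun h => ⟨⟨h.1, h.2.2.symm⟩, h.2.1⟩, fun h => ⟨h.1.1, h.2, h.1.2.symm⟩⟩

lemma riesz_eq_add (x : E) :
    riesz n ρ m X x = riesz n ρ m (X.filter fun y => c y = c x) x + offRiesz n ρ m c X x := by
  rw [riesz, riesz, offRiesz, Finset.sum_filter_add_sum_filter_not]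

lemma sum_energy_fiber : ∑ x ∈ X, m x * ‖riesz n ρ m (X.filter fun y => c y = c x) x‖ ^ 2 =
    ∑ i ∈ X.image c, rieszEnergy n ρ m (X.filter fun y => c y = i) := by
  rw [← Finset.sum_fiberwise_of_maps_to fun x hx => Finset.mem_image_of_mem c hx]
  refine Finset.sum_congr rfl fun i _ => Finset.sum_congr rfl fun x hx => ?_
  rw [(Finset.mem_filter.1 hx).2]

lemma two_mul_sum_inner_le (hG : Growth n 1 ρ m X) (hm : ∀ x, 0 ≤ m x) (hρ : IsScale ρ)
    (hρ' : IsScale ρ') (hle : ∀ x, ρ x ≤ ρ' x)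
    (hc : ∀ x z, c x = c z → ‖x - z‖ ≤ ρ' x / 10) :
    2 * ∑ x ∈ X, m x * inner ℝ (riesz n ρ m (X.filter fun y => c y = c x) x)
      (offRiesz n ρ m c X x) ≤
    (n + 2) * 2 ^ (n + 1) * (3 * 4 ^ (n + 1)) * ∑ x ∈ X, m x +
      ((n + 2) * 2 ^ (n + 1) * (12 * 2 ^ n) + 2 * 2 ^ (n + 4)) *
        ∑ x ∈ X, m x * cutPot n ρ ρ' m c X x := by
  have hexp : ∑ x ∈ X, m x * inner ℝ (riesz n ρ m (X.filter fun y => c y = c x) x)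
      (offRiesz n ρ m c X x) = ∑ x ∈ X, ∑ y ∈ X with c y = c x,
        m x * (m y * inner ℝ (rk n ρ x y) (offRiesz n ρ m c X x)) := by
    refine Finset.sum_congr rfl fun x _ => ?_
    rw [riesz, sum_inner, Finset.mul_sum]
    simp only [real_inner_smul_left]
  have h2 : 2 * ∑ x ∈ X, m x * inner ℝ (riesz n ρ m (X.filter fun y => c y = c x) x)
      (offRiesz n ρ m c X x) = ∑ x ∈ X, ∑ y ∈ X with c y = c x,
        m x * (m y * inner ℝ (rk n ρ x y) (offRiesz n ρ m c X x - offRiesz n ρ m c X y)) := by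
    rw [two_mul]
    nth_rw 2 [hexp]
    rw [sum_fiber_swap, hexp, ← Finset.sum_add_distrib]
    refine Finset.sum_congr rfl fun x _ => ?_
    rw [← Finset.sum_add_distrib]
    refine Finset.sum_congr rfl fun y _ => ?_
    rw [rk_antisymm n ρ y x, inner_neg_left, inner_sub_right]
    ring
  have hpt : ∀ x ∈ X, ∀ y ∈ X.filter (fun y => c y = c x),
      m x * (m y * inner ℝ (rk n ρ x y) (offRiesz n ρ m c X x - offRiesz n ρ m c X y)) ≤
      ∑ z ∈ X with c z ≠ c x, m x * ((n + 2) * 2 ^ (n + 1) * (m y * m z * crossFar n ρ ρ' x y z +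
        m y * m z * crossMid n ρ ρ' x y z) + (m y * m z * crossNear n ρ ρ' x y z +
        m y * m z * crossNear n ρ ρ' y x z)) := by
    intro x _ y hy
    have hcy := (Finset.mem_filter.1 hy).2
    have hoff : offRiesz n ρ m c X x - offRiesz n ρ m c X y =
        ∑ z ∈ X with c z ≠ c x, m z • (rk n ρ x z - rk n ρ y z) := by
      rw [offRiesz, offRiesz, hcy, ← Finset.sum_sub_distrib]
      simp only [smul_sub]
    rw [hoff, inner_sum, Finset.mul_sum, Finset.mul_sum]
    refine Finset.sum_le_sum fun z _ => ?_
    have h1 := norm_rk_mul_norm_sub_le (n := n) hρ hρ' hc hcy z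
    have h3 := (real_inner_le_norm (rk n ρ x y) (rk n ρ x z - rk n ρ y z)).trans h1
    have := hm x
    have := hm y
    have := hm z
    rw [real_inner_smul_right]
    refine (mul_le_mul_of_nonneg_left (mul_le_mul_of_nonneg_left
      (mul_le_mul_of_nonneg_left h3 (hm z)) (hm y)) (hm x)).trans (le_of_eq ?_)
    ring
  have hswap : ∑ x ∈ X, ∑ y ∈ X with c y = c x, ∑ z ∈ X with c z ≠ c x,
      m x * (m y * m z * crossNear n ρ ρ' y x z) = ∑ x ∈ X, m x *
        ∑ y ∈ X with c y = c x, ∑ z ∈ X with c z ≠ c x, m y * m z * crossNear n ρ ρ' x y z := by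
    rw [sum_fiber_swap]
    refine Finset.sum_congr rfl fun x _ => ?_
    rw [Finset.mul_sum]
    refine Finset.sum_congr rfl fun y hy => ?_
    rw [(Finset.mem_filter.1 hy).2, Finset.mul_sum]
    exact Finset.sum_congr rfl fun z _ => by ring
  rw [h2]
  refine (Finset.sum_le_sum fun x hx => Finset.sum_le_sum fun y hy => hpt x hx y hy).trans ?_
  simp only [mul_add, Finset.sum_add_distrib]
  rw [hswap]
  have e : ∀ (k : ℝ) (f : E → E → E → ℝ), ∑ x ∈ X, ∑ y ∈ X with c y = c x,
      ∑ z ∈ X with c z ≠ c x, m x * (k * (m y * m z * f x y z)) = k * ∑ x ∈ X, m x *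
      ∑ y ∈ X with c y = c x, ∑ z ∈ X with c z ≠ c x, m y * m z * f x y z := by
    intro k f
    simp only [Finset.mul_sum]
    exact Finset.sum_congr rfl fun x _ => Finset.sum_congr rfl fun y _ =>
      Finset.sum_congr rfl fun z _ => by ring
  have e1 : ∀ (f : E → E → E → ℝ), ∑ x ∈ X, ∑ y ∈ X with c y = c x,
      ∑ z ∈ X with c z ≠ c x, m x * (m y * m z * f x y z) = ∑ x ∈ X, m x *
      ∑ y ∈ X with c y = c x, ∑ z ∈ X with c z ≠ c x, m y * m z * f x y z := by
    intro f
    simpa using e 1 f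
  rw [e, e, e1]
  have b1 : ∑ x ∈ X, m x * ∑ y ∈ X with c y = c x, ∑ z ∈ X with c z ≠ c x,
      m y * m z * crossFar n ρ ρ' x y z ≤ ∑ x ∈ X, m x * (3 * 4 ^ (n + 1)) :=
    Finset.sum_le_sum fun x hx =>
      mul_le_mul_of_nonneg_left (sum_crossFar_le hG hm hρ hρ' hle hc hx) (hm x)
  have b2 : ∑ x ∈ X, m x * ∑ y ∈ X with c y = c x, ∑ z ∈ X with c z ≠ c x,
      m y * m z * crossMid n ρ ρ' x y z ≤
        ∑ x ∈ X, m x * (12 * 2 ^ n * (2 * cutPot n ρ ρ' m c X x) / 2) :=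
    Finset.sum_le_sum fun x hx =>
      mul_le_mul_of_nonneg_left (sum_crossMid_le hG hm hρ hρ' hle hx) (hm x)
  have b3 : ∑ x ∈ X, m x * ∑ y ∈ X with c y = c x, ∑ z ∈ X with c z ≠ c x,
      m y * m z * crossNear n ρ ρ' x y z ≤
        ∑ x ∈ X, m x * (2 ^ (n + 4) * cutPot n ρ ρ' m c X x) :=
    Finset.sum_le_sum fun x hx =>
      mul_le_mul_of_nonneg_left (sum_crossNear_le hG hm hρ hρ' hle hc hx) (hm x)
  have r2 : ∑ x ∈ X, m x * (12 * 2 ^ n * (2 * cutPot n ρ ρ' m c X x) / 2) =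
      12 * 2 ^ n * ∑ x ∈ X, m x * cutPot n ρ ρ' m c X x := by
    rw [Finset.mul_sum]
    exact Finset.sum_congr rfl fun x _ => by ring
  have r3 : ∑ x ∈ X, m x * (2 ^ (n + 4) * cutPot n ρ ρ' m c X x) =
      2 ^ (n + 4) * ∑ x ∈ X, m x * cutPot n ρ ρ' m c X x := by
    rw [Finset.mul_sum]
    exact Finset.sum_congr rfl fun x _ => by ring
  rw [r2] at b2
  rw [r3] at b3
  rw [← Finset.sum_mul] at b1
  have hk : (0 : ℝ) ≤ (n + 2) * 2 ^ (n + 1) := by positivity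
  have b1' := mul_le_mul_of_nonneg_left b1 hk
  have b2' := mul_le_mul_of_nonneg_left b2 hk
  linarith

lemma sum_norm_offRiesz_sq_le (hG : Growth n 1 ρ m X) (hm : ∀ x, 0 ≤ m x) (hρ : IsScale ρ)
    (hρ' : IsScale ρ') (hle : ∀ x, ρ x ≤ ρ' x)
    (hc : ∀ x z, c x = c z → ‖x - z‖ ≤ ρ' x / 10) :
    ∑ x ∈ X, m x * ‖offRiesz n ρ m c X x‖ ^ 2 ≤
      4 * (rieszEnergy n ρ' m X + (((3 ^ n + 1) * 2 ^ (n + 1)) ^ 2 + 9 ^ n * 2 ^ (3 * n + 4)) *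
        ∑ x ∈ X, m x + 2 ^ (n + 4) * ∑ x ∈ X, m x * cutPot n ρ ρ' m c X x) := by
  have hs := mul_le_mul_of_nonneg_left (sum_spot_sq_le (hG.mono hm hle) hm hρ'.pos)
    (by positivity : (0 : ℝ) ≤ 9 ^ n)
  have : ∑ x ∈ X, m x * ‖offRiesz n ρ m c X x‖ ^ 2 ≤
      4 * (rieszEnergy n ρ' m X + ((3 ^ n + 1) * 2 ^ (n + 1)) ^ 2 * ∑ x ∈ X, m x +
        9 ^ n * ∑ x ∈ X, m x * spot n ρ' m X x ^ 2 +
        2 ^ (n + 4) * ∑ x ∈ X, m x * cutPot n ρ ρ' m c X x) := by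
    rw [rieszEnergy]
    simp only [Finset.mul_sum, ← Finset.sum_add_distrib]
    refine Finset.sum_le_sum fun x hx => ?_
    have h1 := norm_offRiesz_sub_le hG hm hρ hρ' hle hc hx
    have h2 := sum_cut_sq_le (c := c) hG hm hρ hρ'.pos hle hx
    set b := ∑ z ∈ X with c z ≠ c x ∧ ‖x - z‖ ≤ ρ' x, m z * (sep ρ x z ^ n)⁻¹
    have h3 := norm_sub_norm_le (offRiesz n ρ m c X x) (riesz n ρ' m X x)
    set A := ‖riesz n ρ' m X x‖
    set B : ℝ := (3 ^ n + 1) * 2 ^ (n + 1)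
    set D := spot n ρ' m X x
    have h4 : ‖offRiesz n ρ m c X x‖ ≤ A + B + 3 ^ n * D + b := by linarith
    have h5 : ‖offRiesz n ρ m c X x‖ ^ 2 ≤ (A + B + 3 ^ n * D + b) ^ 2 := by gcongr
    have h6 : (A + B + 3 ^ n * D + b) ^ 2 ≤ 4 * (A ^ 2 + B ^ 2 + (3 ^ n * D) ^ 2 + b ^ 2) := by
      nlinarith [sq_nonneg (A - B), sq_nonneg (A - 3 ^ n * D), sq_nonneg (A - b),
        sq_nonneg (B - 3 ^ n * D), sq_nonneg (B - b), sq_nonneg (3 ^ n * D - b)]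
    have h7 : (3 ^ n * D) ^ 2 = 9 ^ n * D ^ 2 := by
      rw [mul_pow, ← pow_mul, mul_comm n 2, pow_mul]
      norm_num
    have h8 : ‖offRiesz n ρ m c X x‖ ^ 2 ≤ 4 * (A ^ 2 + B ^ 2 + 9 ^ n * D ^ 2 +
      2 ^ (n + 4) * cutPot n ρ ρ' m c X x) := by
        rw [h7] at h6
        linarith
    calc _ ≤ m x * _ := mul_le_mul_of_nonneg_left h8 (hm x)
      _ = _ := by ring
  linarith

lemma rieszEnergy_split (hG : Growth n 1 ρ m X) (hm : ∀ x, 0 ≤ m x) (hρ : IsScale ρ)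
    (hρ' : IsScale ρ') (hle : ∀ x, ρ x ≤ ρ' x)
    (hc : ∀ x z, c x = c z → ‖x - z‖ ≤ ρ' x / 10) :
    ∃ C : ℝ, C = (n + 2) * 2 ^ (n + 1) * (3 * 4 ^ (n + 1)) + ((n + 2) * 2 ^ (n + 1) *
        (12 * 2 ^ n) + 6 * 2 ^ (n + 4)) +
        4 * (((3 ^ n + 1) * 2 ^ (n + 1)) ^ 2 + 9 ^ n * 2 ^ (3 * n + 4)) ∧
    rieszEnergy n ρ m X ≤ ∑ i ∈ X.image c, rieszEnergy n ρ m (X.filter fun y => c y = i) +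
      4 * rieszEnergy n ρ' m X + C * (∑ x ∈ X, m x + ∑ x ∈ X, m x * cutPot n ρ ρ' m c X x) := by
  refine ⟨_, rfl, ?_⟩
  have h1 := two_mul_sum_inner_le hG hm hρ hρ' hle hc
  have h2 := sum_norm_offRiesz_sq_le hG hm hρ hρ' hle hc
  have hM : 0 ≤ ∑ x ∈ X, m x := Finset.sum_nonneg fun x _ => hm x
  have hP : 0 ≤ ∑ x ∈ X, m x * cutPot n ρ ρ' m c X x :=
    Finset.sum_nonneg fun x _ => mul_nonneg (hm x) (cutPot_nonneg hm hρ.pos x)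
  have h0 : rieszEnergy n ρ m X = ∑ i ∈ X.image c, rieszEnergy n ρ m (X.filter fun y => c y = i) +
      2 * ∑ x ∈ X, m x * inner ℝ (riesz n ρ m (X.filter fun y => c y = c x) x)
      (offRiesz n ρ m c X x) + ∑ x ∈ X, m x * ‖offRiesz n ρ m c X x‖ ^ 2 := by
    rw [← sum_energy_fiber, rieszEnergy, Finset.mul_sum, ← Finset.sum_add_distrib,
      ← Finset.sum_add_distrib]
    refine Finset.sum_congr rfl fun x _ => ?_
    rw [riesz_eq_add (c := c), norm_add_sq_real]
    ring
  rw [h0]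
  set M := ∑ x ∈ X, m x
  set Q := ∑ x ∈ X, m x * cutPot n ρ ρ' m c X x
  have k1 : 0 ≤ ((n + 2) * 2 ^ (n + 1) * (3 * 4 ^ (n + 1)) +
    4 * (((3 ^ n + 1) * 2 ^ (n + 1)) ^ 2 + 9 ^ n * 2 ^ (3 * n + 4))) * Q := by positivity
  have k2 : 0 ≤ ((n + 2) * 2 ^ (n + 1) * (12 * 2 ^ n) + 6 * 2 ^ (n + 4)) * M := by positivity
  linarith

end Split

section Step

variable {d n : ℕ} {ρ ρ' m : EuclideanSpace ℝ (Fin d) → ℝ}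
  {X : Finset (EuclideanSpace ℝ (Fin d))}

lemma exists_partition_cutPot_le (hG : Growth n 1 ρ m X) (hm : ∀ x, 0 ≤ m x) (hρ : IsScale ρ)
    (hρ' : IsScale ρ') (hle : ∀ x, ρ x ≤ ρ' x) :
    ∃ c : EuclideanSpace ℝ (Fin d) → ℤ × (Fin d → ℤ),
      (∀ x z, c x = c z → ‖x - z‖ ≤ ρ' x / 10) ∧
      (∑ x ∈ X, m x * cutPot n ρ ρ' m c X x ≤
        (2 + 90 * d * (d + 1) + 2) * (2 ^ (n + 2) * 6) * ∑ x ∈ X, m x) ∧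
      (∀ (A : ℕ), 0 < A → ∀ (F : Finset (EuclideanSpace ℝ (Fin d)))
        (x : EuclideanSpace ℝ (Fin d)), (∀ z ∈ F, ‖z - x‖ ≤ A * ρ' x) →
        (∀ z ∈ F, ρ' x ≤ A * ρ' z) → (∀ z ∈ F, ρ' z ≤ A * ρ' x) → Set.InjOn c F →
        F.card ≤ packConst d A) := by
  have hD := sep_pos hρ.pos
  have hkn : ∀ x z, 0 ≤ m z * ((sep ρ x z ^ n)⁻¹ * √(ρ' x / sep ρ x z)) := fun x z => by
    have := hD x z
    have := hm z
    positivity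
  set w : EuclideanSpace ℝ (Fin d) → EuclideanSpace ℝ (Fin d) → ℝ := fun x z =>
    if ‖x - z‖ ≤ ρ' x / 2 then m x * (m z * ((sep ρ x z ^ n)⁻¹ * √(ρ' x / sep ρ x z))) else 0
    with hw
  have hw0 : ∀ x z, 0 ≤ w x z := fun x z => by
    simp only [hw]
    split_ifs
    exacts [mul_nonneg (hm x) (hkn x z), le_rfl]
  obtain ⟨c, hc1, hc2, hc3⟩ := exists_partition hρ' X w hw0
    fun x z h => by by_contra h'; exact h (if_neg h')
  refine ⟨c, hc1, ?_, hc3⟩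
  have hnear : ∀ x ∈ X, ∑ z ∈ X, w x z * (‖x - z‖ / ρ' x) ≤ m x * (2 ^ (n + 2) * 6) := by
    intro x hx
    have hxx := hρ'.pos x
    have hb := hG.ball_sqrt hm hρ.pos hx (t := 3 * ρ' x) (by positivity)
    calc ∑ z ∈ X, w x z * (‖x - z‖ / ρ' x)
        ≤ ∑ z ∈ X with sep ρ x z ≤ 3 * ρ' x,
          m x * (√(ρ' x))⁻¹ * (m z * ((sep ρ x z ^ n)⁻¹ * √(sep ρ x z))) := by
          rw [Finset.sum_filter]
          refine Finset.sum_le_sum fun z _ => ?_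
          have := hD x z
          have := hm z
          have := hm x
          simp only [hw]
          split_ifs with h1 h2 h2
          · have e1 : ‖x - z‖ ≤ sep ρ x z := norm_le_sep _ _ _
            calc m x * (m z * ((sep ρ x z ^ n)⁻¹ * √(ρ' x / sep ρ x z))) * (‖x - z‖ / ρ' x)
                ≤ m x * (m z * ((sep ρ x z ^ n)⁻¹ * √(ρ' x / sep ρ x z))) *
                  (sep ρ x z / ρ' x) := by gcongr
              _ = m x * (m z * ((sep ρ x z ^ n)⁻¹ * (√(ρ' x) / √(sep ρ x z)))) *
                  (√(sep ρ x z) ^ 2 / √(ρ' x) ^ 2) := by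
                    rw [Real.sqrt_div hxx.le, Real.sq_sqrt hxx.le, Real.sq_sqrt (hD x z).le]
              _ = _ := by
                have : 0 < √(ρ' x) := Real.sqrt_pos.2 hxx
                have : 0 < √(sep ρ x z) := Real.sqrt_pos.2 (hD x z)
                field_simp
          · exact absurd (sep_le_of_norm_le hρ (hle x) (h1.trans (by linarith))) h2
          · rw [zero_mul]
            positivity
          · simp
      _ = m x * (√(ρ' x))⁻¹ * ∑ z ∈ X with sep ρ x z ≤ 3 * ρ' x,
          (m z * ((sep ρ x z ^ n)⁻¹ * √(sep ρ x z))) := by rw [Finset.mul_sum]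
      _ ≤ m x * (√(ρ' x))⁻¹ * (2 ^ (n + 2) * √(3 * ρ' x)) := by
          have := hm x
          gcongr
      _ = m x * (2 ^ (n + 2) * √3) := by
          rw [Real.sqrt_mul (by norm_num)]
          have : 0 < √(ρ' x) := Real.sqrt_pos.2 hxx
          field_simp
      _ ≤ _ := by
          have := hm x
          have : √3 ≤ 6 := by rw [Real.sqrt_le_left (by norm_num)]; norm_num
          gcongr
  have hfar : ∀ x ∈ X, ∑ z ∈ X with ρ' x / 2 < ‖x - z‖ ∧ ‖x - z‖ ≤ ρ' x,
      m z * ((sep ρ x z ^ n)⁻¹ * √(ρ' x / sep ρ x z)) ≤ 2 * (2 ^ (n + 2) * 6) := by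
    intro x hx
    have hxx := hρ'.pos x
    have ha := hG.annulus hm hx (t := ρ' x / 2) (T := 3 * ρ' x) (by positivity)
    have e6 : √(3 * ρ' x / (ρ' x / 2)) ≤ 6 := by
      rw [Real.sqrt_le_left (by norm_num), div_le_iff₀ (by positivity)]
      linarith
    calc _ ≤ ∑ z ∈ X with ρ' x / 2 ≤ sep ρ x z ∧ sep ρ x z ≤ 3 * ρ' x,
          m z * ((sep ρ x z ^ n)⁻¹) * 2 := by
          rw [Finset.sum_filter, Finset.sum_filter]
          refine Finset.sum_le_sum fun z _ => ?_
          have := hD x z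
          have := hm z
          have e1 : ‖x - z‖ ≤ sep ρ x z := norm_le_sep _ _ _
          split_ifs with h1 h2 h2
          · have : √(ρ' x / sep ρ x z) ≤ 2 := by
              rw [Real.sqrt_le_left (by norm_num), div_le_iff₀ (by positivity)]
              linarith
            rw [mul_assoc]
            gcongr
          · exact absurd ⟨(h1.1.trans_le e1).le, sep_le_of_norm_le hρ (hle x) h1.2⟩ h2
          · positivity
          · exact le_rfl
      _ ≤ 2 ^ (n + 2) * 6 * 2 := by
          rw [← Finset.sum_mul]
          gcongr
          exact ha.trans (by gcongr)
      _ = _ := by ring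
  calc ∑ x ∈ X, m x * cutPot n ρ ρ' m c X x
      ≤ ∑ x ∈ X, (∑ z ∈ X, (if c x ≠ c z then w x z else 0) + m x *
          ∑ z ∈ X with ρ' x / 2 < ‖x - z‖ ∧ ‖x - z‖ ≤ ρ' x,
          m z * ((sep ρ x z ^ n)⁻¹ * √(ρ' x / sep ρ x z))) := by
        refine Finset.sum_le_sum fun x _ => ?_
        rw [cutPot, Finset.sum_filter, Finset.sum_filter, Finset.mul_sum, Finset.mul_sum,
          ← Finset.sum_add_distrib]
        refine Finset.sum_le_sum fun z _ => ?_
        have h0 := mul_nonneg (hm x) (hkn x z)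
        have h1 := hw0 x z
        by_cases hcz : c z ≠ c x
        · by_cases hf : ‖x - z‖ ≤ ρ' x / 2
          · have hf2 : ‖x - z‖ ≤ ρ' x := by linarith [norm_nonneg (x - z)]
            simp [hcz, hcz.symm, hf, hf2, hw, hf.not_gt]
          · by_cases hf2 : ‖x - z‖ ≤ ρ' x
            · simp [hcz, hcz.symm, hf2, not_le.1 hf, hw, hf]
            · simp [hf2, hcz.symm, h1]
        · push Not at hcz
          simp only [hcz, ne_eq, not_true_eq_false, false_and, if_false, mul_zero, zero_add]
          split_ifs
          exacts [h0, by simp]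
    _ ≤ (2 + 90 * d * (d + 1)) * ∑ x ∈ X, m x * (2 ^ (n + 2) * 6) +
          ∑ x ∈ X, m x * (2 * (2 ^ (n + 2) * 6)) := by
        rw [Finset.sum_add_distrib]
        refine add_le_add (hc2.trans ?_) (Finset.sum_le_sum fun x hx => ?_)
        · exact mul_le_mul_of_nonneg_left (Finset.sum_le_sum hnear) (by positivity)
        · exact mul_le_mul_of_nonneg_left (hfar x hx) (hm x)
    _ = _ := by rw [← Finset.sum_mul, ← Finset.sum_mul]; ring

/-- The energy at scale `ρ` is controlled by the energy at a coarser scale `ρ'` and by the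
energies of the pieces of a partition into cells of size comparable to `ρ'`. -/
lemma exists_rieszEnergy_split (d n : ℕ) : ∃ C : ℝ, 4 ≤ C ∧
    ∀ (ρ ρ' m : EuclideanSpace ℝ (Fin d) → ℝ) (X : Finset (EuclideanSpace ℝ (Fin d))),
    Growth n 1 ρ m X → (∀ x, 0 ≤ m x) → IsScale ρ → IsScale ρ' → (∀ x, ρ x ≤ ρ' x) →
    ∃ (ι : Type) (c : EuclideanSpace ℝ (Fin d) → ι),
      (∀ x z, c x = c z → ‖x - z‖ ≤ ρ' x / 10) ∧
      (rieszEnergy n ρ m X ≤ ∑ i ∈ X.image c, rieszEnergy n ρ m (X.filter fun y => c y = i) +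
        C * rieszEnergy n ρ' m X + C * ∑ x ∈ X, m x) ∧
      (∀ (A : ℕ), 0 < A → ∀ (F : Finset (EuclideanSpace ℝ (Fin d)))
        (x : EuclideanSpace ℝ (Fin d)), (∀ z ∈ F, ‖z - x‖ ≤ A * ρ' x) →
        (∀ z ∈ F, ρ' x ≤ A * ρ' z) → (∀ z ∈ F, ρ' z ≤ A * ρ' x) → Set.InjOn c F →
        F.card ≤ packConst d A) := by
  set C₁ : ℝ := (n + 2) * 2 ^ (n + 1) * (3 * 4 ^ (n + 1)) +
    ((n + 2) * 2 ^ (n + 1) * (12 * 2 ^ n) + 6 * 2 ^ (n + 4)) +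
        4 * (((3 ^ n + 1) * 2 ^ (n + 1)) ^ 2 + 9 ^ n * 2 ^ (3 * n + 4)) with hC₁
  set C₂ : ℝ := (2 + 90 * d * (d + 1) + 2) * (2 ^ (n + 2) * 6) with hC₂
  have h1 : 0 ≤ C₁ := by positivity
  have h2 : 0 ≤ C₂ := by positivity
  refine ⟨4 + C₁ * (1 + C₂), by nlinarith [mul_nonneg h1 h2], ?_⟩
  intro ρ ρ' m X hG hm hρ hρ' hle
  obtain ⟨c, hc, hcut, hpack⟩ := exists_partition_cutPot_le hG hm hρ hρ' hle
  refine ⟨_, c, hc, ?_, hpack⟩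
  obtain ⟨C, hC, h⟩ := rieszEnergy_split hG hm hρ hρ' hle hc
  rw [← hC₁] at hC
  rw [← hC₂] at hcut
  subst hC
  clear_value C₁ C₂
  have hM : 0 ≤ ∑ x ∈ X, m x := Finset.sum_nonneg fun x _ => hm x
  have hE : 0 ≤ rieszEnergy n ρ' m X :=
    Finset.sum_nonneg fun x _ => mul_nonneg (hm x) (sq_nonneg _)
  have h3 := mul_le_mul_of_nonneg_left hcut h1
  have h4 : 0 ≤ C₁ * (1 + C₂) * rieszEnergy n ρ' m X := by positivity
  linarith

end Step

/-! ### A symmetrised kernel on curves -/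

section Curve

variable {H : Type*} [NormedAddCommGroup H] [InnerProductSpace ℝ H]

lemma abs_pow_sub_pow_sub_le (N : ℕ) {x y : ℝ} (hx : 0 ≤ x) (hx1 : x ≤ 1) (hy : 0 ≤ y)
    (hy1 : y ≤ 1) : |y ^ (N + 1) - x ^ (N + 1) - (N + 1) * x ^ N * (y - x)| ≤
      N * (N + 1) * (y - x) ^ 2 := by
  induction N with
  | zero => simp
  | succ N ih =>
    have e : y ^ (N + 1 + 1) - x ^ (N + 1 + 1) - ((N + 1 : ℕ) + 1) * x ^ (N + 1) * (y - x) =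
        y * (y ^ (N + 1) - x ^ (N + 1) - (N + 1) * x ^ N * (y - x)) +
          (N + 1) * x ^ N * (y - x) ^ 2 := by push_cast; ring
    rw [e]
    refine (abs_add_le _ _).trans ?_
    rw [abs_mul, abs_of_nonneg hy, abs_of_nonneg (by positivity :
      0 ≤ (N + 1 : ℝ) * x ^ N * (y - x) ^ 2)]
    have h1 : y * |y ^ (N + 1) - x ^ (N + 1) - (N + 1) * x ^ N * (y - x)| ≤
        1 * (N * (N + 1) * (y - x) ^ 2) := by gcongr
    have h2 : (N + 1 : ℝ) * x ^ N * (y - x) ^ 2 ≤ (N + 1) * 1 * (y - x) ^ 2 := by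
      gcongr
      exact pow_le_one₀ hx hx1
    push_cast
    nlinarith [sq_nonneg (y - x), mul_nonneg (Nat.cast_nonneg N : (0 : ℝ) ≤ N) (sq_nonneg (y - x))]

lemma abs_inv_pow_sub_le (N : ℕ) {r s : ℝ} (hr : 1 ≤ r) (hs : 1 ≤ s) :
    |(s ^ (N + 1))⁻¹ - (r ^ (N + 1))⁻¹ + (N + 1) * (r ^ (N + 2))⁻¹ * (s - r)| ≤
      (N + 1) ^ 2 * (s - r) ^ 2 := by
  have hr0 : 0 < r := by linarith
  have hs0 : 0 < s := by linarith
  have h := abs_pow_sub_pow_sub_le N (inv_nonneg.2 hr0.le) (inv_le_one_of_one_le₀ hr)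
    (inv_nonneg.2 hs0.le) (inv_le_one_of_one_le₀ hs)
  have e : (s ^ (N + 1))⁻¹ - (r ^ (N + 1))⁻¹ + (N + 1) * (r ^ (N + 2))⁻¹ * (s - r) =
      ((s⁻¹) ^ (N + 1) - (r⁻¹) ^ (N + 1) - (N + 1) * (r⁻¹) ^ N * (s⁻¹ - r⁻¹)) +
        (N + 1) * ((r⁻¹) ^ N * (r⁻¹) ^ 2 * s⁻¹) * (s - r) ^ 2 := by
    simp only [inv_pow]
    field_simp
    ring
  have e2 : (s⁻¹ - r⁻¹) ^ 2 ≤ (s - r) ^ 2 := by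
    rw [inv_sub_inv hs0.ne' hr0.ne', div_pow]
    rw [show (r - s) ^ 2 = (s - r) ^ 2 by ring]
    exact div_le_self (sq_nonneg _) (one_le_pow₀ (one_le_mul_of_one_le_of_one_le hs hr))
  have i1 : (r⁻¹) ^ N * (r⁻¹) ^ 2 * s⁻¹ ≤ 1 := by
    have a1 : (r⁻¹) ^ N ≤ 1 := pow_le_one₀ (inv_nonneg.2 hr0.le) (inv_le_one_of_one_le₀ hr)
    have a2 : (r⁻¹) ^ 2 ≤ 1 := pow_le_one₀ (inv_nonneg.2 hr0.le) (inv_le_one_of_one_le₀ hr)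
    exact mul_le_one₀ (mul_le_one₀ a1 (by positivity) a2) (by positivity)
      (inv_le_one_of_one_le₀ hs)
  rw [e]
  refine (abs_add_le _ _).trans ?_
  rw [abs_of_nonneg (by positivity : 0 ≤ (N + 1) * ((r⁻¹) ^ N * (r⁻¹) ^ 2 * s⁻¹) * (s - r) ^ 2)]
  have h3 : (N + 1) * ((r⁻¹) ^ N * (r⁻¹) ^ 2 * s⁻¹) * (s - r) ^ 2 ≤ (N + 1) * 1 * (s - r) ^ 2 := by
    gcongr
  have h4 : (N : ℝ) * (N + 1) * (s⁻¹ - r⁻¹) ^ 2 ≤ N * (N + 1) * (s - r) ^ 2 := by gcongr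
  linarith

/-- The homogeneous kernel `a / |a| ^ (N+1)`. -/
noncomputable def homKer (N : ℕ) (a : H) : H := (‖a‖ ^ (N + 1))⁻¹ • a

/-- The derivative of `homKer`. -/
noncomputable def homKerLin (N : ℕ) (a h : H) : H :=
  (‖a‖ ^ (N + 1))⁻¹ • h - ((N + 1) * (‖a‖ ^ (N + 2))⁻¹ * (inner ℝ a h / ‖a‖)) • a

lemma norm_homKer_le (N : ℕ) {a : H} (ha : 1 ≤ ‖a‖) : ‖homKer N a‖ ≤ 1 := by
  have : 0 < ‖a‖ := by linarith
  rw [homKer, norm_smul, norm_inv, norm_pow, norm_norm, pow_succ, mul_inv, mul_assoc,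
    inv_mul_cancel₀ this.ne', mul_one]
  exact inv_le_one_of_one_le₀ (one_le_pow₀ ha)

lemma abs_norm_add_sub_le {a h : H} (ha : 1 ≤ ‖a‖) (hah : 1 ≤ ‖a + h‖) :
    |‖a + h‖ - ‖a‖ - inner ℝ a h / ‖a‖| ≤ ‖h‖ ^ 2 := by
  have ha0 : 0 < ‖a‖ := by linarith
  have hb0 : 0 ≤ ‖a + h‖ := norm_nonneg _
  have hsq := norm_add_sq_real a h
  have hin : |inner ℝ a h| ≤ ‖a‖ * ‖h‖ := abs_real_inner_le_norm a h
  have hd : |‖a‖ - ‖a + h‖| ≤ ‖h‖ := by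
    have := abs_norm_sub_norm_le a (a + h)
    simpa using this
  have e : ‖a + h‖ - ‖a‖ - inner ℝ a h / ‖a‖ =
      (inner ℝ a h * (‖a‖ - ‖a + h‖) + ‖h‖ ^ 2 * ‖a‖) / (‖a‖ * (‖a‖ + ‖a + h‖)) := by
    field_simp
    linear_combination hsq * ‖a‖
  rw [e, abs_div, abs_of_pos (by positivity : 0 < ‖a‖ * (‖a‖ + ‖a + h‖)),
    div_le_iff₀ (by positivity)]
  calc _ ≤ |inner ℝ a h * (‖a‖ - ‖a + h‖)| + |‖h‖ ^ 2 * ‖a‖| := abs_add_le _ _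
    _ ≤ (‖a‖ * ‖h‖) * ‖h‖ + ‖h‖ ^ 2 * ‖a‖ := by
      rw [abs_mul, abs_of_nonneg (by positivity : 0 ≤ ‖h‖ ^ 2 * ‖a‖)]
      gcongr
    _ = ‖h‖ ^ 2 * (‖a‖ * 2) := by ring
    _ ≤ _ := by gcongr; linarith

lemma norm_homKer_add_sub_le (N : ℕ) {M : ℝ} {a h : H} (ha : 1 ≤ ‖a‖) (hM : ‖a‖ ≤ M)
    (hah : 1 ≤ ‖a + h‖) :
    ‖homKer N (a + h) - homKer N a - homKerLin N a h‖ ≤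
        ((N + 1) + 2 * (N + 1) ^ 2 * M) * ‖h‖ ^ 2 := by
  have ha0 : 0 < ‖a‖ := by linarith
  have hM0 : 0 ≤ M := by linarith
  set r := ‖a‖ with hr
  set s := ‖a + h‖ with hs
  have hs0 : 0 < s := by linarith
  have hd : |s - r| ≤ ‖h‖ := by
    have := abs_norm_sub_norm_le (a + h) a
    simpa using this
  have h1 := abs_inv_pow_sub_le N ha hah
  have h2 := abs_norm_add_sub_le ha hah
  rw [← hr, ← hs] at h2
  have e : homKer N (a + h) - homKer N a - homKerLin N a h =
      ((s ^ (N + 1))⁻¹ - (r ^ (N + 1))⁻¹) • h +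
      (((s ^ (N + 1))⁻¹ - (r ^ (N + 1))⁻¹ + (N + 1) * (r ^ (N + 2))⁻¹ * (s - r)) -
        (N + 1) * (r ^ (N + 2))⁻¹ * (s - r - inner ℝ a h / r)) • a := by
    rw [homKer, homKer, homKerLin, ← hr, ← hs]
    module
  have h3 : |(s ^ (N + 1))⁻¹ - (r ^ (N + 1))⁻¹| ≤ (N + 1) * ‖h‖ := by
    rw [← inv_pow, ← inv_pow]
    have := abs_pow_sub_pow_le s⁻¹ r⁻¹ (N + 1)
    refine this.trans ?_
    have i1 : s⁻¹ ≤ 1 := inv_le_one_of_one_le₀ hah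
    have i2 : r⁻¹ ≤ 1 := inv_le_one_of_one_le₀ ha
    have i3 : max |s⁻¹| |r⁻¹| ≤ 1 := by
      rw [abs_of_pos (by positivity), abs_of_pos (by positivity)]; exact max_le i1 i2
    have i4 : |s⁻¹ - r⁻¹| ≤ ‖h‖ := by
      rw [inv_sub_inv hs0.ne' ha0.ne', abs_div, abs_of_pos (by positivity : 0 < s * r),
        abs_sub_comm]
      exact (div_le_self (abs_nonneg _) (one_le_mul_of_one_le_of_one_le hah ha)).trans hd
    have i5 : max |s⁻¹| |r⁻¹| ^ N ≤ 1 := pow_le_one₀ (le_max_of_le_left (abs_nonneg _)) i3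
    rw [Nat.add_sub_cancel]
    push_cast
    calc _ ≤ ‖h‖ * (N + 1) * 1 := by gcongr
      _ = _ := by ring
  have h4 : |(N + 1) * (r ^ (N + 2))⁻¹ * (s - r - inner ℝ a h / r)| ≤ (N + 1) * ‖h‖ ^ 2 := by
    rw [abs_mul, abs_of_nonneg (by positivity)]
    have : (r ^ (N + 2))⁻¹ ≤ 1 := inv_le_one_of_one_le₀ (one_le_pow₀ ha)
    calc _ ≤ (N + 1) * 1 * ‖h‖ ^ 2 := by gcongr
      _ = _ := by ring
  rw [e]
  have h5 : (s - r) ^ 2 ≤ ‖h‖ ^ 2 := by rw [← sq_abs]; gcongr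
  have h6 := (abs_sub _ _).trans (add_le_add h1 h4)
  calc _ ≤ |(s ^ (N + 1))⁻¹ - (r ^ (N + 1))⁻¹| * ‖h‖ + |_| * r := by
        refine (norm_add_le _ _).trans (le_of_eq ?_)
        rw [norm_smul, norm_smul, Real.norm_eq_abs, Real.norm_eq_abs]
    _ ≤ ((N + 1) * ‖h‖) * ‖h‖ + ((N + 1) ^ 2 * (s - r) ^ 2 + (N + 1) * ‖h‖ ^ 2) * M := by gcongr
    _ ≤ ((N + 1) * ‖h‖) * ‖h‖ + ((N + 1) ^ 2 * ‖h‖ ^ 2 + (N + 1) ^ 2 * ‖h‖ ^ 2) * M := by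
        gcongr
        have : (0 : ℝ) ≤ N := Nat.cast_nonneg N
        nlinarith
    _ = _ := by ring

lemma norm_homKer_add_sub_le_linear (N : ℕ) {a h : H} (ha : 1 ≤ ‖a‖) (hah : 1 ≤ ‖a + h‖) :
    ‖homKer N (a + h) - homKer N a‖ ≤ (N + 2) * ‖h‖ := by
  have ha0 : 0 < ‖a‖ := by linarith
  set r := ‖a‖ with hr
  set s := ‖a + h‖ with hs
  have hs0 : 0 < s := by linarith
  have hd : |s - r| ≤ ‖h‖ := by
    have := abs_norm_sub_norm_le (a + h) a
    simpa using this
  have e : homKer N (a + h) - homKer N a =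
      (s ^ (N + 1))⁻¹ • h + ((s ^ (N + 1))⁻¹ - (r ^ (N + 1))⁻¹) • a := by
    rw [homKer, homKer, ← hr, ← hs]
    module
  have i2 : r⁻¹ ≤ 1 := inv_le_one_of_one_le₀ ha
  have i1 : s⁻¹ ≤ 1 := inv_le_one_of_one_le₀ hah
  have h3 : |(s ^ (N + 1))⁻¹ - (r ^ (N + 1))⁻¹| * r ≤ (N + 1) * ‖h‖ := by
    rw [← inv_pow, ← inv_pow]
    have i3 : max |s⁻¹| |r⁻¹| ≤ 1 := by
      rw [abs_of_pos (by positivity), abs_of_pos (by positivity)]; exact max_le i1 i2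
    have i4 : |s⁻¹ - r⁻¹| ≤ ‖h‖ * r⁻¹ := by
      rw [inv_sub_inv hs0.ne' ha0.ne', abs_div, abs_of_pos (by positivity : 0 < s * r),
        abs_sub_comm, div_eq_mul_inv, mul_inv]
      calc _ ≤ ‖h‖ * (1 * r⁻¹) := by gcongr
        _ = _ := by ring
    have i5 : max |s⁻¹| |r⁻¹| ^ N ≤ 1 := pow_le_one₀ (le_max_of_le_left (abs_nonneg _)) i3
    have := abs_pow_sub_pow_le s⁻¹ r⁻¹ (N + 1)
    rw [Nat.add_sub_cancel] at this
    push_cast at this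
    calc _ ≤ (‖h‖ * r⁻¹ * (N + 1) * 1) * r := by
          refine mul_le_mul_of_nonneg_right (this.trans ?_) ha0.le
          gcongr
      _ = _ := by field_simp
  rw [e]
  have h4 : (s ^ (N + 1))⁻¹ ≤ 1 := inv_le_one_of_one_le₀ (one_le_pow₀ hah)
  calc _ ≤ (s ^ (N + 1))⁻¹ * ‖h‖ + |(s ^ (N + 1))⁻¹ - (r ^ (N + 1))⁻¹| * r := by
        refine (norm_add_le _ _).trans (le_of_eq ?_)
        rw [norm_smul, norm_smul, Real.norm_eq_abs, Real.norm_eq_abs, abs_of_pos (by positivity)]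
    _ ≤ 1 * ‖h‖ + (N + 1) * ‖h‖ := by gcongr
    _ = _ := by ring

lemma homKerLin_add_smul (N : ℕ) (a h : H) (p q : ℝ) :
    p • homKerLin N a (q • h) = q • homKerLin N a (p • h) := by
  simp only [homKerLin, real_inner_smul_right]
  module

/-- Second order cancellation of `homKer` at a convex combination. -/
lemma abs_sum_homKer_le (N : ℕ) {M p q : ℝ} (hp : 0 < p) (hq : 0 < q) {a a₁ a₃ : H}
    (ha : 1 ≤ ‖a‖) (hM : ‖a‖ ≤ M) (ha₁ : 1 ≤ ‖a₁‖) (ha₃ : 1 ≤ ‖a₃‖)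
    (h : (p + q) • a = p • a₁ + q • a₃) :
    |q * inner ℝ (homKer N a₁) (homKer N a) + p * inner ℝ (homKer N a) (homKer N a₃) -
      (p + q) * inner ℝ (homKer N a₁) (homKer N a₃)| ≤
      (2 * ((N + 1) + 2 * (N + 1) ^ 2 * M) + (N + 2) ^ 2) * (p * q / (p + q)) * ‖a₁ - a₃‖ ^ 2 := by
  have hpq : 0 < p + q := by linarith
  set δ := a₁ - a₃ with hδ
  have e1 : a₁ = a + (q / (p + q)) • δ := by
    have : (p + q) • a₁ = (p + q) • (a + (q / (p + q)) • δ) := by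
      rw [smul_add, h, smul_smul, mul_div_cancel₀ _ hpq.ne', hδ]
      module
    exact smul_right_injective H hpq.ne' this
  have e3 : a₃ = a + (-(p / (p + q))) • δ := by
    have : (p + q) • a₃ = (p + q) • (a + (-(p / (p + q))) • δ) := by
      rw [smul_add, h, smul_smul, mul_neg, mul_div_cancel₀ _ hpq.ne', hδ]
      module
    exact smul_right_injective H hpq.ne' this
  set C : ℝ := (N + 1) + 2 * (N + 1) ^ 2 * M with hC
  have hC0 : 0 ≤ C := by have : 0 ≤ M := by linarith
                         positivity
  set f := homKer N a with hf
  set u := homKer N a₁ - f with hu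
  set t := homKer N a₃ - f with ht
  have hn1 : ‖(q / (p + q)) • δ‖ = q / (p + q) * ‖δ‖ := by
    rw [norm_smul, Real.norm_of_nonneg (by positivity)]
  have hn3 : ‖(-(p / (p + q))) • δ‖ = p / (p + q) * ‖δ‖ := by
    rw [norm_smul, norm_neg, Real.norm_of_nonneg (by positivity)]
  have hu1 : ‖u - homKerLin N a ((q / (p + q)) • δ)‖ ≤ C * (q / (p + q) * ‖δ‖) ^ 2 := by
    rw [← hn1, hu, e1]
    exact norm_homKer_add_sub_le N ha hM (e1 ▸ ha₁)
  have ht1 : ‖t - homKerLin N a ((-(p / (p + q))) • δ)‖ ≤ C * (p / (p + q) * ‖δ‖) ^ 2 := by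
    rw [← hn3, ht, e3]
    exact norm_homKer_add_sub_le N ha hM (e3 ▸ ha₃)
  have hu2 : ‖u‖ ≤ (N + 2) * (q / (p + q) * ‖δ‖) := by
    rw [← hn1, hu, e1]
    exact norm_homKer_add_sub_le_linear N ha (e1 ▸ ha₁)
  have ht2 : ‖t‖ ≤ (N + 2) * (p / (p + q) * ‖δ‖) := by
    rw [← hn3, ht, e3]
    exact norm_homKer_add_sub_le_linear N ha (e3 ▸ ha₃)
  have hlin : p • u + q • t = p • (u - homKerLin N a ((q / (p + q)) • δ)) +
      q • (t - homKerLin N a ((-(p / (p + q))) • δ)) := by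
    have : p • homKerLin N a ((q / (p + q)) • δ) + q • homKerLin N a ((-(p / (p + q))) • δ) =
        0 := by
      rw [homKerLin_add_smul, homKerLin_add_smul N a δ q, ← sub_eq_zero]
      simp only [homKerLin, real_inner_smul_right]
      module
    rw [smul_sub p u, smul_sub q t, sub_add_sub_comm, this, sub_zero]
  have hput : ‖p • u + q • t‖ ≤ C * (p * q / (p + q)) * ‖δ‖ ^ 2 := by
    rw [hlin]
    calc _ ≤ p * (C * (q / (p + q) * ‖δ‖) ^ 2) + q * (C * (p / (p + q) * ‖δ‖) ^ 2) := by
          refine (norm_add_le _ _).trans ?_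
          rw [norm_smul, norm_smul, Real.norm_of_nonneg hp.le, Real.norm_of_nonneg hq.le]
          gcongr
      _ = _ := by field_simp; ring
  have hid : q * inner ℝ (homKer N a₁) f + p * inner ℝ f (homKer N a₃) -
      (p + q) * inner ℝ (homKer N a₁) (homKer N a₃) =
      -inner ℝ f (p • u + q • t) - (p + q) * inner ℝ u t := by
    have e4 : homKer N a₁ = f + u := by rw [hu]; abel
    have e5 : homKer N a₃ = f + t := by rw [ht]; abel
    rw [e4, e5]
    simp only [inner_add_left, inner_add_right, real_inner_smul_right]
    rw [real_inner_comm f u]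
    ring
  rw [hid]
  have hf1 : ‖f‖ ≤ 1 := norm_homKer_le N ha
  calc _ ≤ |inner ℝ f (p • u + q • t)| + (p + q) * |inner ℝ u t| := by
        refine (abs_sub _ _).trans ?_
        rw [abs_neg, abs_mul, abs_of_pos hpq]
    _ ≤ 1 * (C * (p * q / (p + q)) * ‖δ‖ ^ 2) + (p + q) *
        (((N + 2) * (q / (p + q) * ‖δ‖)) * ((N + 2) * (p / (p + q) * ‖δ‖))) := by
        gcongr
        · exact (abs_real_inner_le_norm _ _).trans (by gcongr)
        · exact (abs_real_inner_le_norm _ _).trans (by gcongr)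
    _ = (C + (N + 2) ^ 2) * (p * q / (p + q)) * ‖δ‖ ^ 2 := by field_simp
    _ ≤ _ := by gcongr; linarith

end Curve

section Curve

variable {H : Type*} [NormedAddCommGroup H] [InnerProductSpace ℝ H]

variable {Ω : Type*}

/-- The regularised distance between lifted curve points. -/
noncomputable def cdist (g : Ω → H) (ρ : Ω → ℝ) (x y : Ω) : ℝ := max ‖g x - g y‖ (ρ x + ρ y)

/-- The regularised kernel on lifted curve points. -/
noncomputable def cker (k : ℕ) (t : Ω → ℝ) (g : Ω → H) (ρ : Ω → ℝ) (x y : Ω) : H :=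
  (|t x - t y| ^ k / cdist g ρ x y ^ (k + 2)) • (g x - g y)

/-- The symmetrisation of `cker` over triples. -/
noncomputable def csym (k : ℕ) (t : Ω → ℝ) (g : Ω → H) (ρ : Ω → ℝ) (x y z : Ω) : ℝ :=
  inner ℝ (cker k t g ρ x y) (cker k t g ρ x z) + inner ℝ (cker k t g ρ y x) (cker k t g ρ y z) +
    inner ℝ (cker k t g ρ z x) (cker k t g ρ z y)

/-- The largest of the three regularised distances. -/
noncomputable def cdiam (g : Ω → H) (ρ : Ω → ℝ) (x y z : Ω) : ℝ :=
  max (max (cdist g ρ x y) (cdist g ρ x z)) (cdist g ρ y z)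

variable {k : ℕ} {t : Ω → ℝ} {g : Ω → H} {ρ : Ω → ℝ}

lemma cdist_comm (x y : Ω) : cdist g ρ x y = cdist g ρ y x := by
  rw [cdist, cdist, norm_sub_rev, add_comm]

lemma cdist_pos (hρ : ∀ x, 0 < ρ x) (x y : Ω) : 0 < cdist g ρ x y :=
  (add_pos (hρ x) (hρ y)).trans_le (le_max_right _ _)

lemma cdist_triangle (hρ : ∀ x, 0 < ρ x) (x y z : Ω) :
    cdist g ρ x z ≤ cdist g ρ x y + cdist g ρ y z := by
  refine max_le ?_ ?_
  · refine (norm_sub_le_norm_sub_add_norm_sub (g x) (g y) (g z)).trans ?_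
    exact add_le_add (le_max_left _ _) (le_max_left _ _)
  · have h1 : ρ x + ρ y ≤ cdist g ρ x y := le_max_right _ _
    have h2 : ρ y + ρ z ≤ cdist g ρ y z := le_max_right _ _
    linarith [hρ y]

lemma abs_cdist_sub_le (hρ : ∀ x, 0 < ρ x) (x y z : Ω) :
    |cdist g ρ x z - cdist g ρ y z| ≤ cdist g ρ x y := by
  rw [abs_le]
  have h1 := cdist_triangle (g := g) hρ x y z
  have h2 := cdist_triangle (g := g) hρ y x z
  rw [cdist_comm y x] at h2
  constructor <;> linarith

lemma cker_antisymm (x y : Ω) : cker k t g ρ x y = -cker k t g ρ y x := by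
  rw [cker, cker, cdist_comm, abs_sub_comm, ← smul_neg, neg_sub]

lemma norm_cker_le (hρ : ∀ x, 0 < ρ x) (ht : ∀ x y, |t x - t y| ≤ ‖g x - g y‖) (x y : Ω) :
    ‖cker k t g ρ x y‖ ≤ (cdist g ρ x y)⁻¹ := by
  have hD := cdist_pos (g := g) hρ x y
  have h1 : ‖g x - g y‖ ≤ cdist g ρ x y := le_max_left _ _
  have h2 : |t x - t y| ≤ cdist g ρ x y := (ht x y).trans h1
  rw [cker, norm_smul, Real.norm_of_nonneg (by positivity)]
  calc _ ≤ cdist g ρ x y ^ k / cdist g ρ x y ^ (k + 2) * cdist g ρ x y := by gcongr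
    _ = _ := by rw [pow_add]; field_simp

lemma norm_cker_sub_cker_le (hρ : ∀ x, 0 < ρ x) (ht : ∀ x y, |t x - t y| ≤ ‖g x - g y‖)
    {x y z : Ω} (h1 : cdist g ρ x y ≤ cdist g ρ x z) (h2 : cdist g ρ x y ≤ cdist g ρ y z) :
    ‖cker k t g ρ x z - cker k t g ρ y z‖ ≤
      (k + 1) * 2 ^ (k + 5) * cdist g ρ x y * (cdist g ρ x z ^ 2)⁻¹ := by
  set e := cdist g ρ x y with he
  set D := cdist g ρ x z with hD
  set D' := cdist g ρ y z with hD'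
  have he0 : 0 < e := cdist_pos hρ x y
  have hD0 : 0 < D := cdist_pos hρ x z
  have hD'0 : 0 < D' := cdist_pos hρ y z
  have hDD : |D - D'| ≤ e := abs_cdist_sub_le hρ x y z
  have hDD1 : D ≤ 2 * D' := by linarith [(abs_le.1 hDD).2]
  have hDD2 : D' ≤ 2 * D := by linarith [(abs_le.1 hDD).1]
  set A := |t x - t z| with hA
  set A' := |t y - t z| with hA'
  have hAD : A ≤ D := (ht x z).trans (le_max_left _ _)
  have hAD' : A' ≤ D' := (ht y z).trans (le_max_left _ _)
  have hA0 : 0 ≤ A := abs_nonneg _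
  have hA'0 : 0 ≤ A' := abs_nonneg _
  have hAA : |A - A'| ≤ e := by
    refine (abs_abs_sub_abs_le _ _).trans ?_
    rw [sub_sub_sub_cancel_right]
    exact (ht x y).trans (le_max_left _ _)
  have hu' : ‖g y - g z‖ ≤ D' := le_max_left _ _
  have hxy : ‖g x - g y‖ ≤ e := le_max_left _ _
  have hdec : cker k t g ρ x z - cker k t g ρ y z = (A ^ k / D ^ (k + 2)) • (g x - g y) +
      ((A ^ k - A' ^ k) / D ^ (k + 2)) • (g y - g z) +
      (A' ^ k * ((D ^ (k + 2))⁻¹ - (D' ^ (k + 2))⁻¹)) • (g y - g z) := by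
    rw [cker, cker, ← hD, ← hD', ← hA, ← hA', div_eq_mul_inv, div_eq_mul_inv, div_eq_mul_inv]
    module
  have t1 : ‖(A ^ k / D ^ (k + 2)) • (g x - g y)‖ ≤ e * (D ^ 2)⁻¹ := by
    rw [norm_smul, Real.norm_of_nonneg (by positivity)]
    calc _ ≤ D ^ k / D ^ (k + 2) * e := by gcongr
      _ = _ := by rw [pow_add]; field_simp
  have hpow : |A ^ k - A' ^ k| * D' ≤ k * 2 ^ k * e * D ^ k := by
    have := abs_pow_sub_pow_le A A' k
    rw [abs_of_nonneg hA0, abs_of_nonneg hA'0] at this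
    have hm : max A A' ≤ 2 * D := max_le (by linarith) (by linarith)
    have hm0 : 0 ≤ max A A' := le_max_of_le_left hA0
    rcases Nat.eq_zero_or_pos k with rfl | hk
    · simp
    · calc _ ≤ (e * k * (2 * D) ^ (k - 1)) * (2 * D) := by
            refine mul_le_mul (this.trans ?_) hDD2 hD'0.le (by positivity)
            gcongr
        _ = e * k * ((2 * D) ^ (k - 1) * (2 * D)) := by ring
        _ = _ := by rw [← pow_succ, Nat.sub_add_cancel hk, mul_pow]; ring
  have t2 : ‖((A ^ k - A' ^ k) / D ^ (k + 2)) • (g y - g z)‖ ≤ k * 2 ^ k * (e * (D ^ 2)⁻¹) := by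
    rw [norm_smul, norm_div, Real.norm_eq_abs,
      Real.norm_of_nonneg (by positivity : 0 ≤ D ^ (k + 2))]
    calc _ ≤ |A ^ k - A' ^ k| / D ^ (k + 2) * D' := by gcongr
      _ = (|A ^ k - A' ^ k| * D') / D ^ (k + 2) := by ring
      _ ≤ (k * 2 ^ k * e * D ^ k) / D ^ (k + 2) := by gcongr
      _ = _ := by rw [pow_add]; field_simp
  have hinv : |(D ^ (k + 2))⁻¹ - (D' ^ (k + 2))⁻¹| * D' ^ (k + 1) ≤
      (k + 2) * 2 ^ (k + 2) * (e * (D ^ 2)⁻¹) := by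
    have := abs_pow_sub_pow_le D' D (k + 2)
    rw [abs_of_pos hD0, abs_of_pos hD'0, abs_sub_comm D' D] at this
    have hm : max D' D ≤ 2 * D := max_le hDD2 (by linarith)
    have hm0 : 0 ≤ max D' D := le_max_of_le_left hD'0.le
    rw [inv_sub_inv (by positivity) (by positivity), abs_div,
      abs_of_pos (by positivity : 0 < D ^ (k + 2) * D' ^ (k + 2))]
    calc _ ≤ (e * (k + 2) * (2 * D) ^ (k + 1)) / (D ^ (k + 2) * D' ^ (k + 2)) * D' ^ (k + 1) := by
          gcongr
          refine this.trans ?_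
          push_cast
          gcongr
      _ = (e * (k + 2) * 2 ^ (k + 1)) * D⁻¹ * D'⁻¹ := by
          rw [mul_pow, pow_succ D (k + 1), pow_succ D' (k + 1)]
          field_simp
      _ ≤ (e * (k + 2) * 2 ^ (k + 1)) * D⁻¹ * (2 * D⁻¹) := by
          gcongr
          rw [← div_eq_mul_inv, inv_le_comm₀ hD'0 (by positivity), inv_div]
          linarith
      _ = _ := by ring
  have t3 : ‖(A' ^ k * ((D ^ (k + 2))⁻¹ - (D' ^ (k + 2))⁻¹)) • (g y - g z)‖ ≤
      (k + 2) * 2 ^ (k + 2) * (e * (D ^ 2)⁻¹) := by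
    rw [norm_smul, norm_mul, Real.norm_of_nonneg (by positivity : 0 ≤ A' ^ k), Real.norm_eq_abs]
    refine le_trans ?_ hinv
    calc _ ≤ D' ^ k * |(D ^ (k + 2))⁻¹ - (D' ^ (k + 2))⁻¹| * D' := by gcongr
      _ = _ := by ring
  rw [hdec]
  refine (norm_add_le _ _).trans ((add_le_add ((norm_add_le _ _).trans
      (add_le_add t1 t2)) t3).trans ?_)
  have hX : 0 ≤ e * (D ^ 2)⁻¹ := by positivity
  have hk : (1 : ℝ) + k * 2 ^ k + (k + 2) * 2 ^ (k + 2) ≤ (k + 1) * 2 ^ (k + 5) := by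
    have h3 : (1 : ℝ) ≤ 2 ^ k := one_le_pow₀ (by norm_num)
    have : (0 : ℝ) ≤ k * 2 ^ k := by positivity
    rw [pow_add, pow_add]
    nlinarith
  nlinarith [mul_le_mul_of_nonneg_right hk hX]

lemma csym_swap_left (x y z : Ω) : csym k t g ρ x y z = csym k t g ρ y x z := by
  rw [csym, csym, real_inner_comm (cker k t g ρ z y) (cker k t g ρ z x)]
  ring

lemma csym_swap_right (x y z : Ω) : csym k t g ρ x y z = csym k t g ρ x z y := by
  rw [csym, csym, real_inner_comm (cker k t g ρ x z) (cker k t g ρ x y)]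
  ring

lemma cdiam_swap_left (x y z : Ω) : cdiam g ρ x y z = cdiam g ρ y x z := by
  rw [cdiam, cdiam, cdist_comm y x, max_assoc, max_assoc, max_comm (cdist g ρ x z)]

lemma cdiam_swap_right (x y z : Ω) : cdiam g ρ x y z = cdiam g ρ x z y := by
  rw [cdiam, cdiam, cdist_comm z y, max_comm (cdist g ρ x z)]

lemma abs_csym_le_of_le (hρ : ∀ x, 0 < ρ x) (ht : ∀ x y, |t x - t y| ≤ ‖g x - g y‖)
    {x y z : Ω} (h1 : cdist g ρ x y ≤ cdist g ρ x z) (h2 : cdist g ρ x y ≤ cdist g ρ y z) :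
    |csym k t g ρ x y z| ≤ (k + 2) * 2 ^ (k + 7) * (cdiam g ρ x y z ^ 2)⁻¹ := by
  have he0 : 0 < cdist g ρ x y := cdist_pos hρ x y
  have hD0 : 0 < cdist g ρ x z := cdist_pos hρ x z
  have hD'0 : 0 < cdist g ρ y z := cdist_pos hρ y z
  have hH0 : 0 < cdiam g ρ x y z := hD'0.trans_le (le_max_right _ _)
  have hD1 := cdist_triangle (g := g) hρ x y z
  have hD2 := cdist_triangle (g := g) hρ y x z
  rw [cdist_comm y x] at hD2
  have hHD : cdiam g ρ x y z ≤ 2 * cdist g ρ x z :=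
    max_le (max_le (by linarith) (by linarith)) (by linarith)
  have hHD' : cdiam g ρ x y z ≤ 2 * cdist g ρ y z :=
    max_le (max_le (by linarith) (by linarith)) (by linarith)
  have hsym : csym k t g ρ x y z = inner ℝ (cker k t g ρ x y)
      (cker k t g ρ x z - cker k t g ρ y z) +
      inner ℝ (cker k t g ρ z x) (cker k t g ρ z y) := by
    rw [csym, cker_antisymm y x, inner_sub_right, inner_neg_left]
    ring
  have b1 : |inner ℝ (cker k t g ρ x y) (cker k t g ρ x z - cker k t g ρ y z)| ≤
      (k + 1) * 2 ^ (k + 5) * (cdist g ρ x z ^ 2)⁻¹ := by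
    refine (abs_real_inner_le_norm _ _).trans ?_
    calc _ ≤ (cdist g ρ x y)⁻¹ * ((k + 1) * 2 ^ (k + 5) * cdist g ρ x y *
        (cdist g ρ x z ^ 2)⁻¹) := by
          gcongr
          · exact norm_cker_le hρ ht x y
          · exact norm_cker_sub_cker_le hρ ht h1 h2
      _ = _ := by field_simp
  have b2 : |inner ℝ (cker k t g ρ z x) (cker k t g ρ z y)| ≤
      (cdist g ρ x z)⁻¹ * (cdist g ρ y z)⁻¹ := by
    refine (abs_real_inner_le_norm _ _).trans ?_
    rw [cdist_comm x z, cdist_comm y z]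
    exact mul_le_mul (norm_cker_le hρ ht z x) (norm_cker_le hρ ht z y) (norm_nonneg _)
      (inv_nonneg.2 (cdist_pos hρ z x).le)
  have i1 : (cdist g ρ x z)⁻¹ ≤ 2 * (cdiam g ρ x y z)⁻¹ := by
    rw [← div_eq_mul_inv, inv_le_comm₀ hD0 (by positivity), inv_div]; linarith
  have i2 : (cdist g ρ y z)⁻¹ ≤ 2 * (cdiam g ρ x y z)⁻¹ := by
    rw [← div_eq_mul_inv, inv_le_comm₀ hD'0 (by positivity), inv_div]; linarith
  rw [hsym]
  refine (abs_add_le _ _).trans ((add_le_add b1 b2).trans ?_)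
  rw [← inv_pow, ← inv_pow]
  calc _ ≤ (k + 1) * 2 ^ (k + 5) * (2 * (cdiam g ρ x y z)⁻¹) ^ 2 +
        2 * (cdiam g ρ x y z)⁻¹ * (2 * (cdiam g ρ x y z)⁻¹) := by gcongr
    _ = ((k + 1) * 2 ^ (k + 7) + 4) * (cdiam g ρ x y z)⁻¹ ^ 2 := by ring
    _ ≤ _ := by
      gcongr
      have : (1 : ℝ) ≤ 2 ^ k := one_le_pow₀ (by norm_num)
      rw [pow_add]
      nlinarith

lemma abs_csym_le (hρ : ∀ x, 0 < ρ x) (ht : ∀ x y, |t x - t y| ≤ ‖g x - g y‖)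
    (x y z : Ω) :
    |csym k t g ρ x y z| ≤ (k + 2) * 2 ^ (k + 7) * (cdiam g ρ x y z ^ 2)⁻¹ := by
  rcases le_total (cdist g ρ x y) (cdist g ρ x z) with h1 | h1
  · rcases le_total (cdist g ρ x y) (cdist g ρ y z) with h2 | h2
    · exact abs_csym_le_of_le hρ ht h1 h2
    · rw [csym_swap_left, csym_swap_right, cdiam_swap_left, cdiam_swap_right]
      refine abs_csym_le_of_le hρ ht ?_ ?_
      · rwa [cdist_comm y x]
      · rw [cdist_comm z x]
        exact h2.trans h1
  · rcases le_total (cdist g ρ x z) (cdist g ρ y z) with h2 | h2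
    · rw [csym_swap_right, cdiam_swap_right]
      refine abs_csym_le_of_le hρ ht h1 ?_
      rwa [cdist_comm z y]
    · rw [csym_swap_left, csym_swap_right, cdiam_swap_left, cdiam_swap_right]
      refine abs_csym_le_of_le hρ ht ?_ ?_
      · rw [cdist_comm y x]
        exact h2.trans h1
      · rw [cdist_comm z x]
        exact h2

/-- Majorant of the symmetrised kernel at triples with an unresolved pair. -/
noncomputable def cnear (t : Ω → ℝ) (g : Ω → H) (ρ : Ω → ℝ) (x y z : Ω) : ℝ :=
  ρ x * (cdist g ρ x y)⁻¹ * (max (cdist g ρ x y) |t x - t z| ^ 2)⁻¹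

lemma cnear_nonneg (hρ : ∀ x, 0 < ρ x) (x y z : Ω) : 0 ≤ cnear t g ρ x y z := by
  have := hρ x
  have := cdist_pos (g := g) hρ x y
  rw [cnear]
  positivity

lemma abs_csym_le_cnear (hρ : ∀ x, 0 < ρ x) (ht : ∀ x y, |t x - t y| ≤ ‖g x - g y‖)
    {x y z : Ω} (h : ‖g x - g y‖ < ρ x + ρ y) :
    |csym k t g ρ x y z| ≤ (k + 2) * 2 ^ (k + 8) * (cnear t g ρ x y z + cnear t g ρ y x z) := by
  have key : ∀ x y z : Ω, cdist g ρ x y = ρ x + ρ y → ρ y ≤ ρ x →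
      (cdiam g ρ x y z ^ 2)⁻¹ ≤ 2 * cnear t g ρ x y z := by
    intro x y z h1 h2
    have he0 : 0 < cdist g ρ x y := cdist_pos hρ x y
    have h3 : 1 ≤ 2 * (ρ x * (cdist g ρ x y)⁻¹) := by
      rw [← mul_assoc, ← div_eq_mul_inv, le_div_iff₀ he0]
      linarith
    have h4 : max (cdist g ρ x y) |t x - t z| ≤ cdiam g ρ x y z :=
      max_le ((le_max_left _ _).trans (le_max_left _ _)) (((ht x z).trans (le_max_left _ _)).trans
        ((le_max_right _ _).trans (le_max_left _ _)))
    have h5 : 0 < max (cdist g ρ x y) |t x - t z| := lt_max_of_lt_left he0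
    calc (cdiam g ρ x y z ^ 2)⁻¹ ≤ (max (cdist g ρ x y) |t x - t z| ^ 2)⁻¹ := by gcongr
      _ ≤ 2 * (ρ x * (cdist g ρ x y)⁻¹) * (max (cdist g ρ x y) |t x - t z| ^ 2)⁻¹ :=
        le_mul_of_one_le_left (by positivity) h3
      _ = _ := by rw [cnear]; ring
  have hd : cdist g ρ x y = ρ x + ρ y := max_eq_right h.le
  have n1 := cnear_nonneg (t := t) (g := g) hρ x y z
  have n2 := cnear_nonneg (t := t) (g := g) hρ y x z
  have hk : (cdiam g ρ x y z ^ 2)⁻¹ ≤ 2 * (cnear t g ρ x y z + cnear t g ρ y x z) := by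
    rcases le_total (ρ y) (ρ x) with h2 | h2
    · linarith [key x y z hd h2]
    · have := key y x z (by rw [cdist_comm, hd, add_comm]) h2
      rw [cdiam_swap_left]
      linarith
  calc _ ≤ _ := abs_csym_le hρ ht x y z
    _ ≤ (k + 2) * 2 ^ (k + 7) * (2 * (cnear t g ρ x y z + cnear t g ρ y x z)) := by gcongr
    _ = _ := by ring

end Curve

section Far

variable {H : Type*} [NormedAddCommGroup H] [InnerProductSpace ℝ H] {Ω : Type*}

/-- Squared second difference of a curve at an ordered triple of scale at least `ε`. -/
noncomputable def cfar (γ : ℝ → H) (ε a b c : ℝ) : ℝ :=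
  if a < b ∧ b < c ∧ ε ≤ c - a then ‖slope γ a b - slope γ b c‖ ^ 2 / (c - a) ^ 2 else 0

lemma cfar_nonneg (γ : ℝ → H) (ε a b c : ℝ) : 0 ≤ cfar γ ε a b c := by
  rw [cfar]
  split_ifs <;> positivity

lemma one_le_norm_slope {γ : ℝ → H} (hγ : ∀ a b, |a - b| ≤ ‖γ a - γ b‖) {a b : ℝ} (h : a < b) :
    1 ≤ ‖slope γ a b‖ := by
  have h0 : 0 < b - a := sub_pos.2 h
  rw [slope_def_module, norm_smul, norm_inv, Real.norm_of_nonneg h0.le, ← div_eq_inv_mul,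
    one_le_div h0]
  simpa [abs_of_pos h0] using hγ b a

lemma norm_slope_le {γ : ℝ → H} {M : ℝ} (hγ : ∀ a b, ‖γ a - γ b‖ ≤ M * |a - b|) {a b : ℝ}
    (h : a < b) : ‖slope γ a b‖ ≤ M := by
  have h0 : 0 < b - a := sub_pos.2 h
  rw [slope_def_module, norm_smul, norm_inv, Real.norm_of_nonneg h0.le, ← div_eq_inv_mul,
    div_le_iff₀ h0]
  simpa [abs_of_pos h0] using hγ b a

lemma cker_eq_homKer {k : ℕ} {t : Ω → ℝ} {γ : ℝ → H} {ρ : Ω → ℝ} {x y : Ω} (h : t x < t y)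
    (hfar : ρ x + ρ y ≤ ‖γ (t x) - γ (t y)‖) :
    cker k t (fun x => γ (t x)) ρ x y =
      -((t y - t x)⁻¹ • homKer (k + 1) (slope γ (t x) (t y))) := by
  have h0 : 0 < t y - t x := sub_pos.2 h
  have hs : γ (t x) - γ (t y) = -((t y - t x) • slope γ (t x) (t y)) := by
    rw [sub_smul_slope, vsub_eq_sub, neg_sub]
  rw [cker, cdist, max_eq_left hfar, hs, homKer, norm_neg, norm_smul, Real.norm_of_nonneg h0.le,
    abs_sub_comm, abs_of_pos h0, smul_neg, smul_smul, smul_smul, mul_pow]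
  congr 2
  rw [pow_add (t y - t x) k 2]
  field_simp

lemma abs_csym_le_cfar {k : ℕ} {t : Ω → ℝ} {γ : ℝ → H} {ρ : Ω → ℝ} {M : ℝ}
    (hγ : ∀ a b, |a - b| ≤ ‖γ a - γ b‖) (hγ' : ∀ a b, ‖γ a - γ b‖ ≤ M * |a - b|)
    {x y z : Ω} (hxy : t x < t y) (hyz : t y < t z)
    (h1 : ρ x + ρ y ≤ ‖γ (t x) - γ (t y)‖) (h2 : ρ x + ρ z ≤ ‖γ (t x) - γ (t z)‖)
    (h3 : ρ y + ρ z ≤ ‖γ (t y) - γ (t z)‖) :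
    |csym k t (fun x => γ (t x)) ρ x y z| ≤
      (2 * ((k + 2) + 2 * (k + 2) ^ 2 * M) + (k + 3) ^ 2) *
        (‖slope γ (t x) (t y) - slope γ (t y) (t z)‖ ^ 2 / (t z - t x) ^ 2) := by
  set p := t y - t x with hp
  set q := t z - t y with hq
  have hp0 : 0 < p := sub_pos.2 hxy
  have hq0 : 0 < q := sub_pos.2 hyz
  have hpq : t z - t x = p + q := by rw [hp, hq]; ring
  have hxz := hxy.trans hyz
  have hcomb : (p + q) • slope γ (t x) (t z) = p • slope γ (t x) (t y) +
      q • slope γ (t y) (t z) := by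
    rw [← hpq, hp, hq, sub_smul_slope, sub_smul_slope, sub_smul_slope]
    simp
  have key := abs_sum_homKer_le (k + 1) hp0 hq0 (one_le_norm_slope hγ hxz)
    (norm_slope_le hγ' hxz) (one_le_norm_slope hγ hxy) (one_le_norm_slope hγ hyz) hcomb
  have e1 := cker_eq_homKer (k := k) hxy h1
  have e2 := cker_eq_homKer (k := k) hxz h2
  have e3 := cker_eq_homKer (k := k) hyz h3
  have heq : csym k t (fun x => γ (t x)) ρ x y z = (p * q * (p + q))⁻¹ *
      (q * inner ℝ (homKer (k + 1) (slope γ (t x) (t y))) (homKer (k + 1) (slope γ (t x) (t z))) +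
        p * inner ℝ (homKer (k + 1) (slope γ (t x) (t z))) (homKer (k + 1) (slope γ (t y) (t z))) -
        (p + q) * inner ℝ (homKer (k + 1) (slope γ (t x) (t y)))
          (homKer (k + 1) (slope γ (t y) (t z)))) := by
    rw [csym, cker_antisymm y x, cker_antisymm z x, cker_antisymm z y, e1, e2, e3, hpq, ← hp, ← hq]
    simp only [inner_neg_left, inner_neg_right, neg_neg, real_inner_smul_left,
      real_inner_smul_right]
    field_simp
    ring
  rw [heq, abs_mul, abs_of_pos (by positivity : 0 < (p * q * (p + q))⁻¹), hpq]
  refine (mul_le_mul_of_nonneg_left key (by positivity)).trans_eq ?_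
  push_cast
  field_simp
  ring

/-- Sum of a function of three variables over all orderings. -/
def permSum (F : Ω → Ω → Ω → ℝ) (x y z : Ω) : ℝ :=
  F x y z + F x z y + (F y x z + F y z x) + (F z x y + F z y x)

lemma permSum_swap_left (F : Ω → Ω → Ω → ℝ) (x y z : Ω) : permSum F x y z = permSum F y x z := by
  rw [permSum, permSum]
  ring

lemma permSum_swap_right (F : Ω → Ω → Ω → ℝ) (x y z : Ω) : permSum F x y z = permSum F x z y := by
  rw [permSum, permSum]
  ring

lemma abs_csym_le_permSum {k : ℕ} {t : Ω → ℝ} {γ : ℝ → H} {ρ : Ω → ℝ} {M ε : ℝ} (hM : 0 ≤ M)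
    (hγ : ∀ a b, |a - b| ≤ ‖γ a - γ b‖) (hγ' : ∀ a b, ‖γ a - γ b‖ ≤ M * |a - b|)
    (hρ : ∀ x, 0 < ρ x) (hε : ∀ x, M * ε ≤ ρ x) (x y z : Ω) :
    |csym k t (fun x => γ (t x)) ρ x y z| ≤
      permSum (fun x y z => (k + 2) * 2 ^ (k + 8) * cnear t (fun x => γ (t x)) ρ x y z +
        (2 * ((k + 2) + 2 * (k + 2) ^ 2 * M) + (k + 3) ^ 2) * cfar γ ε (t x) (t y)
            (t z)) x y z := by
  set A : ℝ := (k + 2) * 2 ^ (k + 8)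
  set B : ℝ := 2 * ((k + 2) + 2 * (k + 2) ^ 2 * M) + (k + 3) ^ 2 with hB
  set F : Ω → Ω → Ω → ℝ := fun x y z => A * cnear t (fun x => γ (t x)) ρ x y z +
        B * cfar γ ε (t x) (t y) (t z) with hF
  have hA0 : 0 ≤ A := by positivity
  have hB0 : 0 ≤ B := by positivity
  have hcn : ∀ x y z, 0 ≤ A * cnear t (fun x => γ (t x)) ρ x y z := fun x y z =>
    mul_nonneg hA0 (cnear_nonneg hρ x y z)
  have hcf : ∀ x y z : Ω, 0 ≤ B * cfar γ ε (t x) (t y) (t z) := fun x y z =>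
    mul_nonneg hB0 (cfar_nonneg _ _ _ _ _)
  have hF0 : ∀ x y z, 0 ≤ F x y z := fun x y z => add_nonneg (hcn x y z) (hcf x y z)
  have ht : ∀ x y : Ω, |t x - t y| ≤ ‖γ (t x) - γ (t y)‖ := fun x y => hγ _ _
  have near : ∀ x y z : Ω, ‖γ (t x) - γ (t y)‖ < ρ x + ρ y →
      |csym k t (fun x => γ (t x)) ρ x y z| ≤ permSum F x y z := by
    intro x y z h
    refine (abs_csym_le_cnear hρ ht h).trans ?_
    have h1 : A * cnear t (fun x => γ (t x)) ρ x y z ≤ F x y z :=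
      le_add_of_nonneg_right (hcf x y z)
    have h2 : A * cnear t (fun x => γ (t x)) ρ y x z ≤ F y x z :=
      le_add_of_nonneg_right (hcf y x z)
    rw [permSum]
    linarith [hF0 x z y, hF0 y z x, hF0 z x y, hF0 z y x]
  have far : ∀ x y z : Ω, t x < t y → t y < t z → ρ x + ρ y ≤ ‖γ (t x) - γ (t y)‖ →
      ρ x + ρ z ≤ ‖γ (t x) - γ (t z)‖ → ρ y + ρ z ≤ ‖γ (t y) - γ (t z)‖ →
      |csym k t (fun x => γ (t x)) ρ x y z| ≤ permSum F x y z := by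
    intro x y z hxy hyz h1 h2 h3
    refine (abs_csym_le_cfar hγ hγ' hxy hyz h1 h2 h3).trans ?_
    have hε' : ε ≤ t z - t x := by
      by_contra! hlt
      have h4 := hγ' (t x) (t z)
      rw [abs_sub_comm, abs_of_pos (sub_pos.2 (hxy.trans hyz))] at h4
      have := mul_le_mul_of_nonneg_left hlt.le hM
      linarith [hε x, hρ z]
    have h4 : B * cfar γ ε (t x) (t y) (t z) ≤ F x y z := le_add_of_nonneg_left (hcn x y z)
    rw [cfar, if_pos ⟨hxy, hyz, hε'⟩] at h4
    rw [permSum]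
    linarith [hF0 x z y, hF0 y z x, hF0 z x y, hF0 z y x, hF0 y x z]
  by_cases h1 : ρ x + ρ y ≤ ‖γ (t x) - γ (t y)‖
  swap
  · exact near x y z (not_le.1 h1)
  by_cases h2 : ρ x + ρ z ≤ ‖γ (t x) - γ (t z)‖
  swap
  · rw [csym_swap_right, permSum_swap_right]
    exact near x z y (not_le.1 h2)
  by_cases h3 : ρ y + ρ z ≤ ‖γ (t y) - γ (t z)‖
  swap
  · rw [csym_swap_left, permSum_swap_left, csym_swap_right, permSum_swap_right]
    exact near y z x (not_le.1 h3)
  have hne : ∀ x y : Ω, ρ x + ρ y ≤ ‖γ (t x) - γ (t y)‖ → t x ≠ t y := by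
    intro x y h he
    rw [he, sub_self, norm_zero] at h
    linarith [hρ x, hρ y]
  have symm : ∀ x y : Ω, ρ x + ρ y ≤ ‖γ (t x) - γ (t y)‖ → ρ y + ρ x ≤ ‖γ (t y) - γ (t x)‖ := by
    intro x y h
    rwa [norm_sub_rev, add_comm]
  have h1' := symm _ _ h1
  have h2' := symm _ _ h2
  have h3' := symm _ _ h3
  rcases (hne _ _ h1).lt_or_gt with a1 | a1 <;> rcases (hne _ _ h2).lt_or_gt with a2 | a2 <;>
    rcases (hne _ _ h3).lt_or_gt with a3 | a3
  · exact far x y z a1 a3 h1 h2 h3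
  · rw [csym_swap_right, permSum_swap_right]
    exact far x z y a2 a3 h2 h1 h3'
  · linarith
  · rw [csym_swap_right, permSum_swap_right, csym_swap_left, permSum_swap_left]
    exact far z x y a2 a1 h2' h3' h1
  · rw [csym_swap_left, permSum_swap_left]
    exact far y x z a1 a2 h1' h3 h2
  · linarith
  · rw [csym_swap_left, permSum_swap_left, csym_swap_right, permSum_swap_right]
    exact far y z x a3 a2 h3 h1' h2'
  · rw [csym_swap_left, permSum_swap_left, csym_swap_right, permSum_swap_right, csym_swap_left,
      permSum_swap_left]
    exact far z y x a3 a1 h3' h2' h1'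

end Far

section SecondDifference

lemma lintegral_comp_mul_left_pos {α : ℝ} (hα : 0 < α) (f : ℝ → ℝ≥0∞) :
    ∫⁻ x, f x = ENNReal.ofReal α * ∫⁻ x, f (α * x) := by
  have h := Real.smul_map_volume_mul_left hα.ne'
  conv_lhs => rw [← h]
  rw [lintegral_smul_measure, abs_of_pos hα, smul_eq_mul]
  congr 1
  exact (Homeomorph.mulLeft₀ α hα.ne').measurableEmbedding.lintegral_map f

lemma lintegral_comp_affine {α : ℝ} (hα : 0 < α) (a : ℝ) (f : ℝ → ℝ≥0∞) :
    ∫⁻ x, f x = ENNReal.ofReal α * ∫⁻ x, f (a + α * x) := by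
  rw [← lintegral_add_left_eq_self f a, lintegral_comp_mul_left_pos hα]

variable {H : Type*} [NormedAddCommGroup H] [InnerProductSpace ℝ H] [SecondCountableTopology H]
  [MeasurableSpace H] [BorelSpace H]

/-- Mean square of the difference quotients of step `h`. -/
noncomputable def quotSq (γ : ℝ → H) (h : ℝ) : ℝ≥0∞ :=
  ∫⁻ t, ENNReal.ofReal (‖slope γ t (t + h)‖ ^ 2)

/-- Squared second difference in the parameters `(α, L)`. -/
noncomputable def diffSq (γ : ℝ → H) (t α L : ℝ) : ℝ≥0∞ :=
  ENNReal.ofReal (‖slope γ t (t + α * L) - slope γ (t + α * L) (t + L)‖ ^ 2)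

lemma measurable_slope {γ : ℝ → H} (hγ : Continuous γ) :
    Measurable fun p : ℝ × ℝ => slope γ p.1 p.2 := by
  have := hγ.measurable
  simp only [slope_def_module]
  fun_prop

lemma measurable_quotSq {γ : ℝ → H} (hγ : Continuous γ) : Measurable (quotSq γ) := by
  have hs := measurable_slope hγ
  refine Measurable.lintegral_prod_right (f := fun h t => ENNReal.ofReal (‖slope γ t
      (t + h)‖ ^ 2)) ?_
  have : Measurable fun p : ℝ × ℝ => slope γ p.2 (p.2 + p.1) :=
    hs.comp (f := fun p : ℝ × ℝ => (p.2, p.2 + p.1)) (by fun_prop)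
  exact (this.norm.pow_const 2).ennreal_ofReal

lemma measurable_diffSq {γ : ℝ → H} (hγ : Continuous γ) :
    Measurable fun p : ℝ × ℝ × ℝ => diffSq γ p.1 p.2.1 p.2.2 := by
  have hs := measurable_slope hγ
  have h1 : Measurable fun p : ℝ × ℝ × ℝ => slope γ p.1 (p.1 + p.2.1 * p.2.2) :=
    hs.comp (f := fun p : ℝ × ℝ × ℝ => (p.1, p.1 + p.2.1 * p.2.2)) (by fun_prop)
  have h2 : Measurable fun p : ℝ × ℝ × ℝ => slope γ (p.1 + p.2.1 * p.2.2) (p.1 + p.2.2) :=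
    hs.comp (f := fun p : ℝ × ℝ × ℝ => (p.1 + p.2.1 * p.2.2, p.1 + p.2.2)) (by fun_prop)
  exact ((h1.sub h2).norm.pow_const 2).ennreal_ofReal

lemma quotSq_le {γ : ℝ → H} {ℓ a₀ h N : ℝ} (hh : 0 < h)
    (hN : ∀ t, ‖γ t - γ (t + h)‖ ≤ N)
    (hl : ∀ a b, a ≤ a₀ → b ≤ a₀ → γ a = γ b) (hr : ∀ a b, a₀ + ℓ ≤ a → a₀ + ℓ ≤ b → γ a = γ b) :
    quotSq γ h ≤ ENNReal.ofReal ((N / h) ^ 2 * (ℓ + h)) := by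
  have hN0 : 0 ≤ N := (norm_nonneg _).trans (hN 0)
  calc quotSq γ h ≤ ∫⁻ t, (Icc (a₀ - h) (a₀ + ℓ)).indicator
        (fun _ => ENNReal.ofReal ((N / h) ^ 2)) t := by
        refine lintegral_mono fun t => ?_
        by_cases ht : t ∈ Icc (a₀ - h) (a₀ + ℓ)
        · rw [indicator_of_mem ht]
          refine ENNReal.ofReal_le_ofReal ?_
          gcongr
          rw [slope_def_module, add_sub_cancel_left, norm_smul, norm_inv, Real.norm_of_nonneg hh.le,
            ← div_eq_inv_mul, norm_sub_rev]
          gcongr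
          exact hN t
        · rw [indicator_of_notMem ht, slope_def_module]
          have : γ (t + h) = γ t := by
            rw [mem_Icc, not_and_or, not_le, not_le] at ht
            rcases ht with ht | ht
            · exact hl _ _ (by linarith) (by linarith)
            · exact hr _ _ (by linarith) (by linarith)
          simp [this]
    _ = _ := by
      rw [lintegral_indicator_const measurableSet_Icc, Real.volume_Icc,
        ← ENNReal.ofReal_mul (by positivity)]
      congr 2; ring

lemma quotSq_le_const {γ : ℝ → H} {M ℓ a₀ h : ℝ} (hh : 0 < h) (hℓ : 0 ≤ ℓ)
    (hγ' : ∀ a b, ‖γ a - γ b‖ ≤ M * |a - b|) (hγℓ : ∀ a b, ‖γ a - γ b‖ ≤ M * ℓ)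
    (hl : ∀ a b, a ≤ a₀ → b ≤ a₀ → γ a = γ b) (hr : ∀ a b, a₀ + ℓ ≤ a → a₀ + ℓ ≤ b → γ a = γ b) :
    quotSq γ h ≤ ENNReal.ofReal (2 * M ^ 2 * ℓ) := by
  rcases le_total h ℓ with h1 | h1
  · refine (quotSq_le (N := M * h) hh (fun t => ?_) hl hr).trans
      (ENNReal.ofReal_le_ofReal ?_)
    · simpa [abs_of_pos hh] using hγ' t (t + h)
    · rw [mul_div_cancel_right₀ _ hh.ne']
      nlinarith [sq_nonneg M]
  · refine (quotSq_le (N := M * ℓ) hh (fun t => hγℓ _ _) hl hr).trans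
      (ENNReal.ofReal_le_ofReal ?_)
    have h2 : ℓ / h ≤ 1 := (div_le_one hh).2 h1
    have h0 : 0 ≤ ℓ / h := by positivity
    have : (M * ℓ / h) ^ 2 * (ℓ + h) = M ^ 2 * ((ℓ / h) * ((ℓ / h) * ℓ + ℓ)) := by
      field_simp
    rw [this, mul_comm 2, mul_assoc (M ^ 2)]
    refine mul_le_mul_of_nonneg_left ?_ (sq_nonneg M)
    nlinarith [mul_nonneg h0 hℓ]

lemma diffSq_add_quotSq {γ : ℝ → H} (hγ : Continuous γ) {α L : ℝ} (hL : 0 < L) (h0 : 0 < α)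
    (h1 : α < 1) :
    ENNReal.ofReal (α * (1 - α)) * (∫⁻ t, diffSq γ t α L) + quotSq γ L =
      ENNReal.ofReal α * quotSq γ (α * L) + ENNReal.ofReal (1 - α) * quotSq γ ((1 - α) * L) := by
  have h1' : 0 < 1 - α := sub_pos.2 h1
  have hs := measurable_slope hγ
  have hm : ∀ f g : ℝ → ℝ, Measurable f → Measurable g →
      Measurable fun t => ENNReal.ofReal (‖slope γ (f t) (g t)‖ ^ 2) := fun f g hf hg =>
    ((hs.comp (hf.prodMk hg)).norm.pow_const 2).ennreal_ofReal
  have hD : Measurable fun t => diffSq γ t α L :=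
    (measurable_diffSq hγ).comp (f := fun t => (t, α, L)) (by fun_prop)
  have hshift : quotSq γ ((1 - α) * L) =
      ∫⁻ t, ENNReal.ofReal (‖slope γ (t + α * L) (t + L)‖ ^ 2) := by
    rw [quotSq, ← lintegral_add_right_eq_self _ (α * L)]
    congr 1
    ext t
    congr 4
    ring
  rw [hshift, quotSq, quotSq, ← lintegral_const_mul _ hD,
    ← lintegral_const_mul _ (hm _ _ (by fun_prop) (by fun_prop)),
    ← lintegral_const_mul _ (hm _ _ (by fun_prop) (by fun_prop)),
    ← lintegral_add_right _ (hm _ _ (by fun_prop) (by fun_prop)),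
    ← lintegral_add_right _ ((hm _ _ (by fun_prop) (by fun_prop)).const_mul _)]
  congr 1
  ext t
  rw [diffSq, ← ENNReal.ofReal_mul (by positivity), ← ENNReal.ofReal_mul h0.le,
    ← ENNReal.ofReal_mul h1'.le,
    ← ENNReal.ofReal_add (by positivity) (by positivity),
    ← ENNReal.ofReal_add (by positivity) (by positivity)]
  congr 1
  set a := slope γ t (t + α * L) with ha
  set b := slope γ (t + α * L) (t + L) with hb
  have hc : slope γ t (t + L) = α • a + (1 - α) • b := by
    rw [ha, hb, slope_def_module, slope_def_module, slope_def_module, smul_smul, smul_smul]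
    have e1 : α * (t + α * L - t)⁻¹ = L⁻¹ := by rw [add_sub_cancel_left]; field_simp
    have e2 : (1 - α) * (t + L - (t + α * L))⁻¹ = L⁻¹ := by
      rw [show t + L - (t + α * L) = (1 - α) * L by ring]; field_simp
    rw [e1, e2, add_sub_cancel_left]
    module
  rw [hc, norm_add_sq_real, norm_sub_sq_real, norm_smul, norm_smul, real_inner_smul_left,
    real_inner_smul_right, Real.norm_of_nonneg h0.le, Real.norm_of_nonneg h1'.le]
  ring

lemma lintegral_Ici_comp_mul {α ε : ℝ} (hα : 0 < α) (f : ℝ → ℝ≥0∞) :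
    ∫⁻ L in Ici ε, ENNReal.ofReal L⁻¹ * f (α * L) =
        ∫⁻ L in Ici (α * ε), ENNReal.ofReal L⁻¹ * f L := by
  rw [← lintegral_indicator measurableSet_Ici, ← lintegral_indicator measurableSet_Ici,
    lintegral_comp_mul_left_pos hα ((Ici (α * ε)).indicator _),
    ← lintegral_const_mul' _ _ ENNReal.ofReal_ne_top]
  congr 1
  ext L
  by_cases hL : ε ≤ L
  · rw [indicator_of_mem (mem_Ici.2 hL), indicator_of_mem (mem_Ici.2 (by gcongr)), ← mul_assoc,
      ← ENNReal.ofReal_mul hα.le, mul_inv, mul_inv_cancel_left₀ hα.ne']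
  · rw [indicator_of_notMem (by simpa using hL), indicator_of_notMem, mul_zero]
    rwa [mem_Ici, mul_le_mul_iff_right₀ hα]

lemma lintegral_Ici_mul_le {α ε B : ℝ} (hα : 0 < α) (hα1 : α < 1) (hε : 0 < ε) (hB : 0 ≤ B)
    {f : ℝ → ℝ≥0∞} (hf : ∀ L, 0 < L → f L ≤ ENNReal.ofReal B) :
    ∫⁻ L in Ici (α * ε), ENNReal.ofReal L⁻¹ * f L ≤
      (∫⁻ L in Ici ε, ENNReal.ofReal L⁻¹ * f L) + ENNReal.ofReal (B * Real.log α⁻¹) := by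
  have hle : α * ε ≤ ε := by nlinarith
  have hpos : 0 < α * ε := by positivity
  rw [← Ico_union_Ici_eq_Ici hle, lintegral_union measurableSet_Ici
    (disjoint_left.2 fun x h1 h2 => absurd h1.2 (not_lt.2 h2)), add_comm]
  gcongr
  calc ∫⁻ L in Ico (α * ε) ε, ENNReal.ofReal L⁻¹ * f L
      ≤ ∫⁻ L in Ico (α * ε) ε, ENNReal.ofReal B * ENNReal.ofReal L⁻¹ := by
        refine setLIntegral_mono (by fun_prop) fun L hL => ?_
        rw [mul_comm]
        gcongr
        exact hf L (hpos.trans_le hL.1)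
    _ = _ := by
      have h_int : IntegrableOn (fun x : ℝ => x⁻¹) (Ioc (α * ε) ε) :=
        (intervalIntegrable_iff_integrableOn_Ioc_of_le hle).1
          (intervalIntegral.intervalIntegrable_inv (fun x hx => by
            rw [uIcc_of_le hle] at hx
            exact (hpos.trans_le hx.1).ne') continuousOn_id)
      rw [lintegral_const_mul' _ _ ENNReal.ofReal_ne_top, ENNReal.ofReal_mul hB,
        setLIntegral_congr Ico_ae_eq_Ioc, ← ofReal_integral_eq_lintegral_ofReal h_int,
        ← intervalIntegral.integral_of_le hle, integral_inv_of_pos hpos hε]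
      · congr 3; field_simp
      · exact (ae_restrict_mem measurableSet_Ioc).mono fun x hx => inv_nonneg.2 (hpos.trans hx.1).le

lemma lintegral_quotSq_ne_top {γ : ℝ → H} {M ℓ a₀ ε : ℝ} (hε : 0 < ε) (hℓ : 0 ≤ ℓ)
    (hγℓ : ∀ a b, ‖γ a - γ b‖ ≤ M * ℓ)
    (hl : ∀ a b, a ≤ a₀ → b ≤ a₀ → γ a = γ b) (hr : ∀ a b, a₀ + ℓ ≤ a → a₀ + ℓ ≤ b → γ a = γ b) :
    ∫⁻ L in Ici ε, ENNReal.ofReal L⁻¹ * quotSq γ L ≠ ∞ := by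
  have h_int : IntegrableOn (fun L : ℝ => ((M * ℓ) ^ 2 * (ℓ / ε + 1)) * L ^ (-2 : ℝ)) (Ioi ε) :=
    (integrableOn_Ioi_rpow_of_lt (by norm_num) hε).const_mul _
  refine ne_top_of_le_ne_top h_int.lintegral_lt_top.ne ?_
  rw [setLIntegral_congr Ioi_ae_eq_Ici.symm]
  refine setLIntegral_mono (by fun_prop) fun L hL => ?_
  have hL0 : 0 < L := hε.trans hL
  refine (mul_le_mul_right (quotSq_le (N := M * ℓ) hL0 (fun t => hγℓ _ _) hl hr) _).trans ?_
  rw [← ENNReal.ofReal_mul (by positivity)]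
  refine ENNReal.ofReal_le_ofReal ?_
  rw [Real.rpow_neg hL0.le, Real.rpow_two]
  have h1 : ℓ / L ≤ ℓ / ε := by gcongr; exact (mem_Ioi.1 hL).le
  calc L⁻¹ * ((M * ℓ / L) ^ 2 * (ℓ + L)) = ((M * ℓ) ^ 2 * (ℓ / L + 1)) * (L ^ 2)⁻¹ := by
        field_simp
    _ ≤ _ := by gcongr

lemma mul_log_inv_le {α : ℝ} (h0 : 0 < α) (h1 : α < 1) :
    Real.log α⁻¹ ≤ (1 - α) * (2 * α ^ (-(1 / 2) : ℝ)) := by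
  set r := √α with hr
  have hr0 : 0 < r := Real.sqrt_pos.2 h0
  have hα : α = r ^ 2 := (Real.sq_sqrt h0.le).symm
  have hr1 : r < 1 := by nlinarith
  rw [Real.rpow_neg h0.le, ← Real.sqrt_eq_rpow, ← hr]
  have hlog : Real.log α⁻¹ = 2 * Real.log r⁻¹ := by rw [hα, ← inv_pow, Real.log_pow]; norm_num
  have := Real.log_le_sub_one_of_pos (inv_pos.2 hr0)
  rw [hlog, hα]
  have h2 : (1 - r ^ 2) * (2 * r⁻¹) = 2 * (r⁻¹ - r) := by field_simp
  rw [h2]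
  linarith

lemma lintegral_diffSq_le {γ : ℝ → H} {M ℓ a₀ α ε : ℝ} (hM : 0 ≤ M) (hℓ : 0 ≤ ℓ)
    (hγ' : ∀ a b, ‖γ a - γ b‖ ≤ M * |a - b|) (hγℓ : ∀ a b, ‖γ a - γ b‖ ≤ M * ℓ)
    (hl : ∀ a b, a ≤ a₀ → b ≤ a₀ → γ a = γ b) (hr : ∀ a b, a₀ + ℓ ≤ a → a₀ + ℓ ≤ b → γ a = γ b)
    (hε : 0 < ε) (h0 : 0 < α) (h1 : α < 1) :
    ∫⁻ L in Ici ε, ENNReal.ofReal L⁻¹ * ∫⁻ t, diffSq γ t α L ≤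
      ENNReal.ofReal (4 * M ^ 2 * ℓ * (α ^ (-(1 / 2) : ℝ) + (1 - α) ^ (-(1 / 2) : ℝ))) := by
  have hγ : Continuous γ := by
    refine (LipschitzWith.of_dist_le_mul (K := ⟨M, hM⟩) fun a b => ?_).continuous
    rw [dist_eq_norm, Real.dist_eq]
    exact hγ' a b
  have h1' : 0 < 1 - α := sub_pos.2 h1
  have h1'' : 1 - α < 1 := by linarith
  have hsm := measurable_quotSq hγ
  have hDm : Measurable fun L => ∫⁻ t, diffSq γ t α L :=
    Measurable.lintegral_prod_right (f := fun L t => diffSq γ t α L)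
      ((measurable_diffSq hγ).comp (f := fun p : ℝ × ℝ => (p.2, α, p.1)) (by fun_prop))
  set B := 2 * M ^ 2 * ℓ with hB
  have hB0 : 0 ≤ B := by positivity
  have hsB : ∀ L, 0 < L → quotSq γ L ≤ ENNReal.ofReal B := fun L hL =>
    quotSq_le_const hL hℓ hγ' hγℓ hl hr
  set I := ∫⁻ L in Ici ε, ENNReal.ofReal L⁻¹ * quotSq γ L with hI
  set Q := ∫⁻ L in Ici ε, ENNReal.ofReal L⁻¹ * ∫⁻ t, diffSq γ t α L with hQ
  have hIfin : I ≠ ∞ := lintegral_quotSq_ne_top hε hℓ hγℓ hl hr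
  have hpt : ENNReal.ofReal (α * (1 - α)) * Q + I =
      ENNReal.ofReal α * (∫⁻ L in Ici ε, ENNReal.ofReal L⁻¹ * quotSq γ (α * L)) +
      ENNReal.ofReal (1 - α) * (∫⁻ L in Ici ε, ENNReal.ofReal L⁻¹ * quotSq γ ((1 - α) * L)) := by
    rw [hQ, hI, ← lintegral_const_mul' _ _ ENNReal.ofReal_ne_top,
      ← lintegral_const_mul' _ _ ENNReal.ofReal_ne_top,
      ← lintegral_const_mul' _ _ ENNReal.ofReal_ne_top, ← lintegral_add_left (by fun_prop),
      ← lintegral_add_left (by fun_prop)]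
    refine setLIntegral_congr_fun measurableSet_Ici fun L hL => ?_
    have := diffSq_add_quotSq hγ (hε.trans_le hL) h0 h1
    rw [mul_left_comm, ← mul_add, this]
    ring
  rw [lintegral_Ici_comp_mul h0, lintegral_Ici_comp_mul h1'] at hpt
  have hle : ENNReal.ofReal (α * (1 - α)) * Q + I ≤
      ENNReal.ofReal (α * (B * Real.log α⁻¹) + (1 - α) * (B * Real.log (1 - α)⁻¹)) + I := by
    have hl1 : 0 ≤ Real.log α⁻¹ := Real.log_nonneg ((one_le_inv₀ h0).2 h1.le)
    have hl2 : 0 ≤ Real.log (1 - α)⁻¹ := Real.log_nonneg ((one_le_inv₀ h1').2 h1''.le)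
    rw [hpt, ENNReal.ofReal_add (by positivity) (by positivity), ENNReal.ofReal_mul h0.le,
      ENNReal.ofReal_mul h1'.le]
    calc _ ≤ ENNReal.ofReal α * (I + ENNReal.ofReal (B * Real.log α⁻¹)) +
          ENNReal.ofReal (1 - α) * (I + ENNReal.ofReal (B * Real.log (1 - α)⁻¹)) := by
          gcongr
          · exact lintegral_Ici_mul_le h0 h1 hε hB0 hsB
          · exact lintegral_Ici_mul_le h1' h1'' hε hB0 hsB
      _ = (ENNReal.ofReal α + ENNReal.ofReal (1 - α)) * I +
          (ENNReal.ofReal α * ENNReal.ofReal (B * Real.log α⁻¹) +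
            ENNReal.ofReal (1 - α) * ENNReal.ofReal (B * Real.log (1 - α)⁻¹)) := by ring
      _ = _ := by
        rw [← ENNReal.ofReal_add h0.le h1'.le, add_sub_cancel, ENNReal.ofReal_one, one_mul,
          add_comm]
  have hcan := (ENNReal.add_le_add_iff_right hIfin).1 hle
  have hα0 : 0 < α * (1 - α) := by positivity
  refine (ENNReal.mul_le_mul_iff_right (by simpa using hα0) ENNReal.ofReal_ne_top).1
    (hcan.trans ?_)
  rw [← ENNReal.ofReal_mul hα0.le]
  refine ENNReal.ofReal_le_ofReal ?_
  have e1 := mul_le_mul_of_nonneg_left (mul_log_inv_le h0 h1) (mul_nonneg h0.le hB0)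
  have e2 := mul_le_mul_of_nonneg_left (mul_log_inv_le h1' h1'') (mul_nonneg h1'.le hB0)
  rw [sub_sub_cancel] at e2
  rw [mul_assoc α B] at e1
  rw [mul_assoc (1 - α) B] at e2
  refine (add_le_add e1 e2).trans_eq ?_
  rw [hB]
  ring

lemma lintegral_rpow_neg_half :
    ∫⁻ α in Ioo (0 : ℝ) 1, ENNReal.ofReal (α ^ (-(1 / 2) : ℝ) + (1 - α) ^ (-(1 / 2) : ℝ)) ≤ 4 := by
  have hi : IntervalIntegrable (fun x : ℝ => x ^ (-(1 / 2) : ℝ)) volume 0 1 :=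
    intervalIntegral.intervalIntegrable_rpow' (by norm_num)
  have hi' : IntervalIntegrable (fun x : ℝ => (1 - x) ^ (-(1 / 2) : ℝ)) volume 0 1 := by
    have := (hi.comp_sub_left 1).symm
    simpa using this
  have h1 : ∫ x in (0 : ℝ)..1, x ^ (-(1 / 2) : ℝ) = 2 := by
    rw [integral_rpow (Or.inl (by norm_num))]; norm_num
  have h2 : ∫ x in (0 : ℝ)..1, (1 - x) ^ (-(1 / 2) : ℝ) = 2 := by
    rw [intervalIntegral.integral_comp_sub_left (fun x : ℝ => x ^ (-(1 / 2) : ℝ)) 1, sub_self,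
      sub_zero, h1]
  have hadd := hi.add hi'
  have h_int := (intervalIntegrable_iff_integrableOn_Ioo_of_le zero_le_one).1 hadd
  have h3 : ∫ x in Ioo (0 : ℝ) 1, (x ^ (-(1 / 2) : ℝ) + (1 - x) ^ (-(1 / 2) : ℝ)) = 4 := by
    rw [← integral_Ioc_eq_integral_Ioo, ← intervalIntegral.integral_of_le zero_le_one,
      intervalIntegral.integral_add hi hi', h1, h2]
    norm_num
  rw [← ofReal_integral_eq_lintegral_ofReal h_int]
  · rw [h3]
    norm_num
  · refine (ae_restrict_mem measurableSet_Ioo).mono fun x hx => ?_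
    have := Real.rpow_nonneg hx.1.le (-(1 / 2))
    have := Real.rpow_nonneg (sub_nonneg.2 hx.2.le) (-(1 / 2))
    exact add_nonneg (by assumption) (by assumption)

lemma measurable_cfar {γ : ℝ → H} (hγ : Continuous γ) (ε : ℝ) :
    Measurable fun p : ℝ × ℝ × ℝ => cfar γ ε p.1 p.2.1 p.2.2 := by
  have hs := measurable_slope hγ
  have h1 : Measurable fun p : ℝ × ℝ × ℝ => slope γ p.1 p.2.1 :=
    hs.comp (f := fun p : ℝ × ℝ × ℝ => (p.1, p.2.1)) (by fun_prop)
  have h2 : Measurable fun p : ℝ × ℝ × ℝ => slope γ p.2.1 p.2.2 :=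
    hs.comp (f := fun p : ℝ × ℝ × ℝ => (p.2.1, p.2.2)) (by fun_prop)
  have hset : MeasurableSet {p : ℝ × ℝ × ℝ | p.1 < p.2.1 ∧ p.2.1 < p.2.2 ∧ ε ≤ p.2.2 - p.1} := by
    simp only [ofPred_and]
    refine (measurableSet_lt ?_ ?_).inter ((measurableSet_lt ?_ ?_).inter
        (measurableSet_le ?_ ?_)) <;>
      fun_prop
  exact Measurable.ite hset (((h1.sub h2).norm.pow_const 2).div (by fun_prop)) measurable_const

lemma lintegral_cfar_le_of_const {γ : ℝ → H} {M ℓ a₀ ε : ℝ} (hM : 0 ≤ M) (hℓ : 0 ≤ ℓ)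
    (hγ' : ∀ a b, ‖γ a - γ b‖ ≤ M * |a - b|) (hγℓ : ∀ a b, ‖γ a - γ b‖ ≤ M * ℓ)
    (hl : ∀ a b, a ≤ a₀ → b ≤ a₀ → γ a = γ b) (hr : ∀ a b, a₀ + ℓ ≤ a → a₀ + ℓ ≤ b → γ a = γ b)
    (hε : 0 < ε) :
    ∫⁻ a, ∫⁻ b, ∫⁻ c, ENNReal.ofReal (cfar γ ε a b c) ≤ ENNReal.ofReal (16 * M ^ 2 * ℓ) := by
  have hγ : Continuous γ := by
    refine (LipschitzWith.of_dist_le_mul (K := ⟨M, hM⟩) fun a b => ?_).continuous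
    rw [dist_eq_norm, Real.dist_eq]
    exact hγ' a b
  have hcm := (measurable_cfar hγ ε).ennreal_ofReal
  have hDm := measurable_diffSq hγ
  have hpt : ∀ a L α, ENNReal.ofReal L * ENNReal.ofReal (cfar γ ε a (a + L * α) (a + L)) =
      (Ici ε).indicator (fun L => (Ioo (0 : ℝ) 1).indicator
        (fun α => ENNReal.ofReal L⁻¹ * diffSq γ a α L) α) L := by
    intro a L α
    by_cases hL : ε ≤ L
    · have hL0 : 0 < L := hε.trans_le hL
      rw [indicator_of_mem (mem_Ici.2 hL)]
      by_cases hα : α ∈ Ioo (0 : ℝ) 1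
      · rw [indicator_of_mem hα, cfar, if_pos, diffSq, ← ENNReal.ofReal_mul hL0.le,
          ← ENNReal.ofReal_mul (by positivity), mul_comm L α, add_sub_cancel_left]
        · congr 1
          field_simp
        · have h1 := mul_pos hL0 hα.1
          have h2 := mul_lt_mul_of_pos_left hα.2 hL0
          refine ⟨by linarith, by linarith, by linarith⟩
      · rw [indicator_of_notMem hα, cfar, if_neg, ENNReal.ofReal_zero, mul_zero]
        rintro ⟨h1, h2, -⟩
        refine hα ⟨?_, ?_⟩
        · exact pos_of_mul_pos_right (by linarith : 0 < L * α) hL0.le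
        · have : L * α < L * 1 := by linarith
          exact lt_of_mul_lt_mul_left this hL0.le
    · rw [indicator_of_notMem (by simpa using hL), cfar, if_neg, ENNReal.ofReal_zero, mul_zero]
      rintro ⟨-, -, h3⟩
      exact hL (by linarith)
  have step : ∀ a, ∫⁻ b, ∫⁻ c, ENNReal.ofReal (cfar γ ε a b c) =
      ∫⁻ L in Ici ε, ∫⁻ α in Ioo (0 : ℝ) 1, ENNReal.ofReal L⁻¹ * diffSq γ a α L := by
    intro a
    have hma : Measurable (Function.uncurry fun b c => ENNReal.ofReal (cfar γ ε a b c)) :=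
      hcm.comp (f := fun p : ℝ × ℝ => (a, p.1, p.2)) (by fun_prop)
    rw [lintegral_lintegral_swap hma.aemeasurable, ← lintegral_indicator measurableSet_Ici,
      ← lintegral_add_left_eq_self _ a]
    congr 1
    ext L
    by_cases hL : ε ≤ L
    · have hL0 : 0 < L := hε.trans_le hL
      rw [lintegral_comp_affine hL0 a, indicator_of_mem (mem_Ici.2 hL),
        ← lintegral_indicator measurableSet_Ioo, ← lintegral_const_mul' _ _ ENNReal.ofReal_ne_top]
      congr 1
      ext α
      rw [hpt, indicator_of_mem (mem_Ici.2 hL)]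
    · rw [indicator_of_notMem (by simpa using hL)]
      refine (lintegral_congr fun b => ?_).trans lintegral_zero
      rw [cfar, if_neg, ENNReal.ofReal_zero]
      rintro ⟨-, -, h3⟩
      exact hL (by linarith)
  calc ∫⁻ a, ∫⁻ b, ∫⁻ c, ENNReal.ofReal (cfar γ ε a b c)
      = ∫⁻ a, ∫⁻ L in Ici ε, ∫⁻ α in Ioo (0 : ℝ) 1, ENNReal.ofReal L⁻¹ * diffSq γ a α L := by
        simp only [step]
    _ = ∫⁻ L in Ici ε, ∫⁻ a, ∫⁻ α in Ioo (0 : ℝ) 1, ENNReal.ofReal L⁻¹ * diffSq γ a α L := by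
        refine lintegral_lintegral_swap (Measurable.aemeasurable ?_)
        refine Measurable.lintegral_prod_right
          (f := fun (p : ℝ × ℝ) α => ENNReal.ofReal p.2⁻¹ * diffSq γ p.1 α p.2) ?_
        exact Measurable.mul (by fun_prop)
          (hDm.comp (f := fun q : (ℝ × ℝ) × ℝ => (q.1.1, q.2, q.1.2)) (by fun_prop))
    _ = ∫⁻ L in Ici ε, ∫⁻ α in Ioo (0 : ℝ) 1, ENNReal.ofReal L⁻¹ * ∫⁻ a, diffSq γ a α L := by
        congr 1
        ext L
        rw [lintegral_lintegral_swap]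
        · simp only [lintegral_const_mul' _ _ ENNReal.ofReal_ne_top]
        · exact (Measurable.const_mul (hDm.comp (f := fun q : ℝ × ℝ => (q.1, q.2, L))
            (by fun_prop)) _).aemeasurable
    _ = ∫⁻ α in Ioo (0 : ℝ) 1, ∫⁻ L in Ici ε, ENNReal.ofReal L⁻¹ * ∫⁻ a, diffSq γ a α L := by
        refine lintegral_lintegral_swap (Measurable.aemeasurable ?_)
        refine Measurable.mul (by fun_prop) (Measurable.lintegral_prod_right
          (f := fun (p : ℝ × ℝ) a => diffSq γ a p.2 p.1) ?_)
        exact hDm.comp (f := fun q : (ℝ × ℝ) × ℝ => (q.2, q.1.2, q.1.1)) (by fun_prop)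
    _ ≤ ∫⁻ α in Ioo (0 : ℝ) 1, ENNReal.ofReal (4 * M ^ 2 * ℓ) *
          ENNReal.ofReal (α ^ (-(1 / 2) : ℝ) + (1 - α) ^ (-(1 / 2) : ℝ)) := by
        refine setLIntegral_mono' measurableSet_Ioo fun α hα => ?_
        rw [← ENNReal.ofReal_mul (by positivity)]
        exact lintegral_diffSq_le hM hℓ hγ' hγℓ hl hr hε hα.1 hα.2
    _ ≤ ENNReal.ofReal (4 * M ^ 2 * ℓ) * 4 := by
        rw [lintegral_const_mul' _ _ ENNReal.ofReal_ne_top]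
        gcongr
        exact lintegral_rpow_neg_half
    _ = _ := by
        rw [← ENNReal.ofReal_ofNat 4, ← ENNReal.ofReal_mul (by positivity)]
        congr 1
        ring

/-- Mean square second differences of a Lipschitz curve over an interval. -/
theorem setLIntegral_cfar_le {γ : ℝ → H} {M ℓ a₀ ε : ℝ} (hM : 0 ≤ M) (hℓ : 0 ≤ ℓ)
    (hγ' : ∀ a b, ‖γ a - γ b‖ ≤ M * |a - b|) (hε : 0 < ε) :
    ∫⁻ a in Icc a₀ (a₀ + ℓ), ∫⁻ b in Icc a₀ (a₀ + ℓ), ∫⁻ c in Icc a₀ (a₀ + ℓ),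
      ENNReal.ofReal (cfar γ ε a b c) ≤ ENNReal.ofReal (16 * M ^ 2 * ℓ) := by
  have hle : a₀ ≤ a₀ + ℓ := by linarith
  set cl : ℝ → ℝ := fun x => (projIcc a₀ (a₀ + ℓ) hle x : ℝ) with hcl
  have hlip : ∀ a b, |cl a - cl b| ≤ |a - b| := fun a b => abs_projIcc_sub_projIcc hle
  have hmem : ∀ a, cl a ∈ Icc a₀ (a₀ + ℓ) := fun a => Subtype.prop _
  have hid : ∀ a ∈ Icc a₀ (a₀ + ℓ), cl a = a := fun a ha => by
    rw [hcl]
    simp only [projIcc_of_mem hle ha]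
  have key := lintegral_cfar_le_of_const (γ := fun x => γ (cl x)) (a₀ := a₀) hM hℓ
    (fun a b => (hγ' _ _).trans (mul_le_mul_of_nonneg_left (hlip a b) hM))
    (fun a b => (hγ' _ _).trans (mul_le_mul_of_nonneg_left (abs_le.2
      ⟨by linarith [(hmem a).1, (hmem b).2], by linarith [(hmem a).2, (hmem b).1]⟩) hM))
    (fun a b ha hb => by simp only [hcl, projIcc_of_le_left hle ha, projIcc_of_le_left hle hb])
    (fun a b ha hb => by simp only [hcl, projIcc_of_right_le hle ha, projIcc_of_right_le hle hb]) hε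
  refine le_trans ?_ key
  calc _ = ∫⁻ a in Icc a₀ (a₀ + ℓ), ∫⁻ b in Icc a₀ (a₀ + ℓ), ∫⁻ c in Icc a₀ (a₀ + ℓ),
      ENNReal.ofReal (cfar (fun x => γ (cl x)) ε a b c) := by
        refine setLIntegral_congr_fun measurableSet_Icc fun a ha => ?_
        refine setLIntegral_congr_fun measurableSet_Icc fun b hb => ?_
        refine setLIntegral_congr_fun measurableSet_Icc fun c hc => ?_
        simp only [cfar, slope_def_module, hid a ha, hid b hb, hid c hc]
    _ ≤ _ := by
      refine (setLIntegral_le_lintegral _ _).trans (lintegral_mono fun a => ?_)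
      refine (setLIntegral_le_lintegral _ _).trans (lintegral_mono fun b => ?_)
      exact setLIntegral_le_lintegral _ _

end SecondDifference

section CurveEnergy

variable {Ω : Type*} [MeasurableSpace Ω] {lam : Measure Ω} [IsFiniteMeasure lam]

lemma measurePreserving_swap_left :
    MeasurePreserving (fun p : Ω × Ω × Ω => (p.2.1, p.1, p.2.2)) (lam.prod (lam.prod lam))
      (lam.prod (lam.prod lam)) := by
  have h1 := (measurePreserving_prodAssoc lam lam lam).symm
  have h2 : MeasurePreserving (Prod.map (Prod.swap : Ω × Ω → Ω × Ω) (id : Ω → Ω))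
      ((lam.prod lam).prod lam) ((lam.prod lam).prod lam) :=
    measurePreserving_swap.prod (MeasurePreserving.id lam)
  exact (measurePreserving_prodAssoc lam lam lam).comp (h2.comp h1)

lemma measurePreserving_swap_right :
    MeasurePreserving (fun p : Ω × Ω × Ω => (p.1, p.2.2, p.2.1)) (lam.prod (lam.prod lam))
      (lam.prod (lam.prod lam)) :=
  (MeasurePreserving.id lam).prod measurePreserving_swap

lemma lintegral_permSum_le {F : Ω → Ω → Ω → ℝ}
    (hF : Measurable fun p : Ω × Ω × Ω => F p.1 p.2.1 p.2.2) :
    ∫⁻ p, ENNReal.ofReal (permSum F p.1 p.2.1 p.2.2) ∂(lam.prod (lam.prod lam)) ≤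
      6 * ∫⁻ p, ENNReal.ofReal (F p.1 p.2.1 p.2.2) ∂(lam.prod (lam.prod lam)) := by
  have hl := measurePreserving_swap_left (lam := lam)
  have hr := measurePreserving_swap_right (lam := lam)
  have hF' := hF.ennreal_ofReal
  have key : ∀ e : Ω × Ω × Ω → Ω × Ω × Ω, MeasurePreserving e (lam.prod (lam.prod lam))
      (lam.prod (lam.prod lam)) →
      ∫⁻ p, ENNReal.ofReal (F (e p).1 (e p).2.1 (e p).2.2) ∂(lam.prod (lam.prod lam)) =
        ∫⁻ p, ENNReal.ofReal (F p.1 p.2.1 p.2.2) ∂(lam.prod (lam.prod lam)) :=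
    fun e he => he.lintegral_comp hF'
  have mea : ∀ e : Ω × Ω × Ω → Ω × Ω × Ω, MeasurePreserving e (lam.prod (lam.prod lam))
      (lam.prod (lam.prod lam)) → Measurable fun p => ENNReal.ofReal (F (e p).1 (e p).2.1
          (e p).2.2) :=
    fun e he => hF'.comp he.measurable
  have hle : ∀ p : Ω × Ω × Ω, ENNReal.ofReal (permSum F p.1 p.2.1 p.2.2) ≤
      ENNReal.ofReal (F p.1 p.2.1 p.2.2) + ENNReal.ofReal (F p.1 p.2.2 p.2.1) +
      (ENNReal.ofReal (F p.2.1 p.1 p.2.2) + ENNReal.ofReal (F p.2.1 p.2.2 p.1)) +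
      (ENNReal.ofReal (F p.2.2 p.1 p.2.1) + ENNReal.ofReal (F p.2.2 p.2.1 p.1)) := fun p => by
    rw [permSum]
    refine ENNReal.ofReal_add_le.trans (add_le_add (ENNReal.ofReal_add_le.trans (add_le_add
      ENNReal.ofReal_add_le ENNReal.ofReal_add_le)) ENNReal.ofReal_add_le)
  refine (lintegral_mono hle).trans ?_
  rw [lintegral_add_right, lintegral_add_right, lintegral_add_right, lintegral_add_right,
    lintegral_add_right]
  · have e2 := key _ hr
    have e3 := key _ hl
    have e4 := key _ (hr.comp hl)
    have e5 := key _ (hl.comp hr)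
    have e6 := key _ (hl.comp (hr.comp hl))
    simp only [Function.comp] at e2 e3 e4 e5 e6
    rw [e2, e3, e4, e5, e6]
    ring_nf
    exact le_rfl
  · exact mea _ (hl.comp (hr.comp hl))
  · exact mea _ (hr.comp hl)
  · exact mea _ hr
  · exact (mea _ hl).add (mea _ (hr.comp hl))
  · exact (mea _ (hl.comp hr)).add (mea _ (hl.comp (hr.comp hl)))

lemma lintegral_inv_max_sq_le {D : ℝ} (hD : 0 < D) (a : ℝ) :
    ∫⁻ s, ENNReal.ofReal ((max D |a - s| ^ 2)⁻¹) ≤ ENNReal.ofReal (2 * π / D) := by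
  have h_int : Integrable (fun s : ℝ => (2 / D ^ 2) * (1 + ((a - s) / D) ^ 2)⁻¹) :=
    ((integrable_inv_one_add_sq.comp_div hD.ne').comp_sub_left a).const_mul _
  calc _ ≤ ∫⁻ s, ENNReal.ofReal ((2 / D ^ 2) * (1 + ((a - s) / D) ^ 2)⁻¹) := by
        refine lintegral_mono fun s => ENNReal.ofReal_le_ofReal ?_
        have h1 : (2 / D ^ 2) * (1 + ((a - s) / D) ^ 2)⁻¹ = ((D ^ 2 + |a - s| ^ 2) / 2)⁻¹ := by
          rw [sq_abs]
          field_simp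
        rw [h1]
        have h2 : D ≤ max D |a - s| := le_max_left _ _
        have h3 : |a - s| ≤ max D |a - s| := le_max_right _ _
        have h4 := pow_le_pow_left₀ hD.le h2 2
        have h5 := pow_le_pow_left₀ (abs_nonneg _) h3 2
        gcongr
        linarith
    _ = _ := by
      rw [← ofReal_integral_eq_lintegral_ofReal h_int (Eventually.of_forall fun s => by positivity),
        integral_const_mul, integral_sub_left_eq_self (fun s => (1 + (s / D) ^ 2)⁻¹) volume a,
        integral_comp_div (fun s => (1 + s ^ 2)⁻¹), integral_univ_inv_one_add_sq, abs_of_pos hD]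
      congr 1
      simp only [smul_eq_mul]
      field_simp

variable {H : Type*} [NormedAddCommGroup H] [InnerProductSpace ℝ H] [SecondCountableTopology H]
  [MeasurableSpace H] [BorelSpace H] [CompleteSpace H]

variable {t : Ω → ℝ} {g : Ω → H} {ρ : Ω → ℝ} {k : ℕ}

lemma measurable_cdist (hg : Measurable g) (hρ : Measurable ρ) :
    Measurable fun p : Ω × Ω => cdist g ρ p.1 p.2 := by
  unfold cdist
  fun_prop

lemma measurable_cker (ht : Measurable t) (hg : Measurable g) (hρ : Measurable ρ) :
    Measurable fun p : Ω × Ω => cker k t g ρ p.1 p.2 := by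
  have := measurable_cdist hg hρ
  unfold cker
  refine Measurable.smul (Measurable.div ?_ (this.pow_const _)) (by fun_prop)
  have : Measurable fun p : Ω × Ω => ‖t p.1 - t p.2‖ := by fun_prop
  exact this.pow_const _

lemma measurable_cnear (ht : Measurable t) (hg : Measurable g) (hρ : Measurable ρ) :
    Measurable fun p : Ω × Ω × Ω => cnear t g ρ p.1 p.2.1 p.2.2 := by
  have h1 : Measurable fun p : Ω × Ω × Ω => cdist g ρ p.1 p.2.1 :=
    (measurable_cdist hg hρ).comp (f := fun p : Ω × Ω × Ω => (p.1, p.2.1)) (by fun_prop)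
  have h2 : Measurable fun p : Ω × Ω × Ω => ‖t p.1 - t p.2.2‖ := by fun_prop
  exact ((hρ.comp measurable_fst).mul h1.inv).mul ((h1.max h2).pow_const 2).inv

lemma lintegral_comp_le {Cg a₀ ℓ : ℝ} (ht : Measurable t)
    (hmap : lam.map t ≤ ENNReal.ofReal Cg • volume.restrict (Icc a₀ (a₀ + ℓ)))
    {f : ℝ → ℝ≥0∞} (hf : Measurable f) :
    ∫⁻ x, f (t x) ∂lam ≤ ENNReal.ofReal Cg * ∫⁻ a in Icc a₀ (a₀ + ℓ), f a := by
  rw [← lintegral_map hf ht]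
  refine (lintegral_mono' hmap le_rfl).trans ?_
  rw [lintegral_smul_measure, smul_eq_mul]

lemma lintegral_cnear_le {Cg a₀ ℓ : ℝ} (hCg : 0 ≤ Cg) (ht : Measurable t) (hρ : ∀ x, 0 < ρ x)
    (htg : ∀ x y, |t x - t y| ≤ ‖g x - g y‖)
    (hmap : lam.map t ≤ ENNReal.ofReal Cg • volume.restrict (Icc a₀ (a₀ + ℓ))) :
    ∫⁻ x, ∫⁻ y, ∫⁻ z, ENNReal.ofReal (cnear t g ρ x y z) ∂lam ∂lam ∂lam ≤
      ENNReal.ofReal ((2 * π * Cg) ^ 2 * (Cg * ℓ)) := by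
  have base : ∀ D : ℝ, 0 < D → ∀ x, ∫⁻ z, ENNReal.ofReal ((max D |t x - t z| ^ 2)⁻¹) ∂lam ≤
      ENNReal.ofReal (2 * π * Cg / D) := by
    intro D hD x
    have hm : Measurable fun s : ℝ => ENNReal.ofReal ((max D |t x - s| ^ 2)⁻¹) := by
      have : Measurable fun s : ℝ => ‖t x - s‖ := by fun_prop
      exact ((measurable_const.max this).pow_const 2).inv.ennreal_ofReal
    refine (lintegral_comp_le ht hmap hm).trans ?_
    calc _ ≤ ENNReal.ofReal Cg * ENNReal.ofReal (2 * π / D) := by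
          gcongr
          exact (setLIntegral_le_lintegral _ _).trans (lintegral_inv_max_sq_le hD _)
      _ = _ := by rw [← ENNReal.ofReal_mul hCg]; congr 1; ring
  have inner : ∀ x y, ∫⁻ z, ENNReal.ofReal (cnear t g ρ x y z) ∂lam ≤
      ENNReal.ofReal (2 * π * Cg * ρ x) * ENNReal.ofReal ((max (ρ x) |t x - t y| ^ 2)⁻¹) := by
    intro x y
    have hD := cdist_pos (g := g) hρ x y
    have h0 : 0 ≤ ρ x * (cdist g ρ x y)⁻¹ := mul_nonneg (hρ x).le (inv_nonneg.2 hD.le)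
    simp only [cnear, ENNReal.ofReal_mul h0]
    rw [lintegral_const_mul' _ _ ENNReal.ofReal_ne_top]
    refine (mul_le_mul_right (base _ hD x) _).trans ?_
    rw [← ENNReal.ofReal_mul h0, ← ENNReal.ofReal_mul
      (mul_nonneg (by positivity) (hρ x).le)]
    refine ENNReal.ofReal_le_ofReal ?_
    have h1 : max (ρ x) |t x - t y| ≤ cdist g ρ x y :=
      max_le ((by linarith [hρ y] : ρ x ≤ ρ x + ρ y).trans (le_max_right _ _))
        ((htg x y).trans (le_max_left _ _))
    have h2 : 0 < max (ρ x) |t x - t y| := lt_max_of_lt_left (hρ x)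
    have h3 := hρ x
    calc ρ x * (cdist g ρ x y)⁻¹ * (2 * π * Cg / cdist g ρ x y)
        = 2 * π * Cg * ρ x * (cdist g ρ x y ^ 2)⁻¹ := by field_simp
      _ ≤ _ := by gcongr
  have middle : ∀ x, ∫⁻ y, ∫⁻ z, ENNReal.ofReal (cnear t g ρ x y z) ∂lam ∂lam ≤
      ENNReal.ofReal ((2 * π * Cg) ^ 2) := by
    intro x
    have h3 := hρ x
    refine (lintegral_mono (inner x)).trans ?_
    rw [lintegral_const_mul' _ _ ENNReal.ofReal_ne_top]
    refine (mul_le_mul_right (base _ (hρ x) x) _).trans_eq ?_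
    rw [← ENNReal.ofReal_mul (by positivity)]
    congr 1
    field_simp
  refine (lintegral_mono middle).trans ?_
  rw [lintegral_const, ENNReal.ofReal_mul (by positivity)]
  gcongr
  have := lintegral_comp_le ht hmap (f := fun _ => 1) measurable_const
  simp only [lintegral_const, one_mul, restrict_apply_univ, Real.volume_Icc,
    add_sub_cancel_left] at this
  rwa [ENNReal.ofReal_mul hCg]

lemma lintegral_cfar_le {γ : ℝ → H} {M Cg a₀ ℓ ε : ℝ} (hM : 0 ≤ M) (hCg : 0 ≤ Cg) (hℓ : 0 ≤ ℓ)
    (hε : 0 < ε) (ht : Measurable t) (hγ' : ∀ a b, ‖γ a - γ b‖ ≤ M * |a - b|)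
    (hmap : lam.map t ≤ ENNReal.ofReal Cg • volume.restrict (Icc a₀ (a₀ + ℓ))) :
    ∫⁻ x, ∫⁻ y, ∫⁻ z, ENNReal.ofReal (cfar γ ε (t x) (t y) (t z)) ∂lam ∂lam ∂lam ≤
      ENNReal.ofReal (Cg ^ 3 * (16 * M ^ 2 * ℓ)) := by
  have hγ : Continuous γ := by
    refine (LipschitzWith.of_dist_le_mul (K := ⟨M, hM⟩) fun a b => ?_).continuous
    rw [dist_eq_norm, Real.dist_eq]
    exact hγ' a b
  have hm := (measurable_cfar hγ ε).ennreal_ofReal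
  have m2 : Measurable fun p : ℝ × ℝ => ∫⁻ c in Icc a₀ (a₀ + ℓ), ENNReal.ofReal
      (cfar γ ε p.1 p.2 c) :=
    Measurable.lintegral_prod_right (f := fun (p : ℝ × ℝ) c => ENNReal.ofReal (cfar γ ε p.1 p.2 c))
      (hm.comp (f := fun q : (ℝ × ℝ) × ℝ => (q.1.1, q.1.2, q.2)) (by fun_prop))
  have m1 : Measurable fun a => ∫⁻ b in Icc a₀ (a₀ + ℓ), ∫⁻ c in Icc a₀ (a₀ + ℓ),
      ENNReal.ofReal (cfar γ ε a b c) :=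
    Measurable.lintegral_prod_right
      (f := fun a b => ∫⁻ c in Icc a₀ (a₀ + ℓ), ENNReal.ofReal (cfar γ ε a b c)) m2
  calc _ ≤ ∫⁻ x, ∫⁻ y, ENNReal.ofReal Cg *
        (∫⁻ c in Icc a₀ (a₀ + ℓ), ENNReal.ofReal (cfar γ ε (t x) (t y) c)) ∂lam ∂lam := by
        refine lintegral_mono fun x => lintegral_mono fun y => lintegral_comp_le ht hmap ?_
        exact hm.comp (f := fun c => (t x, t y, c)) (by fun_prop)
    _ ≤ ∫⁻ x, ENNReal.ofReal Cg * (ENNReal.ofReal Cg * ∫⁻ b in Icc a₀ (a₀ + ℓ),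
        ∫⁻ c in Icc a₀ (a₀ + ℓ), ENNReal.ofReal (cfar γ ε (t x) b c)) ∂lam := by
        refine lintegral_mono fun x => ?_
        rw [lintegral_const_mul' _ _ ENNReal.ofReal_ne_top]
        gcongr
        exact lintegral_comp_le ht hmap (m2.comp (f := fun b => (t x, b)) (by fun_prop))
    _ ≤ ENNReal.ofReal Cg * (ENNReal.ofReal Cg * (ENNReal.ofReal Cg * ∫⁻ a in Icc a₀ (a₀ + ℓ),
        ∫⁻ b in Icc a₀ (a₀ + ℓ), ∫⁻ c in Icc a₀ (a₀ + ℓ), ENNReal.ofReal (cfar γ ε a b c))) := by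
        rw [lintegral_const_mul' _ _ ENNReal.ofReal_ne_top,
          lintegral_const_mul' _ _ ENNReal.ofReal_ne_top]
        gcongr
        exact lintegral_comp_le ht hmap m1
    _ ≤ ENNReal.ofReal Cg * (ENNReal.ofReal Cg * (ENNReal.ofReal Cg *
          ENNReal.ofReal (16 * M ^ 2 * ℓ))) := by
        gcongr
        exact setLIntegral_cfar_le hM hℓ hγ' hε
    _ = _ := by
        rw [← ENNReal.ofReal_mul hCg, ← ENNReal.ofReal_mul hCg, ← ENNReal.ofReal_mul hCg]
        congr 1
        ring

lemma sq_norm_integral_eq {F : Ω → H} (hF : Integrable F lam) :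
    ‖∫ y, F y ∂lam‖ ^ 2 = ∫ y, ∫ z, inner ℝ (F y) (F z) ∂lam ∂lam := by
  have h1 : ∀ y, ∫ z, inner ℝ (F y) (F z) ∂lam = inner ℝ (∫ z, F z ∂lam) (F y) := fun y => by
    rw [integral_inner hF, real_inner_comm]
  simp_rw [h1]
  rw [integral_inner hF, real_inner_self_eq_norm_sq]

/-- The square of the regularised kernel on a Lipschitz curve is integrable with the expected
bound. -/
theorem lintegral_cker_le {γ : ℝ → H} {M Cg a₀ ℓ r : ℝ} (hM : 1 ≤ M) (hCg : 0 ≤ Cg) (hℓ : 0 ≤ ℓ)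
    (hr : 0 < r) (ht : Measurable t) (hρm : Measurable ρ) (hρ : ∀ x, r ≤ ρ x)
    (hγ : ∀ a b, |a - b| ≤ ‖γ a - γ b‖) (hγ' : ∀ a b, ‖γ a - γ b‖ ≤ M * |a - b|)
    (hmap : lam.map t ≤ ENNReal.ofReal Cg • volume.restrict (Icc a₀ (a₀ + ℓ))) :
    ∫⁻ x, ENNReal.ofReal (‖∫ y, cker k t (fun x => γ (t x)) ρ x y ∂lam‖ ^ 2) ∂lam ≤
      ENNReal.ofReal (6 * ((k + 2) * 2 ^ (k + 8) * ((2 * π * Cg) ^ 2 * Cg) +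
        (2 * ((k + 2) + 2 * (k + 2) ^ 2 * M) + (k + 3) ^ 2) * (Cg ^ 3 * (16 * M ^ 2))) * ℓ) := by
  have hM0 : 0 ≤ M := by linarith
  have hγc : Continuous γ := by
    refine (LipschitzWith.of_dist_le_mul (K := ⟨M, hM0⟩) fun a b => ?_).continuous
    rw [dist_eq_norm, Real.dist_eq]
    exact hγ' a b
  set g : Ω → H := fun x => γ (t x) with hg
  have hgm : Measurable g := hγc.measurable.comp ht
  have hρ0 : ∀ x, 0 < ρ x := fun x => hr.trans_le (hρ x)
  have htg : ∀ x y, |t x - t y| ≤ ‖g x - g y‖ := fun x y => hγ _ _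
  have hκm := measurable_cker (k := k) ht hgm hρm
  have hκ : ∀ x y, ‖cker k t g ρ x y‖ ≤ r⁻¹ := fun x y => by
    refine (norm_cker_le hρ0 htg x y).trans (inv_anti₀ hr ?_)
    have : ρ x + ρ y ≤ cdist g ρ x y := le_max_right _ _
    linarith [hρ x, hρ0 y]
  set T : Ω → Ω → Ω → ℝ := fun x y z => inner ℝ (cker k t g ρ x y) (cker k t g ρ x z) with hT
  have hTb : ∀ x y z, ‖T x y z‖ ≤ r⁻¹ * r⁻¹ := fun x y z =>
    (norm_inner_le_norm _ _).trans (mul_le_mul (hκ _ _) (hκ _ _) (norm_nonneg _) (by positivity))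
  have hTm : Measurable fun p : Ω × Ω × Ω => T p.1 p.2.1 p.2.2 :=
    (hκm.comp (f := fun p : Ω × Ω × Ω => (p.1, p.2.1)) (by fun_prop)).inner
      (hκm.comp (f := fun p : Ω × Ω × Ω => (p.1, p.2.2)) (by fun_prop))
  set Λ := lam.prod (lam.prod lam) with hΛ
  have hTi : Integrable (fun p : Ω × Ω × Ω => T p.1 p.2.1 p.2.2) Λ :=
    Integrable.of_bound hTm.aestronglyMeasurable (r⁻¹ * r⁻¹)
        (Eventually.of_forall fun p => hTb _ _ _)
  have hTx : ∀ x, Integrable (fun p : Ω × Ω => T x p.1 p.2) (lam.prod lam) := fun x =>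
    Integrable.of_bound (hTm.comp (f := fun p : Ω × Ω => (x, p.1, p.2))
      (by fun_prop)).aestronglyMeasurable (r⁻¹ * r⁻¹) (Eventually.of_forall fun p => hTb _ _ _)
  have hsq : ∀ x, ‖∫ y, cker k t g ρ x y ∂lam‖ ^ 2 = ∫ p, T x p.1 p.2 ∂(lam.prod lam) := fun x => by
    rw [integral_prod _ (hTx x)]
    exact sq_norm_integral_eq (Integrable.of_bound (hκm.comp (f := fun y : Ω => (x, y))
      (by fun_prop)).aestronglyMeasurable r⁻¹ (Eventually.of_forall fun p => hκ _ _))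
  have hI : ∫⁻ x, ENNReal.ofReal (‖∫ y, cker k t g ρ x y ∂lam‖ ^ 2) ∂lam =
      ENNReal.ofReal (∫ p, T p.1 p.2.1 p.2.2 ∂Λ) := by
    simp_rw [hsq]
    rw [integral_prod _ hTi, ofReal_integral_eq_lintegral_ofReal hTi.integral_prod_left]
    exact Eventually.of_forall fun x => by simp only [Pi.zero_apply]; rw [← hsq]; positivity
  have hl := measurePreserving_swap_left (lam := lam)
  have hr' := measurePreserving_swap_right (lam := lam)
  have mp : ∀ e : Ω × Ω × Ω → Ω × Ω × Ω, MeasurePreserving e Λ Λ →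
      ∫ p, T (e p).1 (e p).2.1 (e p).2.2 ∂Λ = ∫ p, T p.1 p.2.1 p.2.2 ∂Λ := fun e he => by
    rw [← integral_map (f := fun p : Ω × Ω × Ω => T p.1 p.2.1 p.2.2) he.measurable.aemeasurable
      hTm.aestronglyMeasurable, he.map_eq]
  have mi : ∀ e : Ω × Ω × Ω → Ω × Ω × Ω, MeasurePreserving e Λ Λ →
      Integrable (fun p => T (e p).1 (e p).2.1 (e p).2.2) Λ := fun e he =>
    he.integrable_comp_of_integrable hTi
  have hthree : 3 * ∫ p, T p.1 p.2.1 p.2.2 ∂Λ = ∫ p, csym k t g ρ p.1 p.2.1 p.2.2 ∂Λ := by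
    have e2 := mp _ hl
    have e3 := mp _ (hl.comp hr')
    have i2 := mi _ hl
    have i3 := mi _ (hl.comp hr')
    simp only [Function.comp] at e2 e3 i2 i3
    have : ∀ p : Ω × Ω × Ω, csym k t g ρ p.1 p.2.1 p.2.2 = T p.1 p.2.1 p.2.2 + T p.2.1 p.1 p.2.2 +
        T p.2.2 p.1 p.2.1 := fun p => rfl
    simp_rw [this]
    have i12 : Integrable (fun p : Ω × Ω × Ω => T p.1 p.2.1 p.2.2 + T p.2.1 p.1 p.2.2) Λ :=
      hTi.add i2
    rw [integral_add i12 i3, integral_add hTi i2, e2, e3]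
    ring
  set A : ℝ := (k + 2) * 2 ^ (k + 8) with hA
  set B : ℝ := 2 * ((k + 2) + 2 * (k + 2) ^ 2 * M) + (k + 3) ^ 2 with hB
  have hA0 : 0 ≤ A := by positivity
  have hB0 : 0 ≤ B := by positivity
  have hε : 0 < r / M := by positivity
  set F : Ω → Ω → Ω → ℝ := fun x y z => A * cnear t g ρ x y z + B * cfar γ (r / M) (t x) (t y) (t z)
    with hF
  have hnm : Measurable fun p : Ω × Ω × Ω => cnear t g ρ p.1 p.2.1 p.2.2 :=
    measurable_cnear ht hgm hρm
  have hfm : Measurable fun p : Ω × Ω × Ω => cfar γ (r / M) (t p.1) (t p.2.1) (t p.2.2) :=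
    (measurable_cfar hγc (r / M)).comp (f := fun p : Ω × Ω × Ω => (t p.1, t p.2.1, t p.2.2))
      (by fun_prop)
  have hFm : Measurable fun p : Ω × Ω × Ω => F p.1 p.2.1 p.2.2 :=
    (hnm.const_mul A).add (hfm.const_mul B)
  have iter : ∀ f : Ω × Ω × Ω → ℝ≥0∞, Measurable f → ∫⁻ p, f p ∂Λ =
      ∫⁻ x, ∫⁻ y, ∫⁻ z, f (x, y, z) ∂lam ∂lam ∂lam := fun f hf => by
    rw [hΛ, lintegral_prod _ hf.aemeasurable]
    refine lintegral_congr fun x => ?_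
    exact lintegral_prod (fun q => f (x, q))
      (hf.comp (f := fun q : Ω × Ω => (x, q)) (by fun_prop)).aemeasurable
  rw [hI]
  calc ENNReal.ofReal (∫ p, T p.1 p.2.1 p.2.2 ∂Λ)
      ≤ ENNReal.ofReal |3 * ∫ p, T p.1 p.2.1 p.2.2 ∂Λ| := by
        refine ENNReal.ofReal_le_ofReal ?_
        rw [abs_mul, abs_of_pos (by norm_num : (0 : ℝ) < 3)]
        linarith [le_abs_self (∫ p, T p.1 p.2.1 p.2.2 ∂Λ), abs_nonneg (∫ p, T p.1 p.2.1 p.2.2 ∂Λ)]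
    _ ≤ ∫⁻ p, ENNReal.ofReal |csym k t g ρ p.1 p.2.1 p.2.2| ∂Λ := by
        rw [hthree, ← Real.enorm_eq_ofReal_abs]
        refine (enorm_integral_le_lintegral_enorm _).trans_eq ?_
        simp_rw [Real.enorm_eq_ofReal_abs]
    _ ≤ ∫⁻ p, ENNReal.ofReal (permSum F p.1 p.2.1 p.2.2) ∂Λ := by
        refine lintegral_mono fun p => ENNReal.ofReal_le_ofReal ?_
        refine abs_csym_le_permSum hM0 hγ hγ' hρ0 (fun x => ?_) _ _ _
        rw [mul_div_cancel₀ _ (by linarith : M ≠ 0)]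
        exact hρ x
    _ ≤ 6 * ∫⁻ p, ENNReal.ofReal (F p.1 p.2.1 p.2.2) ∂Λ := lintegral_permSum_le hFm
    _ = 6 * (ENNReal.ofReal A * (∫⁻ p, ENNReal.ofReal (cnear t g ρ p.1 p.2.1 p.2.2) ∂Λ) +
          ENNReal.ofReal B *
            ∫⁻ p, ENNReal.ofReal (cfar γ (r / M) (t p.1) (t p.2.1) (t p.2.2)) ∂Λ) := by
        rw [← lintegral_const_mul' _ _ ENNReal.ofReal_ne_top,
          ← lintegral_const_mul' _ _ ENNReal.ofReal_ne_top, ← lintegral_add_left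
          (hnm.ennreal_ofReal.const_mul _)]
        congr 2; ext p
        rw [← ENNReal.ofReal_mul hA0, ← ENNReal.ofReal_mul hB0, ← ENNReal.ofReal_add
          (mul_nonneg hA0 (cnear_nonneg hρ0 _ _ _)) (mul_nonneg hB0 (cfar_nonneg _ _ _ _ _))]
    _ ≤ 6 * (ENNReal.ofReal A * ENNReal.ofReal ((2 * π * Cg) ^ 2 * (Cg * ℓ)) +
          ENNReal.ofReal B * ENNReal.ofReal (Cg ^ 3 * (16 * M ^ 2 * ℓ))) := by
        rw [iter _ hnm.ennreal_ofReal, iter _ hfm.ennreal_ofReal]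
        gcongr
        · exact lintegral_cnear_le hCg ht hρ0 htg hmap
        · exact lintegral_cfar_le hM0 hCg hℓ hε ht hγ' hmap
    _ = _ := by
        rw [← ENNReal.ofReal_mul hA0, ← ENNReal.ofReal_mul hB0, ← ENNReal.ofReal_add (by positivity)
          (by positivity), ← ENNReal.ofReal_ofNat 6, ← ENNReal.ofReal_mul (by norm_num)]
        congr 1
        ring

end CurveEnergy

section LineEnergy

variable {H : Type*} [NormedAddCommGroup H] [InnerProductSpace ℝ H]

/-- The weighted regularised Riesz kernel along a curve, with regularisation parameter `e`. -/
noncomputable def lineKer (k : ℕ) (γ : ℝ → H) (e s u : ℝ) : H :=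
  (|s - u| ^ k / max ‖γ s - γ u‖ e ^ (k + 2)) • (γ s - γ u)

/-- The constant in the one-dimensional energy estimate. -/
noncomputable def lineConst (k : ℕ) (Cg M : ℝ) : ℝ :=
  6 * ((k + 2) * 2 ^ (k + 8) * ((2 * π * Cg) ^ 2 * Cg) +
    (2 * ((k + 2) + 2 * (k + 2) ^ 2 * M) + (k + 3) ^ 2) * (Cg ^ 3 * (16 * M ^ 2)))

lemma lineConst_nonneg {k : ℕ} {Cg M : ℝ} (hCg : 0 ≤ Cg) (hM : 1 ≤ M) : 0 ≤ lineConst k Cg M := by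
  have : 0 ≤ M := by linarith
  rw [lineConst]
  positivity

variable [SecondCountableTopology H] [MeasurableSpace H] [BorelSpace H] [CompleteSpace H]

theorem lintegral_sum_lineKer_le {E : Type*} [MeasurableSpace E] {ρ : E → ℝ} {k : ℕ} {γ : ℝ → H}
    {M Cg a₀ ℓ r : ℝ} {X : Finset E} {a : E → ℝ → ℝ} (hM : 1 ≤ M) (hCg : 0 ≤ Cg) (hℓ : 0 ≤ ℓ)
    (hr : 0 < r) (hρm : Measurable ρ) (hρ : ∀ x, r ≤ ρ x)
    (hγ : ∀ a b, |a - b| ≤ ‖γ a - γ b‖) (hγ' : ∀ a b, ‖γ a - γ b‖ ≤ M * |a - b|)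
    (ham : ∀ x, Measurable (a x)) (ha0 : ∀ x s, 0 ≤ a x s)
    (hsum : ∀ s, ∑ x ∈ X, a x s ≤ (Icc a₀ (a₀ + ℓ)).indicator (fun _ => Cg) s) :
    ∫⁻ s, ∑ x ∈ X, ENNReal.ofReal
      (a x s * ‖∫ u, ∑ y ∈ X, a y u • lineKer k γ (ρ x + ρ y) s u‖ ^ 2) ≤
      ENNReal.ofReal (lineConst k Cg M * ℓ) := by
  have hM0 : 0 ≤ M := by linarith
  have hγc : Continuous γ := by
    refine (LipschitzWith.of_dist_le_mul (K := ⟨M, hM0⟩) fun a b => ?_).continuous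
    rw [dist_eq_norm, Real.dist_eq]
    exact hγ' a b
  set w : E → Measure ℝ := fun x => volume.withDensity fun s => ENNReal.ofReal (a x s) with hw
  set lam : Measure (E × ℝ) := ∑ x ∈ X, (w x).map (Prod.mk x) with hlam
  have hmk : ∀ x : E, Measurable (Prod.mk x : ℝ → E × ℝ) := fun x => measurable_prodMk_left
  have hmap : lam.map Prod.snd ≤ ENNReal.ofReal Cg • volume.restrict (Icc a₀ (a₀ + ℓ)) := by
    refine Measure.le_iff.2 fun S hS => ?_
    rw [Measure.map_apply measurable_snd hS, hlam, Measure.finsetSum_apply]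
    have h1 : ∀ x ∈ X, ((w x).map (Prod.mk x)) (Prod.snd ⁻¹' S) =
        ∫⁻ s in S, ENNReal.ofReal (a x s) := fun x _ => by
      rw [Measure.map_apply (hmk x) (measurable_snd hS), ← preimage_comp]
      exact withDensity_apply _ hS
    rw [Finset.sum_congr rfl h1, ← lintegral_finsetSum _ fun x _ => (ham x).ennreal_ofReal]
    calc ∫⁻ s in S, ∑ x ∈ X, ENNReal.ofReal (a x s)
        ≤ ∫⁻ s in S, (Icc a₀ (a₀ + ℓ)).indicator (fun _ => ENNReal.ofReal Cg) s := by
          refine lintegral_mono fun s => ?_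
          rw [← ENNReal.ofReal_sum_of_nonneg fun x _ => ha0 x s]
          refine (ENNReal.ofReal_le_ofReal (hsum s)).trans_eq ?_
          by_cases h : s ∈ Icc a₀ (a₀ + ℓ) <;> simp [h]
      _ = _ := by
          rw [lintegral_indicator measurableSet_Icc, setLIntegral_const, Measure.smul_apply,
            Measure.restrict_apply hS, Measure.restrict_apply measurableSet_Icc, inter_comm]
          rfl
  have hfin : IsFiniteMeasure lam := by
    refine ⟨?_⟩
    have h1 : lam univ = lam.map Prod.snd univ := by
      rw [Measure.map_apply measurable_snd MeasurableSet.univ, preimage_univ]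
    rw [h1]
    refine (hmap univ).trans_lt ?_
    rw [Measure.smul_apply, Measure.restrict_apply MeasurableSet.univ, univ_inter, Real.volume_Icc]
    exact ENNReal.mul_lt_top ENNReal.ofReal_lt_top ENNReal.ofReal_lt_top
  have key := lintegral_cker_le (lam := lam) (k := k) (t := Prod.snd) (ρ := fun p => ρ p.1) (γ := γ)
    hM hCg hℓ hr measurable_snd (hρm.comp measurable_fst) (fun p => hρ p.1) hγ hγ' hmap
  have hκm := measurable_cker (k := k) (t := (Prod.snd : E × ℝ → ℝ)) (ρ := fun p => ρ p.1)
    (g := fun p => γ p.2) measurable_snd (hγc.measurable.comp measurable_snd)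
    (hρm.comp measurable_fst)
  have hin : ∀ p : E × ℝ, ∫ q, cker k Prod.snd (fun p => γ p.2) (fun p => ρ p.1) p q ∂lam =
      ∫ u, ∑ y ∈ X, a y u • lineKer k γ (ρ p.1 + ρ y) p.2 u := fun p => by
    have hb : ∀ q, ‖cker k Prod.snd (fun p => γ p.2) (fun p => ρ p.1) p q‖ ≤ r⁻¹ := fun q => by
      refine (norm_cker_le (ρ := fun p : E × ℝ => ρ p.1) (t := Prod.snd) (g := fun p => γ p.2)
        (fun x => hr.trans_le (hρ _)) (fun x y => hγ _ _) p q).trans (inv_anti₀ hr ?_)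
      have : ρ p.1 + ρ q.1 ≤ cdist (fun p : E × ℝ => γ p.2) (fun p => ρ p.1) p q := le_max_right _ _
      linarith [hρ p.1, hρ q.1]
    have hqm : Measurable fun q => cker k Prod.snd (fun p => γ p.2) (fun p => ρ p.1) p q :=
      hκm.comp (f := fun q : E × ℝ => (p, q)) (by fun_prop)
    have h_int : Integrable (fun q => cker k Prod.snd (fun p => γ p.2) (fun p => ρ p.1) p q) lam :=
      Integrable.of_bound hqm.aestronglyMeasurable r⁻¹ (Eventually.of_forall hb)
    have h_int' : ∀ y ∈ X, Integrable
        (fun q => cker k Prod.snd (fun p => γ p.2) (fun p => ρ p.1) p q) ((w y).map (Prod.mk y)) :=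
      integrable_finsetSum_measure.1 h_int
    have hval : ∀ y u, (ENNReal.ofReal (a y u)).toReal • cker k Prod.snd (fun p => γ p.2)
        (fun p => ρ p.1) p (y, u) = a y u • lineKer k γ (ρ p.1 + ρ y) p.2 u := fun y u => by
      rw [ENNReal.toReal_ofReal (ha0 _ _)]
      rfl
    rw [hlam, integral_finsetSum_measure h_int', integral_finsetSum]
    · refine Finset.sum_congr rfl fun y _ => ?_
      rw [integral_map (hmk y).aemeasurable hqm.aestronglyMeasurable,
        integral_withDensity_eq_integral_toReal_smul (ham y).ennreal_ofReal
          (Eventually.of_forall fun _ => ENNReal.ofReal_lt_top)]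
      exact integral_congr_ae (Eventually.of_forall fun u => hval y u)
    · intro y hy
      have := (integrable_map_measure hqm.aestronglyMeasurable (hmk y).aemeasurable).1 (h_int' y hy)
      rw [hw, integrable_withDensity_iff_integrable_smul' (ham y).ennreal_ofReal
        (Eventually.of_forall fun _ => ENNReal.ofReal_lt_top)] at this
      exact this.congr (Eventually.of_forall fun u => hval y u)
  refine le_trans (le_of_eq ?_) key
  have hFm : Measurable fun p : E × ℝ =>
      ∫ q, cker k Prod.snd (fun p => γ p.2) (fun p => ρ p.1) p q ∂lam :=
    (hκm.stronglyMeasurable.integral_prod_right (ν := lam)).measurable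
  have hFm' := (hFm.norm.pow_const 2).ennreal_ofReal
  rw [lintegral_finsetSum_measure (μ := fun x => (w x).map (Prod.mk x)), lintegral_finsetSum]
  · refine Finset.sum_congr rfl fun x _ => ?_
    rw [lintegral_map hFm' (hmk x)]
    refine Eq.trans ?_ (lintegral_withDensity_eq_lintegral_mul volume
      (ham x).ennreal_ofReal (hFm'.comp (hmk x))).symm
    refine lintegral_congr fun s => ?_
    rw [ENNReal.ofReal_mul (ha0 _ _), Pi.mul_apply, ← hin (x, s)]
    rfl
  · intro x _
    have := (ham x).mul ((hFm.comp (hmk x)).norm.pow_const 2)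
    simp_rw [← hin (x, _)]
    exact this.ennreal_ofReal

end LineEnergy

section Rotation

/-- The logarithmic measure of a dyadic annulus in the line. -/
noncomputable def logMass : ℝ≥0∞ :=
  ∫⁻ t : ℝ, ENNReal.ofReal |t|⁻¹ * {t : ℝ | 1 / 2 ≤ |t| ∧ |t| ≤ 1}.indicator 1 t

lemma half_le_logMass : 2⁻¹ ≤ logMass := by
  have h : ∀ t : ℝ, (Icc (1 / 2 : ℝ) 1).indicator 1 t ≤
      ENNReal.ofReal |t|⁻¹ * {t : ℝ | 1 / 2 ≤ |t| ∧ |t| ≤ 1}.indicator 1 t := fun t => by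
    by_cases ht : t ∈ Icc (1 / 2 : ℝ) 1
    · have h0 : |t| = t := abs_of_nonneg (by linarith [ht.1])
      have h1 : t ∈ {t : ℝ | 1 / 2 ≤ |t| ∧ |t| ≤ 1} := by
        rw [mem_ofPred_eq, h0]
        exact ht
      rw [indicator_of_mem ht, indicator_of_mem h1, h0, Pi.one_apply, mul_one]
      refine ENNReal.one_le_ofReal.2 ((one_le_inv₀ (by linarith [ht.1])).2 ht.2)
    · rw [indicator_of_notMem ht]
      exact zero_le
  refine le_trans ?_ (lintegral_mono h)
  rw [lintegral_indicator_one measurableSet_Icc, Real.volume_Icc, ← ENNReal.ofReal_ofNat,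
    ← ENNReal.ofReal_inv_of_pos (by norm_num)]
  exact ENNReal.ofReal_le_ofReal (by norm_num)

lemma logMass_ne_top : logMass ≠ ∞ := by
  have h : ∀ t : ℝ, ENNReal.ofReal |t|⁻¹ * {t : ℝ | 1 / 2 ≤ |t| ∧ |t| ≤ 1}.indicator 1 t ≤
      (Icc (-1 : ℝ) 1).indicator (fun _ => ENNReal.ofReal 2) t := fun t => by
    by_cases ht : t ∈ {t : ℝ | 1 / 2 ≤ |t| ∧ |t| ≤ 1}
    · rw [indicator_of_mem ht, indicator_of_mem (show t ∈ Icc (-1 : ℝ) 1 from abs_le.1 ht.2),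
        Pi.one_apply,
        mul_one]
      refine ENNReal.ofReal_le_ofReal (inv_le_of_inv_le₀ (by norm_num) ?_)
      linarith [ht.1]
    · rw [indicator_of_notMem ht, mul_zero]
      exact zero_le
  refine ((lintegral_mono h).trans_lt ?_).ne
  rw [lintegral_indicator_const measurableSet_Icc, Real.volume_Icc]
  exact ENNReal.mul_lt_top ENNReal.ofReal_lt_top ENNReal.ofReal_lt_top

variable {V : Type*} [NormedAddCommGroup V] [NormedSpace ℝ V] [FiniteDimensional ℝ V]
  [MeasurableSpace V] [BorelSpace V] [SecondCountableTopology V]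
  {μ : Measure V} [μ.IsAddHaarMeasure] {k : ℕ}

variable (V) in
/-- The dyadic annulus. -/
def annulus : Set V := {v | 1 ≤ ‖v‖ ∧ ‖v‖ ≤ 2}

lemma measurableSet_annulus : MeasurableSet (annulus V) :=
  (by fun_prop : Measurable fun v : V => ‖v‖) (measurableSet_Icc (a := 1) (b := 2))

lemma measure_annulus_ne_top : μ (annulus V) ≠ ∞ := by
  refine ((measure_mono (t := closedBall 0 2) fun v hv => ?_).trans_lt measure_closedBall_lt_top).ne
  rw [mem_closedBall, dist_zero_right]
  exact hv.2

lemma lintegral_comp_smul_eq {f : V → ℝ≥0∞} (hf : Measurable f) {t : ℝ} (ht : t ≠ 0) :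
    ∫⁻ v, f (t • v) ∂μ = ENNReal.ofReal |(t ^ Module.finrank ℝ V)⁻¹| * ∫⁻ v, f v ∂μ := by
  rw [← lintegral_map hf (by fun_prop), map_addHaar_smul μ ht, lintegral_smul_measure, smul_eq_mul]

lemma lintegral_inv_indicator_annulus {u : V} (hu : u ≠ 0) :
    ∫⁻ t : ℝ, ENNReal.ofReal |t|⁻¹ * (annulus V).indicator 1 (t⁻¹ • u) = logMass := by
  have hu' : 0 < ‖u‖ := norm_pos_iff.2 hu
  rw [lintegral_comp_mul_left_pos hu', logMass, ← lintegral_const_mul' _ _ ENNReal.ofReal_ne_top]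
  refine lintegral_congr fun t => ?_
  rcases eq_or_ne t 0 with rfl | ht
  · simp
  have ht' : 0 < |t| := abs_pos.2 ht
  rw [abs_mul, abs_of_pos hu', mul_inv, ENNReal.ofReal_mul (by positivity), ← mul_assoc,
    ← mul_assoc,
    ← ENNReal.ofReal_mul hu'.le, mul_inv_cancel₀ hu'.ne', ENNReal.ofReal_one, one_mul]
  congr 1
  have h1 : ‖(‖u‖ * t)⁻¹ • u‖ = |t|⁻¹ := by
    rw [norm_smul, Real.norm_eq_abs, abs_inv, abs_mul, abs_of_pos hu']
    field_simp
  have : (‖u‖ * t)⁻¹ • u ∈ annulus V ↔ t ∈ {t : ℝ | 1 / 2 ≤ |t| ∧ |t| ≤ 1} := by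
    rw [annulus, mem_ofPred_eq, mem_ofPred_eq, h1, one_le_inv₀ ht', inv_le_comm₀ ht' (by norm_num),
      one_div, and_comm]
  by_cases h : t ∈ {t : ℝ | 1 / 2 ≤ |t| ∧ |t| ≤ 1}
  · rw [indicator_of_mem h, indicator_of_mem (this.2 h)]
    rfl
  · rw [indicator_of_notMem h, indicator_of_notMem (mt this.1 h)]

/-- The measure `|t| ^ k dt` on the line. -/
noncomputable def powMeasure (k : ℕ) : Measure ℝ :=
  volume.withDensity fun t => ENNReal.ofReal (|t| ^ k)

instance : SFinite (powMeasure k) := by rw [powMeasure]; infer_instance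

/-- Polar coordinates averaged over a dyadic annulus. -/
lemma map_smul_annulus (hV : Module.finrank ℝ V = k + 1) :
    ((μ.restrict (annulus V)).prod (powMeasure k)).map (fun p => p.2 • p.1) = logMass • μ := by
  refine Measure.ext_of_lintegral _ fun f hf => ?_
  have hm : Measurable fun p : V × ℝ => p.2 • p.1 := by fun_prop
  have h0 : Measurable fun p : V × ℝ => (annulus V).indicator (1 : V → ℝ≥0∞) p.1 :=
    (measurable_one.indicator measurableSet_annulus).comp measurable_fst
  rw [lintegral_map hf hm, lintegral_prod (fun p : V × ℝ => f (p.2 • p.1))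
    (hf.comp hm).aemeasurable, lintegral_smul_measure,
    smul_eq_mul, ← lintegral_indicator measurableSet_annulus]
  have h1 : ∀ v : V, (annulus V).indicator
      (fun v => ∫⁻ t : ℝ, f ((v, t).2 • (v, t).1) ∂powMeasure k) v =
      ∫⁻ t : ℝ, ENNReal.ofReal (|t| ^ k) * ((annulus V).indicator 1 v * f (t • v)) := fun v => by
    by_cases hv : v ∈ annulus V
    · simp only [indicator_of_mem hv, Pi.one_apply, one_mul]
      exact lintegral_withDensity_eq_lintegral_mul volume
        (by fun_prop : Measurable fun t : ℝ => ENNReal.ofReal (|t| ^ k))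
        (by fun_prop : Measurable fun t : ℝ => f (t • v))
    · simp [indicator_of_notMem hv]
  simp_rw [h1]
  have m1 : Measurable fun p : V × ℝ =>
      ENNReal.ofReal (|p.2| ^ k) * ((annulus V).indicator 1 p.1 * f (p.2 • p.1)) :=
    (by fun_prop : Measurable fun p : V × ℝ => ENNReal.ofReal (|p.2| ^ k)).mul (h0.mul (hf.comp hm))
  rw [lintegral_lintegral_swap m1.aemeasurable]
  have h2 : Measurable fun p : ℝ × V => (annulus V).indicator (1 : V → ℝ≥0∞) (p.1⁻¹ • p.2) :=
    (measurable_one.indicator measurableSet_annulus).comp (by fun_prop)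
  have h3 : ∀ t : ℝ, t ≠ 0 → ∫⁻ v : V,
      ENNReal.ofReal (|t| ^ k) * ((annulus V).indicator 1 v * f (t • v)) ∂μ =
      ∫⁻ u, ENNReal.ofReal |t|⁻¹ * ((annulus V).indicator 1 (t⁻¹ • u) * f u) ∂μ := fun t ht => by
    have ht' : 0 < |t| := abs_pos.2 ht
    have e : ∀ v, (annulus V).indicator (1 : V → ℝ≥0∞) v * f (t • v) =
        (fun u => (annulus V).indicator (1 : V → ℝ≥0∞) (t⁻¹ • u) * f u) (t • v) := fun v => by
      simp only [inv_smul_smul₀ ht]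
    rw [lintegral_const_mul' _ _ ENNReal.ofReal_ne_top, lintegral_congr e,
      lintegral_comp_smul_eq (f := fun u => (annulus V).indicator (1 : V → ℝ≥0∞) (t⁻¹ • u) * f u)
        ((h2.comp (measurable_prodMk_left (x := t))).mul hf) ht, hV,
      lintegral_const_mul' _ _ ENNReal.ofReal_ne_top, ← mul_assoc,
      ← ENNReal.ofReal_mul (by positivity)]
    congr 2
    rw [abs_inv, abs_pow, pow_succ]
    field_simp
  have h4 : ∀ᵐ t : ℝ, t ≠ 0 := by simp [ae_iff]
  rw [lintegral_congr_ae (h4.mono fun t ht => h3 t ht)]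
  have m2 : Measurable fun p : ℝ × V =>
      ENNReal.ofReal |p.1|⁻¹ * ((annulus V).indicator 1 (p.1⁻¹ • p.2) * f p.2) :=
    (by fun_prop : Measurable fun p : ℝ × V => ENNReal.ofReal |p.1|⁻¹).mul
      (h2.mul (hf.comp measurable_snd))
  rw [lintegral_lintegral_swap m2.aemeasurable, ← lintegral_const_mul _ hf]
  have h5 : ∀ᵐ u ∂μ, u ≠ 0 := by
    have : Nontrivial V := Module.nontrivial_of_finrank_pos (R := ℝ) (by omega)
    simp [ae_iff]
  refine lintegral_congr_ae (h5.mono fun u hu => ?_)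
  simp_rw [← mul_assoc]
  have m3 : Measurable fun t : ℝ => ENNReal.ofReal |t|⁻¹ *
      (annulus V).indicator (1 : V → ℝ≥0∞) (t⁻¹ • u) :=
    (by fun_prop : Measurable fun t : ℝ => ENNReal.ofReal |t|⁻¹).mul
      (h2.comp (measurable_prodMk_right (y := u)))
  rw [lintegral_mul_const _ m3, lintegral_inv_indicator_annulus hu]

end Rotation

section Rotation

lemma sq_lintegral_le {Ω : Type*} [MeasurableSpace Ω] {ν : Measure Ω} {f : Ω → ℝ≥0∞}
    (hf : AEMeasurable f ν) : (∫⁻ x, f x ∂ν) ^ 2 ≤ ν univ * ∫⁻ x, f x ^ 2 ∂ν := by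
  have h := ENNReal.lintegral_mul_le_Lp_mul_Lq ν Real.HolderConjugate.two_two
    (measurable_one.aemeasurable (f := (1 : Ω → ℝ≥0∞))) hf
  simp only [one_mul, Pi.one_apply, ENNReal.one_rpow, lintegral_one] at h
  calc (∫⁻ x, f x ∂ν) ^ 2 ≤ (ν univ ^ (1 / 2 : ℝ) * (∫⁻ x, f x ^ (2 : ℝ) ∂ν) ^
      (1 / 2 : ℝ)) ^ 2 := by
        gcongr
    _ = _ := by
        rw [mul_pow, ← ENNReal.rpow_natCast, ← ENNReal.rpow_mul, ← ENNReal.rpow_natCast,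
          ← ENNReal.rpow_mul]
        norm_num

variable {V : Type*} [NormedAddCommGroup V] [NormedSpace ℝ V] [FiniteDimensional ℝ V]
  [MeasurableSpace V] [BorelSpace V] [SecondCountableTopology V]
  {μ : Measure V} [μ.IsAddHaarMeasure] {k : ℕ}
  {H : Type*} [NormedAddCommGroup H] [InnerProductSpace ℝ H] [SecondCountableTopology H]
  [MeasurableSpace H] [BorelSpace H] [CompleteSpace H]

lemma sq_enorm_integral_le_polar (hV : Module.finrank ℝ V = k + 1) {f : V → H} (hf : Measurable f)
    (hfi : Integrable f μ) :
    ‖∫ u, f u ∂μ‖ₑ ^ 2 ≤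
      4 * μ (annulus V) * ∫⁻ v in annulus V, ‖∫ t : ℝ, |t| ^ k • f (t • v)‖ₑ ^ 2 ∂μ := by
  have hm : Measurable fun p : V × ℝ => p.2 • p.1 := by fun_prop
  set ν := (μ.restrict (annulus V)).prod (powMeasure k) with hν
  have hmap : ν.map (fun p => p.2 • p.1) = logMass • μ := map_smul_annulus hV
  have hi : Integrable (fun p : V × ℝ => f (p.2 • p.1)) ν := by
    refine (integrable_map_measure (μ := ν) (g := f) hf.aestronglyMeasurable hm.aemeasurable).1 ?_
    rw [hmap]
    exact hfi.smul_measure logMass_ne_top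
  have hpow : ∀ v : V, ∫ t, f (t • v) ∂powMeasure k = ∫ t : ℝ, |t| ^ k • f (t • v) := fun v => by
    rw [powMeasure, integral_withDensity_eq_integral_toReal_smul (by fun_prop)
      (Eventually.of_forall fun _ => ENNReal.ofReal_lt_top)]
    refine integral_congr_ae (Eventually.of_forall fun t => ?_)
    simp only
    rw [ENNReal.toReal_ofReal (by positivity)]
  have h1 : logMass.toReal • ∫ u, f u ∂μ =
      ∫ v in annulus V, (∫ t : ℝ, |t| ^ k • f (t • v)) ∂μ := by
    rw [← integral_smul_measure, ← hmap, integral_map hm.aemeasurable hf.aestronglyMeasurable,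
      integral_prod _ hi]
    simp_rw [hpow]
  have h2 : ‖∫ u, f u ∂μ‖ₑ ≤ 2 * ∫⁻ v in annulus V, ‖∫ t : ℝ, |t| ^ k • f (t • v)‖ₑ ∂μ := by
    have h3 := enorm_integral_le_lintegral_enorm (μ := μ.restrict (annulus V))
      fun v => ∫ t : ℝ, |t| ^ k • f (t • v)
    rw [← h1, enorm_smul, Real.enorm_of_nonneg ENNReal.toReal_nonneg,
      ENNReal.ofReal_toReal logMass_ne_top] at h3
    calc ‖∫ u, f u ∂μ‖ₑ = 2 * (2⁻¹ * ‖∫ u, f u ∂μ‖ₑ) := by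
          rw [← mul_assoc, ENNReal.mul_inv_cancel (by norm_num) (by norm_num), one_mul]
      _ ≤ 2 * (logMass * ‖∫ u, f u ∂μ‖ₑ) := by gcongr; exact half_le_logMass
      _ ≤ _ := by gcongr
  have hJ : StronglyMeasurable fun v : V => ∫ t : ℝ, |t| ^ k • f (t • v) := by
    refine StronglyMeasurable.integral_prod_right (f := fun (v : V) (t : ℝ) => |t| ^ k • f
        (t • v)) ?_
    exact ((by fun_prop : Measurable fun p : V × ℝ => |p.2| ^ k).smul
        (hf.comp hm)).stronglyMeasurable
  calc ‖∫ u, f u ∂μ‖ₑ ^ 2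
      ≤ (2 * ∫⁻ v in annulus V, ‖∫ t : ℝ, |t| ^ k • f (t • v)‖ₑ ∂μ) ^ 2 := by gcongr
    _ ≤ 4 * (μ (annulus V) * ∫⁻ v in annulus V, ‖∫ t : ℝ, |t| ^ k • f (t • v)‖ₑ ^ 2 ∂μ) := by
        rw [mul_pow]
        norm_num
        gcongr
        have := sq_lintegral_le (ν := μ.restrict (annulus V)) hJ.measurable.enorm.aemeasurable
        rwa [Measure.restrict_apply_univ] at this
    _ = _ := (mul_assoc _ _ _).symm

/-- The regularised Riesz kernel on a graph. -/
noncomputable def graphKer (k : ℕ) (γ : V → H) (e : ℝ) (w u : V) : H :=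
  (max ‖γ w - γ u‖ e ^ (k + 2))⁻¹ • (γ w - γ u)

lemma measurable_graphKer {γ : V → H} (hγ : Measurable γ) (e : ℝ) :
    Measurable fun p : V × V => graphKer k γ e p.1 p.2 := by
  unfold graphKer
  fun_prop

lemma norm_graphKer_le {γ : V → H} {e : ℝ} (he : 0 < e) (w u : V) :
    ‖graphKer k γ e w u‖ ≤ (e ^ (k + 1))⁻¹ := by
  set D := max ‖γ w - γ u‖ e with hD
  have hDe : e ≤ D := le_max_right _ _
  have hD0 : 0 < D := he.trans_le hDe
  rw [graphKer, norm_smul, ← hD, Real.norm_of_nonneg (by positivity)]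
  calc (D ^ (k + 2))⁻¹ * ‖γ w - γ u‖ ≤ (D ^ (k + 2))⁻¹ * D := by gcongr; exact le_max_left _ _
    _ = (D ^ (k + 1))⁻¹ := by rw [pow_succ D (k + 1)]; field_simp
    _ ≤ _ := by gcongr

end Rotation

section Rotation

variable {V : Type*} [NormedAddCommGroup V] [NormedSpace ℝ V] [FiniteDimensional ℝ V]
  [MeasurableSpace V] [BorelSpace V] [SecondCountableTopology V]
  {μ : Measure V} [μ.IsAddHaarMeasure] {k : ℕ}
  {H : Type*} [NormedAddCommGroup H] [InnerProductSpace ℝ H] [SecondCountableTopology H]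
  [MeasurableSpace H] [BorelSpace H] [CompleteSpace H]

lemma ofReal_mul_sq_norm {a : ℝ} (ha : 0 ≤ a) (z : H) :
    ENNReal.ofReal (a * ‖z‖ ^ 2) = ENNReal.ofReal a * ‖z‖ₑ ^ 2 := by
  rw [ENNReal.ofReal_mul ha, ENNReal.ofReal_pow (norm_nonneg _), ofReal_norm]

variable {E : Type*} [MeasurableSpace E] {ρ : E → ℝ} {γ : V → H} {M Cg R r : ℝ} {p : V}
  {X : Finset E} {a : E → V → ℝ}

/-- The energy along one direction. -/
lemma lintegral_line_le (hM : 1 ≤ M) (hCg : 0 ≤ Cg) (hR : 0 < R) (hr : 0 < r) (hρm : Measurable ρ)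
    (hρ : ∀ x, r ≤ ρ x) (hγ : ∀ w u, ‖w - u‖ ≤ ‖γ w - γ u‖)
    (hγ' : ∀ w u, ‖γ w - γ u‖ ≤ M * ‖w - u‖) (ham : ∀ x, Measurable (a x))
    (ha0 : ∀ x w, 0 ≤ a x w) (hsum : ∀ w, ∑ x ∈ X, a x w ≤ (closedBall p R).indicator
        (fun _ => Cg) w)
    {v : V} (hv : v ∈ annulus V) (w : V) :
    ∫⁻ s : ℝ, ∑ x ∈ X, ENNReal.ofReal (a x (w + s • v)) * ‖∫ t : ℝ, |t| ^ k •
      ∑ y ∈ X, a y (w + s • v + t • v) • graphKer k γ (ρ x + ρ y) (w + s • v)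
          (w + s • v + t • v)‖ₑ ^ 2 ≤
      ENNReal.ofReal (lineConst k Cg (2 * M) * (4 * R)) := by
  have hd : ∀ s u : ℝ, ‖(w + s • v) - (w + u • v)‖ = |s - u| * ‖v‖ := fun s u => by
    rw [add_sub_add_left_eq_sub, ← sub_smul, norm_smul, Real.norm_eq_abs]
  obtain ⟨a₀, ha₀⟩ : ∃ a₀ : ℝ, ∀ s : ℝ, w + s • v ∈ closedBall p R → s ∈ Icc a₀ (a₀ + 4 * R) := by
    by_cases h : ∃ s : ℝ, w + s • v ∈ closedBall p R
    · obtain ⟨s₀, hs₀⟩ := h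
      refine ⟨s₀ - 2 * R, fun s hs => ?_⟩
      have h1 : |s - s₀| * ‖v‖ ≤ 2 * R := by
        rw [← hd, ← dist_eq_norm]
        linarith [dist_triangle_right (w + s • v) (w + s₀ • v) p, mem_closedBall.1 hs,
          mem_closedBall.1 hs₀]
      have h2 : |s - s₀| ≤ 2 * R := by nlinarith [hv.1, abs_nonneg (s - s₀)]
      have := abs_le.1 h2
      constructor <;> linarith [this.1, this.2]
    · exact ⟨0, fun s hs => absurd ⟨s, hs⟩ h⟩
  have hmw : Measurable fun s : ℝ => w + s • v := by fun_prop
  have key := lintegral_sum_lineKer_le (k := k) (γ := fun s : ℝ => γ (w + s • v)) (M := 2 * M)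
    (Cg := Cg) (a₀ := a₀) (ℓ := 4 * R) (r := r) (ρ := ρ) (X := X) (a := fun x s => a x (w + s • v))
    (by linarith) hCg (by positivity) hr hρm hρ (fun s u => ?_) (fun s u => ?_)
    (fun x => (ham x).comp hmw) (fun x s => ha0 _ _) (fun s => ?_)
  · refine le_trans (le_of_eq ?_) key
    refine lintegral_congr fun s => Finset.sum_congr rfl fun x _ => ?_
    rw [ofReal_mul_sq_norm (ha0 _ _)]
    congr 3
    refine Eq.trans ?_ (integral_add_left_eq_self (fun u => ∑ y ∈ X, a y (w + u • v) •
      lineKer k (fun s : ℝ => γ (w + s • v)) (ρ x + ρ y) s u) s)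
    refine integral_congr_ae (Eventually.of_forall fun t => ?_)
    simp only
    rw [Finset.smul_sum]
    refine Finset.sum_congr rfl fun y _ => ?_
    rw [add_assoc w, ← add_smul, lineKer, graphKer, smul_comm, smul_smul (|t| ^ k), div_eq_mul_inv,
      sub_add_cancel_left, abs_neg]
  · refine le_trans ?_ (hγ _ _)
    rw [hd]
    nlinarith [hv.1, abs_nonneg (s - u)]
  · refine (hγ' _ _).trans ?_
    rw [hd]
    nlinarith [hv.2, abs_nonneg (s - u), mul_nonneg (by linarith : 0 ≤ M) (abs_nonneg (s - u))]
  · refine (hsum _).trans ?_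
    by_cases h : w + s • v ∈ closedBall p R
    · rw [indicator_of_mem h, indicator_of_mem (ha₀ s h)]
    · rw [indicator_of_notMem h]
      exact indicator_nonneg (fun _ _ => hCg) _

lemma lintegral_direction_le (hM : 1 ≤ M) (hCg : 0 ≤ Cg) (hR : 0 < R) (hr : 0 < r)
    (hρm : Measurable ρ)
    (hρ : ∀ x, r ≤ ρ x) (hγ : ∀ w u, ‖w - u‖ ≤ ‖γ w - γ u‖)
    (hγ' : ∀ w u, ‖γ w - γ u‖ ≤ M * ‖w - u‖) (ham : ∀ x, Measurable (a x))
    (ha0 : ∀ x w, 0 ≤ a x w) (hsum : ∀ w, ∑ x ∈ X, a x w ≤ (closedBall p R).indicator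
        (fun _ => Cg) w)
    {v : V} (hv : v ∈ annulus V)
    (hmeas : Measurable fun w => ∑ x ∈ X, ENNReal.ofReal (a x w) * ‖∫ t : ℝ, |t| ^ k •
      ∑ y ∈ X, a y (w + t • v) • graphKer k γ (ρ x + ρ y) w (w + t • v)‖ₑ ^ 2) :
    ∫⁻ w, ∑ x ∈ X, ENNReal.ofReal (a x w) * ‖∫ t : ℝ, |t| ^ k •
      ∑ y ∈ X, a y (w + t • v) • graphKer k γ (ρ x + ρ y) w (w + t • v)‖ₑ ^ 2 ∂μ ≤
      μ (closedBall p (3 * R)) * ENNReal.ofReal (4 * lineConst k Cg (2 * M)) := by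
  set h : V → ℝ≥0∞ := fun w => ∑ x ∈ X, ENNReal.ofReal (a x w) * ‖∫ t : ℝ, |t| ^ k •
      ∑ y ∈ X, a y (w + t • v) • graphKer k γ (ρ x + ρ y) w (w + t • v)‖ₑ ^ 2 with hh
  have h0 : ∀ w, w ∉ closedBall p R → h w = 0 := fun w hw => by
    have h1 : ∀ x ∈ X, a x w = 0 := by
      have := hsum w
      rw [indicator_of_notMem hw] at this
      exact (Finset.sum_eq_zero_iff_of_nonneg fun x _ => ha0 x w).1
        (le_antisymm this (Finset.sum_nonneg fun x _ => ha0 x w))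
    refine Finset.sum_eq_zero fun x hx => ?_
    rw [h1 x hx, ENNReal.ofReal_zero, zero_mul]
  have hms : Measurable fun q : V × ℝ => h (q.1 + q.2 • v) := hmeas.comp (by fun_prop)
  have hRpos : ENNReal.ofReal R ≠ 0 := by simpa using hR
  have h2 : ENNReal.ofReal R * ∫⁻ w, h w ∂μ ≤ ENNReal.ofReal R *
      (μ (closedBall p (3 * R)) * ENNReal.ofReal (4 * lineConst k Cg (2 * M))) := by
    calc ENNReal.ofReal R * ∫⁻ w, h w ∂μ = ∫⁻ s in Icc 0 R, (∫⁻ w, h w ∂μ) := by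
          rw [setLIntegral_const, Real.volume_Icc, sub_zero, mul_comm]
      _ = ∫⁻ s in Icc 0 R, (∫⁻ w, h (w + s • v) ∂μ) := by
          refine lintegral_congr fun s => ?_
          rw [lintegral_add_right_eq_self]
      _ = ∫⁻ w, (∫⁻ s in Icc 0 R, h (w + s • v)) ∂μ := by
          rw [lintegral_lintegral_swap]
          exact (hms.comp measurable_swap).aemeasurable
      _ ≤ ∫⁻ w, (closedBall p (3 * R)).indicator
            (fun _ => ENNReal.ofReal (lineConst k Cg (2 * M) * (4 * R))) w ∂μ := by
          refine lintegral_mono fun w => ?_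
          by_cases hw : w ∈ closedBall p (3 * R)
          · rw [indicator_of_mem hw]
            refine le_trans (setLIntegral_le_lintegral _ _) ?_
            exact lintegral_line_le hM hCg hR hr hρm hρ hγ hγ' ham ha0 hsum hv w
          · rw [indicator_of_notMem hw, nonpos_iff_eq_zero]
            refine setLIntegral_eq_zero measurableSet_Icc fun s hs => ?_
            refine h0 _ fun hws => hw ?_
            rw [mem_closedBall] at hws ⊢
            have h3 : dist w (w + s • v) ≤ 2 * R := by
              rw [dist_eq_norm, sub_add_cancel_left, norm_neg, norm_smul, Real.norm_eq_abs,
                abs_of_nonneg hs.1]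
              nlinarith [hs.1, hs.2, hv.2, norm_nonneg v]
            linarith [dist_triangle w (w + s • v) p]
      _ = _ := by
          rw [lintegral_indicator_const measurableSet_closedBall, mul_left_comm (ENNReal.ofReal R),
            ← ENNReal.ofReal_mul hR.le, mul_comm]
          congr 2
          ring
  exact (ENNReal.mul_le_mul_iff_right hRpos ENNReal.ofReal_ne_top).1 h2

set_option maxHeartbeats 400000 in
/-- The energy of a density of bounded total height carried by a Lipschitz graph. -/
theorem lintegral_graphKer_le (hV : Module.finrank ℝ V = k + 1) (hM : 1 ≤ M) (hCg : 0 ≤ Cg)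
    (hR : 0 < R) (hr : 0 < r) (hρm : Measurable ρ)
    (hρ : ∀ x, r ≤ ρ x) (hγ : ∀ w u, ‖w - u‖ ≤ ‖γ w - γ u‖)
    (hγ' : ∀ w u, ‖γ w - γ u‖ ≤ M * ‖w - u‖) (ham : ∀ x, Measurable (a x))
    (ha0 : ∀ x w, 0 ≤ a x w)
    (hsum : ∀ w, ∑ x ∈ X, a x w ≤ (closedBall p R).indicator (fun _ => Cg) w) :
    ∫⁻ w, ∑ x ∈ X, ENNReal.ofReal (a x w) *
      ‖∫ u, ∑ y ∈ X, a y u • graphKer k γ (ρ x + ρ y) w u ∂μ‖ₑ ^ 2 ∂μ ≤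
      4 * μ (annulus V) * (μ (annulus V) * (μ (closedBall p (3 * R)) *
        ENNReal.ofReal (4 * lineConst k Cg (2 * M)))) := by
  have hM0 : 0 ≤ M := by linarith
  have hγc : Continuous γ := by
    refine (LipschitzWith.of_dist_le_mul (K := ⟨M, hM0⟩) fun a b => ?_).continuous
    rw [dist_eq_norm, dist_eq_norm]
    exact hγ' a b
  set G : E → V → V → H := fun x w u => ∑ y ∈ X, a y u • graphKer k γ (ρ x + ρ y) w u with hG
  have hGm : ∀ x, Measurable fun q : V × V => G x q.1 q.2 := fun x =>
    Finset.measurable_fun_sum _ fun y _ =>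
      ((ham y).comp measurable_snd).smul (measurable_graphKer hγc.measurable _)
  have hGi : ∀ x w, Integrable (G x w) μ := fun x w => by
    refine integrable_finsetSum _ fun y hy => ?_
    have hg : Measurable fun u => graphKer k γ (ρ x + ρ y) w u :=
      (measurable_graphKer hγc.measurable _).comp measurable_prodMk_left
    refine Integrable.mono' (g := (closedBall p R).indicator
      fun _ => Cg * ((ρ x + ρ y) ^ (k + 1))⁻¹) ?_ ((ham y).smul hg).aestronglyMeasurable
      (Eventually.of_forall fun u => ?_)
    · exact (integrable_indicator_iff measurableSet_closedBall).2
        (integrableOn_const measure_closedBall_lt_top.ne)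
    · have h1 : a y u ≤ (closedBall p R).indicator (fun _ => Cg) u :=
        (Finset.single_le_sum (f := fun y => a y u) (fun y _ => ha0 y u) hy).trans (hsum u)
      have hp : 0 < ρ x + ρ y := by linarith [hρ x, hρ y]
      have h2 := norm_graphKer_le (k := k) (γ := γ) hp w u
      rw [norm_smul, Real.norm_of_nonneg (ha0 _ _)]
      by_cases hu : u ∈ closedBall p R
      · rw [indicator_of_mem hu] at h1 ⊢
        exact mul_le_mul h1 h2 (norm_nonneg _) hCg
      · rw [indicator_of_notMem hu] at h1 ⊢
        exact mul_nonpos_of_nonpos_of_nonneg h1 (norm_nonneg _)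
  clear_value G
  set J : E → V → V → H := fun x w v => ∫ t : ℝ, |t| ^ k • G x w (w + t • v) with hJ
  have hJm : ∀ x, Measurable fun q : V × V => J x q.1 q.2 := fun x => by
    refine (StronglyMeasurable.integral_prod_right (f := fun (q : V × V) (t : ℝ) =>
      |t| ^ k • G x q.1 (q.1 + t • q.2)) ?_).measurable
    have h1 : Measurable fun z : (V × V) × ℝ => G x z.1.1 (z.1.1 + z.2 • z.1.2) :=
      (hGm x).comp (by fun_prop : Measurable fun z : (V × V) × ℝ => (z.1.1, z.1.1 + z.2 • z.1.2))
    exact ((by fun_prop : Measurable fun z : (V × V) × ℝ => |z.2| ^ k).smul h1).stronglyMeasurable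
  clear_value J
  have hstep : ∀ x w, ‖∫ u, G x w u ∂μ‖ₑ ^ 2 ≤
      4 * μ (annulus V) * ∫⁻ v in annulus V, ‖J x w v‖ₑ ^ 2 ∂μ := fun x w => by
    rw [hJ]
    rw [← integral_add_left_eq_self _ w]
    have h1 : Measurable fun u => G x w (w + u) :=
      (hGm x).comp (f := fun u : V => (w, w + u)) (by fun_prop)
    have h2 : Integrable (fun u => G x w (w + u)) μ := (hGi x w).comp_add_left w
    exact sq_enorm_integral_le_polar hV h1 h2
  have hsummeas : Measurable fun q : V × V => ∑ x ∈ X, ENNReal.ofReal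
      (a x q.1) * ‖J x q.1 q.2‖ₑ ^ 2 :=
    Finset.measurable_fun_sum _ fun x _ =>
      ((ham x).comp measurable_fst).ennreal_ofReal.mul ((hJm x).enorm.pow_const 2)
  have hA := measure_annulus_ne_top (μ := μ)
  suffices hmain : ∫⁻ w, ∑ x ∈ X, ENNReal.ofReal (a x w) * ‖∫ u, G x w u ∂μ‖ₑ ^ 2 ∂μ ≤
      4 * μ (annulus V) * (μ (annulus V) * (μ (closedBall p (3 * R)) *
        ENNReal.ofReal (4 * lineConst k Cg (2 * M)))) by
    subst hG
    exact hmain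
  calc ∫⁻ w, ∑ x ∈ X, ENNReal.ofReal (a x w) * ‖∫ u, G x w u ∂μ‖ₑ ^ 2 ∂μ
      ≤ ∫⁻ w, ∑ x ∈ X, ENNReal.ofReal (a x w) *
          (4 * μ (annulus V) * ∫⁻ v in annulus V, ‖J x w v‖ₑ ^ 2 ∂μ) ∂μ := by
        refine lintegral_mono fun w => Finset.sum_le_sum fun x _ => ?_
        gcongr
        exact hstep x w
    _ = ∫⁻ w, 4 * μ (annulus V) * (∫⁻ v in annulus V,
          ∑ x ∈ X, ENNReal.ofReal (a x w) * ‖J x w v‖ₑ ^ 2 ∂μ) ∂μ := by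
        refine lintegral_congr fun w => ?_
        rw [lintegral_finsetSum _ fun x _ => ?_, Finset.mul_sum]
        · refine Finset.sum_congr rfl fun x _ => ?_
          rw [lintegral_const_mul' _ _ ENNReal.ofReal_ne_top, mul_left_comm]
        · exact (((hJm x).comp (measurable_prodMk_left (x := w))).enorm.pow_const 2).const_mul _
    _ = 4 * μ (annulus V) * ∫⁻ v in annulus V,
          (∫⁻ w, ∑ x ∈ X, ENNReal.ofReal (a x w) * ‖J x w v‖ₑ ^ 2 ∂μ) ∂μ := by
        rw [lintegral_const_mul' _ _ (ENNReal.mul_ne_top (by norm_num) hA),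
          lintegral_lintegral_swap hsummeas.aemeasurable]
    _ ≤ 4 * μ (annulus V) * ∫⁻ v in annulus V, μ (closedBall p (3 * R)) *
        ENNReal.ofReal (4 * lineConst k Cg (2 * M)) ∂μ := by
        gcongr 4 * μ (annulus V) * ?_
        refine setLIntegral_mono' measurableSet_annulus fun v hv => ?_
        subst hJ hG
        exact lintegral_direction_le hM hCg hR hr hρm hρ hγ hγ' ham ha0 hsum hv
          (hsummeas.comp (measurable_prodMk_right (y := v)))
    _ = _ := by rw [setLIntegral_const, mul_comm (_ * _) (μ (annulus V))]

end Rotation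

section RegKer

variable {H : Type*} [NormedAddCommGroup H] [NormedSpace ℝ H]

lemma norm_regKer_sub_le {N : ℕ} {e L : ℝ} (he : 0 < e) (hL : 0 ≤ L) {z z' : H}
    (h : ‖z - z'‖ ≤ L * e) :
    ‖(max ‖z‖ e ^ N)⁻¹ • z - (max ‖z'‖ e ^ N)⁻¹ • z'‖ ≤
      L * (1 + N * (1 + L) ^ (N - 1)) * (e * (max ‖z‖ e ^ N)⁻¹) := by
  set a := max ‖z‖ e with ha
  set b := max ‖z'‖ e with hb
  have hae : e ≤ a := le_max_right _ _
  have hbe : e ≤ b := le_max_right _ _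
  have ha0 : 0 < a := he.trans_le hae
  have hb0 : 0 < b := he.trans_le hbe
  have hab : |a - b| ≤ L * e := by
    refine le_trans ?_ h
    have h1 : |‖z‖ - ‖z'‖| ≤ ‖z - z'‖ := abs_norm_sub_norm_le z z'
    have h2 := abs_max_sub_max_le_abs ‖z‖ ‖z'‖ e
    exact h2.trans h1
  have hba : b⁻¹ ≤ (1 + L) * a⁻¹ := by
    rw [← div_eq_mul_inv, inv_eq_one_div, div_le_div_iff₀ hb0 ha0]
    nlinarith [(abs_le.1 hab).2]
  have h1 : |(a ^ N)⁻¹ - (b ^ N)⁻¹| * b ≤ L * e * (N * (1 + L) ^ (N - 1)) * (a ^ N)⁻¹ := by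
    rcases Nat.eq_zero_or_pos N with rfl | hN
    · simp
    rw [← inv_pow, ← inv_pow]
    have h2 := abs_pow_sub_pow_le a⁻¹ b⁻¹ N
    have h3 : |a⁻¹ - b⁻¹| = |a - b| * (a⁻¹ * b⁻¹) := by
      rw [inv_sub_inv ha0.ne' hb0.ne', abs_div, abs_of_pos (mul_pos ha0 hb0), abs_sub_comm,
        div_eq_mul_inv, mul_inv]
    have h4 : max |a⁻¹| |b⁻¹| ≤ (1 + L) * a⁻¹ := by
      rw [abs_of_pos (inv_pos.2 ha0), abs_of_pos (inv_pos.2 hb0)]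
      refine max_le ?_ hba
      nlinarith [inv_pos.2 ha0]
    calc |a⁻¹ ^ N - b⁻¹ ^ N| * b
        ≤ (L * e * (a⁻¹ * b⁻¹) * N * ((1 + L) * a⁻¹) ^ (N - 1)) * b := by
          refine mul_le_mul_of_nonneg_right (h2.trans ?_) hb0.le
          rw [h3]
          gcongr
      _ = L * e * (N * (1 + L) ^ (N - 1)) * (a⁻¹ ^ (N - 1) * a⁻¹) * (b⁻¹ * b) := by
          rw [mul_pow]
          ring
      _ = _ := by rw [inv_mul_cancel₀ hb0.ne', mul_one, ← pow_succ, Nat.sub_add_cancel hN]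
  have hdec : (a ^ N)⁻¹ • z - (b ^ N)⁻¹ • z' = (a ^ N)⁻¹ • (z - z') +
      ((a ^ N)⁻¹ - (b ^ N)⁻¹) • z' := by
    rw [smul_sub, sub_smul]
    abel
  calc ‖(a ^ N)⁻¹ • z - (b ^ N)⁻¹ • z'‖
      ≤ (a ^ N)⁻¹ * (L * e) + |(a ^ N)⁻¹ - (b ^ N)⁻¹| * b := by
        rw [hdec]
        refine (norm_add_le _ _).trans (add_le_add ?_ ?_)
        · rw [norm_smul, Real.norm_of_nonneg (by positivity)]
          gcongr
        · rw [norm_smul, Real.norm_eq_abs]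
          gcongr
          exact le_max_left _ _
    _ ≤ (a ^ N)⁻¹ * (L * e) + L * e * (N * (1 + L) ^ (N - 1)) * (a ^ N)⁻¹ := by gcongr
    _ = _ := by ring

end RegKer

section Carried

variable {V : Type*} [NormedAddCommGroup V] [NormedSpace ℝ V] [FiniteDimensional ℝ V]
  [MeasurableSpace V] [BorelSpace V] [SecondCountableTopology V]
  {μ : Measure V} [μ.IsAddHaarMeasure] {k : ℕ}
  {E : Type*} [NormedAddCommGroup E] [InnerProductSpace ℝ E] [SecondCountableTopology E]
  [MeasurableSpace E] [BorelSpace E] [CompleteSpace E]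

lemma IsScale.measurable {ρ : E → ℝ} (h : IsScale ρ) : Measurable ρ := by
  refine (LipschitzWith.of_dist_le_mul (K := 1) fun x y => ?_).continuous.measurable
  rw [Real.dist_eq, dist_eq_norm, NNReal.coe_one, one_mul, abs_le]
  have h1 := h.lip x y
  have h2 := h.lip y x
  rw [norm_sub_rev] at h2
  constructor <;> linarith

/-- The normalised indicator of a ball. -/
noncomputable def bump (μ : Measure V) (p : V) (r : ℝ) (w : V) : ℝ :=
  (closedBall p r).indicator (fun _ => (μ.real (closedBall p r))⁻¹) w

lemma bump_nonneg (p : V) (r : ℝ) (w : V) : 0 ≤ bump μ p r w :=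
  indicator_nonneg (fun _ _ => inv_nonneg.2 measureReal_nonneg) _

lemma measurable_bump (p : V) (r : ℝ) : Measurable (bump μ p r) :=
  measurable_const.indicator measurableSet_closedBall

lemma integrable_bump (p : V) (r : ℝ) : Integrable (bump μ p r) μ :=
  (integrableOn_const measure_closedBall_lt_top.ne).integrable_indicator measurableSet_closedBall

lemma integral_bump (p : V) {r : ℝ} (hr : 0 < r) : ∫ w, bump μ p r w ∂μ = 1 := by
  unfold bump
  rw [integral_indicator_const _ measurableSet_closedBall, smul_eq_mul, mul_inv_cancel₀]
  exact (ENNReal.toReal_pos (measure_closedBall_pos μ p hr).ne' measure_closedBall_lt_top.ne).ne'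

lemma lintegral_bump (p : V) {r : ℝ} (hr : 0 < r) :
    ∫⁻ w, ENNReal.ofReal (bump μ p r w) ∂μ = 1 := by
  rw [← ofReal_integral_eq_lintegral_ofReal (integrable_bump p r)
    (Eventually.of_forall (bump_nonneg p r)), integral_bump p hr, ENNReal.ofReal_one]

lemma bump_of_notMem {p : V} {r : ℝ} {w : V} (h : ¬ ‖w - p‖ ≤ r) : bump μ p r w = 0 := by
  refine indicator_of_notMem ?_ _
  rwa [mem_closedBall, dist_eq_norm]

lemma bump_of_mem (hV : Module.finrank ℝ V = k + 1) {p : V} {r : ℝ} (hr : 0 ≤ r) {w : V}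
    (h : ‖w - p‖ ≤ r) : bump μ p r w = (r ^ (k + 1) * μ.real (ball 0 1))⁻¹ := by
  rw [bump, indicator_of_mem (by rwa [mem_closedBall, dist_eq_norm]), measureReal_def,
    addHaar_closedBall _ _ hr, hV, ENNReal.toReal_mul, ENNReal.toReal_ofReal (by positivity),
    measureReal_def]

variable {ρ m : E → ℝ} {X : Finset E} {P : E →ₗ[ℝ] V} {γ : V → E} {M A G c r : ℝ}

lemma norm_riesz_sub_integral_le (hM : 0 ≤ M) (hA : 0 ≤ A)
    (hc : 0 < c) (hc1 : c ≤ 1) (hm : ∀ x, 0 ≤ m x) (hρ : IsScale ρ)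
    (hγ' : ∀ w u, ‖γ w - γ u‖ ≤ M * ‖w - u‖) (hX : ∀ x ∈ X, ‖x - γ (P x)‖ ≤ A * ρ x)
    {x : E} (hx : x ∈ X) {w : V} (hw : ‖w - P x‖ ≤ c * ρ x) :
    ‖riesz (k + 1) ρ m X x -
        ∫ u, ∑ y ∈ X, (m y * bump μ (P y) (c * ρ y) u) • graphKer k γ (ρ x + ρ y) w u ∂μ‖ ≤
      (A + M) * (1 + (k + 2 : ℕ) * (1 + (A + M)) ^ (k + 1)) *
        ∑ y ∈ X, m y * ((ρ x + ρ y) * (sep ρ x y ^ (k + 1 + 1))⁻¹) := by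
  have hγc : Continuous γ := by
    refine (LipschitzWith.of_dist_le_mul (K := ⟨M, hM⟩) fun a b => ?_).continuous
    rw [dist_eq_norm, dist_eq_norm]
    exact hγ' a b
  set B : E → ℝ := fun y => (A + M) * (1 + (k + 2 : ℕ) * (1 + (A + M)) ^ (k + 1)) *
    ((ρ x + ρ y) * (sep ρ x y ^ (k + 1 + 1))⁻¹) with hB
  have hgm : ∀ y, Measurable fun u => graphKer k γ (ρ x + ρ y) w u := fun y =>
    (measurable_graphKer hγc.measurable _).comp measurable_prodMk_left
  have hpos : ∀ y, 0 < ρ x + ρ y := fun y => add_pos (hρ.pos x) (hρ.pos y)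
  have h_int : ∀ y, Integrable (fun u => bump μ (P y) (c * ρ y) u •
      graphKer k γ (ρ x + ρ y) w u) μ := fun y => by
    refine ((integrable_bump (P y) (c * ρ y)).mul_const
      (((ρ x + ρ y) ^ (k + 1))⁻¹)).mono'
      ((measurable_bump _ _).smul (hgm y)).aestronglyMeasurable (Eventually.of_forall fun u => ?_)
    rw [norm_smul, Real.norm_of_nonneg (bump_nonneg _ _ _)]
    exact mul_le_mul_of_nonneg_left (norm_graphKer_le (hpos y) _ _) (bump_nonneg _ _ _)
  have hterm : ∀ y ∈ X, ‖rk (k + 1) ρ x y - ∫ u, bump μ (P y) (c * ρ y) u •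
      graphKer k γ (ρ x + ρ y) w u ∂μ‖ ≤ B y := by
    intro y hy
    have hcy : 0 < c * ρ y := mul_pos hc (hρ.pos y)
    have h1 : rk (k + 1) ρ x y = ∫ u, bump μ (P y) (c * ρ y) u • rk (k + 1) ρ x y ∂μ := by
      rw [integral_smul_const, integral_bump _ hcy, one_smul]
    rw [h1, ← integral_sub ((integrable_bump _ _).smul_const _) (h_int y)]
    calc _ ≤ ∫ u, bump μ (P y) (c * ρ y) u * B y ∂μ := by
          refine norm_integral_le_of_norm_le ((integrable_bump _ _).mul_const _)
            (Eventually.of_forall fun u => ?_)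
          rw [← smul_sub, norm_smul, Real.norm_of_nonneg (bump_nonneg _ _ _)]
          by_cases hu : ‖u - P y‖ ≤ c * ρ y
          · refine mul_le_mul_of_nonneg_left ?_ (bump_nonneg _ _ _)
            refine norm_regKer_sub_le (N := k + 2) (hpos y) (by positivity) ?_
            have e : x - y - (γ w - γ u) =
                (x - γ (P x)) - (y - γ (P y)) + (γ (P x) - γ w) + (γ u - γ (P y)) := by abel
            rw [e]
            have h2 := hγ' (P x) w
            have h3 := hγ' u (P y)
            rw [norm_sub_rev (P x)] at h2
            have h4 : M * ‖w - P x‖ ≤ M * ρ x := by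
              gcongr
              nlinarith [hρ.pos x]
            have h5 : M * ‖u - P y‖ ≤ M * ρ y := by
              gcongr
              nlinarith [hρ.pos y]
            have := norm_add₃_le (a := (x - γ (P x)) - (y - γ (P y))) (b := γ (P x) - γ w)
              (c := γ u - γ (P y))
            have := norm_sub_le (x - γ (P x)) (y - γ (P y))
            nlinarith [hX x hx, hX y hy]
          · rw [bump_of_notMem hu]
            simp
      _ = B y := by rw [integral_mul_const, integral_bump _ hcy, one_mul]
  have hI : ∫ u, ∑ y ∈ X, (m y * bump μ (P y) (c * ρ y) u) • graphKer k γ (ρ x + ρ y) w u ∂μ =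
      ∑ y ∈ X, m y • ∫ u, bump μ (P y) (c * ρ y) u • graphKer k γ (ρ x + ρ y) w u ∂μ := by
    simp_rw [mul_smul]
    refine (integral_finsetSum X fun y _ => (h_int y).smul (m y)).trans ?_
    simp only [Pi.smul_apply, integral_smul]
  rw [hI, riesz, ← Finset.sum_sub_distrib, Finset.mul_sum]
  refine (norm_sum_le _ _).trans (Finset.sum_le_sum fun y hy => ?_)
  rw [← smul_sub, norm_smul, Real.norm_of_nonneg (hm y), mul_left_comm]
  exact mul_le_mul_of_nonneg_left (hterm y hy) (hm y)

lemma sum_add_mul_sep_le {n : ℕ} (hG : Growth n 1 ρ m X) (hm : ∀ x, 0 ≤ m x) (hρ : IsScale ρ)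
    {x : E} (hx : x ∈ X) :
    ∑ y ∈ X, m y * ((ρ x + ρ y) * (sep ρ x y ^ (n + 1))⁻¹) ≤ 2 ^ (n + 1) + spot n ρ m X x := by
  have h1 : ∑ y ∈ X, m y * ((ρ x + ρ y) * (sep ρ x y ^ (n + 1))⁻¹) =
      ρ x * (∑ y ∈ X, m y * (sep ρ x y ^ (n + 1))⁻¹) + spot n ρ m X x := by
    rw [spot, Finset.mul_sum, ← Finset.sum_add_distrib]
    exact Finset.sum_congr rfl fun y _ => by ring
  rw [h1]
  have h2 := hG.sum_le hm hρ.pos hx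
  have h3 := hρ.pos x
  have : ρ x * (∑ y ∈ X, m y * (sep ρ x y ^ (n + 1))⁻¹) ≤ ρ x * (2 ^ (n + 1) * (ρ x)⁻¹) := by gcongr
  have e : ρ x * (2 ^ (n + 1) * (ρ x)⁻¹) = 2 ^ (n + 1) := by field_simp
  linarith

lemma sum_mul_sq_add_le {n : ℕ} (hG : Growth n 1 ρ m X) (hm : ∀ x, 0 ≤ m x) (hρ : IsScale ρ) :
    ∑ x ∈ X, m x * (∑ y ∈ X, m y * ((ρ x + ρ y) * (sep ρ x y ^ (n + 1))⁻¹)) ^ 2 ≤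
      2 ^ (4 * n + 8) * ∑ x ∈ X, m x := by
  have h1 : ∀ x ∈ X, m x * (∑ y ∈ X, m y * ((ρ x + ρ y) * (sep ρ x y ^ (n + 1))⁻¹)) ^ 2 ≤
      2 * (2 ^ (n + 1)) ^ 2 * m x + 2 * (m x * spot n ρ m X x ^ 2) := by
    intro x hx
    have h2 := sum_add_mul_sep_le hG hm hρ hx
    have h3 : 0 ≤ ∑ y ∈ X, m y * ((ρ x + ρ y) * (sep ρ x y ^ (n + 1))⁻¹) :=
      Finset.sum_nonneg fun y _ => mul_nonneg (hm y) (mul_nonneg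
        (add_pos (hρ.pos x) (hρ.pos y)).le (inv_nonneg.2 (pow_nonneg (sep_pos hρ.pos x y).le _)))
    have h4 := pow_le_pow_left₀ h3 h2 2
    nlinarith [mul_le_mul_of_nonneg_left h4 (hm x),
      mul_nonneg (hm x) (sq_nonneg ((2 : ℝ) ^ (n + 1) - spot n ρ m X x))]
  refine (Finset.sum_le_sum h1).trans ?_
  rw [Finset.sum_add_distrib, ← Finset.mul_sum, ← Finset.mul_sum]
  have h5 := sum_spot_sq_le hG hm hρ.pos
  have h6 : 0 ≤ ∑ x ∈ X, m x := Finset.sum_nonneg fun y _ => hm y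
  have e1 : 2 * ((2 : ℝ) ^ (n + 1)) ^ 2 ≤ 2 ^ (4 * n + 7) := by
    rw [← pow_mul, ← pow_succ']
    exact pow_le_pow_right₀ one_le_two (by omega)
  have e2 : 2 * (2 : ℝ) ^ (3 * n + 4) ≤ 2 ^ (4 * n + 7) := by
    rw [← pow_succ']
    exact pow_le_pow_right₀ one_le_two (by omega)
  have e3 : (2 : ℝ) ^ (4 * n + 8) = 2 ^ (4 * n + 7) + 2 ^ (4 * n + 7) := by
    rw [pow_succ _ (4 * n + 7)]
    ring
  rw [e3, add_mul]
  refine add_le_add (mul_le_mul_of_nonneg_right e1 h6) ?_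
  nlinarith

/-- The energy of a weighted set carried, up to its own scale, by a Lipschitz graph. -/
lemma exists_rieszEnergy_carried_le (μ : Measure V) [μ.IsAddHaarMeasure]
    (hV : Module.finrank ℝ V = k + 1) {M A G c : ℝ} (hM : 1 ≤ M)
    (hA : 0 ≤ A) (hG0 : 0 ≤ G) (hc : 0 < c) (hc1 : c ≤ 1) :
    ∃ C : ℝ, 0 ≤ C ∧ ∀ (X : Finset E) (m ρ : E → ℝ) (P : E →ₗ[ℝ] V) (γ : V → E) (r r₀ : ℝ) (x₀ : E),
      (∀ x, 0 ≤ m x) → IsScale ρ → 0 < r₀ → (∀ x, r₀ ≤ ρ x) → (∀ x, ‖P x‖ ≤ ‖x‖) →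
      (∀ w u, ‖w - u‖ ≤ ‖γ w - γ u‖) → (∀ w u, ‖γ w - γ u‖ ≤ M * ‖w - u‖) →
      (∀ x ∈ X, ‖x - γ (P x)‖ ≤ A * ρ x) → x₀ ∈ X → (∀ x ∈ X, ‖x - x₀‖ ≤ r) →
      (∀ x ∈ X, ρ x ≤ r) → Growth (k + 1) 1 ρ m X →
      (∀ w, ∑ y ∈ X with ‖w - P y‖ ≤ c * ρ y, m y * (ρ y ^ (k + 1))⁻¹ ≤ G) →
      rieszEnergy (k + 1) ρ m X ≤ C * r ^ (k + 1) := by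
  set v := μ.real (ball (0 : V) 1) with hv
  have hv0 : 0 < v := ENNReal.toReal_pos (measure_ball_pos μ 0 one_pos).ne' measure_ball_lt_top.ne
  set Cg := G * (c ^ (k + 1) * v)⁻¹ with hCg
  have hCg0 : 0 ≤ Cg := by positivity
  set D := (A + M) * (1 + (k + 2 : ℕ) * (1 + (A + M)) ^ (k + 1)) with hD
  set T := 4 * μ.real (annulus V) * (μ.real (annulus V) * (6 ^ (k + 1) * v *
    (4 * lineConst k Cg (2 * M)))) with hT
  have hT0 : 0 ≤ T := by
    have := lineConst_nonneg (k := k) hCg0 (show 1 ≤ 2 * M by linarith)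
    have : 0 ≤ μ.real (annulus V) := measureReal_nonneg
    positivity
  refine ⟨2 * T + 2 * D ^ 2 * 2 ^ (4 * (k + 1) + 8) * 2 ^ (k + 1), by positivity, ?_⟩
  intro X m ρ P γ r r₀ x₀ hm hρ hr₀ hρr hP hγ hγ' hX hx₀ hXr hXρ hgr hov
  have hr : 0 < r := (hρ.pos x₀).trans_le (hXρ x₀ hx₀)
  set a : E → V → ℝ := fun y w => m y * bump μ (P y) (c * ρ y) w with ha
  have ha0 : ∀ x w, 0 ≤ a x w := fun x w => mul_nonneg (hm x) (bump_nonneg _ _ _)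
  have ham : ∀ x, Measurable (a x) := fun x => (measurable_bump _ _).const_mul _
  have hsum : ∀ w, ∑ x ∈ X, a x w ≤ (closedBall (P x₀) (2 * r)).indicator (fun _ => Cg) w := by
    intro w
    have h1 : ∑ x ∈ X, a x w = ∑ x ∈ X with ‖w - P x‖ ≤ c * ρ x,
        m x * (ρ x ^ (k + 1))⁻¹ * (c ^ (k + 1) * v)⁻¹ := by
      rw [Finset.sum_filter]
      refine Finset.sum_congr rfl fun x hx => ?_
      split_ifs with h
      · simp only [ha]
        rw [bump_of_mem hV (mul_pos hc (hρ.pos x)).le h, mul_pow, mul_inv, mul_inv, mul_inv]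
        ring
      · simp only [ha]
        rw [bump_of_notMem h, mul_zero]
    rw [h1]
    by_cases hw : w ∈ closedBall (P x₀) (2 * r)
    · rw [indicator_of_mem hw, ← Finset.sum_mul]
      exact mul_le_mul_of_nonneg_right (hov w) (by positivity)
    · rw [indicator_of_notMem hw, Finset.sum_eq_zero]
      · intro x hx
        exfalso
        rw [Finset.mem_filter] at hx
        refine hw ?_
        rw [mem_closedBall, dist_eq_norm]
        have h2 := hP (x - x₀)
        rw [map_sub] at h2
        have h3 := norm_sub_le_norm_sub_add_norm_sub w (P x) (P x₀)
        have h4 : c * ρ x ≤ ρ x := mul_le_of_le_one_left (hρ.pos x).le hc1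
        linarith [hXr x hx.1, hXρ x hx.1, hx.2]
  set F : E → V → E := fun x w => ∫ u, ∑ y ∈ X, a y u • graphKer k γ (ρ x + ρ y) w u ∂μ with hF
  have hrot := lintegral_graphKer_le (μ := μ) (p := P x₀) (R := 2 * r) hV hM hCg0
    (by linarith) hr₀ hρ.measurable hρr hγ hγ' ham ha0 hsum
  set S : E → ℝ := fun x => ∑ y ∈ X, m y * ((ρ x + ρ y) * (sep ρ x y ^ (k + 1 + 1))⁻¹) with hS
  have hmass : ∑ x ∈ X, m x ≤ (2 * r) ^ (k + 1) := by
    have h1 := hgr x₀ hx₀ (2 * r) (by linarith)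
    rw [one_mul, Finset.filter_true_of_mem] at h1
    · exact h1
    · intro y hy
      refine max_le ?_ ?_
      · rw [norm_sub_rev]
        linarith [hXr y hy]
      · linarith [hXρ y hy, hXρ x₀ hx₀]
  have hpt : ∀ w, ∀ x ∈ X, ENNReal.ofReal (a x w) * ‖riesz (k + 1) ρ m X x‖ₑ ^ 2 ≤
      2 * (ENNReal.ofReal (a x w) * ‖F x w‖ₑ ^ 2) +
        ENNReal.ofReal (a x w) * ENNReal.ofReal (2 * (D * S x) ^ 2) := by
    intro w x hx
    by_cases hw : ‖w - P x‖ ≤ c * ρ x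
    · have h1 : ‖riesz (k + 1) ρ m X x - F x w‖ ≤ D * S x :=
        norm_riesz_sub_integral_le (by linarith) hA hc hc1 hm hρ hγ' hX hx hw
      have h2 : ‖riesz (k + 1) ρ m X x‖ ^ 2 ≤ 2 * ‖F x w‖ ^ 2 + 2 * (D * S x) ^ 2 := by
        have h3 := norm_sub_norm_le (riesz (k + 1) ρ m X x) (F x w)
        have h4 : ‖riesz (k + 1) ρ m X x‖ ≤ ‖F x w‖ + D * S x := by linarith
        have h5 := pow_le_pow_left₀ (norm_nonneg _) h4 2
        nlinarith [sq_nonneg (‖F x w‖ - D * S x)]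
      rw [← ofReal_mul_sq_norm (ha0 x w), ← ofReal_mul_sq_norm (ha0 x w),
        ← ENNReal.ofReal_mul (ha0 x w), ← ENNReal.ofReal_ofNat 2,
        ← ENNReal.ofReal_mul (by norm_num), ← ENNReal.ofReal_add
          (mul_nonneg (by norm_num) (mul_nonneg (ha0 x w) (sq_nonneg _)))
          (mul_nonneg (ha0 x w) (by positivity))]
      refine ENNReal.ofReal_le_ofReal ?_
      nlinarith [mul_le_mul_of_nonneg_left h2 (ha0 x w)]
    · simp only [ha]
      rw [bump_of_notMem hw]
      simp
  have hcard : ∀ x, ∀ b : ℝ≥0∞, ENNReal.ofReal (m x) * b =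
      ∫⁻ w, ENNReal.ofReal (a x w) * b ∂μ := by
    intro x b
    rw [lintegral_mul_const _ (ham x).ennreal_ofReal]
    simp only [ha]
    simp_rw [ENNReal.ofReal_mul (hm x)]
    rw [lintegral_const_mul _ (measurable_bump _ _).ennreal_ofReal,
      lintegral_bump _ (mul_pos hc (hρ.pos x)), mul_one]
  have key : ENNReal.ofReal (rieszEnergy (k + 1) ρ m X) ≤
      ENNReal.ofReal ((2 * T + 2 * D ^ 2 * 2 ^ (4 * (k + 1) + 8) * 2 ^ (k + 1)) * r ^ (k + 1)) := by
    calc ENNReal.ofReal (rieszEnergy (k + 1) ρ m X)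
        = ∑ x ∈ X, ENNReal.ofReal (m x) * ‖riesz (k + 1) ρ m X x‖ₑ ^ 2 := by
          rw [rieszEnergy, ENNReal.ofReal_sum_of_nonneg fun x _ =>
            mul_nonneg (hm x) (sq_nonneg _)]
          exact Finset.sum_congr rfl fun x _ => ofReal_mul_sq_norm (hm x) _
      _ = ∫⁻ w, ∑ x ∈ X, ENNReal.ofReal (a x w) * ‖riesz (k + 1) ρ m X x‖ₑ ^ 2 ∂μ := by
          rw [lintegral_finsetSum _ fun x _ => (ham x).ennreal_ofReal.mul_const _]
          exact Finset.sum_congr rfl fun x _ => hcard x _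
      _ ≤ ∫⁻ w, (2 * (∑ x ∈ X, ENNReal.ofReal (a x w) * ‖F x w‖ₑ ^ 2) +
            ∑ x ∈ X, ENNReal.ofReal (a x w) * ENNReal.ofReal (2 * (D * S x) ^ 2)) ∂μ := by
          refine lintegral_mono fun w => ?_
          rw [Finset.mul_sum, ← Finset.sum_add_distrib]
          exact Finset.sum_le_sum (hpt w)
      _ = 2 * (∫⁻ w, ∑ x ∈ X, ENNReal.ofReal (a x w) * ‖F x w‖ₑ ^ 2 ∂μ) +
            ENNReal.ofReal (2 * D ^ 2 * ∑ x ∈ X, m x * S x ^ 2) := by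
          rw [lintegral_add_right _ (Finset.measurable_fun_sum _ fun x _ =>
            (ham x).ennreal_ofReal.mul_const _), lintegral_const_mul' _ _ (by norm_num),
            lintegral_finsetSum _ fun x _ => (ham x).ennreal_ofReal.mul_const _, Finset.mul_sum,
            ENNReal.ofReal_sum_of_nonneg fun x _ => mul_nonneg (by positivity)
              (mul_nonneg (hm x) (sq_nonneg _))]
          congr 1
          refine Finset.sum_congr rfl fun x _ => ?_
          rw [← hcard, ← ENNReal.ofReal_mul (hm x)]
          congr 1
          ring
      _ ≤ 2 * ENNReal.ofReal (T * r ^ (k + 1)) +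
            ENNReal.ofReal (2 * D ^ 2 * (2 ^ (4 * (k + 1) + 8) * (2 * r) ^ (k + 1))) := by
          refine add_le_add (mul_le_mul_right (hrot.trans (le_of_eq ?_)) _)
            (ENNReal.ofReal_le_ofReal ?_)
          · rw [addHaar_closedBall _ _ (by positivity), hV,
              ← ENNReal.ofReal_toReal (measure_annulus_ne_top (μ := μ)),
              ← ENNReal.ofReal_toReal (measure_ball_lt_top (μ := μ) (x := (0 : V)) (r := 1)).ne,
              ← measureReal_def, ← measureReal_def, ← ENNReal.ofReal_ofNat 4, ← ENNReal.ofReal_mul,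
              ← ENNReal.ofReal_mul, ← ENNReal.ofReal_mul, ← ENNReal.ofReal_mul,
              ← ENNReal.ofReal_mul, hT]
            · congr 1
              rw [show 3 * (2 * r) = 6 * r by ring, mul_pow]
              ring
            all_goals positivity
          · refine mul_le_mul_of_nonneg_left ((sum_mul_sq_add_le hgr hm hρ).trans ?_)
              (by positivity)
            gcongr
      _ = _ := by
          rw [← ENNReal.ofReal_ofNat 2, ← ENNReal.ofReal_mul (by norm_num), ← ENNReal.ofReal_add
            (by positivity) (by positivity)]
          congr 1
          rw [mul_pow]
          push_cast
          ring
  exact (ENNReal.ofReal_le_ofReal_iff (by positivity)).1 key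

end Carried

section Counting

variable {V : Type*} [NormedAddCommGroup V] [NormedSpace ℝ V] [FiniteDimensional ℝ V]

/-- Balls contained in a big ball, with bounded overlap, have bounded total volume. -/
lemma sum_pow_le_of_overlap_le {α : Type*} (F : Finset α) (p : α → V) (q : α → ℝ) (N : ℕ)
    (hq : ∀ i ∈ F, 0 ≤ q i) (hN : ∀ w, (F.filter fun i => ‖w - p i‖ ≤ q i).card ≤ N) (p₀ : V)
    {R : ℝ} (hR : 0 ≤ R) (hsub : ∀ i ∈ F, ‖p i - p₀‖ + q i ≤ R) :
    ∑ i ∈ F, q i ^ Module.finrank ℝ V ≤ N * R ^ Module.finrank ℝ V := by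
  borelize V
  set μ : Measure V := addHaar with hμ
  have hv : μ (ball (0 : V) 1) ≠ ∞ := measure_ball_lt_top.ne
  have hv0 : μ (ball (0 : V) 1) ≠ 0 := (measure_ball_pos μ 0 one_pos).ne'
  have h1 : ∑ i ∈ F, μ (closedBall (p i) (q i)) ≤ N * μ (closedBall p₀ R) := by
    calc ∑ i ∈ F, μ (closedBall (p i) (q i))
        = ∑ i ∈ F, ∫⁻ w, (closedBall (p i) (q i)).indicator 1 w ∂μ := by
          refine Finset.sum_congr rfl fun i _ => ?_
          rw [lintegral_indicator_one measurableSet_closedBall]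
      _ = ∫⁻ w, ∑ i ∈ F, (closedBall (p i) (q i)).indicator 1 w ∂μ :=
          (lintegral_finsetSum _ fun i _ =>
            measurable_one.indicator measurableSet_closedBall).symm
      _ ≤ ∫⁻ w, (closedBall p₀ R).indicator (fun _ => (N : ℝ≥0∞)) w ∂μ := by
          refine lintegral_mono fun w => ?_
          have h2 : ∑ i ∈ F, (closedBall (p i) (q i)).indicator (1 : V → ℝ≥0∞) w =
              (F.filter fun i => ‖w - p i‖ ≤ q i).card := by
            rw [Finset.card_eq_sum_ones, Nat.cast_sum, Finset.sum_filter]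
            refine Finset.sum_congr rfl fun i _ => ?_
            simp [indicator_apply, mem_closedBall, dist_eq_norm]
          simp only [h2]
          by_cases hw : w ∈ closedBall p₀ R
          · rw [indicator_of_mem hw]
            exact_mod_cast hN w
          · rw [indicator_of_notMem hw, Finset.filter_false_of_mem]
            · simp
            · intro i hi h
              refine hw ?_
              rw [mem_closedBall, dist_eq_norm]
              linarith [norm_sub_le_norm_sub_add_norm_sub w (p i) p₀, hsub i hi]
      _ = _ := lintegral_indicator_const measurableSet_closedBall _
  have h3 : ∀ i ∈ F, μ (closedBall (p i) (q i)) =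
      ENNReal.ofReal (q i ^ Module.finrank ℝ V) * μ (ball 0 1) := fun i hi =>
    addHaar_closedBall _ _ (hq i hi)
  rw [Finset.sum_congr rfl h3, ← Finset.sum_mul, addHaar_closedBall _ _ hR, ← mul_assoc,
    ENNReal.mul_le_mul_iff_left hv0 hv, ← ENNReal.ofReal_sum_of_nonneg fun i hi =>
      pow_nonneg (hq i hi) _, ← ENNReal.ofReal_natCast, ← ENNReal.ofReal_mul (by positivity)] at h1
  exact (ENNReal.ofReal_le_ofReal_iff (by positivity)).1 h1

/-- A separated family in a ball has bounded cardinality. -/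
lemma card_le_of_separated {α : Type*} (F : Finset α) (x : α → V) (x₀ : V) {h A : ℝ} (hh : 0 < h)
    (hA : 0 ≤ A) (hF : ∀ i ∈ F, ‖x i - x₀‖ ≤ A * h)
    (hsep : ∀ i ∈ F, ∀ j ∈ F, i ≠ j → h ≤ ‖x i - x j‖) :
    (F.card : ℝ) ≤ (3 * A + 1) ^ Module.finrank ℝ V := by
  have h1 := sum_pow_le_of_overlap_le F x (fun _ => h / 3) 1 (fun _ _ => by positivity)
      (fun w => ?_)
    x₀ (R := A * h + h / 3) (by positivity) fun i hi => by linarith [hF i hi]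
  · rw [Finset.sum_const, nsmul_eq_mul, Nat.cast_one, one_mul,
      show A * h + h / 3 = (3 * A + 1) * (h / 3) by ring, mul_pow] at h1
    exact le_of_mul_le_mul_right h1 (by positivity)
  · refine Finset.card_le_one.2 fun i hi j hj => ?_
    rw [Finset.mem_filter] at hi hj
    by_contra hij
    have h2 := hsep i hi.1 j hj.1 hij
    have h3 := norm_sub_le_norm_sub_add_norm_sub (x i) w (x j)
    rw [norm_sub_rev (x i) w] at h3
    linarith [hi.2, hj.2]

/-- Greedy selection: a maximal `R`-independent subset, chosen in decreasing order of `t`. -/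
lemma exists_greedy {α : Type*} (t : α → ℝ) (R : α → α → Prop) (hR : ∀ x, R x x)
    (hR' : ∀ x y, R x y → R y x) (X : Finset α) :
    ∃ F ⊆ X, (∀ x ∈ X, ∃ i ∈ F, t x ≤ t i ∧ R i x) ∧ ∀ i ∈ F, ∀ j ∈ F, i ≠ j → ¬ R i j := by
  induction X using Finset.strongInduction with
  | H X ih =>
    rcases X.eq_empty_or_nonempty with rfl | hX
    · exact ⟨∅, le_rfl, by simp, by simp⟩
    obtain ⟨i, hi, hmax⟩ := X.exists_max_image t hX
    obtain ⟨F, hF, hcov, hind⟩ := ih (X.filter fun x => ¬ R i x)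
      (Finset.filter_ssubset.2 ⟨i, hi, by simpa using hR i⟩)
    have hFi : ∀ j ∈ F, ¬ R i j := fun j hj => (Finset.mem_filter.1 (hF hj)).2
    refine ⟨insert i F, Finset.insert_subset hi (hF.trans (Finset.filter_subset _ _)), ?_, ?_⟩
    · intro x hx
      by_cases h : R i x
      · exact ⟨i, Finset.mem_insert_self _ _, hmax x hx, h⟩
      · obtain ⟨j, hj, h1⟩ := hcov x (Finset.mem_filter.2 ⟨hx, h⟩)
        exact ⟨j, Finset.mem_insert_of_mem hj, h1⟩
    · intro j hj l hl hjl
      rcases Finset.mem_insert.1 hj with rfl | hj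
      · rcases Finset.mem_insert.1 hl with rfl | hl
        · exact absurd rfl hjl
        · exact hFi l hl
      · rcases Finset.mem_insert.1 hl with hli | hl
        · exact fun h => hFi j hj (hR' _ _ (hli ▸ h))
        · exact hind j hj l hl hjl

end Counting

section Stopping

variable {E : Type*} [NormedAddCommGroup E] [InnerProductSpace ℝ E]
  {V : Type*} [NormedAddCommGroup V] [NormedSpace ℝ V]

/-- The potential at `x` of the part of `(X, m)` lying in a cone around `ker P`,
outside the ball of radius `t`. -/
noncomputable def conePot (n : ℕ) (P : E →ₗ[ℝ] V) (s₀ : ℝ) (m : E → ℝ) (X : Finset E) (t : ℝ)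
    (x : E) : ℝ :=
  ∑ y ∈ X with t ≤ ‖x - y‖ ∧ ‖P (x - y)‖ < s₀ * ‖x - y‖, m y * (‖x - y‖ ^ n)⁻¹

/-- The conical energy of `(X, m)` truncated at the scale `ρ`. -/
noncomputable def coneEnergy (n : ℕ) (P : E →ₗ[ℝ] V) (s₀ : ℝ) (ρ m : E → ℝ) (X : Finset E) : ℝ :=
  ∑ x ∈ X, m x * conePot n P s₀ m X (ρ x) x

variable {n : ℕ} {P : E →ₗ[ℝ] V} {s₀ δ τ r : ℝ} {ρ m s : E → ℝ} {X : Finset E}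

lemma conePot_nonneg (hm : ∀ x, 0 ≤ m x) (t : ℝ) (x : E) : 0 ≤ conePot n P s₀ m X t x :=
  Finset.sum_nonneg fun y _ => mul_nonneg (hm y) (inv_nonneg.2 (pow_nonneg (norm_nonneg _) _))

lemma coneEnergy_nonneg (hm : ∀ x, 0 ≤ m x) : 0 ≤ coneEnergy n P s₀ ρ m X :=
  Finset.sum_nonneg fun x _ => mul_nonneg (hm x) (conePot_nonneg hm _ _)

/-- Above the scale `s`, and up to scale `r`, the set `(X, m)` has density at least `δ` and small
conical potential. -/
structure IsStopping (n : ℕ) (P : E →ₗ[ℝ] V) (s₀ δ τ r : ℝ) (m : E → ℝ) (X : Finset E)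
    (s : E → ℝ) : Prop where
  dense : ∀ x ∈ X, ∀ t, s x < t → t ≤ r → δ * t ^ n ≤ ∑ y ∈ X with ‖x - y‖ ≤ 8 * t, m y
  small : ∀ x ∈ X, ∀ t, s x < t → t ≤ r → conePot n P s₀ m X t x ≤ τ

lemma IsStopping.le_norm_map (h : IsStopping n P s₀ δ τ r m X s) (hP : ∀ x, ‖P x‖ ≤ ‖x‖)
    (hs₀ : 0 < s₀) (hs₁ : s₀ ≤ 1) (hτ : τ < δ * (s₀ / 128) ^ n) (hm : ∀ x, 0 ≤ m x)
    (hr : 0 ≤ r) {x y : E} (hx : x ∈ X) (hy : y ∈ X)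
    (hxy : ‖x - y‖ ≤ 2 * r) (hsx : s x < ‖x - y‖ / 2) (hsy : s y < s₀ / 64 * ‖x - y‖) :
    s₀ / 2 * ‖x - y‖ ≤ ‖P (x - y)‖ := by
  by_contra! hlt
  set g := ‖x - y‖ with hg
  have hg0 : 0 < g := by
    by_contra! h0
    have : g = 0 := le_antisymm h0 (norm_nonneg _)
    rw [this, mul_zero] at hlt
    exact absurd hlt (not_lt.2 (norm_nonneg _))
  have h1 := h.dense y hy (s₀ / 64 * g) hsy (by nlinarith)
  have h2 := h.small x hx (g / 2) hsx (by linarith)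
  have h3 : (∑ z ∈ X with ‖y - z‖ ≤ 8 * (s₀ / 64 * g), m z) * ((2 * g) ^ n)⁻¹ ≤
      conePot n P s₀ m X (g / 2) x := by
    rw [conePot, Finset.sum_mul]
    calc _ ≤ ∑ z ∈ X with ‖y - z‖ ≤ 8 * (s₀ / 64 * g), m z * (‖x - z‖ ^ n)⁻¹ := by
          refine Finset.sum_le_sum fun z hz => mul_le_mul_of_nonneg_left ?_ (hm z)
          have hz2 := (Finset.mem_filter.1 hz).2
          have h4 := norm_sub_le_norm_sub_add_norm_sub x y z
          have h5 := norm_sub_le_norm_sub_add_norm_sub x z y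
          rw [norm_sub_rev z y] at h5
          have : 0 < ‖x - z‖ := by nlinarith
          refine inv_anti₀ (by positivity) (pow_le_pow_left₀ this.le ?_ _)
          nlinarith
      _ ≤ _ := by
          refine Finset.sum_le_sum_of_subset_of_nonneg ?_ fun z _ _ =>
            mul_nonneg (hm z) (inv_nonneg.2 (pow_nonneg (norm_nonneg _) _))
          refine Finset.monotone_filter_right _ fun z _ hz2 => ?_
          have h5 := norm_sub_le_norm_sub_add_norm_sub x z y
          rw [norm_sub_rev z y] at h5
          have h6 : P (x - z) = P (x - y) + P (y - z) := by rw [← map_add]; congr 1; abel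
          have h7 : ‖P (x - z)‖ ≤ ‖P (x - y)‖ + ‖P (y - z)‖ := h6 ▸ norm_add_le _ _
          have h8 := hP (y - z)
          have h9 : 7 / 8 * g ≤ ‖x - z‖ := by nlinarith
          constructor
          · linarith
          · nlinarith [mul_le_mul_of_nonneg_left h9 hs₀.le]
  have h4 : δ * (s₀ / 128) ^ n = δ * (s₀ / 64 * g) ^ n * ((2 * g) ^ n)⁻¹ := by
    rw [mul_assoc, ← inv_pow, ← mul_pow]
    congr 2
    field_simp
    norm_num
  have h5 : δ * (s₀ / 64 * g) ^ n * ((2 * g) ^ n)⁻¹ ≤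
      (∑ z ∈ X with ‖y - z‖ ≤ 8 * (s₀ / 64 * g), m z) * ((2 * g) ^ n)⁻¹ :=
    mul_le_mul_of_nonneg_right h1 (by positivity)
  linarith

end Stopping

lemma sum_biUnion_le_sum {α β : Type*} {f : β → ℝ} (hf : ∀ x, 0 ≤ f x) (F : Finset α)
    (t : α → Finset β) : ∑ x ∈ F.biUnion t, f x ≤ ∑ i ∈ F, ∑ x ∈ t i, f x := by
  induction F using Finset.induction_on with
  | empty => simp
  | insert i F hi ih =>
    rw [Finset.biUnion_insert, Finset.sum_insert hi]
    have := Finset.sum_union_inter (s₁ := t i) (s₂ := F.biUnion t) (f := f)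
    have h0 : 0 ≤ ∑ x ∈ t i ∩ F.biUnion t, f x := Finset.sum_nonneg fun x _ => hf x
    linarith

section Sparse

variable {E : Type*} [NormedAddCommGroup E] [InnerProductSpace ℝ E] [FiniteDimensional ℝ E]
  {V : Type*} [NormedAddCommGroup V] [NormedSpace ℝ V] [FiniteDimensional ℝ V]
  {n : ℕ} {P : E →ₗ[ℝ] V} {s₀ δ τ r : ℝ} {ρ m s t : E → ℝ} {X D : Finset E} {x₀ : E}

/-- Bound for the number of separated points of comparable scale in a common shadow. -/
noncomputable def shadowConst (d : ℕ) (s₀ : ℝ) : ℕ := ⌊(3 * (16 / s₀) + 1) ^ d⌋₊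

lemma IsStopping.norm_sub_le_of_shadow (h : IsStopping n P s₀ δ τ r m X s)
    (hP : ∀ x, ‖P x‖ ≤ ‖x‖) (hs₀ : 0 < s₀) (hs₁ : s₀ ≤ 1) (hτ : τ < δ * (s₀ / 128) ^ n)
    (hm : ∀ x, 0 ≤ m x) (hr : 0 ≤ r) (hX : ∀ x ∈ X, ‖x - x₀‖ ≤ r) {x y : E} (hx : x ∈ X)
    (hy : y ∈ X) (hty : 0 < t y) (hsx : s x ≤ 2 * t x) (hsy : s y ≤ 2 * t y) (hle : t y ≤ t x)
    (hsep : 8 * t x < ‖x - y‖) {w : V} (hwx : ‖w - P x‖ ≤ s₀ * t x)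
    (hwy : ‖w - P y‖ ≤ s₀ * t y) : ‖x - y‖ ≤ 16 / s₀ * (8 * t y) := by
  by_contra! hlt
  have h1 : s y < s₀ / 64 * ‖x - y‖ := by
    have h2 := mul_lt_mul_of_pos_left hlt (show 0 < s₀ / 64 by positivity)
    have e : s₀ / 64 * (16 / s₀ * (8 * t y)) = 2 * t y := by field_simp; norm_num
    linarith
  have h2 : ‖x - y‖ ≤ 2 * r := by
    have := norm_sub_le_norm_sub_add_norm_sub x x₀ y
    rw [norm_sub_rev x₀ y] at this
    linarith [hX x hx, hX y hy]
  have h3 := h.le_norm_map hP hs₀ hs₁ hτ hm hr hx hy h2 (by linarith) h1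
  have h4 := norm_sub_le_norm_sub_add_norm_sub (P x) w (P y)
  rw [norm_sub_rev (P x) w, ← map_sub] at h4
  nlinarith

/-- Points stopped because of low density carry little mass. -/
lemma IsStopping.sum_sparse_le (h : IsStopping n P s₀ δ τ r m X s) (hV : Module.finrank ℝ V = n)
    (hP : ∀ x, ‖P x‖ ≤ ‖x‖) (hs₀ : 0 < s₀) (hs₁ : s₀ ≤ 1) (hτ : τ < δ * (s₀ / 128) ^ n)
    (hδ : 0 ≤ δ) (hm : ∀ x, 0 ≤ m x) (hr : 0 ≤ r) (hX : ∀ x ∈ X, ‖x - x₀‖ ≤ r) (hD : D ⊆ X)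
    (ht : ∀ x ∈ D, 0 < t x) (htr : ∀ x ∈ D, t x ≤ r) (hst : ∀ x ∈ D, s x ≤ 2 * t x)
    (hld : ∀ x ∈ D, ∑ y ∈ X with ‖x - y‖ ≤ 8 * t x, m y ≤ δ * t x ^ n) :
    ∑ x ∈ D, m x ≤ δ * (shadowConst (Module.finrank ℝ E) s₀ * (2 / s₀) ^ n * r ^ n) := by
  obtain ⟨F, hFD, hcov, hsep⟩ := exists_greedy t (fun x y => ‖x - y‖ ≤ 8 * max (t x) (t y) ∨ x = y)
    (fun x => Or.inr rfl) (fun x y hxy => hxy.imp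
      (fun hxy => by rwa [norm_sub_rev, max_comm]) Eq.symm) D
  have hsep' : ∀ i ∈ F, ∀ j ∈ F, i ≠ j → 8 * max (t i) (t j) < ‖i - j‖ := fun i hi j hj hij => by
    have := hsep i hi j hj hij
    push Not at this
    exact this.1
  have hsum : ∑ i ∈ F, (s₀ * t i) ^ n ≤
      shadowConst (Module.finrank ℝ E) s₀ * (2 * r) ^ n := by
    rw [← hV]
    refine sum_pow_le_of_overlap_le F (fun i => P i) (fun i => s₀ * t i) _
      (fun i hi => mul_nonneg hs₀.le (ht i (hFD hi)).le) (fun w => ?_) (P x₀)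
      (by linarith) (fun i hi => ?_)
    · rcases (F.filter fun i => ‖w - P i‖ ≤ s₀ * t i).eq_empty_or_nonempty with h0 | h0
      · rw [h0]
        simp
      obtain ⟨j, hj, hmin⟩ := Finset.exists_min_image _ t h0
      rw [Finset.mem_filter] at hj
      have htj := ht j (hFD hj.1)
      refine Nat.le_floor ?_
      refine card_le_of_separated _ (fun i => i) j (h := 8 * t j) (by linarith) (by positivity)
        (fun i hi => ?_) (fun i hi l hl hil => ?_)
      · have hij := hmin i hi
        rw [Finset.mem_filter] at hi
        by_cases hne : i = j
        · rw [hne, sub_self, norm_zero]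
          positivity
        have h1 := hsep' i hi.1 j hj.1 hne
        rw [max_eq_left hij] at h1
        exact h.norm_sub_le_of_shadow hP hs₀ hs₁ hτ hm hr hX (hD (hFD hi.1)) (hD (hFD hj.1)) htj
          (hst i (hFD hi.1)) (hst j (hFD hj.1)) hij h1 hi.2 hj.2
      · have hij := hmin i hi
        rw [Finset.mem_filter] at hi hl
        have h1 := hsep' i hi.1 l hl.1 hil
        have h2 := le_max_left (t i) (t l)
        linarith
    · have h1 := hP (i - x₀)
      rw [map_sub] at h1
      have h2 : s₀ * t i ≤ 1 * r := mul_le_mul hs₁ (htr i (hFD hi)) (ht i (hFD hi)).le zero_le_one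
      linarith [hX i (hD (hFD hi))]
  have hmass : ∑ x ∈ D, m x ≤ ∑ i ∈ F, ∑ y ∈ X with ‖i - y‖ ≤ 8 * t i, m y := by
    have h1 : D ⊆ F.biUnion fun i => X.filter fun y => ‖i - y‖ ≤ 8 * t i := fun x hx => by
      obtain ⟨i, hi, hti, h2⟩ := hcov x hx
      refine Finset.mem_biUnion.2 ⟨i, hi, Finset.mem_filter.2 ⟨hD hx, ?_⟩⟩
      rcases h2 with h2 | rfl
      · rwa [max_eq_left hti] at h2
      · rw [sub_self, norm_zero]
        linarith [ht i hx]
    calc ∑ x ∈ D, m x ≤ ∑ x ∈ F.biUnion fun i => X.filter fun y => ‖i - y‖ ≤ 8 * t i, m x :=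
          Finset.sum_le_sum_of_subset_of_nonneg h1 fun x _ _ => hm x
      _ ≤ _ := sum_biUnion_le_sum hm _ _
  refine hmass.trans ((Finset.sum_le_sum fun i hi => hld i (hFD hi)).trans ?_)
  rw [← Finset.mul_sum]
  refine mul_le_mul_of_nonneg_left ?_ hδ
  have e1 : ∑ i ∈ F, (s₀ * t i) ^ n = s₀ ^ n * ∑ i ∈ F, t i ^ n := by
    rw [Finset.mul_sum]
    exact Finset.sum_congr rfl fun i _ => mul_pow _ _ _
  rw [e1] at hsum
  have hp : 0 < s₀ ^ n := by positivity
  rw [← mul_le_mul_iff_right₀ hp]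
  refine hsum.trans (le_of_eq ?_)
  rw [div_pow, mul_pow]
  field_simp

end Sparse

section MinScale

variable {E : Type*} [NormedAddCommGroup E] {s ρ ρ' : E → ℝ} {X : Finset E}

/-- `ρ'` is the largest `1`-Lipschitz function which is at most `s` on `X`. -/
structure IsMinScale (s : E → ℝ) (X : Finset E) (ρ' : E → ℝ) : Prop where
  le : ∀ x, ∀ y ∈ X, ρ' x ≤ s y + ‖x - y‖
  eq : ∀ x, ∃ y ∈ X, ρ' x = s y + ‖x - y‖

lemma exists_isMinScale (s : E → ℝ) (hX : X.Nonempty) : ∃ ρ', IsMinScale s X ρ' := by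
  have h : ∀ x : E, ∃ y ∈ X, ∀ z ∈ X, s y + ‖x - y‖ ≤ s z + ‖x - z‖ := fun x =>
    X.exists_min_image _ hX
  choose f hf hmin using h
  exact ⟨fun x => s (f x) + ‖x - f x‖, fun x y hy => hmin x y hy, fun x => ⟨f x, hf x, rfl⟩⟩

lemma IsMinScale.isScale (h : IsMinScale s X ρ') (hs : ∀ x ∈ X, 0 < s x) : IsScale ρ' where
  pos x := by
    obtain ⟨y, hy, e⟩ := h.eq x
    rw [e]
    linarith [hs y hy, norm_nonneg (x - y)]
  lip x y := by
    obtain ⟨z, hz, e⟩ := h.eq y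
    have := h.le x z hz
    linarith [norm_sub_le_norm_sub_add_norm_sub x y z]

lemma IsMinScale.le_self (h : IsMinScale s X ρ') {x : E} (hx : x ∈ X) : ρ' x ≤ s x := by
  simpa using h.le x x hx

lemma IsMinScale.ge (h : IsMinScale s X ρ') (hρ : IsScale ρ) (hs : ∀ x ∈ X, ρ x ≤ s x) (x : E) :
    ρ x ≤ ρ' x := by
  obtain ⟨y, hy, e⟩ := h.eq x
  linarith [hρ.lip x y, hs y hy]

lemma IsMinScale.exists_lower (h : IsMinScale s X ρ') (hs : ∀ x ∈ X, 0 < s x) :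
    ∃ r₀, 0 < r₀ ∧ ∀ x, r₀ ≤ ρ' x := by
  obtain ⟨y, hy, -⟩ := h.eq 0
  obtain ⟨z, hz, hmin⟩ := X.exists_min_image s ⟨y, hy⟩
  refine ⟨s z, hs z hz, fun x => ?_⟩
  obtain ⟨w, hw, e⟩ := h.eq x
  linarith [hmin w hw, norm_nonneg (x - w)]

lemma norm_sub_le_of_mem_ball {r : ℝ} {x₀ : E} (hX : ∀ x ∈ X, ‖x - x₀‖ ≤ r)
    {x y : E} (hx : x ∈ X) (hy : y ∈ X) :
    ‖x - y‖ ≤ 2 * r := by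
  have := norm_sub_le_norm_sub_add_norm_sub x x₀ y
  rw [norm_sub_rev x₀ y] at this
  linarith [hX x hx, hX y hy]

end MinScale

section Graph

variable {E : Type*} [NormedAddCommGroup E] [InnerProductSpace ℝ E] [FiniteDimensional ℝ E]
  {V : Type*} [NormedAddCommGroup V] [NormedSpace ℝ V]
  {n : ℕ} {P : E →ₗ[ℝ] V} {J : V →ₗ[ℝ] E} {s₀ δ τ r : ℝ} {ρ ρ' m s : E → ℝ} {X : Finset E} {x₀ : E}

/-- Lipschitz constant of the graph. -/
noncomputable def graphConst (E : Type*) [NormedAddCommGroup E] [InnerProductSpace ℝ E]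
    [FiniteDimensional ℝ E] (s₀ : ℝ) : ℝ :=
  1 + 2 * (lipschitzExtensionConstant E * (2 / s₀))

lemma IsStopping.exists_graph (h : IsStopping n P s₀ δ τ r m X s)
    (hP : ∀ x, ‖P x‖ ≤ ‖x‖) (hPJ : ∀ v, P (J v) = v) (hJ : ∀ v, ‖J v‖ ≤ ‖v‖)
    (hs₀ : 0 < s₀) (hs₁ : s₀ ≤ 1) (hτ : τ < δ * (s₀ / 128) ^ n)
    (hm : ∀ x, 0 ≤ m x) (hr : 0 ≤ r) (hX : ∀ x ∈ X, ‖x - x₀‖ ≤ r) (hs : ∀ x ∈ X, 0 < s x) :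
    ∃ γ : V → E, (∀ w u, ‖w - u‖ ≤ ‖γ w - γ u‖) ∧
      (∀ w u, ‖γ w - γ u‖ ≤ graphConst E s₀ * ‖w - u‖) ∧
      ∀ x ∈ X, ‖x - γ (P x)‖ ≤ (1 + graphConst E s₀) * (128 / s₀ * s x) := by
  obtain ⟨F, hFX, hcov, hsep⟩ := exists_greedy (fun x => - s x)
    (fun x y => ‖x - y‖ ≤ 128 / s₀ * max (s x) (s y) ∨ x = y)
    (fun x => Or.inr rfl) (fun x y hxy => hxy.imp
      (fun hxy => by rwa [norm_sub_rev, max_comm]) Eq.symm) X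
  have hlow : ∀ i ∈ F, ∀ j ∈ F, s₀ / 2 * ‖i - j‖ ≤ ‖P (i - j)‖ := by
    intro i hi j hj
    rcases eq_or_ne i j with rfl | hij
    · simp
    have h1 := hsep i hi j hj hij
    push Not at h1
    have h2 : max (s i) (s j) < s₀ / 128 * ‖i - j‖ := by
      have := mul_lt_mul_of_pos_left h1.1 (show 0 < s₀ / 128 by positivity)
      have e : s₀ / 128 * (128 / s₀ * max (s i) (s j)) = max (s i) (s j) := by field_simp
      rwa [e] at this
    have h3 := le_max_left (s i) (s j)
    have h4 := le_max_right (s i) (s j)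
    have h5 := norm_nonneg (i - j)
    exact h.le_norm_map hP hs₀ hs₁ hτ hm hr (hFX hi) (hFX hj)
      (norm_sub_le_of_mem_ball hX (hFX hi) (hFX hj)) (by nlinarith) (by nlinarith)
  have hinj : ∀ i ∈ F, ∀ j ∈ F, P i = P j → i = j := fun i hi j hj hij => by
    have h1 := hlow i hi j hj
    rw [map_sub, hij, sub_self, norm_zero] at h1
    have h2 : ‖i - j‖ ≤ 0 := by
      by_contra! h3
      have := mul_pos (half_pos hs₀) h3
      linarith
    exact sub_eq_zero.1 (norm_le_zero_iff.1 h2)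
  set f : V → E := Function.invFunOn P F with hf
  have hfP : ∀ i ∈ F, f (P i) = i := fun i hi => by
    have h1 : P i ∈ P '' (F : Set E) := ⟨i, hi, rfl⟩
    exact hinj _ (Function.invFunOn_mem h1) _ hi (Function.invFunOn_eq h1)
  set K : NNReal := ⟨2 / s₀, by positivity⟩ with hK
  have hlip : LipschitzOnWith K f (P '' (F : Set E)) := by
    refine LipschitzOnWith.of_dist_le_mul ?_
    rintro _ ⟨i, hi, rfl⟩ _ ⟨j, hj, rfl⟩
    rw [hfP i hi, hfP j hj, dist_eq_norm, dist_eq_norm, ← map_sub]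
    have h1 := mul_le_mul_of_nonneg_left (hlow i hi j hj) (show 0 ≤ 2 / s₀ by positivity)
    have e : 2 / s₀ * (s₀ / 2 * ‖i - j‖) = ‖i - j‖ := by field_simp
    rw [e] at h1
    exact h1
  obtain ⟨g, hg, hgf⟩ := hlip.extend_finite_dimension
  have hgn : ∀ w u, ‖g w - g u‖ ≤ lipschitzExtensionConstant E * (2 / s₀) * ‖w - u‖ := fun w u => by
    have := hg.dist_le_mul w u
    rw [dist_eq_norm, dist_eq_norm] at this
    exact this
  set γ : V → E := fun w => J w + (g w - J (P (g w))) with hγ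
  have hPγ : ∀ w, P (γ w) = w := fun w => by simp [hγ, hPJ]
  have hγF : ∀ i ∈ F, γ (P i) = i := fun i hi => by
    have h1 : g (P i) = i := by rw [← hgf ⟨i, hi, rfl⟩, hfP i hi]
    simp [hγ, h1]
  have hup : ∀ w u, ‖γ w - γ u‖ ≤ graphConst E s₀ * ‖w - u‖ := fun w u => by
    have e : γ w - γ u = J (w - u) + (g w - g u) - J (P (g w - g u)) := by
      simp only [hγ, map_sub]
      abel
    have h1 := norm_sub_le (J (w - u) + (g w - g u)) (J (P (g w - g u)))
    have h2 := norm_add_le (J (w - u)) (g w - g u)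
    have h3 := (hJ _).trans (hP (g w - g u))
    rw [e, graphConst]
    nlinarith [hJ (w - u), hgn w u]
  refine ⟨γ, fun w u => ?_, hup, fun x hx => ?_⟩
  · have := hP (γ w - γ u)
    rwa [map_sub, hPγ, hPγ] at this
  · obtain ⟨i, hi, hsi, h1⟩ := hcov x hx
    have hsi' : s i ≤ s x := by simpa using hsi
    have h2 : ‖x - i‖ ≤ 128 / s₀ * s x := by
      rcases h1 with h1 | rfl
      · rwa [max_eq_right hsi', norm_sub_rev] at h1
      · rw [sub_self, norm_zero]
        have := hs i hx
        positivity
    have h3 := hup (P i) (P x)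
    rw [hγF i hi, ← map_sub] at h3
    have h4 := hP (i - x)
    rw [norm_sub_rev] at h4
    have h5 := norm_sub_le_norm_sub_add_norm_sub x i (γ (P x))
    have h6 : 0 ≤ graphConst E s₀ := by
      unfold graphConst
      positivity
    rw [add_mul, one_mul]
    have h7 := mul_le_mul_of_nonneg_left (h4.trans h2) h6
    linarith

end Graph

section Overlap

variable {E : Type*} [NormedAddCommGroup E] [InnerProductSpace ℝ E]
  {V : Type*} [NormedAddCommGroup V] [NormedSpace ℝ V]
  {n : ℕ} {P : E →ₗ[ℝ] V} {s₀ δ τ r : ℝ} {ρ ρ' m s : E → ℝ} {X : Finset E} {x₀ : E}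

lemma Growth.sum_norm_le (hG : Growth n 1 ρ m X) (hm : ∀ x, 0 ≤ m x) (hρ : IsScale ρ) {x : E}
    (hx : x ∈ X) {t : ℝ} (ht : ρ x ≤ t) : ∑ y ∈ X with ‖x - y‖ ≤ t, m y ≤ (3 * t) ^ n := by
  have h0 := hρ.pos x
  have h1 := hG x hx (3 * t) (by linarith)
  rw [one_mul] at h1
  refine le_trans (Finset.sum_le_sum_of_subset_of_nonneg ?_ fun y _ _ => hm y) h1
  exact Finset.monotone_filter_right _ fun y _ hy => sep_le_of_norm_le hρ ht hy

/-- Bound for the overlap of the shadows of the balls `B(x, ρ' x)`. -/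
noncomputable def overlapConst (n : ℕ) (s₀ : ℝ) : ℝ :=
  (3 * ((1 + 128 / s₀) * (16 / s₀) + 1)) ^ n + (1 + 128 / s₀) ^ n

lemma IsStopping.norm_sub_le_of_minScale (h : IsStopping n P s₀ δ τ r m X s)
    (hP : ∀ x, ‖P x‖ ≤ ‖x‖) (hs₀ : 0 < s₀) (hs₁ : s₀ ≤ 1) (hτ : τ < δ * (s₀ / 128) ^ n)
    (hm : ∀ x, 0 ≤ m x) (hr : 0 ≤ r) (hX : ∀ x ∈ X, ‖x - x₀‖ ≤ r) (hs : ∀ x ∈ X, 0 < s x)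
    (hρ' : IsMinScale s X ρ') {y z : E} {w : V} {t : ℝ} (hz : z ∈ X)
    (hwy : ‖w - P y‖ ≤ ρ' y) (hwz : ‖w - P z‖ ≤ 2 * t) (hsz : s z ≤ t) (ht : t ≤ ρ' y) :
    ‖y - z‖ ≤ (1 + 128 / s₀) * ρ' y := by
  obtain ⟨y', hy', e⟩ := hρ'.eq y
  have hpos := (hρ'.isScale hs).pos y
  suffices h1 : ‖y' - z‖ ≤ 128 / s₀ * ρ' y by
    have h2 := norm_sub_le_norm_sub_add_norm_sub y y' z
    have h3 := hs y' hy'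
    rw [add_mul, one_mul]
    linarith
  by_contra! hlt
  have h1 : ρ' y < s₀ / 128 * ‖y' - z‖ := by
    have := mul_lt_mul_of_pos_left hlt (show 0 < s₀ / 128 by positivity)
    have e : s₀ / 128 * (128 / s₀ * ρ' y) = ρ' y := by field_simp
    rwa [e] at this
  have hn := norm_nonneg (y - y')
  have hg := norm_nonneg (y' - z)
  have h2 := h.le_norm_map hP hs₀ hs₁ hτ hm hr hy' hz (norm_sub_le_of_mem_ball hX hy' hz)
    (by nlinarith) (by nlinarith)
  have h3 := norm_sub_le_norm_sub_add_norm_sub (P y') (P y) (P z)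
  have h4 := norm_sub_le_norm_sub_add_norm_sub (P y) w (P z)
  rw [norm_sub_rev (P y) w] at h4
  have h5 := hP (y' - y)
  rw [map_sub, norm_sub_rev y' y] at h5
  rw [map_sub] at h2
  have h6 := hs y' hy'
  nlinarith

lemma IsStopping.overlap_le (h : IsStopping n P s₀ δ τ r m X s)
    (hP : ∀ x, ‖P x‖ ≤ ‖x‖) (hs₀ : 0 < s₀) (hs₁ : s₀ ≤ 1) (hτ : τ < δ * (s₀ / 128) ^ n)
    (hτ1 : τ ≤ 1) (hm : ∀ x, 0 ≤ m x) (hr : 0 ≤ r) (hX : ∀ x ∈ X, ‖x - x₀‖ ≤ r)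
    (hG : Growth n 1 ρ m X) (hρ : IsScale ρ) (hρs : ∀ x ∈ X, ρ x ≤ s x)
    (hsr : ∀ x ∈ X, s x ≤ r) (hρ' : IsMinScale s X ρ') (w : V) :
    ∑ y ∈ X with ‖w - P y‖ ≤ s₀ / 8 * ρ' y, m y * (ρ' y ^ n)⁻¹ ≤ overlapConst n s₀ := by
  have hs : ∀ x ∈ X, 0 < s x := fun x hx => (hρ.pos x).trans_le (hρs x hx)
  have hpos := (hρ'.isScale hs).pos
  have hbc : 0 ≤ overlapConst n s₀ := by unfold overlapConst; positivity
  rcases (X.filter fun y => ‖w - P y‖ ≤ s₀ / 8 * ρ' y).eq_empty_or_nonempty with h0 | h0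
  · rwa [h0, Finset.sum_empty]
  obtain ⟨y₀, hy₀, hmin⟩ := Finset.exists_min_image _ ρ' h0
  set Y := X.filter fun y => ‖w - P y‖ ≤ s₀ / 8 * ρ' y with hY
  obtain ⟨hy₀X, hy₀w⟩ := Finset.mem_filter.1 hy₀
  obtain ⟨z, hz, e⟩ := hρ'.eq y₀
  set t := ρ' y₀ with ht
  have ht0 : 0 < t := hpos y₀
  have hsz : s z ≤ t := by linarith [norm_nonneg (y₀ - z)]
  have hyz : ‖y₀ - z‖ ≤ t := by linarith [hs z hz]
  have hwz : ‖w - P z‖ ≤ 2 * t := by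
    have h1 := norm_sub_le_norm_sub_add_norm_sub w (P y₀) (P z)
    have h2 := hP (y₀ - z)
    rw [map_sub] at h2
    nlinarith
  set B := 1 + 128 / s₀ with hB
  have hB0 : 0 < B := by positivity
  have hnear : ∀ y ∈ Y, ‖y - z‖ ≤ B * ρ' y := fun y hy => by
    have hyw := (Finset.mem_filter.1 hy).2
    refine h.norm_sub_le_of_minScale hP hs₀ hs₁ hτ hm hr hX hs hρ' hz ?_ hwz hsz (hmin y hy)
    nlinarith [hpos y]
  have hsplit := Finset.sum_filter_add_sum_filter_not Y (fun y => ρ' y < 16 / s₀ * t)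
    fun y => m y * (ρ' y ^ n)⁻¹
  rw [← hsplit, overlapConst]
  refine add_le_add ?_ ?_
  · have h16 : 1 ≤ B * (16 / s₀) + 1 := by
      have : 0 ≤ B * (16 / s₀) := by positivity
      linarith
    calc ∑ y ∈ Y with ρ' y < 16 / s₀ * t, m y * (ρ' y ^ n)⁻¹
        ≤ ∑ y ∈ Y with ρ' y < 16 / s₀ * t, m y * (t ^ n)⁻¹ := by
          refine Finset.sum_le_sum fun y hy => mul_le_mul_of_nonneg_left ?_ (hm y)
          have := hmin y (Finset.mem_filter.1 hy).1
          exact inv_anti₀ (by positivity) (pow_le_pow_left₀ ht0.le this _)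
      _ ≤ (∑ y ∈ X with ‖y₀ - y‖ ≤ (B * (16 / s₀) + 1) * t, m y) * (t ^ n)⁻¹ := by
          rw [← Finset.sum_mul]
          refine mul_le_mul_of_nonneg_right (Finset.sum_le_sum_of_subset_of_nonneg (fun y hy => ?_)
            fun y _ _ => hm y) (by positivity)
          obtain ⟨hyY, hyt⟩ := Finset.mem_filter.1 hy
          refine Finset.mem_filter.2 ⟨(Finset.mem_filter.1 hyY).1, ?_⟩
          have h1 := hnear y hyY
          have h2 := norm_sub_le_norm_sub_add_norm_sub y₀ z y
          rw [norm_sub_rev z y] at h2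
          nlinarith [mul_lt_mul_of_pos_left hyt hB0]
      _ ≤ (3 * ((B * (16 / s₀) + 1) * t)) ^ n * (t ^ n)⁻¹ := by
          refine mul_le_mul_of_nonneg_right (hG.sum_norm_le hm hρ hy₀X ?_) (by positivity)
          have := hρ'.ge hρ hρs y₀
          nlinarith
      _ = _ := by
          rw [← mul_assoc, mul_pow, mul_assoc, mul_inv_cancel₀ (by positivity), mul_one]
  · by_cases htr : 16 / s₀ * t / 2 ≤ r
    · have hlt : s z < 16 / s₀ * t / 2 := by
        have : 16 / s₀ * t / 2 = 8 * t / s₀ := by ring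
        rw [this, lt_div_iff₀ hs₀]
        nlinarith [hs z hz]
      have h1 := h.small z hz _ hlt htr
      calc ∑ y ∈ Y with ¬ ρ' y < 16 / s₀ * t, m y * (ρ' y ^ n)⁻¹
          ≤ ∑ y ∈ Y with ¬ ρ' y < 16 / s₀ * t, B ^ n * (m y * (‖z - y‖ ^ n)⁻¹) := by
            refine Finset.sum_le_sum fun y hy => ?_
            obtain ⟨hyY, hyt⟩ := Finset.mem_filter.1 hy
            rw [mul_left_comm]
            refine mul_le_mul_of_nonneg_left ?_ (hm y)
            have h2 := hnear y hyY
            have h3 := hρ'.le y z hz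
            rw [not_lt] at hyt
            have h4 : 16 * t ≤ 16 / s₀ * t := by
              rw [div_mul_eq_mul_div, le_div_iff₀ hs₀]
              nlinarith
            have h5 : 0 < ‖y - z‖ := by linarith
            rw [norm_sub_rev z y, ← div_eq_mul_inv, ← div_pow, ← inv_pow]
            refine pow_le_pow_left₀ (inv_nonneg.2 (hpos y).le) ?_ _
            rw [inv_eq_one_div, div_le_div_iff₀ (hpos y) h5]
            linarith
        _ ≤ B ^ n * conePot n P s₀ m X (16 / s₀ * t / 2) z := by
            rw [← Finset.mul_sum, conePot]
            refine mul_le_mul_of_nonneg_left (Finset.sum_le_sum_of_subset_of_nonneg (fun y hy => ?_)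
              fun y _ _ => mul_nonneg (hm y) (inv_nonneg.2 (pow_nonneg (norm_nonneg _) _)))
              (by positivity)
            obtain ⟨hyY, hyt⟩ := Finset.mem_filter.1 hy
            obtain ⟨hyX, hyw⟩ := Finset.mem_filter.1 hyY
            have h3 := hρ'.le y z hz
            rw [not_lt] at hyt
            have h4 : 16 * t ≤ 16 / s₀ * t := by
              rw [div_mul_eq_mul_div, le_div_iff₀ hs₀]
              nlinarith
            have h6 : 16 * t ≤ s₀ * ρ' y := by
              have := mul_le_mul_of_nonneg_left hyt hs₀.le
              have e : s₀ * (16 / s₀ * t) = 16 * t := by field_simp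
              linarith
            rw [norm_sub_rev] at h3
            have h7 := norm_sub_le_norm_sub_add_norm_sub (P z) w (P y)
            rw [norm_sub_rev (P z) w, ← map_sub] at h7
            refine Finset.mem_filter.2 ⟨hyX, by linarith, ?_⟩
            have h8 : ρ' y / 2 < ‖z - y‖ := by linarith
            nlinarith [mul_lt_mul_of_pos_left h8 hs₀]
        _ ≤ B ^ n * 1 := mul_le_mul_of_nonneg_left (h1.trans hτ1) (by positivity)
        _ = _ := mul_one _
    · rw [Finset.filter_false_of_mem]
      · rw [Finset.sum_empty]
        positivity
      · intro y hy hyt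
        have h1 := (hρ'.le_self (Finset.mem_filter.1 hy).1).trans (hsr y (Finset.mem_filter.1 hy).1)
        linarith [hpos y]

end Overlap

section CoreEstimate

variable {E : Type*} [NormedAddCommGroup E] [InnerProductSpace ℝ E] [FiniteDimensional ℝ E]
  [MeasurableSpace E] [BorelSpace E]
  {V : Type*} [NormedAddCommGroup V] [NormedSpace ℝ V] [FiniteDimensional ℝ V]

lemma exists_rieszEnergy_stopped_le (E : Type*) [NormedAddCommGroup E] [InnerProductSpace ℝ E]
    [FiniteDimensional ℝ E] (V : Type*) [NormedAddCommGroup V] [NormedSpace ℝ V]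
    [FiniteDimensional ℝ V] {k : ℕ} (hV : Module.finrank ℝ V = k + 1) {s₀ : ℝ} (hs₀ : 0 < s₀)
    (hs₁ : s₀ ≤ 1) :
    ∃ C : ℝ, 0 ≤ C ∧ ∀ (P : E →ₗ[ℝ] V) (J : V →ₗ[ℝ] E), (∀ x, ‖P x‖ ≤ ‖x‖) → (∀ v, P (J v) = v) →
      (∀ v, ‖J v‖ ≤ ‖v‖) → ∀ (X : Finset E) (m ρ ρ' s : E → ℝ) (δ τ r : ℝ) (x₀ : E),
      τ < δ * (s₀ / 128) ^ (k + 1) → τ ≤ 1 → (∀ x, 0 ≤ m x) → x₀ ∈ X → (∀ x ∈ X, ‖x - x₀‖ ≤ r) →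
      Growth (k + 1) 1 ρ m X → IsScale ρ → (∀ x ∈ X, ρ x ≤ s x) → (∀ x ∈ X, s x ≤ r) →
      IsStopping (k + 1) P s₀ δ τ r m X s → IsMinScale s X ρ' →
      rieszEnergy (k + 1) ρ' m X ≤ C * r ^ (k + 1) := by
  borelize E
  borelize V
  set M := graphConst E s₀ with hM
  have hM1 : 1 ≤ M := by
    have : 0 ≤ 2 * ((lipschitzExtensionConstant E : ℝ) * (2 / s₀)) := by positivity
    rw [hM, graphConst]
    linarith
  have hM0 : 0 ≤ M := by linarith
  obtain ⟨C, hC, hcore⟩ := exists_rieszEnergy_carried_le (E := E) (addHaar : Measure V) hV hM1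
    (A := (1 + M) * (1 + 128 / s₀)) (G := overlapConst (k + 1) s₀) (c := s₀ / 8) (by positivity)
    (by unfold overlapConst; positivity) (by positivity) (by linarith)
  refine ⟨C, hC, ?_⟩
  intro P J hP hPJ hJ X m ρ ρ' s δ τ r x₀ hτ hτ1 hm hx₀ hX hG hρ hρs hsr hst hρ'
  have hs : ∀ x ∈ X, 0 < s x := fun x hx => (hρ.pos x).trans_le (hρs x hx)
  have hr : 0 ≤ r := (hs x₀ hx₀).le.trans (hsr x₀ hx₀)
  obtain ⟨γ, hγ, hγ', hγX⟩ := hst.exists_graph hP hPJ hJ hs₀ hs₁ hτ hm hr hX hs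
  obtain ⟨r₀, hr₀, hr₀'⟩ := hρ'.exists_lower hs
  refine hcore X m ρ' P γ r r₀ x₀ hm (hρ'.isScale hs) hr₀ hr₀' hP hγ hγ' (fun x hx => ?_) hx₀ hX
    (fun x hx => (hρ'.le_self hx).trans (hsr x hx)) (hG.mono hm (hρ'.ge hρ hρs))
    (hst.overlap_le hP hs₀ hs₁ hτ hτ1 hm hr hX hG hρ hρs hsr hρ')
  obtain ⟨y, hy, e⟩ := hρ'.eq x
  have h1 := hγX y hy
  have h2 := hγ' (P y) (P x)
  rw [← map_sub] at h2
  have h3 := hP (y - x)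
  rw [norm_sub_rev] at h3
  have h4 := norm_sub_le_norm_sub_add_norm_sub x y (γ (P x))
  have h5 := norm_sub_le_norm_sub_add_norm_sub y (γ (P y)) (γ (P x))
  have h6 : M * ‖P (y - x)‖ ≤ M * ‖x - y‖ := by
    rw [norm_sub_rev x y]
    exact mul_le_mul_of_nonneg_left (hP _) hM0
  have h7 : 0 ≤ (1 + M) * s y := mul_nonneg (by linarith) (hs y hy).le
  have h8 : 0 ≤ (1 + M) * (128 / s₀ * ‖x - y‖) := by positivity
  rw [e]
  nlinarith

end CoreEstimate

lemma exists_sup_scale {a r : ℝ} (ha : 0 < a) (har : a ≤ r) (p : ℝ → Prop) :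
    ∃ s, a ≤ s ∧ s ≤ r ∧ (∀ t, s < t → t ≤ r → ¬ p t) ∧
      (s = a ∨ ∃ t, a < t ∧ s ≤ 2 * t ∧ t ≤ s ∧ p t) := by
  set B : Set ℝ := {t | a < t ∧ t ≤ r ∧ p t} with hB
  rcases B.eq_empty_or_nonempty with h | h
  · refine ⟨a, le_rfl, har, fun t h1 h2 h3 => ?_, Or.inl rfl⟩
    have : t ∈ B := ⟨h1, h2, h3⟩
    rw [h] at this
    exact this
  · have hb : BddAbove B := ⟨r, fun t ht => ht.2.1⟩
    obtain ⟨t₀, ht₀⟩ := h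
    have h0 : a ≤ sSup B := ht₀.1.le.trans (le_csSup hb ht₀)
    refine ⟨sSup B, h0, csSup_le ⟨t₀, ht₀⟩ fun t ht => ht.2.1, fun t h1 h2 h3 =>
      not_lt.2 (le_csSup hb ⟨h0.trans_lt h1, h2, h3⟩) h1, Or.inr ?_⟩
    obtain ⟨t, ht, hlt⟩ := exists_lt_of_lt_csSup ⟨t₀, ht₀⟩
      (show sSup B / 2 < sSup B by linarith)
    exact ⟨t, ht.1, by linarith, le_csSup hb ht, ht.2.2⟩

section Pieces

variable {E : Type*} [NormedAddCommGroup E] [InnerProductSpace ℝ E]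
  {V : Type*} [NormedAddCommGroup V] [NormedSpace ℝ V]
  {n : ℕ} {P : E →ₗ[ℝ] V} {s₀ : ℝ} {ρ m : E → ℝ} {X Y : Finset E} {ι : Type*} {c : E → ι}

lemma rieszEnergy_le_of_small (hG : Growth n 1 ρ m X) (hm : ∀ x, 0 ≤ m x) (hρ : IsScale ρ)
    (hY : Y ⊆ X) {x : E} (hx : x ∈ Y) (h : ∀ z ∈ Y, ‖x - z‖ ≤ ρ x / 10) :
    rieszEnergy n ρ m Y ≤ 36 ^ n * ∑ z ∈ Y, m z := by
  have hx0 := hρ.pos x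
  have hmass : ∑ y ∈ Y, m y ≤ (3 * ρ x) ^ n := by
    refine le_trans (Finset.sum_le_sum_of_subset_of_nonneg (fun y hy => ?_) fun y _ _ => hm y)
      (hG.sum_norm_le hm hρ (hY hx) le_rfl)
    exact Finset.mem_filter.2 ⟨hY hy, by linarith [h y hy]⟩
  rw [rieszEnergy, Finset.mul_sum]
  refine Finset.sum_le_sum fun z hz => ?_
  rw [mul_comm]
  refine mul_le_mul_of_nonneg_right ?_ (hm z)
  have h1 : ‖riesz n ρ m Y z‖ ≤ 6 ^ n := by
    calc ‖riesz n ρ m Y z‖ ≤ ∑ y ∈ Y, m y * ((ρ x / 2) ^ n)⁻¹ := by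
          refine (norm_sum_le _ _).trans (Finset.sum_le_sum fun y _ => ?_)
          rw [norm_smul, Real.norm_of_nonneg (hm y)]
          refine mul_le_mul_of_nonneg_left ((norm_rk_le hρ.pos z y).trans ?_) (hm y)
          refine inv_anti₀ (by positivity) (pow_le_pow_left₀ (by positivity) ?_ _)
          linarith [left_le_sep hρ.pos z y, hρ.lip x z, h z hz]
      _ ≤ (3 * ρ x) ^ n * ((ρ x / 2) ^ n)⁻¹ := by
          rw [← Finset.sum_mul]
          exact mul_le_mul_of_nonneg_right hmass (by positivity)
      _ = 6 ^ n := by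
          rw [← div_eq_mul_inv, ← div_pow]
          congr 1
          field_simp
          norm_num
  calc ‖riesz n ρ m Y z‖ ^ 2 ≤ (6 ^ n) ^ 2 := pow_le_pow_left₀ (norm_nonneg _) h1 2
    _ = 36 ^ n := by rw [← pow_mul, mul_comm n, pow_mul]; norm_num

/-- The part of the conical energy coming from pairs of points with different labels. -/
noncomputable def crossEnergy (n : ℕ) (P : E →ₗ[ℝ] V) (s₀ : ℝ) (ρ m : E → ℝ) (c : E → ι)
    (X : Finset E) : ℝ :=
  ∑ x ∈ X, m x * ∑ y ∈ X with c y ≠ c x ∧ ρ x ≤ ‖x - y‖ ∧ ‖P (x - y)‖ < s₀ * ‖x - y‖,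
    m y * (‖x - y‖ ^ n)⁻¹

lemma sum_image_fiber (f : E → ℝ) :
    ∑ i ∈ X.image c, ∑ x ∈ X with c x = i, f x = ∑ x ∈ X, f x :=
  Finset.sum_fiberwise_of_maps_to (fun _ hx => Finset.mem_image_of_mem c hx) f

lemma coneEnergy_eq_sum_add_cross : coneEnergy n P s₀ ρ m X =
    ∑ i ∈ X.image c, coneEnergy n P s₀ ρ m (X.filter fun y => c y = i) +
      crossEnergy n P s₀ ρ m c X := by
  have h1 : ∑ i ∈ X.image c, coneEnergy n P s₀ ρ m (X.filter fun y => c y = i) =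
      ∑ x ∈ X, m x * conePot n P s₀ m (X.filter fun y => c y = c x) (ρ x) x := by
    rw [← sum_image_fiber (c := c)]
    refine Finset.sum_congr rfl fun i _ => Finset.sum_congr rfl fun x hx => ?_
    rw [(Finset.mem_filter.1 hx).2]
  rw [h1, crossEnergy, ← Finset.sum_add_distrib, coneEnergy]
  refine Finset.sum_congr rfl fun x _ => ?_
  rw [← mul_add, conePot, conePot, Finset.filter_filter,
    ← Finset.sum_filter_add_sum_filter_not _ (fun y => c y = c x), Finset.filter_filter,
    Finset.filter_filter]
  congr 2
  · exact Finset.sum_congr (Finset.filter_congr fun y _ => by tauto) fun _ _ => rfl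
  · exact Finset.sum_congr (Finset.filter_congr fun y _ => by tauto) fun _ _ => rfl

lemma crossEnergy_nonneg (hm : ∀ x, 0 ≤ m x) : 0 ≤ crossEnergy n P s₀ ρ m c X :=
  Finset.sum_nonneg fun x _ => mul_nonneg (hm x) (Finset.sum_nonneg fun y _ =>
    mul_nonneg (hm y) (inv_nonneg.2 (pow_nonneg (norm_nonneg _) _)))

end Pieces

section Tree

variable {k : ℕ} {V : Type*} [NormedAddCommGroup V] [NormedSpace ℝ V] [FiniteDimensional ℝ V]

lemma exists_tree_decomposition (d : ℕ) (hV : Module.finrank ℝ V = k + 1) {s₀ : ℝ} (hs₀ : 0 < s₀)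
    (hs₁ : s₀ ≤ 1) :
    ∃ C : ℝ, 0 ≤ C ∧ ∀ (P : EuclideanSpace ℝ (Fin d) →ₗ[ℝ] V)
      (J : V →ₗ[ℝ] EuclideanSpace ℝ (Fin d)), (∀ x, ‖P x‖ ≤ ‖x‖) → (∀ v, P (J v) = v) →
      (∀ v, ‖J v‖ ≤ ‖v‖) → ∀ (X : Finset (EuclideanSpace ℝ (Fin d)))
      (m ρ : EuclideanSpace ℝ (Fin d) → ℝ) (δ τ r : ℝ) (x₀ : EuclideanSpace ℝ (Fin d)), 0 ≤ δ →
      0 < τ →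
      τ < δ * (s₀ / 128) ^ (k + 1) → τ ≤ 1 → (∀ x, 0 ≤ m x) → x₀ ∈ X → (∀ x ∈ X, ‖x - x₀‖ ≤ r) →
      (∀ x ∈ X, ρ x ≤ r) → Growth (k + 1) 1 ρ m X → IsScale ρ →
      ∃ (ι : Type) (c : EuclideanSpace ℝ (Fin d) → ι) (I : Finset ι), I ⊆ X.image c ∧
        rieszEnergy (k + 1) ρ m X ≤
          ∑ i ∈ I, rieszEnergy (k + 1) ρ m (X.filter fun y => c y = i) + C * r ^ (k + 1) ∧
        ∑ i ∈ I, ∑ x ∈ X with c x = i, m x ≤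
          C * δ * r ^ (k + 1) + τ⁻¹ * crossEnergy (k + 1) P s₀ ρ m c X := by
  obtain ⟨C₁, hC₁4, hsplit⟩ := exists_rieszEnergy_split d (k + 1)
  have hC₁ : 0 ≤ C₁ := by linarith
  obtain ⟨C₂, hC₂, hcore⟩ := exists_rieszEnergy_stopped_le (EuclideanSpace ℝ (Fin d)) V hV hs₀ hs₁
  set C₃ := shadowConst (Module.finrank ℝ (EuclideanSpace ℝ (Fin d))) s₀ * (2 / s₀) ^ (k + 1)
    with hC₃
  have hC₃0 : 0 ≤ C₃ := by positivity
  refine ⟨36 ^ (k + 1) * 3 ^ (k + 1) + C₁ * C₂ + C₁ * 3 ^ (k + 1) + C₃, by positivity, ?_⟩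
  intro P J hP hPJ hJ X m ρ δ τ r x₀ hδ hτ0 hτ hτ1 hm hx₀ hX hρr hG hρ
  have hr : 0 < r := (hρ.pos x₀).trans_le (hρr x₀ hx₀)
  have hex : ∀ x, ∃ s, x ∈ X → ρ x ≤ s ∧ s ≤ r ∧ (∀ t, s < t → t ≤ r →
      ¬ (∑ y ∈ X with ‖x - y‖ ≤ 8 * t, m y < δ * t ^ (k + 1) ∨
        τ < conePot (k + 1) P s₀ m X t x)) ∧
      (s = ρ x ∨ ∃ t, ρ x < t ∧ s ≤ 2 * t ∧ t ≤ s ∧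
        (∑ y ∈ X with ‖x - y‖ ≤ 8 * t, m y < δ * t ^ (k + 1) ∨
          τ < conePot (k + 1) P s₀ m X t x)) := fun x => by
    by_cases hx : x ∈ X
    · obtain ⟨s, hs⟩ := exists_sup_scale (hρ.pos x) (hρr x hx) fun t =>
        ∑ y ∈ X with ‖x - y‖ ≤ 8 * t, m y < δ * t ^ (k + 1) ∨ τ < conePot (k + 1) P s₀ m X t x
      exact ⟨s, fun _ => hs⟩
    · exact ⟨0, fun h => absurd h hx⟩
  choose s hs using hex
  obtain ⟨ρ', hρ'⟩ := exists_isMinScale s ⟨x₀, hx₀⟩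
  have hρs : ∀ x ∈ X, ρ x ≤ s x := fun x hx => (hs x hx).1
  have hsr : ∀ x ∈ X, s x ≤ r := fun x hx => (hs x hx).2.1
  have hst : IsStopping (k + 1) P s₀ δ τ r m X s :=
    ⟨fun x hx t h1 h2 => not_lt.1 fun h => (hs x hx).2.2.1 t h1 h2 (Or.inl h),
      fun x hx t h1 h2 => not_lt.1 fun h => (hs x hx).2.2.1 t h1 h2 (Or.inr h)⟩
  have hs0 : ∀ x ∈ X, 0 < s x := fun x hx => (hρ.pos x).trans_le (hρs x hx)
  have hΦ := hcore P J hP hPJ hJ X m ρ ρ' s δ τ r x₀ hτ hτ1 hm hx₀ hX hG hρ hρs hsr hst hρ'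
  obtain ⟨ι, c, hc, hle, -⟩ := hsplit ρ ρ' m X hG hm hρ (hρ'.isScale hs0) (hρ'.ge hρ hρs)
  have hmass : ∑ x ∈ X, m x ≤ 3 ^ (k + 1) * r ^ (k + 1) := by
    rw [← mul_pow]
    refine le_trans (le_of_eq ?_) (hG.sum_norm_le hm hρ hx₀ (hρr x₀ hx₀))
    rw [Finset.filter_true_of_mem fun y hy => ?_]
    rw [norm_sub_rev]
    exact hX y hy
  set I := (X.image c).filter fun i => ∀ x ∈ X, c x = i → ρ x < ρ' x with hI
  have hrn : 0 ≤ r ^ (k + 1) := by positivity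
  refine ⟨ι, c, I, Finset.filter_subset _ _, ?_, ?_⟩
  · have h1 : ∑ i ∈ (X.image c).filter (fun i => ¬ ∀ x ∈ X, c x = i → ρ x < ρ' x),
        rieszEnergy (k + 1) ρ m (X.filter fun y => c y = i) ≤ 36 ^ (k + 1) * ∑ x ∈ X, m x := by
      rw [← sum_image_fiber (c := c), Finset.mul_sum]
      refine le_trans (Finset.sum_le_sum fun i hi => ?_) (Finset.sum_le_sum_of_subset_of_nonneg
        (Finset.filter_subset _ _) fun i _ _ => mul_nonneg (by positivity)
          (Finset.sum_nonneg fun x _ => hm x))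
      have hi2 := (Finset.mem_filter.1 hi).2
      push Not at hi2
      obtain ⟨x, hx, hxi, hle⟩ := hi2
      refine rieszEnergy_le_of_small hG hm hρ (Finset.filter_subset _ _)
        (Finset.mem_filter.2 ⟨hx, hxi⟩) fun z hz => ?_
      have := hc x z (hxi.trans (Finset.mem_filter.1 hz).2.symm)
      linarith
    have h2 := Finset.sum_filter_add_sum_filter_not (X.image c)
      (fun i => ∀ x ∈ X, c x = i → ρ x < ρ' x)
      fun i => rieszEnergy (k + 1) ρ m (X.filter fun y => c y = i)
    have h3 : C₁ * rieszEnergy (k + 1) ρ' m X ≤ C₁ * (C₂ * r ^ (k + 1)) := by gcongr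
    have h4 : C₁ * ∑ x ∈ X, m x ≤ C₁ * (3 ^ (k + 1) * r ^ (k + 1)) := by gcongr
    have h5 : 36 ^ (k + 1) * ∑ x ∈ X, m x ≤ 36 ^ (k + 1) * (3 ^ (k + 1) * r ^ (k + 1)) := by gcongr
    have h6 : 0 ≤ C₃ * r ^ (k + 1) := by positivity
    linarith
  · set D := X.filter fun x => c x ∈ I with hD
    have hDX : D ⊆ X := Finset.filter_subset _ _
    have hDsum : ∑ i ∈ I, ∑ x ∈ X with c x = i, m x = ∑ x ∈ D, m x := by
      rw [← Finset.sum_fiberwise_of_maps_to (s := D) (t := I) (g := c)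
        fun x hx => (Finset.mem_filter.1 hx).2]
      refine Finset.sum_congr rfl fun i hi => Finset.sum_congr ?_ fun _ _ => rfl
      ext x
      simp only [hD, Finset.mem_filter]
      constructor
      · rintro ⟨h1, rfl⟩
        exact ⟨⟨h1, hi⟩, rfl⟩
      · rintro ⟨⟨h1, -⟩, h2⟩
        exact ⟨h1, h2⟩
    have hext : ∀ x, ∃ t, x ∈ D → ρ x < t ∧ s x ≤ 2 * t ∧ t ≤ s x ∧
        (∑ y ∈ X with ‖x - y‖ ≤ 8 * t, m y < δ * t ^ (k + 1) ∨
          τ < conePot (k + 1) P s₀ m X t x) := fun x => by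
      by_cases hx : x ∈ D
      · have h1 := (Finset.mem_filter.1 (Finset.mem_filter.1 hx).2).2 x (hDX hx) rfl
        have h2 := hρ'.le_self (hDX hx)
        rcases (hs x (hDX hx)).2.2.2 with h3 | ⟨t, ht⟩
        · linarith
        · exact ⟨t, fun _ => ht⟩
      · exact ⟨0, fun h => absurd h hx⟩
    choose t ht using hext
    have htpos : ∀ x ∈ D, 0 < t x := fun x hx => (hρ.pos x).trans (ht x hx).1
    rw [hDsum, ← Finset.sum_filter_add_sum_filter_not D
      fun x => ∑ y ∈ X with ‖x - y‖ ≤ 8 * t x, m y < δ * t x ^ (k + 1)]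
    refine add_le_add ?_ ?_
    · have h1 := hst.sum_sparse_le (t := t) (D := D.filter fun x =>
        ∑ y ∈ X with ‖x - y‖ ≤ 8 * t x, m y < δ * t x ^ (k + 1)) hV hP hs₀ hs₁ hτ hδ hm hr.le hX
        ((Finset.filter_subset _ _).trans hDX) (fun x hx => htpos x (Finset.mem_filter.1 hx).1)
        (fun x hx => (ht x (Finset.mem_filter.1 hx).1).2.2.1.trans
          (hsr x (hDX (Finset.mem_filter.1 hx).1)))
        (fun x hx => (ht x (Finset.mem_filter.1 hx).1).2.1)
        (fun x hx => (Finset.mem_filter.1 hx).2.le)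
      refine h1.trans ?_
      rw [← hC₃]
      have h2 : 0 ≤ δ * r ^ (k + 1) := by positivity
      have h3 : 0 ≤ 36 ^ (k + 1) * 3 ^ (k + 1) + C₁ * C₂ + C₁ * 3 ^ (k + 1) := by positivity
      nlinarith [mul_nonneg h2 h3]
    · rw [crossEnergy, Finset.mul_sum]
      have hnn : ∀ x, 0 ≤ τ⁻¹ * (m x * ∑ y ∈ X with c y ≠ c x ∧ ρ x ≤ ‖x - y‖ ∧
          ‖P (x - y)‖ < s₀ * ‖x - y‖, m y * (‖x - y‖ ^ (k + 1))⁻¹) := fun x =>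
        mul_nonneg (inv_nonneg.2 hτ0.le) (mul_nonneg (hm x) (Finset.sum_nonneg fun y _ =>
          mul_nonneg (hm y) (inv_nonneg.2 (pow_nonneg (norm_nonneg _) _))))
      refine le_trans (Finset.sum_le_sum fun x hx => ?_) (Finset.sum_le_sum_of_subset_of_nonneg
        ((Finset.filter_subset _ _).trans hDX) fun x _ _ => hnn x)
      obtain ⟨hxD, hx2⟩ := Finset.mem_filter.1 hx
      obtain ⟨h1, h2, h3, h4⟩ := ht x hxD
      have h5 := h4.resolve_left hx2
      have h6 : conePot (k + 1) P s₀ m X (t x) x ≤ ∑ y ∈ X with c y ≠ c x ∧ ρ x ≤ ‖x - y‖ ∧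
          ‖P (x - y)‖ < s₀ * ‖x - y‖, m y * (‖x - y‖ ^ (k + 1))⁻¹ := by
        refine Finset.sum_le_sum_of_subset_of_nonneg ?_ fun y _ _ =>
          mul_nonneg (hm y) (inv_nonneg.2 (pow_nonneg (norm_nonneg _) _))
        refine Finset.monotone_filter_right _ fun y _ hy => ⟨fun hcy => ?_, h1.le.trans hy.1, hy.2⟩
        have h7 := hc x y hcy.symm
        have h8 := hρ'.le_self (hDX hxD)
        linarith [hy.1, htpos x hxD]
      rw [inv_mul_eq_div, le_div_iff₀ hτ0]
      exact mul_le_mul_of_nonneg_left (h5.le.trans h6) (hm x)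

end Tree

lemma exists_max_scale {E : Type*} [NormedAddCommGroup E] {ρ : E → ℝ} (hρ : IsScale ρ)
    (f : E → ℝ) (Z : Finset E) :
    ∃ ρ', IsScale ρ' ∧ (∀ x, ρ x ≤ ρ' x) ∧ (∀ y ∈ Z, ∀ x, f y - ‖x - y‖ ≤ ρ' x) ∧
      ∀ x, ρ' x = ρ x ∨ ∃ y ∈ Z, ρ' x = f y - ‖x - y‖ := by
  induction Z using Finset.induction_on with
  | empty => exact ⟨ρ, hρ, fun x => le_rfl, by simp, fun x => Or.inl rfl⟩
  | insert a Z _ ih =>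
    obtain ⟨ρ', h, hle, hlow, heq⟩ := ih
    refine ⟨fun x => max (ρ' x) (f a - ‖x - a‖), ⟨fun x => (h.pos x).trans_le (le_max_left _ _),
      fun x y => ?_⟩, fun x => (hle x).trans (le_max_left _ _), ?_, fun x => ?_⟩
    · refine max_le ?_ ?_
      · linarith [h.lip x y, le_max_left (ρ' y) (f a - ‖y - a‖)]
      · linarith [le_max_right (ρ' y) (f a - ‖y - a‖), norm_sub_le_norm_sub_add_norm_sub y x a,
          norm_sub_rev x y]
    · intro y hy x
      rcases Finset.mem_insert.1 hy with rfl | hy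
      · exact le_max_right _ _
      · exact (hlow y hy x).trans (le_max_left _ _)
    · rcases le_total (ρ' x) (f a - ‖x - a‖) with h1 | h1
      · exact Or.inr ⟨a, Finset.mem_insert_self _ _, max_eq_right h1⟩
      · rcases heq x with h2 | ⟨y, hy, h2⟩
        · exact Or.inl ((max_eq_left h1).trans h2)
        · exact Or.inr ⟨y, Finset.mem_insert_of_mem hy, (max_eq_left h1).trans h2⟩

section Dense

variable {E : Type*} [NormedAddCommGroup E] {n : ℕ} {δ : ℝ} {ρ ρ' m s : E → ℝ} {X Z : Finset E}

/-- The scale `ρ'` raises `ρ` around the points of `Z`, where the weighted set `(X, m)` has density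
about `δ` at the scale `s` and density at most `δ` at all larger scales. -/
structure IsDenseScale (n : ℕ) (δ : ℝ) (ρ m : E → ℝ) (X Z : Finset E) (s ρ' : E → ℝ) : Prop where
  subset : Z ⊆ X
  sparse : ∀ y ∈ Z, ∀ u, s y < u → ∑ x ∈ X with ‖y - x‖ ≤ u, m x ≤ δ * u ^ n
  dense : ∀ y ∈ Z, ∃ t, ρ y < t ∧ t ≤ s y ∧ s y ≤ 2 * t ∧
    δ * t ^ n ≤ ∑ x ∈ X with ‖y - x‖ ≤ t, m x
  scale_eq : ∀ y ∈ Z, ρ' y = 4 * s y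
  stopped : ∀ x, ρ x < ρ' x → ∃ y ∈ Z, ‖x - y‖ ≤ 4 * s y

lemma exists_isDenseScale (hn : n ≠ 0) (hδ : 0 < δ) (hρ : IsScale ρ) (hm : ∀ x, 0 ≤ m x)
    (X : Finset E) : ∃ (Z : Finset E) (s ρ' : E → ℝ), IsScale ρ' ∧ (∀ x, ρ x ≤ ρ' x) ∧
      Growth n (2 ^ n * δ) ρ' m X ∧ IsDenseScale n δ ρ m X Z s ρ' := by
  have hex : ∀ y, ∃ s, ρ y ≤ s ∧ (∀ u, s < u → ∑ x ∈ X with ‖y - x‖ ≤ u, m x ≤ δ * u ^ n) ∧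
      (s = ρ y ∨ ∃ t, ρ y < t ∧ s ≤ 2 * t ∧ t ≤ s ∧
        δ * t ^ n ≤ ∑ x ∈ X with ‖y - x‖ ≤ t, m x) := fun y => by
    have hM : 0 ≤ ∑ x ∈ X, m x := Finset.sum_nonneg fun x _ => hm x
    obtain ⟨s, h1, h2, h3, h4⟩ := exists_sup_scale (hρ.pos y)
      (le_max_left (ρ y) ((∑ x ∈ X, m x) / δ + 1))
      fun t => δ * t ^ n ≤ ∑ x ∈ X with ‖y - x‖ ≤ t, m x
    refine ⟨s, h1, fun u hu => ?_, h4⟩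
    by_cases hur : u ≤ max (ρ y) ((∑ x ∈ X, m x) / δ + 1)
    · exact (not_le.1 (h3 u hu hur)).le
    · have h5 : (∑ x ∈ X, m x) / δ + 1 < u := (le_max_right _ _).trans_lt (not_le.1 hur)
      have h6 : 0 ≤ (∑ x ∈ X, m x) / δ := by positivity
      have h7 : u ≤ u ^ n := le_self_pow₀ (by linarith) hn
      calc ∑ x ∈ X with ‖y - x‖ ≤ u, m x ≤ ∑ x ∈ X, m x :=
            Finset.sum_le_sum_of_subset_of_nonneg (Finset.filter_subset _ _) fun x _ _ => hm x
        _ = δ * ((∑ x ∈ X, m x) / δ) := by field_simp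
        _ ≤ δ * u ^ n := by gcongr; linarith
  choose s hs1 hs2 hs3 using hex
  obtain ⟨ρ', h, hle, hlow, heq⟩ := exists_max_scale hρ (fun y => 4 * s y)
    (X.filter fun y => s y ≠ ρ y)
  have hs' : ∀ x ∈ X, s x ≤ ρ' x := fun x hx => by
    by_cases hsx : s x = ρ x
    · exact hsx.trans_le (hle x)
    · have := hlow x (Finset.mem_filter.2 ⟨hx, hsx⟩) x
      simp only [sub_self, norm_zero, sub_zero] at this
      linarith [hs1 x, hρ.pos x]
  refine ⟨X.filter fun y => s y ≠ ρ y ∧ ρ' y = 4 * s y, s, ρ', h, hle, fun x hx u hu => ?_,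
    Finset.filter_subset _ _, fun y _ => hs2 y, fun y hy => ?_, fun y hy =>
    (Finset.mem_filter.1 hy).2.2, fun x hx => ?_⟩
  · by_cases hux : ρ' x < u
    · have h1 := hs2 x (2 * u) (by linarith [hs' x hx])
      refine le_trans (Finset.sum_le_sum_of_subset_of_nonneg ?_ fun y _ _ => hm y)
        (h1.trans_eq (by rw [mul_pow]; ring))
      refine Finset.monotone_filter_right _ fun y _ hy => ?_
      exact ((norm_le_sep ρ' x y).trans hy).trans (by linarith)
    · rw [Finset.sum_eq_zero]
      · positivity
      · intro y hy
        have h1 := (Finset.mem_filter.1 hy).2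
        have h2 : ρ' x + ρ' y ≤ sep ρ' x y := le_max_right _ _
        linarith [h.pos y]
  · obtain ⟨h1, h2, -⟩ := Finset.mem_filter.1 hy
    obtain ⟨t, h3, h4, h5, h6⟩ := (hs3 y).resolve_left h2
    exact ⟨t, h3, h5, h4, h6⟩
  · obtain ⟨y, hy, h1⟩ := (heq x).resolve_left hx.ne'
    obtain ⟨hyX, hy2⟩ := Finset.mem_filter.1 hy
    have h2 := hlow y hy y
    simp only [sub_self, norm_zero, sub_zero] at h2
    have h3 := h.lip y x
    rw [norm_sub_rev] at h3
    exact ⟨y, Finset.mem_filter.2 ⟨hyX, hy2, le_antisymm (by linarith) h2⟩,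
      by linarith [h.pos x]⟩

namespace IsDenseScale

lemma pos (h : IsDenseScale n δ ρ m X Z s ρ') (hρ : IsScale ρ) {y : E} (hy : y ∈ Z) :
    0 < s y := by
  obtain ⟨t, h1, h2, -⟩ := h.dense y hy
  linarith [hρ.pos y]

lemma exists_separated (h : IsDenseScale n δ ρ m X Z s ρ') (hρ : IsScale ρ) (hδ : 0 < δ)
    (hm : ∀ x, 0 ≤ m x) : ∃ F ⊆ Z, (∀ y ∈ Z, ∃ z ∈ F, s y ≤ s z ∧ ‖z - y‖ ≤ 2 * s z) ∧
      δ * ∑ y ∈ F, s y ^ n ≤ 2 ^ n * ∑ x ∈ X with ∃ y ∈ Z, ‖x - y‖ ≤ s y, m x := by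
  obtain ⟨F, hF, hcov, hsep⟩ := exists_greedy (α := {y // y ∈ Z}) (fun y => s y)
    (fun y z => ‖(y : E) - z‖ ≤ s y + s z)
    (fun y => by rw [sub_self, norm_zero]; linarith [h.pos hρ y.2])
    (fun y z hyz => by rw [norm_sub_rev, add_comm]; exact hyz) Z.attach
  refine ⟨F.map (Function.Embedding.subtype _), fun y hy => ?_, fun y hy => ?_, ?_⟩
  · obtain ⟨z, -, rfl⟩ := Finset.mem_map.1 hy
    exact z.2
  · obtain ⟨z, hz, h1, h2⟩ := hcov ⟨y, hy⟩ (Finset.mem_attach _ _)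
    exact ⟨z, Finset.mem_map_of_mem _ hz, h1, by simp only at h1 h2; linarith⟩
  · rw [Finset.sum_map, Finset.mul_sum]
    choose t h1 h2 h3 h4 using h.dense
    have hdisj : Set.PairwiseDisjoint (F : Set {y // y ∈ Z})
        fun y => X.filter fun x => ‖(y : E) - x‖ ≤ s y := by
      intro y hy z hz hyz
      refine Finset.disjoint_left.2 fun x hx hx' => hsep y hy z hz hyz ?_
      have e1 := (Finset.mem_filter.1 hx).2
      have e2 := (Finset.mem_filter.1 hx').2
      rw [norm_sub_rev] at e2
      linarith [norm_sub_le_norm_sub_add_norm_sub (y : E) x z]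
    calc ∑ y ∈ F, δ * s y ^ n
        ≤ ∑ y ∈ F, 2 ^ n * ∑ x ∈ X with ‖(y : E) - x‖ ≤ s y, m x := by
          refine Finset.sum_le_sum fun y _ => ?_
          have e1 : δ * s y ^ n ≤ δ * (2 * t y y.2) ^ n := by
            have := (h.pos hρ y.2).le
            gcongr
            exact h3 y y.2
          have e2 : ∑ x ∈ X with ‖(y : E) - x‖ ≤ t y y.2, m x ≤
              ∑ x ∈ X with ‖(y : E) - x‖ ≤ s y, m x :=
            Finset.sum_le_sum_of_subset_of_nonneg (Finset.monotone_filter_right _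
              fun x _ hx => le_trans hx (h2 y y.2)) fun x _ _ => hm x
          calc δ * s y ^ n ≤ 2 ^ n * (δ * t y y.2 ^ n) := by
                rw [mul_pow] at e1
                linarith
            _ ≤ _ := by
              gcongr
              exact (h4 y y.2).trans e2
      _ = 2 ^ n * ∑ x ∈ F.biUnion fun y => X.filter fun x => ‖(y : E) - x‖ ≤ s y, m x := by
          rw [Finset.sum_biUnion hdisj, Finset.mul_sum]
      _ ≤ _ := by
          refine mul_le_mul_of_nonneg_left (Finset.sum_le_sum_of_subset_of_nonneg
            (fun x hx => ?_) fun x _ _ => hm x) (by positivity)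
          obtain ⟨y, -, hx⟩ := Finset.mem_biUnion.1 hx
          obtain ⟨hxX, hx⟩ := Finset.mem_filter.1 hx
          rw [norm_sub_rev] at hx
          exact Finset.mem_filter.2 ⟨hxX, y, y.2, hx⟩

lemma sum_stopped_le (h : IsDenseScale n δ ρ m X Z s ρ') (hρ : IsScale ρ) (hδ : 0 < δ)
    (hm : ∀ x, 0 ≤ m x) : ∑ x ∈ X with ρ x < ρ' x, m x ≤
      14 ^ n * ∑ x ∈ X with ∃ y ∈ Z, ‖x - y‖ ≤ s y, m x := by
  obtain ⟨F, hFZ, hcov, hF⟩ := h.exists_separated hρ hδ hm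
  calc ∑ x ∈ X with ρ x < ρ' x, m x
      ≤ ∑ x ∈ F.biUnion fun y => X.filter fun x => ‖y - x‖ ≤ 7 * s y, m x := by
        refine Finset.sum_le_sum_of_subset_of_nonneg (fun x hx => ?_) fun x _ _ => hm x
        obtain ⟨hxX, hx⟩ := Finset.mem_filter.1 hx
        obtain ⟨y, hy, hxy⟩ := h.stopped x hx
        obtain ⟨z, hz, h1, h2⟩ := hcov y hy
        refine Finset.mem_biUnion.2 ⟨z, hz, Finset.mem_filter.2 ⟨hxX, ?_⟩⟩
        rw [norm_sub_rev] at hxy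
        linarith [norm_sub_le_norm_sub_add_norm_sub z y x, h.pos hρ (hFZ hz)]
    _ ≤ ∑ y ∈ F, ∑ x ∈ X with ‖y - x‖ ≤ 7 * s y, m x := sum_biUnion_le_sum hm _ _
    _ ≤ ∑ y ∈ F, 7 ^ n * (δ * s y ^ n) := by
        refine Finset.sum_le_sum fun y hy => ?_
        refine (h.sparse y (hFZ hy) _ (by linarith [h.pos hρ (hFZ hy)])).trans_eq ?_
        rw [mul_pow]
        ring
    _ ≤ _ := by
        rw [← Finset.mul_sum, ← Finset.mul_sum]
        calc _ ≤ (7 : ℝ) ^ n * (2 ^ n * ∑ x ∈ X with ∃ y ∈ Z, ‖x - y‖ ≤ s y, m x) := by gcongr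
          _ = _ := by rw [← mul_assoc, ← mul_pow]; norm_num

lemma sum_pow_le_of_packing (h : IsDenseScale n δ ρ m X Z s ρ') (hρ : IsScale ρ)
    (hρ' : IsScale ρ') (hδ : 0 < δ) (hm : ∀ x, 0 ≤ m x) {ι : Type*} {c : E → ι} {K : ℕ}
    (hK : ∀ (F : Finset E) (x : E), (∀ z ∈ F, ‖z - x‖ ≤ 3 * ρ' x) → (∀ z ∈ F, ρ' x ≤ 3 * ρ' z) →
      (∀ z ∈ F, ρ' z ≤ 3 * ρ' x) → Set.InjOn c F → F.card ≤ K)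
    (I : Finset ι) (x y : ι → E) (hx : ∀ i ∈ I, c (x i) = i) (hy : ∀ i ∈ I, y i ∈ Z)
    (hxy : ∀ i ∈ I, ‖x i - y i‖ ≤ s (y i)) :
    δ * ∑ i ∈ I, s (y i) ^ n ≤ K * 2 ^ n * ∑ x ∈ X, m x := by
  obtain ⟨F, hFZ, hcov, hF⟩ := h.exists_separated hρ hδ hm
  have hex : ∀ i, ∃ z, i ∈ I → z ∈ F ∧ s (y i) ≤ s z ∧ ‖z - y i‖ ≤ 2 * s z := fun i => by
    by_cases hi : i ∈ I
    · obtain ⟨z, hz⟩ := hcov (y i) (hy i hi)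
      exact ⟨z, fun _ => hz⟩
    · exact ⟨0, fun hi' => absurd hi' hi⟩
  choose g hg using hex
  have hcard : ∀ z ∈ F, ((I.filter fun i => g i = z).card : ℝ) ≤ K := fun z hz => by
    have hinj : Set.InjOn x (I.filter fun i => g i = z : Finset ι) := fun i hi j hj hij => by
      rw [← hx i (Finset.mem_filter.1 hi).1, ← hx j (Finset.mem_filter.1 hj).1, hij]
    rw [← Finset.card_image_of_injOn hinj, Nat.cast_le]
    have hzs := h.pos hρ (hFZ hz)
    have hz4 := h.scale_eq z (hFZ hz)
    have key : ∀ w ∈ (I.filter fun i => g i = z).image x, ‖w - z‖ ≤ 3 * s z ∧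
        1.5 * s z ≤ ρ' w ∧ ρ' w ≤ 5 * s z := by
      intro w hw
      obtain ⟨i, hiF, rfl⟩ := Finset.mem_image.1 hw
      obtain ⟨hi, rfl⟩ := Finset.mem_filter.1 hiF
      obtain ⟨h1, h2, h3⟩ := hg i hi
      have h4 := hxy i hi
      have h5 := h.scale_eq _ (hy i hi)
      have h6 := hρ'.lip (x i) (y i)
      have h7 := hρ'.lip (y i) (x i)
      have h8 := hρ'.lip (g i) (y i)
      have h9 := norm_sub_le_norm_sub_add_norm_sub (x i) (y i) (g i)
      rw [norm_sub_rev] at h7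
      rw [norm_sub_rev (y i) (g i)] at h9
      refine ⟨by linarith, by linarith, by linarith⟩
    refine hK _ z (fun w hw => ?_) (fun w hw => ?_) (fun w hw => ?_) ?_
    · linarith [(key w hw).1]
    · linarith [(key w hw).2.1]
    · linarith [(key w hw).2.2]
    · intro w hw w' hw' e
      obtain ⟨i, hi, rfl⟩ := Finset.mem_image.1 hw
      obtain ⟨j, hj, rfl⟩ := Finset.mem_image.1 hw'
      rw [hx i (Finset.mem_filter.1 hi).1, hx j (Finset.mem_filter.1 hj).1] at e
      rw [e]
  calc δ * ∑ i ∈ I, s (y i) ^ n ≤ δ * ∑ i ∈ I, s (g i) ^ n := by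
        gcongr with i hi
        · exact (h.pos hρ (hy i hi)).le
        · exact (hg i hi).2.1
    _ = δ * ∑ z ∈ F, ((I.filter fun i => g i = z).card : ℝ) * s z ^ n := by
        rw [← Finset.sum_fiberwise_of_maps_to fun i hi => (hg i hi).1]
        congr 1
        refine Finset.sum_congr rfl fun z _ => ?_
        rw [← nsmul_eq_mul, ← Finset.sum_const]
        exact Finset.sum_congr rfl fun i hi => by rw [(Finset.mem_filter.1 hi).2]
    _ ≤ δ * ∑ z ∈ F, (K : ℝ) * s z ^ n := by
        gcongr with z hz
        · exact pow_nonneg (h.pos hρ (hFZ hz)).le _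
        · exact_mod_cast hcard z hz
    _ = K * (δ * ∑ z ∈ F, s z ^ n) := by
        rw [← Finset.mul_sum]
        ring
    _ ≤ K * (2 ^ n * ∑ x ∈ X, m x) := by
        refine mul_le_mul_of_nonneg_left (hF.trans (mul_le_mul_of_nonneg_left ?_ (by positivity)))
          (by positivity)
        exact Finset.sum_le_sum_of_subset_of_nonneg (Finset.filter_subset _ _) fun x _ _ => hm x
    _ = _ := by ring

end IsDenseScale

end Dense

section Bound

variable {E : Type*} [NormedAddCommGroup E] [InnerProductSpace ℝ E]
  {V : Type*} [NormedAddCommGroup V] [NormedSpace ℝ V]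
  {n j : ℕ} {P : E →ₗ[ℝ] V} {s₀ N Q : ℝ} {ρ ρ' m : E → ℝ} {X : Finset E}

/-- The Riesz energy of any weighted set of growth `1` with at most `j` points is controlled by `N`
times its mass and `Q` times its conical energy. -/
def EnergyBound (n : ℕ) (P : E →ₗ[ℝ] V) (s₀ : ℝ) (j : ℕ) (N Q : ℝ) : Prop :=
  ∀ (X : Finset E) (m ρ : E → ℝ), X.card ≤ j → (∀ x, 0 ≤ m x) → Growth n 1 ρ m X → IsScale ρ →
    rieszEnergy n ρ m X ≤ N * ∑ x ∈ X, m x + Q * coneEnergy n P s₀ ρ m X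

lemma EnergyBound.of_growth (h : EnergyBound n P s₀ j N Q) (hX : X.card ≤ j)
    (hm : ∀ x, 0 ≤ m x) (hρ : IsScale ρ) {c : ℝ} (hc : 0 < c) (hG : Growth n c ρ m X) :
    rieszEnergy n ρ m X ≤ c ^ 2 * N * ∑ x ∈ X, m x + c * Q * coneEnergy n P s₀ ρ m X := by
  have h1 := h X (fun x => c⁻¹ * m x) ρ hX (fun x => mul_nonneg (inv_nonneg.2 hc.le) (hm x))
    (fun x hx u hu => by
      rw [← Finset.mul_sum, inv_mul_le_iff₀ hc, one_mul]
      exact hG x hx u hu) hρ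
  have e1 : rieszEnergy n ρ (fun x => c⁻¹ * m x) X = (c⁻¹) ^ 3 * rieszEnergy n ρ m X := by
    rw [rieszEnergy, rieszEnergy, Finset.mul_sum]
    refine Finset.sum_congr rfl fun x _ => ?_
    have : riesz n ρ (fun x => c⁻¹ * m x) X x = c⁻¹ • riesz n ρ m X x := by
      rw [riesz, riesz, Finset.smul_sum]
      exact Finset.sum_congr rfl fun y _ => by rw [smul_smul]
    rw [this, norm_smul, Real.norm_of_nonneg (inv_nonneg.2 hc.le)]
    ring
  have e2 : coneEnergy n P s₀ ρ (fun x => c⁻¹ * m x) X = (c⁻¹) ^ 2 * coneEnergy n P s₀ ρ m X := by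
    rw [coneEnergy, coneEnergy, Finset.mul_sum]
    refine Finset.sum_congr rfl fun x _ => ?_
    have : conePot n P s₀ (fun x => c⁻¹ * m x) X (ρ x) x = c⁻¹ * conePot n P s₀ m X (ρ x) x := by
      rw [conePot, conePot, Finset.mul_sum]
      exact Finset.sum_congr rfl fun y _ => by rw [mul_assoc]
    rw [this]
    ring
  rw [e1, e2, ← Finset.mul_sum] at h1
  have h2 := mul_le_mul_of_nonneg_left h1 (pow_nonneg hc.le 3)
  have e3 : c ^ 3 * (c⁻¹ ^ 3 * rieszEnergy n ρ m X) = rieszEnergy n ρ m X := by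
    field_simp
  have e4 : c ^ 3 * (N * (c⁻¹ * ∑ x ∈ X, m x) + Q * (c⁻¹ ^ 2 * coneEnergy n P s₀ ρ m X)) =
      c ^ 2 * N * ∑ x ∈ X, m x + c * Q * coneEnergy n P s₀ ρ m X := by
    field_simp
  rwa [e3, e4] at h2

lemma energyBound_card_sq (hQ : 0 ≤ Q) : EnergyBound n P s₀ j (j ^ 2) Q := by
  intro X m ρ hX hm hG hρ
  have h1 : ∀ x ∈ X, ‖riesz n ρ m X x‖ ≤ j := fun x hx => by
    calc ‖riesz n ρ m X x‖ ≤ ∑ y ∈ X, 1 := by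
          refine (norm_sum_le _ _).trans (Finset.sum_le_sum fun y hy => ?_)
          have hs := sep_pos hρ.pos x y
          have hy' : y ∈ X.filter fun z => sep ρ x z ≤ sep ρ x y :=
            Finset.mem_filter.2 ⟨hy, le_rfl⟩
          have h2 : m y ≤ sep ρ x y ^ n :=
            (Finset.single_le_sum (f := m) (fun z _ => hm z) hy').trans
              ((hG x hx _ hs).trans_eq (one_mul _))
          rw [norm_smul, Real.norm_of_nonneg (hm y)]
          calc m y * ‖rk n ρ x y‖ ≤ sep ρ x y ^ n * (sep ρ x y ^ n)⁻¹ := by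
                gcongr
                exact norm_rk_le hρ.pos x y
            _ = 1 := mul_inv_cancel₀ (by positivity)
      _ = X.card := by simp
      _ ≤ j := by exact_mod_cast hX
  have h2 : 0 ≤ Q * coneEnergy n P s₀ ρ m X := mul_nonneg hQ (coneEnergy_nonneg hm)
  calc rieszEnergy n ρ m X ≤ ∑ x ∈ X, (j : ℝ) ^ 2 * m x := by
        refine Finset.sum_le_sum fun x hx => ?_
        rw [mul_comm]
        exact mul_le_mul_of_nonneg_right (pow_le_pow_left₀ (norm_nonneg _) (h1 x hx) 2) (hm x)
    _ ≤ _ := by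
        rw [← Finset.mul_sum]
        linarith

lemma coneEnergy_le_crossEnergy {ι : Type*} {c : E → ι} (hm : ∀ x, 0 ≤ m x)
    (hρ' : IsScale ρ') (hle : ∀ x, ρ x ≤ ρ' x)
    (hc : ∀ x z, c x = c z → ‖x - z‖ ≤ ρ' x / 10) :
    coneEnergy n P s₀ ρ' m X ≤ crossEnergy n P s₀ ρ m c X := by
  refine Finset.sum_le_sum fun x _ => mul_le_mul_of_nonneg_left
    (Finset.sum_le_sum_of_subset_of_nonneg (Finset.monotone_filter_right _ fun y _ hy => ?_)
      fun y _ _ => mul_nonneg (hm y) (inv_nonneg.2 (pow_nonneg (norm_nonneg _) _))) (hm x)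
  refine ⟨fun hcy => ?_, (hle x).trans hy.1, hy.2⟩
  linarith [hc x y hcy.symm, hρ'.pos x, hy.1]

lemma sum_coneEnergy_add_cross_le {ι : Type*} {c : E → ι} (hm : ∀ x, 0 ≤ m x) {I : Finset ι}
    (hI : I ⊆ X.image c) : ∑ i ∈ I, coneEnergy n P s₀ ρ m (X.filter fun y => c y = i) +
      crossEnergy n P s₀ ρ m c X ≤ coneEnergy n P s₀ ρ m X := by
  rw [coneEnergy_eq_sum_add_cross (n := n) (P := P) (c := c)]
  refine add_le_add_left (Finset.sum_le_sum_of_subset_of_nonneg hI fun i _ _ => ?_) _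
  exact coneEnergy_nonneg hm

end Bound

section Step

variable {k : ℕ} {V : Type*} [NormedAddCommGroup V] [NormedSpace ℝ V] [FiniteDimensional ℝ V]

lemma exists_rieszEnergy_le_of_ball (d : ℕ) (hV : Module.finrank ℝ V = k + 1) {s₀ : ℝ}
    (hs₀ : 0 < s₀) (hs₁ : s₀ ≤ 1) :
    ∃ C : ℝ, 0 ≤ C ∧ ∀ (P : EuclideanSpace ℝ (Fin d) →ₗ[ℝ] V)
      (J : V →ₗ[ℝ] EuclideanSpace ℝ (Fin d)), (∀ x, ‖P x‖ ≤ ‖x‖) → (∀ v, P (J v) = v) →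
      (∀ v, ‖J v‖ ≤ ‖v‖) → ∀ (δ τ : ℝ), 0 ≤ δ → 0 < τ → τ < δ * (s₀ / 128) ^ (k + 1) → τ ≤ 1 →
      ∀ (j : ℕ) (N N' Q : ℝ), 0 ≤ N' → N' ≤ N → N' ≤ τ * Q →
      EnergyBound (k + 1) P s₀ (j + 1) N Q → EnergyBound (k + 1) P s₀ j N' Q →
      ∀ (X : Finset (EuclideanSpace ℝ (Fin d))) (m ρ : EuclideanSpace ℝ (Fin d) → ℝ) (r : ℝ)
      (x₀ : EuclideanSpace ℝ (Fin d)), X.card ≤ j + 1 → (∀ x, 0 ≤ m x) → x₀ ∈ X →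
      (∀ x ∈ X, ‖x - x₀‖ ≤ r) → (∀ x ∈ X, ρ x ≤ r) → Growth (k + 1) 1 ρ m X → IsScale ρ →
      rieszEnergy (k + 1) ρ m X ≤
        C * (δ * N + 1) * r ^ (k + 1) + Q * coneEnergy (k + 1) P s₀ ρ m X := by
  obtain ⟨C, hC, htree⟩ := exists_tree_decomposition d hV hs₀ hs₁
  refine ⟨C, hC, ?_⟩
  intro P J hP hPJ hJ δ τ hδ hτ0 hτ hτ1 j N N' Q hN' hNN' hQ hbN hbN' X m ρ r x₀ hXj hm hx₀ hX hρr
    hG hρ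
  have hQ0 : 0 ≤ Q := by
    by_contra! hQ0
    linarith [mul_neg_of_pos_of_neg hτ0 hQ0]
  have hr : 0 < r := (hρ.pos x₀).trans_le (hρr x₀ hx₀)
  obtain ⟨ι, c, I, hI, h1, h2⟩ := htree P J hP hPJ hJ X m ρ δ τ r x₀ hδ hτ0 hτ hτ1 hm hx₀ hX hρr
    hG hρ
  have hcross := crossEnergy_nonneg (n := k + 1) (P := P) (s₀ := s₀) (ρ := ρ) (c := c) (X := X) hm
  have hsub := sum_coneEnergy_add_cross_le (n := k + 1) (P := P) (s₀ := s₀) (ρ := ρ) hm hI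
  have hQsub := mul_le_mul_of_nonneg_left hsub hQ0
  have hgr : ∀ i, Growth (k + 1) 1 ρ m (X.filter fun y => c y = i) := fun i =>
    hG.subset hm (Finset.filter_subset _ _)
  have hnn : 0 ≤ C * δ * r ^ (k + 1) := by positivity
  by_cases hfull : ∃ i ∈ I, (X.filter fun y => c y = i) = X
  · obtain ⟨i₀, -, hi₀⟩ := hfull
    have hci : ∀ x ∈ X, c x = i₀ := Finset.filter_eq_self.1 hi₀
    have h0 : crossEnergy (k + 1) P s₀ ρ m c X = 0 := by
      refine Finset.sum_eq_zero fun x hx => ?_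
      rw [Finset.filter_false_of_mem, Finset.sum_empty, mul_zero]
      intro y hy h
      exact h.1 ((hci y hy).trans (hci x hx).symm)
    have h3 : ∑ i ∈ I, rieszEnergy (k + 1) ρ m (X.filter fun y => c y = i) ≤
        N * ∑ i ∈ I, ∑ x ∈ X with c x = i, m x +
          Q * ∑ i ∈ I, coneEnergy (k + 1) P s₀ ρ m (X.filter fun y => c y = i) := by
      rw [Finset.mul_sum, Finset.mul_sum, ← Finset.sum_add_distrib]
      exact Finset.sum_le_sum fun i _ => hbN _ m ρ ((Finset.card_filter_le _ _).trans hXj) hm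
        (hgr i) hρ
    rw [h0, mul_zero, add_zero] at h2
    have h4 := mul_le_mul_of_nonneg_left h2 (hN'.trans hNN')
    rw [h0, add_zero] at hQsub
    linarith
  · push Not at hfull
    have h3 : ∑ i ∈ I, rieszEnergy (k + 1) ρ m (X.filter fun y => c y = i) ≤
        N' * ∑ i ∈ I, ∑ x ∈ X with c x = i, m x +
          Q * ∑ i ∈ I, coneEnergy (k + 1) P s₀ ρ m (X.filter fun y => c y = i) := by
      rw [Finset.mul_sum, Finset.mul_sum, ← Finset.sum_add_distrib]
      refine Finset.sum_le_sum fun i hi => hbN' _ m ρ ?_ hm (hgr i) hρ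
      have := Finset.card_lt_card ((Finset.filter_subset (fun y => c y = i) X).ssubset_of_ne
        (hfull i hi))
      omega
    have h4 := mul_le_mul_of_nonneg_left h2 hN'
    have h5 : N' * (τ⁻¹ * crossEnergy (k + 1) P s₀ ρ m c X) ≤
        Q * crossEnergy (k + 1) P s₀ ρ m c X := by
      rw [← mul_assoc]
      refine mul_le_mul_of_nonneg_right ?_ hcross
      rw [← div_eq_mul_inv, div_le_iff₀ hτ0]
      linarith
    have h6 : N' * (C * δ * r ^ (k + 1)) ≤ N * (C * δ * r ^ (k + 1)) := by gcongr
    linarith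

end Step

section Iteration

variable {k : ℕ} {V : Type*} [NormedAddCommGroup V] [NormedSpace ℝ V] [FiniteDimensional ℝ V]

lemma exists_energyBound_step (d : ℕ) (hV : Module.finrank ℝ V = k + 1) {s₀ : ℝ}
    (hs₀ : 0 < s₀) (hs₁ : s₀ ≤ 1) :
    ∃ θ C τ : ℝ, 0 ≤ θ ∧ θ < 1 ∧ 0 ≤ C ∧ 0 < τ ∧ ∀ (P : EuclideanSpace ℝ (Fin d) →ₗ[ℝ] V)
      (J : V →ₗ[ℝ] EuclideanSpace ℝ (Fin d)), (∀ x, ‖P x‖ ≤ ‖x‖) → (∀ v, P (J v) = v) →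
      (∀ v, ‖J v‖ ≤ ‖v‖) → ∀ (j : ℕ) (N N' Q : ℝ), 0 ≤ N' → N' ≤ N → N' ≤ τ * Q →
      EnergyBound (k + 1) P s₀ (j + 1) N Q → EnergyBound (k + 1) P s₀ j N' Q →
      EnergyBound (k + 1) P s₀ (j + 1) (θ * N + C) Q := by
  obtain ⟨C₁, hC₁, hsplit⟩ := exists_rieszEnergy_split d (k + 1)
  obtain ⟨C₂, hC₂, hball⟩ := exists_rieszEnergy_le_of_ball d hV hs₀ hs₁
  set n := k + 1 with hn
  set K : ℝ := ((packConst d 3 : ℕ) : ℝ) with hK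
  set κ : ℝ := (1 + 14 ^ n)⁻¹ with hκ
  have hκ0 : 0 < κ := by positivity
  have hκ1 : κ ≤ 1 := inv_le_one_of_one_le₀
      (by linarith [pow_pos (show (0 : ℝ) < 14 by norm_num) n])
  set b : ℝ := κ / (4 * C₁) with hb
  have hb0 : 0 < b := by positivity
  have hC₁b : C₁ * b = κ / 4 := by
    rw [hb]
    field_simp
  have hb1 : b ≤ 1 := by nlinarith
  set δ₁ : ℝ := b / 2 ^ n with hδ₁
  have hδ₁0 : 0 < δ₁ := by positivity
  set A : ℝ := C₂ * 6 ^ n * (K * 2 ^ n) / δ₁ with hA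
  have hA0 : 0 ≤ A := by positivity
  set δ₂ : ℝ := κ / (4 * (A + 1)) with hδ₂
  have hδ₂0 : 0 < δ₂ := by positivity
  have hAδ : A * δ₂ ≤ κ / 4 := by
    rw [hδ₂, mul_div_assoc', div_le_div_iff₀ (by positivity) (by positivity)]
    nlinarith
  set τ : ℝ := min (δ₂ * (s₀ / 128) ^ n / 2) 1 with hτ
  have hτ0 : 0 < τ := lt_min (by positivity) one_pos
  have hτlt : τ < δ₂ * (s₀ / 128) ^ n :=
    (min_le_left _ _).trans_lt (half_lt_self (by positivity))
  have hτ1 : τ ≤ 1 := min_le_right _ _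
  refine ⟨1 - κ / 2, C₁ + 36 ^ n + A, τ, by linarith, by linarith, by positivity, hτ0, ?_⟩
  intro P J hP hPJ hJ j N N' Q hN' hNN' hQ hbN hbN' X m ρ hXj hm hG hρ
  have hN : 0 ≤ N := hN'.trans hNN'
  have hQ0 : 0 ≤ Q := by
    by_contra! hQ0
    linarith [mul_neg_of_pos_of_neg hτ0 hQ0]
  obtain ⟨Z, s, ρ', hρ', hle, hG', hD⟩ := exists_isDenseScale (n := n) (Nat.succ_ne_zero k) hδ₁0
    hρ hm X
  rw [show 2 ^ n * δ₁ = b by rw [hδ₁]; field_simp] at hG'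
  obtain ⟨ι, c, hc, hΦ, hpack⟩ := hsplit ρ ρ' m X hG hm hρ hρ' hle
  set M := ∑ x ∈ X, m x with hM
  have hM0 : 0 ≤ M := Finset.sum_nonneg fun x _ => hm x
  have hΦ' := hbN.of_growth hXj hm hρ' hb0 hG'
  have hcr := coneEnergy_le_crossEnergy (n := n) (P := P) (s₀ := s₀) (X := X) hm hρ' hle hc
  have hcross := crossEnergy_nonneg (n := n) (P := P) (s₀ := s₀) (ρ := ρ) (c := c) (X := X) hm
  have h1 : C₁ * rieszEnergy n ρ' m X ≤ κ / 4 * N * M + Q * crossEnergy n P s₀ ρ m c X := by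
    have e1 : C₁ * rieszEnergy n ρ' m X ≤
        C₁ * (b ^ 2 * N * M + b * Q * coneEnergy n P s₀ ρ' m X) := by gcongr
    have e2 : C₁ * (b ^ 2 * N * M + b * Q * coneEnergy n P s₀ ρ' m X) =
        κ / 4 * (b * (N * M)) + κ / 4 * (Q * coneEnergy n P s₀ ρ' m X) := by
      rw [← hC₁b]
      ring
    have e3 : b * (N * M) ≤ N * M := mul_le_of_le_one_left (by positivity) hb1
    have e4 : Q * coneEnergy n P s₀ ρ' m X ≤ Q * crossEnergy n P s₀ ρ m c X := by gcongr
    have e5 : 0 ≤ Q * crossEnergy n P s₀ ρ m c X := by positivity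
    nlinarith
  set core : EuclideanSpace ℝ (Fin d) → Prop := fun x => ∃ y ∈ Z, ‖x - y‖ ≤ s y with hcore
  set piece : ι → Finset (EuclideanSpace ℝ (Fin d)) := fun i => X.filter fun y => c y = i
    with hpiece
  set Ia := (X.image c).filter fun i => ∃ x ∈ piece i, core x with hIa
  set Ic := (X.image c).filter fun i => ∀ x ∈ piece i, ¬ core x ∧ ρ x < ρ' x with hIc
  have hexy : ∀ i, ∃ xy : EuclideanSpace ℝ (Fin d) × EuclideanSpace ℝ (Fin d), i ∈ Ia →
      xy.1 ∈ piece i ∧ xy.2 ∈ Z ∧ ‖xy.1 - xy.2‖ ≤ s xy.2 := fun i => by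
    by_cases hi : i ∈ Ia
    · obtain ⟨x, hx, y, hy, hxy⟩ := (Finset.mem_filter.1 hi).2
      exact ⟨(x, y), fun _ => ⟨hx, hy, hxy⟩⟩
    · exact ⟨(0, 0), fun h => absurd h hi⟩
  choose xy hxy using hexy
  have hgr : ∀ i, Growth n 1 ρ m (piece i) := fun i => hG.subset hm (Finset.filter_subset _ _)
  have hcard : ∀ i, (piece i).card ≤ j + 1 := fun i => (Finset.card_filter_le _ _).trans hXj
  have hmp : ∀ i, 0 ≤ ∑ x ∈ piece i, m x := fun i => Finset.sum_nonneg fun x _ => hm x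
  have hen : ∀ i, 0 ≤ Q * coneEnergy n P s₀ ρ m (piece i) := fun i =>
    mul_nonneg hQ0 (coneEnergy_nonneg hm)
  have hs : ∀ y ∈ Z, 0 < s y := fun y hy => hD.pos hρ hy
  have hpt : ∀ i ∈ X.image c, rieszEnergy n ρ m (piece i) ≤
      Q * coneEnergy n P s₀ ρ m (piece i) + 36 ^ n * ∑ x ∈ piece i, m x +
        (if i ∈ Ia then C₂ * (δ₂ * N + 1) * (6 * s (xy i).2) ^ n else 0) +
        (if i ∈ Ic then N * ∑ x ∈ piece i, m x else 0) := by
    intro i hi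
    have e0 : 0 ≤ 36 ^ n * ∑ x ∈ piece i, m x := mul_nonneg (by positivity) (hmp i)
    have e1 : 0 ≤ if i ∈ Ic then N * ∑ x ∈ piece i, m x else 0 := by
      split_ifs
      · exact mul_nonneg hN (hmp i)
      · exact le_rfl
    by_cases hia : i ∈ Ia
    · obtain ⟨hx, hy, hle'⟩ := hxy i hia
      have hsy := hs _ hy
      have h4 := hD.scale_eq _ hy
      have hxi := (Finset.mem_filter.1 hx).2
      have hdist : ∀ z ∈ piece i, ‖z - (xy i).1‖ ≤ s (xy i).2 / 2 := fun z hz => by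
        have e2 := hc (xy i).1 z (hxi.trans (Finset.mem_filter.1 hz).2.symm)
        rw [norm_sub_rev]
        linarith [hρ'.lip (xy i).1 (xy i).2]
      have := hball P J hP hPJ hJ δ₂ τ hδ₂0.le hτ0 hτlt hτ1 j N N' Q hN' hNN' hQ hbN hbN'
        (piece i) m ρ (6 * s (xy i).2) (xy i).1 (hcard i) hm hx
        (fun z hz => (hdist z hz).trans (by linarith))
        (fun z hz => by
          linarith [hle z, hρ'.lip z (xy i).1, hρ'.lip (xy i).1 (xy i).2, hdist z hz])
        (hgr i) hρ
      rw [if_pos hia]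
      linarith
    · rw [if_neg hia]
      by_cases hic : i ∈ Ic
      · rw [if_pos hic]
        linarith [hbN (piece i) m ρ (hcard i) hm (hgr i) hρ]
      · have hnc : ∀ x ∈ piece i, ¬ core x := fun x hx h =>
          hia (Finset.mem_filter.2 ⟨hi, x, hx, h⟩)
        have : ∃ x ∈ piece i, ρ' x ≤ ρ x := by
          by_contra! h
          exact hic (Finset.mem_filter.2 ⟨hi, fun x hx => ⟨hnc x hx, h x hx⟩⟩)
        obtain ⟨x, hx, hxρ⟩ := this
        have := rieszEnergy_le_of_small hG hm hρ (Finset.filter_subset _ _) hx fun z hz =>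
          (hc x z ((Finset.mem_filter.1 hx).2.trans (Finset.mem_filter.1 hz).2.symm)).trans
            (by linarith)
        linarith [hen i]
  have hsum := Finset.sum_le_sum hpt
  rw [Finset.sum_add_distrib, Finset.sum_add_distrib, Finset.sum_add_distrib, ← Finset.mul_sum,
    ← Finset.mul_sum, Finset.sum_ite_mem, Finset.sum_ite_mem,
    Finset.inter_eq_right.2 (Finset.filter_subset _ _),
    Finset.inter_eq_right.2 (Finset.filter_subset _ _), sum_image_fiber, ← hM] at hsum
  have hIa_le : ∑ i ∈ Ia, C₂ * (δ₂ * N + 1) * (6 * s (xy i).2) ^ n ≤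
      A * (δ₂ * N + 1) * M := by
    have e1 := hD.sum_pow_le_of_packing hρ hρ' hδ₁0 hm (c := c) (K := packConst d 3)
      (fun F x a1 a2 a3 a4 => hpack 3 (by norm_num) F x (by exact_mod_cast a1)
        (by exact_mod_cast a2) (by exact_mod_cast a3) a4) Ia (fun i => (xy i).1)
      (fun i => (xy i).2) (fun i hi => (Finset.mem_filter.1 (hxy i hi).1).2)
      (fun i hi => (hxy i hi).2.1) (fun i hi => (hxy i hi).2.2)
    rw [← hK, ← hM] at e1
    have e2 : ∑ i ∈ Ia, s (xy i).2 ^ n ≤ K * 2 ^ n * M / δ₁ := by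
      rw [le_div_iff₀ hδ₁0]
      linarith
    calc ∑ i ∈ Ia, C₂ * (δ₂ * N + 1) * (6 * s (xy i).2) ^ n
        = C₂ * (δ₂ * N + 1) * 6 ^ n * ∑ i ∈ Ia, s (xy i).2 ^ n := by
          rw [Finset.mul_sum]
          exact Finset.sum_congr rfl fun i _ => by rw [mul_pow]; ring
      _ ≤ C₂ * (δ₂ * N + 1) * 6 ^ n * (K * 2 ^ n * M / δ₁) := by gcongr
      _ = _ := by
          rw [hA]
          ring
  have hIc_le : ∑ i ∈ Ic, N * ∑ x ∈ piece i, m x ≤ (1 - κ) * N * M := by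
    rw [← Finset.mul_sum]
    have e0 : ∑ i ∈ Ic, ∑ x ∈ piece i, m x = ∑ x ∈ X with c x ∈ Ic, m x := by
      rw [← Finset.sum_fiberwise_of_maps_to (s := X.filter fun x => c x ∈ Ic) (t := Ic) (g := c)
        fun x hx => (Finset.mem_filter.1 hx).2]
      refine Finset.sum_congr rfl fun i hi => Finset.sum_congr ?_ fun _ _ => rfl
      rw [Finset.filter_filter]
      exact Finset.filter_congr fun x _ => ⟨fun h => ⟨h ▸ hi, h⟩, fun h => h.2⟩
    have hmem : ∀ x ∈ X, c x ∈ Ic → ¬ core x ∧ ρ x < ρ' x := fun x hx hxc =>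
      (Finset.mem_filter.1 hxc).2 x (Finset.mem_filter.2 ⟨hx, rfl⟩)
    have e1 : ∑ x ∈ X with c x ∈ Ic, m x ≤ ∑ x ∈ X with ρ x < ρ' x, m x := by
      refine Finset.sum_le_sum_of_subset_of_nonneg (fun x hx => ?_) fun x _ _ => hm x
      obtain ⟨hx, hxc⟩ := Finset.mem_filter.1 hx
      exact Finset.mem_filter.2 ⟨hx, (hmem x hx hxc).2⟩
    have e2 := hD.sum_stopped_le hρ hδ₁0 hm
    have e3 : ∑ x ∈ X with c x ∈ Ic, m x ≤ ∑ x ∈ X with ¬ core x, m x := by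
      refine Finset.sum_le_sum_of_subset_of_nonneg (fun x hx => ?_) fun x _ _ => hm x
      obtain ⟨hx, hxc⟩ := Finset.mem_filter.1 hx
      exact Finset.mem_filter.2 ⟨hx, (hmem x hx hxc).1⟩
    have e4 : ∑ x ∈ X with core x, m x + ∑ x ∈ X with ¬ core x, m x = M :=
      Finset.sum_filter_add_sum_filter_not _ _ _
    have e5 : ∑ x ∈ X with c x ∈ Ic, m x ≤ (1 - κ) * M := by
      have e6 : (1 - κ) = κ * 14 ^ n := by
        rw [hκ]
        field_simp
        ring
      have e7 : (1 + 14 ^ n) * ∑ x ∈ X with c x ∈ Ic, m x ≤ 14 ^ n * M := by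
        rw [← e4]
        have e8 := mul_le_mul_of_nonneg_left e3 (by positivity : (0 : ℝ) ≤ 14 ^ n)
        linarith
      rw [e6, mul_assoc, hκ, inv_mul_eq_div, le_div_iff₀ (by positivity)]
      linarith
    rw [e0]
    calc N * ∑ x ∈ X with c x ∈ Ic, m x ≤ N * ((1 - κ) * M) := by gcongr
      _ = _ := by ring
  have hcone := coneEnergy_eq_sum_add_cross (n := n) (P := P) (s₀ := s₀) (ρ := ρ) (m := m)
    (c := c) (X := X)
  have e1 : A * (δ₂ * N + 1) * M ≤ κ / 4 * (N * M) + A * M := by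
    have := mul_le_mul_of_nonneg_right hAδ (mul_nonneg hN hM0)
    linarith
  rw [hcone]
  linarith

lemma exists_energyBound (d : ℕ) (hV : Module.finrank ℝ V = k + 1) {s₀ : ℝ}
    (hs₀ : 0 < s₀) (hs₁ : s₀ ≤ 1) :
    ∃ C : ℝ, 0 ≤ C ∧ ∀ (P : EuclideanSpace ℝ (Fin d) →ₗ[ℝ] V)
      (J : V →ₗ[ℝ] EuclideanSpace ℝ (Fin d)), (∀ x, ‖P x‖ ≤ ‖x‖) → (∀ v, P (J v) = v) →
      (∀ v, ‖J v‖ ≤ ‖v‖) → ∀ j, EnergyBound (k + 1) P s₀ j C C := by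
  obtain ⟨θ, C, τ, hθ0, hθ1, hC, hτ, hstep⟩ := exists_energyBound_step d hV hs₀ hs₁
  set N := C / (1 - θ) with hN
  have h1θ : 0 < 1 - θ := by linarith
  have hN0 : 0 ≤ N := by positivity
  have hNC : θ * N + C = N := by
    rw [hN]
    field_simp
    ring
  set Q := N / τ with hQ
  have hQ0 : 0 ≤ Q := by positivity
  have hNQ : N ≤ τ * Q := by
    rw [hQ]
    field_simp
    exact le_rfl
  refine ⟨max N Q, hN0.trans (le_max_left _ _), fun P J hP hPJ hJ j => ?_⟩
  have main : EnergyBound (k + 1) P s₀ j N Q := by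
    induction j with
    | zero =>
      intro X m ρ hX hm _ _
      rw [Nat.le_zero, Finset.card_eq_zero] at hX
      subst hX
      simp [rieszEnergy, coneEnergy]
    | succ j ih =>
      have hiter : ∀ i : ℕ,
          EnergyBound (k + 1) P s₀ (j + 1) (N + θ ^ i * ((j + 1 : ℕ) : ℝ) ^ 2) Q := by
        intro i
        induction i with
        | zero =>
          intro X m ρ hX hm hG hρ
          refine (energyBound_card_sq (P := P) (s₀ := s₀) hQ0 X m ρ hX hm hG hρ).trans ?_
          have := Finset.sum_nonneg fun x (_ : x ∈ X) => hm x
          gcongr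
          simpa using hN0
        | succ i ihi =>
          have := hstep P J hP hPJ hJ j _ N Q hN0
            (le_add_of_nonneg_right (by positivity)) hNQ ihi ih
          rwa [show θ * (N + θ ^ i * ((j + 1 : ℕ) : ℝ) ^ 2) + C =
            N + θ ^ (i + 1) * ((j + 1 : ℕ) : ℝ) ^ 2 by linear_combination hNC] at this
      intro X m ρ hX hm hG hρ
      have hlim : Tendsto (fun i : ℕ => (N + θ ^ i * ((j + 1 : ℕ) : ℝ) ^ 2) * ∑ x ∈ X, m x +
          Q * coneEnergy (k + 1) P s₀ ρ m X) atTop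
          (𝓝 ((N + 0 * ((j + 1 : ℕ) : ℝ) ^ 2) * ∑ x ∈ X, m x +
            Q * coneEnergy (k + 1) P s₀ ρ m X)) :=
        (((tendsto_pow_atTop_nhds_zero_of_lt_one hθ0 hθ1).mul_const _).const_add _
          |>.mul_const _).add_const _
      rw [zero_mul, add_zero] at hlim
      exact ge_of_tendsto' hlim fun i => hiter i X m ρ hX hm hG hρ
  intro X m ρ hX hm hG hρ
  refine (main X m ρ hX hm hG hρ).trans ?_
  have h1 := Finset.sum_nonneg fun x (_ : x ∈ X) => hm x
  have h2 := coneEnergy_nonneg (n := k + 1) (P := P) (s₀ := s₀) (ρ := ρ) (X := X) hm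
  gcongr
  · exact le_max_left _ _
  · exact le_max_right _ _

end Iteration

/-! ### Discretisation of finite measures -/

lemma exists_simpleFunc_dist_lt {E : Type*} [PseudoMetricSpace E] [MeasurableSpace E]
    [OpensMeasurableSpace E] [SecondCountableTopology E] [Nonempty E] (μ : Measure E)
    [IsFiniteMeasure μ] {η : ℝ} (hη : 0 < η) {κ : ℝ≥0∞} (hκ : 0 < κ) :
    ∃ c : SimpleFunc E E, μ {x | ¬ dist (c x) x < η} ≤ κ := by
  set e := TopologicalSpace.denseSeq E
  set A : ℕ → Set E := fun N => {x | ∀ k ≤ N, η ≤ dist (e k) x} with hA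
  have hanti : Antitone A := fun N N' h x hx k hk => hx k (hk.trans h)
  have hclosed : ∀ N, IsClosed (A N) := fun N => by
    simp only [hA, ofPred_forall]
    exact isClosed_biInter fun k _ => isClosed_le continuous_const (by fun_prop)
  have hempty : ⋂ N, A N = ∅ := by
    refine Set.eq_empty_of_forall_notMem fun x hx => ?_
    obtain ⟨k, hk⟩ := (TopologicalSpace.denseRange_denseSeq E).exists_dist_lt x hη
    have := Set.mem_iInter.1 hx k k le_rfl
    rw [dist_comm] at hk
    exact absurd hk (not_lt.2 this)
  have hlim := tendsto_measure_iInter_atTop (μ := μ) (fun N => (hclosed N).nullMeasurableSet) hanti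
    ⟨0, measure_ne_top _ _⟩
  rw [hempty, measure_empty] at hlim
  obtain ⟨N, hN⟩ := (hlim.eventually (gt_mem_nhds hκ)).exists
  refine ⟨SimpleFunc.nearestPt e N, (measure_mono fun x hx k hk => ?_).trans hN.le⟩
  have h1 := SimpleFunc.edist_nearestPt_le e x hk
  rw [edist_dist, edist_dist, ENNReal.ofReal_le_ofReal_iff dist_nonneg] at h1
  exact (not_lt.1 hx).trans h1

section SimpleFunc

variable {α β : Type*} [MeasurableSpace α] {ν : Measure α} (c : SimpleFunc α β)

lemma lintegral_comp_simpleFunc (f : β → ℝ≥0∞) :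
    ∫⁻ x, f (c x) ∂ν = ∑ z ∈ c.range, f z * ν (c ⁻¹' {z}) := by
  rw [← SimpleFunc.map_lintegral]
  exact SimpleFunc.lintegral_eq_lintegral (c.map f) ν

lemma integral_comp_simpleFunc [IsFiniteMeasure ν] {F : Type*} [NormedAddCommGroup F]
    [NormedSpace ℝ F] [CompleteSpace F] (f : β → F) :
    ∫ x, f (c x) ∂ν = ∑ z ∈ c.range, ν.real (c ⁻¹' {z}) • f z := by
  have h1 : ∀ x, f (c x) = ∑ z ∈ c.range, (c ⁻¹' {z}).indicator (fun _ => f z) x := fun x => by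
    rw [Finset.sum_eq_single (c x)]
    · rw [Set.indicator_of_mem (by simp)]
    · intro z _ hz
      exact Set.indicator_of_notMem (fun h => hz (by simpa using h.symm)) _
    · intro h
      exact absurd (SimpleFunc.mem_range_self c x) h
  simp_rw [h1]
  refine (integral_finsetSum _ fun z _ =>
    (integrable_const _).indicator (c.measurableSet_fiber z)).trans ?_
  exact Finset.sum_congr rfl fun z _ => integral_indicator_const _ (c.measurableSet_fiber z)

end SimpleFunc

section Discrete

variable {E : Type*} [NormedAddCommGroup E] [InnerProductSpace ℝ E] [FiniteDimensional ℝ E]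
  [MeasurableSpace E] [BorelSpace E] {n : ℕ} {ε c₀ η : ℝ} {μ : Measure E} [IsFiniteMeasure μ]

lemma isScale_const (hε : 0 < ε) : IsScale fun _ : E => ε :=
  ⟨fun _ => hε, fun x y => by linarith [norm_nonneg (x - y)]⟩

lemma continuous_rk_const (hε : 0 < ε) (x : E) : Continuous (rk n (fun _ => ε) x) := by
  have h : ∀ y : E, max ‖x - y‖ (ε + ε) ^ (n + 1) ≠ 0 := fun y =>
    (pow_pos (lt_max_of_lt_right (by linarith)) _).ne'
  unfold rk sep
  fun_prop (disch := exact h _)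

lemma norm_rk_const_le (hε : 0 < ε) (x y : E) : ‖rk n (fun _ => ε) x y‖ ≤ (ε ^ n)⁻¹ := by
  refine (norm_rk_le (fun _ => hε) x y).trans (inv_anti₀ (by positivity)
    (pow_le_pow_left₀ hε.le ?_ _))
  have : ε + ε ≤ sep (fun _ => ε) x y := le_max_right _ _
  linarith

lemma integrable_rk_const (hε : 0 < ε) (x : E) : Integrable (rk n (fun _ => ε) x) μ :=
  Integrable.of_bound (continuous_rk_const hε x).aestronglyMeasurable (ε ^ n)⁻¹
    (Eventually.of_forall (norm_rk_const_le hε x))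

lemma norm_inv_pow_smul_le {x y : E} (hε : 0 < ε) (h : ε ≤ ‖x - y‖) :
    ‖(‖x - y‖ ^ (n + 1))⁻¹ • (x - y)‖ ≤ (ε ^ n)⁻¹ := by
  have h0 : 0 < ‖x - y‖ := hε.trans_le h
  rw [norm_smul, norm_inv, norm_pow, norm_norm, pow_succ, mul_inv, mul_assoc,
    inv_mul_cancel₀ h0.ne', mul_one]
  exact inv_anti₀ (by positivity) (pow_le_pow_left₀ hε.le h _)

lemma norm_setIntegral_le_measureReal (hε : 0 < ε) (x : E) :
    ‖∫ y in {y | ε < dist x y}, (‖x - y‖ ^ (n + 1))⁻¹ • (x - y) ∂μ‖ ≤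
      (ε ^ n)⁻¹ * μ.real Set.univ := by
  refine (norm_setIntegral_le_of_norm_le_const (measure_lt_top _ _) fun y hy => ?_).trans
    (mul_le_mul_of_nonneg_left (measureReal_mono (Set.subset_univ _)) (by positivity))
  refine norm_inv_pow_smul_le hε (le_of_lt ?_)
  rw [← dist_eq_norm]
  exact hy

lemma norm_setIntegral_sub_integral_rk_le (hε : 0 < ε) (hc₀ : 0 ≤ c₀)
    (hμ : ∀ (x : E) (r : ℝ), 0 < r → μ (ball x r) ≤ ENNReal.ofReal (c₀ * r ^ n)) (x : E) :
    ‖(∫ y in {y | ε < dist x y}, (‖x - y‖ ^ (n + 1))⁻¹ • (x - y) ∂μ) -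
      ∫ y, rk n (fun _ => ε) x y ∂μ‖ ≤ 2 * 3 ^ n * c₀ := by
  have hmeas : MeasurableSet {y : E | ε < dist x y} :=
    (isOpen_lt continuous_const (by fun_prop)).measurableSet
  have h_int : Integrable ({y : E | ε < dist x y}.indicator
      fun y => (‖x - y‖ ^ (n + 1))⁻¹ • (x - y)) μ := by
    refine Integrable.of_bound (Measurable.aestronglyMeasurable ?_) (ε ^ n)⁻¹
      (Eventually.of_forall fun y => ?_)
    · refine Measurable.indicator ?_ hmeas
      fun_prop
    · by_cases hy : y ∈ {y : E | ε < dist x y}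
      · rw [Set.indicator_of_mem hy]
        refine norm_inv_pow_smul_le hε (le_of_lt ?_)
        rw [← dist_eq_norm]
        exact hy
      · rw [Set.indicator_of_notMem hy, norm_zero]
        positivity
  rw [← integral_indicator hmeas, ← integral_sub h_int (integrable_rk_const hε x)]
  have hbound : ∀ y, ‖{y : E | ε < dist x y}.indicator
      (fun y => (‖x - y‖ ^ (n + 1))⁻¹ • (x - y)) y - rk n (fun _ => ε) x y‖ ≤
        (ball x (3 * ε)).indicator (fun _ => 2 * (ε ^ n)⁻¹) y := fun y => by
    by_cases hy : y ∈ ball x (3 * ε)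
    · rw [Set.indicator_of_mem hy]
      refine (norm_sub_le _ _).trans ?_
      have h1 := norm_rk_const_le (n := n) hε x y
      by_cases hy' : y ∈ {y : E | ε < dist x y}
      · rw [Set.indicator_of_mem hy']
        have h2 := norm_inv_pow_smul_le (n := n) hε
          (show ε ≤ ‖x - y‖ by rw [← dist_eq_norm]; exact le_of_lt hy')
        linarith
      · rw [Set.indicator_of_notMem hy', norm_zero]
        have : 0 < (ε ^ n)⁻¹ := by positivity
        linarith
    · rw [Set.indicator_of_notMem hy]
      rw [mem_ball, dist_comm, not_lt] at hy
      have hmem : y ∈ {y : E | ε < dist x y} := show ε < dist x y by linarith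
      rw [Set.indicator_of_mem hmem, rk, sep, max_eq_left, sub_self,
        norm_zero]
      rw [← dist_eq_norm]
      linarith
  have h3 := norm_integral_le_of_norm_le (μ := μ)
    ((integrable_const (2 * (ε ^ n)⁻¹)).indicator measurableSet_ball) (Eventually.of_forall hbound)
  refine h3.trans ?_
  rw [integral_indicator_const _ measurableSet_ball, smul_eq_mul]
  have h4 : μ.real (ball x (3 * ε)) ≤ c₀ * (3 * ε) ^ n :=
    ENNReal.toReal_le_of_le_ofReal (by positivity) (hμ x _ (by positivity))
  calc μ.real (ball x (3 * ε)) * (2 * (ε ^ n)⁻¹)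
      ≤ c₀ * (3 * ε) ^ n * (2 * (ε ^ n)⁻¹) := by gcongr
    _ = 2 * 3 ^ n * c₀ := by
        rw [mul_pow]
        field_simp

end Discrete

/-! ### Passing to a discrete approximation of a finite measure -/

/-- The mass which the restriction of `μ` to `G` gives to the fibre of `c` over `z`. -/
noncomputable def fiberMass {E : Type*} [MeasurableSpace E] (μ : Measure E) (G : Set E)
    (c : SimpleFunc E E) (z : E) : ℝ :=
  (μ.restrict G).real (c ⁻¹' {z})

section Approximation

variable {E : Type*} [NormedAddCommGroup E] [InnerProductSpace ℝ E] [FiniteDimensional ℝ E]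
  [MeasurableSpace E] [BorelSpace E] {n : ℕ} {ε c₀ η : ℝ} {μ : Measure E} [IsFiniteMeasure μ]
  {c : SimpleFunc E E} {G : Set E}

lemma fiberMass_nonneg (z : E) : 0 ≤ fiberMass μ G c z := measureReal_nonneg

lemma sum_fiberMass_le (X : Finset E) : ∑ z ∈ X, fiberMass μ G c z ≤ μ.real Set.univ := by
  refine (sum_measureReal_preimage_singleton X fun z _ => c.measurableSet_fiber z).trans_le ?_
  refine (measureReal_mono (Set.subset_univ _)).trans ?_
  rw [measureReal_restrict_apply_univ]
  exact measureReal_mono (Set.subset_univ _)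

lemma growth_fiberMass (hε : 0 < ε) (hηε : η ≤ ε) (hc₀ : 0 ≤ c₀)
    (hG : ∀ x ∈ G, dist (c x) x < η)
    (hμ : ∀ (x : E) (r : ℝ), 0 < r → μ (ball x r) ≤ ENNReal.ofReal (c₀ * r ^ n)) :
    Growth n (2 ^ n * c₀) (fun _ => ε) (fiberMass μ G c) c.range := by
  intro x _ u hu
  rcases lt_or_ge u (2 * ε) with h | h
  · rw [Finset.filter_false_of_mem, Finset.sum_empty]
    · positivity
    · intro y _
      have : ε + ε ≤ sep (fun _ => ε) x y := le_max_right _ _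
      linarith
  · set F := c.range.filter fun y => sep (fun _ => ε) x y ≤ u with hF
    have h1 : ∑ y ∈ F, fiberMass μ G c y = (μ.restrict G).real (c ⁻¹' F) :=
      sum_measureReal_preimage_singleton F fun z _ => c.measurableSet_fiber z
    have h2 : (μ.restrict G).real (c ⁻¹' F) ≤ μ.real (ball x (2 * u)) := by
      rw [measureReal_restrict_apply (c.measurableSet_preimage _)]
      refine measureReal_mono ?_
      rintro y ⟨hy, hyG⟩
      have hy' : sep (fun _ => ε) x (c y) ≤ u :=
        (Finset.mem_filter.1 (Finset.mem_coe.1 (Set.mem_preimage.1 hy))).2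
      have h3 : ‖x - c y‖ ≤ u := (le_max_left _ _).trans hy'
      rw [← dist_eq_norm] at h3
      have h4 := dist_triangle_left y x (c y)
      rw [dist_comm (c y) x] at h4
      rw [mem_ball]
      linarith [hG y hyG]
    have h5 : μ.real (ball x (2 * u)) ≤ c₀ * (2 * u) ^ n :=
      ENNReal.toReal_le_of_le_ofReal (by positivity) (hμ x _ (by positivity))
    rw [h1]
    refine h2.trans (h5.trans_eq ?_)
    ring

lemma riesz_fiberMass (z : E) :
    riesz n (fun _ => ε) (fiberMass μ G c) c.range z =
      ∫ y in G, rk n (fun _ => ε) z (c y) ∂μ :=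
  (integral_comp_simpleFunc c (ν := μ.restrict G) (rk n (fun _ => ε) z)).symm

lemma norm_rk_sub_rk_comp_le (hε : 0 < ε) (hηε : 2 * η ≤ ε) {x y x' y' : E}
    (hx : dist x' x < η) (hy : dist y' y < η) :
    ‖rk n (fun _ => ε) x y - rk n (fun _ => ε) x' y'‖ ≤ 2 * (n + 2) * η * (ε ^ (n + 1))⁻¹ := by
  have key : ∀ a b e : E, dist b a < η → ‖rk n (fun _ => ε) a e - rk n (fun _ => ε) b e‖ ≤
      (n + 2) * η * (ε ^ (n + 1))⁻¹ := fun a b e h => by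
    have h1 : ε + ε ≤ sep (fun _ => ε) a e := le_max_right _ _
    rw [dist_comm, dist_eq_norm] at h
    refine (norm_rk_sub_rk_le (isScale_const hε) a b e (by linarith)).trans ?_
    have h2 : (sep (fun _ => ε) a e ^ (n + 1))⁻¹ ≤ ((2 * ε) ^ (n + 1))⁻¹ :=
      inv_anti₀ (by positivity) (pow_le_pow_left₀ (by positivity) (by linarith) _)
    calc ((n : ℝ) + 2) * 2 ^ (n + 1) * ‖a - b‖ * (sep (fun _ => ε) a e ^ (n + 1))⁻¹
        ≤ ((n : ℝ) + 2) * 2 ^ (n + 1) * η * ((2 * ε) ^ (n + 1))⁻¹ := by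
          refine mul_le_mul (mul_le_mul_of_nonneg_left h.le (by positivity)) h2
            (inv_nonneg.2 (pow_nonneg (by linarith) _)) ?_
          have := (norm_nonneg (a - b)).trans h.le
          positivity
      _ = (n + 2) * η * (ε ^ (n + 1))⁻¹ := by
          rw [mul_pow]
          field_simp
  have h1 := key x x' y hx
  have h2 := key y y' x' hy
  have h3 : rk n (fun _ => ε) x y - rk n (fun _ => ε) x' y' =
      (rk n (fun _ => ε) x y - rk n (fun _ => ε) x' y) -
        (rk n (fun _ => ε) y x' - rk n (fun _ => ε) y' x') := by
    rw [rk_antisymm n _ x' y, rk_antisymm n _ x' y']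
    abel
  rw [h3]
  refine (norm_sub_le _ _).trans ?_
  linarith

lemma norm_integral_rk_sub_riesz_le (hε : 0 < ε) (hηε : 2 * η ≤ ε) (hGm : MeasurableSet G)
    (hG : ∀ x ∈ G, dist (c x) x < η) {x : E} (hx : x ∈ G) :
    ‖(∫ y, rk n (fun _ => ε) x y ∂μ) -
      riesz n (fun _ => ε) (fiberMass μ G c) c.range (c x)‖ ≤
        2 * (n + 2) * η * (ε ^ (n + 1))⁻¹ * μ.real Set.univ + (ε ^ n)⁻¹ * μ.real Gᶜ := by
  have hη : 0 < η := dist_nonneg.trans_lt (hG x hx)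
  have hi := integrable_rk_const (n := n) (μ := μ) hε x
  have hi' : Integrable (fun y => rk n (fun _ => ε) (c x) (c y)) (μ.restrict G) :=
    Integrable.of_bound (((continuous_rk_const hε (c x)).measurable.comp
      c.measurable).aestronglyMeasurable) (ε ^ n)⁻¹
      (Eventually.of_forall fun y => norm_rk_const_le hε _ _)
  rw [riesz_fiberMass, ← integral_add_compl hGm hi, add_sub_right_comm,
    ← integral_sub hi.integrableOn hi']
  refine (norm_add_le _ _).trans (add_le_add ?_ ?_)
  · refine (norm_setIntegral_le_of_norm_le_const (measure_lt_top _ _) fun y hy =>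
      norm_rk_sub_rk_comp_le hε hηε (hG x hx) (hG y hy)).trans ?_
    exact mul_le_mul_of_nonneg_left (measureReal_mono (Set.subset_univ _)) (by positivity)
  · exact norm_setIntegral_le_of_norm_le_const (measure_lt_top _ _) fun y _ =>
      norm_rk_const_le hε x y

lemma lintegral_riesz_comp :
    ∫⁻ x in G, ENNReal.ofReal
      (‖riesz n (fun _ => ε) (fiberMass μ G c) c.range (c x)‖ ^ 2) ∂μ =
        ENNReal.ofReal (rieszEnergy n (fun _ => ε) (fiberMass μ G c) c.range) := by
  rw [lintegral_comp_simpleFunc c (fun z => ENNReal.ofReal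
    (‖riesz n (fun _ => ε) (fiberMass μ G c) c.range z‖ ^ 2)), rieszEnergy,
    ENNReal.ofReal_sum_of_nonneg fun z _ => mul_nonneg (fiberMass_nonneg z) (sq_nonneg _)]
  refine Finset.sum_congr rfl fun z _ => ?_
  rw [ENNReal.ofReal_mul (fiberMass_nonneg z), mul_comm, fiberMass, ofReal_measureReal]

variable {V : Type*} [NormedAddCommGroup V] [NormedSpace ℝ V] {P : E →ₗ[ℝ] V} {s s₀ : ℝ}

lemma ofReal_coneEnergy :
    ENNReal.ofReal (coneEnergy n P s₀ (fun _ => ε) (fiberMass μ G c) c.range) =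
      ∫⁻ x in G, ∫⁻ y in G,
        (if ε ≤ ‖c x - c y‖ ∧ ‖P (c x - c y)‖ < s₀ * ‖c x - c y‖ then
          ENNReal.ofReal ((‖c x - c y‖ ^ n)⁻¹) else 0) ∂μ ∂μ := by
  set g : E → E → ℝ≥0∞ := fun z w => if ε ≤ ‖z - w‖ ∧ ‖P (z - w)‖ < s₀ * ‖z - w‖ then
    ENNReal.ofReal ((‖z - w‖ ^ n)⁻¹) else 0 with hg
  have h1 : ∀ z, ∫⁻ y in G, g z (c y) ∂μ =
      ENNReal.ofReal (conePot n P s₀ (fiberMass μ G c) c.range ε z) := fun z => by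
    rw [lintegral_comp_simpleFunc c (g z), conePot, Finset.sum_filter,
      ENNReal.ofReal_sum_of_nonneg]
    · refine Finset.sum_congr rfl fun w _ => ?_
      simp only [hg]
      split_ifs
      · rw [ENNReal.ofReal_mul (fiberMass_nonneg w), mul_comm, fiberMass, ofReal_measureReal]
      · simp
    · intro w _
      split_ifs
      · exact mul_nonneg (fiberMass_nonneg w) (by positivity)
      · exact le_rfl
  have h0 : ∀ z, 0 ≤ conePot n P s₀ (fiberMass μ G c) c.range ε z := fun z =>
    Finset.sum_nonneg fun w _ => mul_nonneg (fiberMass_nonneg w) (by positivity)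
  change _ = ∫⁻ x in G, ∫⁻ y in G, g (c x) (c y) ∂μ ∂μ
  rw [lintegral_congr fun x => h1 (c x), lintegral_comp_simpleFunc c fun z =>
    ENNReal.ofReal (conePot n P s₀ (fiberMass μ G c) c.range ε z), coneEnergy,
    ENNReal.ofReal_sum_of_nonneg fun z _ => mul_nonneg (fiberMass_nonneg z) (h0 z)]
  refine Finset.sum_congr rfl fun z _ => ?_
  rw [ENNReal.ofReal_mul (fiberMass_nonneg z), mul_comm, fiberMass, ofReal_measureReal]

lemma ofReal_coneEnergy_le (hε : 0 < ε) (hηε : 4 * η ≤ ε) (hs₀ : 0 < s₀) (hs₁ : s₀ ≤ 1)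
    (hs₀s : 2 * s₀ ≤ s) (hηs : 16 * η ≤ s * ε) (hP : ∀ x, ‖P x‖ ≤ ‖x‖) (hGm : MeasurableSet G)
    (hG : ∀ x ∈ G, dist (c x) x < η) :
    ENNReal.ofReal (coneEnergy n P s₀ (fun _ => ε) (fiberMass μ G c) c.range) ≤
      ENNReal.ofReal (2 ^ n) * ∫⁻ x, ∫⁻ y, Set.indicator {y | ‖P (x - y)‖ < s * ‖x - y‖}
        (fun y => ENNReal.ofReal ((‖x - y‖ ^ n)⁻¹)) y ∂μ ∂μ := by
  have key : ∀ x ∈ G, ∀ y ∈ G, (if ε ≤ ‖c x - c y‖ ∧ ‖P (c x - c y)‖ < s₀ * ‖c x - c y‖ then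
      ENNReal.ofReal ((‖c x - c y‖ ^ n)⁻¹) else 0) ≤
        ENNReal.ofReal (2 ^ n) * Set.indicator {y | ‖P (x - y)‖ < s * ‖x - y‖}
          (fun y => ENNReal.ofReal ((‖x - y‖ ^ n)⁻¹)) y := by
    intro x hx y hy
    split_ifs with h
    · obtain ⟨h1, h2⟩ := h
      have hxy : x - y = (c x - c y) - ((c x - x) - (c y - y)) := by abel
      have hx' := hG x hx
      have hy' := hG y hy
      rw [dist_eq_norm] at hx' hy'
      have h3 : ‖(c x - x) - (c y - y)‖ ≤ 2 * η := (norm_sub_le _ _).trans (by linarith)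
      have h4 : ‖x - y‖ ≤ ‖c x - c y‖ + 2 * η := by
        rw [hxy]
        exact (norm_sub_le _ _).trans (by linarith)
      have h5 : ‖c x - c y‖ - 2 * η ≤ ‖x - y‖ := by
        rw [hxy]
        linarith [norm_sub_norm_le (c x - c y) ((c x - x) - (c y - y))]
      have h6 : ‖P (x - y)‖ < s₀ * ‖c x - c y‖ + 2 * η := by
        rw [hxy, map_sub]
        refine (norm_sub_le _ _).trans_lt ?_
        linarith [hP ((c x - x) - (c y - y))]
      have h7 : s₀ * ‖c x - c y‖ ≤ s₀ * ‖x - y‖ + 2 * η := by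
        have := mul_le_mul_of_nonneg_left h5 hs₀.le
        have hη : 0 ≤ η := by linarith [norm_nonneg (c x - x)]
        nlinarith
      have h8 : ε / 2 ≤ ‖x - y‖ := by linarith
      have hmem : y ∈ {y | ‖P (x - y)‖ < s * ‖x - y‖} := by
        change ‖P (x - y)‖ < s * ‖x - y‖
        have h9 : s * (ε / 2) ≤ s * ‖x - y‖ := mul_le_mul_of_nonneg_left h8 (by linarith)
        have h10 : 2 * s₀ * ‖x - y‖ ≤ s * ‖x - y‖ :=
          mul_le_mul_of_nonneg_right hs₀s (norm_nonneg _)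
        linarith
      rw [Set.indicator_of_mem hmem, ← ENNReal.ofReal_mul (by positivity)]
      refine ENNReal.ofReal_le_ofReal ?_
      have h11 : 0 < ‖x - y‖ := by linarith
      rw [← div_eq_mul_inv, ← one_div, div_le_div_iff₀ (pow_pos (by linarith) _)
        (pow_pos h11 _), one_mul, ← mul_pow]
      exact pow_le_pow_left₀ h11.le (by linarith) _
    · exact zero_le
  rw [ofReal_coneEnergy, ← lintegral_const_mul' _ _ ENNReal.ofReal_ne_top]
  refine (setLIntegral_mono' hGm fun x hx => ?_).trans (setLIntegral_le_lintegral G _)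
  rw [← lintegral_const_mul' _ _ ENNReal.ofReal_ne_top]
  exact (setLIntegral_mono' hGm fun y hy => key x hx y hy).trans (setLIntegral_le_lintegral G _)

end Approximation

section Measure

variable {E : Type*} [NormedAddCommGroup E] [InnerProductSpace ℝ E] [FiniteDimensional ℝ E]
  [MeasurableSpace E] [BorelSpace E] {n : ℕ} {c₀ : ℝ}
  {V : Type*} [NormedAddCommGroup V] [NormedSpace ℝ V] {P : E →ₗ[ℝ] V} {s s₀ C : ℝ}

/-- The `L²` bound for truncated Riesz transforms of a finite measure, deduced from the bound for
discrete measures. -/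
lemma EnergyBound.lintegral_norm_sq_le (hE : ∀ j, EnergyBound n P s₀ j C C) (hC : 0 ≤ C)
    (hc₀ : 0 < c₀) (hs₀ : 0 < s₀) (hs₁ : s₀ ≤ 1) (hs₀s : 2 * s₀ ≤ s) (hP : ∀ x, ‖P x‖ ≤ ‖x‖)
    {μ : Measure E} [IsFiniteMeasure μ]
    (hμ : ∀ (x : E) (r : ℝ), 0 < r → μ (ball x r) ≤ ENNReal.ofReal (c₀ * r ^ n))
    {ε : ℝ} (hε : 0 < ε) :
    ∫⁻ x, ENNReal.ofReal
        (‖∫ y in {y | ε < dist x y}, (‖x - y‖ ^ (n + 1))⁻¹ • (x - y) ∂μ‖ ^ 2) ∂μ ≤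
      ENNReal.ofReal (2 * (2 + 2 * 3 ^ n * c₀) ^ 2 + 1 + 2 * ((2 ^ n * c₀) ^ 2 * C) +
          2 * (2 ^ n * c₀ * C) * 2 ^ n) *
        (μ Set.univ + ∫⁻ x, ∫⁻ y, Set.indicator {y | ‖P (x - y)‖ < s * ‖x - y‖}
          (fun y => ENNReal.ofReal ((‖x - y‖ ^ n)⁻¹)) y ∂μ ∂μ) := by
  set M := μ.real Set.univ with hM
  set B := (ε ^ n)⁻¹ with hB
  set L := 2 * ((n : ℝ) + 2) * (ε ^ (n + 1))⁻¹ with hL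
  set D := 2 + 2 * 3 ^ n * c₀ with hD
  set a := 2 ^ n * c₀ with ha
  set I := ∫⁻ x, ∫⁻ y, Set.indicator {y | ‖P (x - y)‖ < s * ‖x - y‖}
    (fun y => ENNReal.ofReal ((‖x - y‖ ^ n)⁻¹)) y ∂μ ∂μ with hI
  have hM0 : 0 ≤ M := measureReal_nonneg
  have hB0 : 0 < B := by positivity
  have hL0 : 0 < L := by positivity
  have hD0 : 0 < D := by positivity
  have ha0 : 0 < a := by positivity
  have hs : 0 < s := by linarith
  set η := min (ε / 4) (min (s * ε / 16) (1 / (L * (M + 1)))) with hη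
  have hη0 : 0 < η := by positivity
  have hη1 : η ≤ ε / 4 := min_le_left _ _
  have hη2 : η ≤ s * ε / 16 := (min_le_right _ _).trans (min_le_left _ _)
  have hη3 : η * (L * (M + 1)) ≤ 1 := (le_div_iff₀ (by positivity)).1
    ((min_le_right _ _).trans (min_le_right _ _))
  set κ := 1 / ((B + 1) ^ 2 * (M + 1)) with hκ
  have hκ0 : 0 < κ := by positivity
  have hκ1 : κ * ((B + 1) ^ 2 * (M + 1)) = 1 := by rw [hκ]; field_simp
  obtain ⟨c, hc⟩ := exists_simpleFunc_dist_lt μ hη0 (ENNReal.ofReal_pos.2 hκ0)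
  set G := {x | dist (c x) x < η} with hGdef
  have hG : ∀ x ∈ G, dist (c x) x < η := fun x hx => hx
  have hGm : MeasurableSet G := measurableSet_lt (c.measurable.dist measurable_id) measurable_const
  have hcompl : μ Gᶜ ≤ ENNReal.ofReal κ := hc
  have hcompl' : μ.real Gᶜ ≤ κ := ENNReal.toReal_le_of_le_ofReal hκ0.le hcompl
  have hBκ : B * κ ≤ 1 := by
    rw [← hκ1, mul_comm]
    refine mul_le_mul_of_nonneg_left ?_ hκ0.le
    nlinarith [mul_nonneg hM0 (sq_nonneg (B + 1)), sq_nonneg B]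
  have hBMκ : (B * M) ^ 2 * κ ≤ M := by
    have h1 : B ^ 2 * M ≤ (B + 1) ^ 2 * (M + 1) := by
      have := mul_nonneg hM0 hB0.le
      nlinarith [sq_nonneg (B + 1)]
    have h2 := mul_le_mul_of_nonneg_left h1 (mul_nonneg hM0 hκ0.le)
    calc (B * M) ^ 2 * κ = M * κ * (B ^ 2 * M) := by ring
      _ ≤ M * κ * ((B + 1) ^ 2 * (M + 1)) := h2
      _ = M * (κ * ((B + 1) ^ 2 * (M + 1))) := by ring
      _ = M := by rw [hκ1, mul_one]
  set T := fun z => riesz n (fun _ => ε) (fiberMass μ G c) c.range z with hT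
  have hgood : ∀ x ∈ G, ENNReal.ofReal
      (‖∫ y in {y | ε < dist x y}, (‖x - y‖ ^ (n + 1))⁻¹ • (x - y) ∂μ‖ ^ 2) ≤
        ENNReal.ofReal (2 * D ^ 2) + ENNReal.ofReal 2 * ENNReal.ofReal (‖T (c x)‖ ^ 2) := by
    intro x hx
    have h1 := norm_setIntegral_sub_integral_rk_le hε hc₀.le hμ x
    have h2 := norm_integral_rk_sub_riesz_le (n := n) (μ := μ) hε (by linarith) hGm hG hx
    have h3 : 2 * ((n : ℝ) + 2) * η * (ε ^ (n + 1))⁻¹ * M + B * μ.real Gᶜ ≤ 2 := by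
      have h4 : 2 * ((n : ℝ) + 2) * η * (ε ^ (n + 1))⁻¹ * M = η * (L * M) := by
        rw [hL]
        ring
      have h5 : η * (L * M) ≤ η * (L * (M + 1)) := by
        gcongr
        linarith
      have h6 := mul_le_mul_of_nonneg_left hcompl' hB0.le
      rw [h4]
      linarith
    set R := ∫ y in {y | ε < dist x y}, (‖x - y‖ ^ (n + 1))⁻¹ • (x - y) ∂μ
    set S := ∫ y, rk n (fun _ => ε) x y ∂μ
    have h7 : ‖R‖ ≤ D + ‖T (c x)‖ := by
      have h8 : ‖S‖ - ‖T (c x)‖ ≤ ‖S - T (c x)‖ := norm_sub_norm_le _ _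
      have h9 := norm_sub_norm_le R S
      have h10 := h2.trans h3
      linarith
    rw [← ENNReal.ofReal_mul zero_le_two, ← ENNReal.ofReal_add (by positivity) (by positivity)]
    refine ENNReal.ofReal_le_ofReal ?_
    have h8 := pow_le_pow_left₀ (norm_nonneg R) h7 2
    linarith [sq_nonneg (D - ‖T (c x)‖), add_sq D ‖T (c x)‖, sub_sq D ‖T (c x)‖]
  have hbad : ∀ x, ENNReal.ofReal
      (‖∫ y in {y | ε < dist x y}, (‖x - y‖ ^ (n + 1))⁻¹ • (x - y) ∂μ‖ ^ 2) ≤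
        ENNReal.ofReal ((B * M) ^ 2) := fun x =>
    ENNReal.ofReal_le_ofReal
      (pow_le_pow_left₀ (norm_nonneg _) (norm_setIntegral_le_measureReal hε x) 2)
  have hMμ : ENNReal.ofReal M = μ Set.univ := ofReal_measureReal
  have hcone := ofReal_coneEnergy_le (n := n) (P := P) (s := s) (s₀ := s₀) (μ := μ) hε
    (by linarith) hs₀ hs₁ hs₀s (by linarith) hP hGm hG
  have hcone0 : 0 ≤ coneEnergy n P s₀ (fun _ => ε) (fiberMass μ G c) c.range :=
    coneEnergy_nonneg fiberMass_nonneg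
  have henergy : ENNReal.ofReal (rieszEnergy n (fun _ => ε) (fiberMass μ G c) c.range) ≤
      ENNReal.ofReal (a ^ 2 * C) * μ Set.univ + ENNReal.ofReal (a * C * 2 ^ n) * I := by
    have h1 := (hE c.range.card).of_growth le_rfl (fiberMass_nonneg (μ := μ) (G := G) (c := c))
      (isScale_const hε) ha0 (growth_fiberMass hε (by linarith) hc₀.le hG hμ)
    have h2 : a ^ 2 * C * ∑ z ∈ c.range, fiberMass μ G c z ≤ a ^ 2 * C * M :=
      mul_le_mul_of_nonneg_left (sum_fiberMass_le _) (by positivity)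
    refine (ENNReal.ofReal_le_ofReal (h1.trans (add_le_add_left h2 _))).trans ?_
    rw [ENNReal.ofReal_add (by positivity) (by positivity),
      ENNReal.ofReal_mul (p := a ^ 2 * C) (by positivity), hMμ,
      ENNReal.ofReal_mul (p := a * C) (by positivity),
      ENNReal.ofReal_mul (p := a * C) (by positivity), mul_assoc _ _ I]
    exact add_le_add_right (mul_le_mul_right hcone _) _
  rw [← lintegral_add_compl _ hGm]
  have h1 : ∫⁻ x in G, ENNReal.ofReal
      (‖∫ y in {y | ε < dist x y}, (‖x - y‖ ^ (n + 1))⁻¹ • (x - y) ∂μ‖ ^ 2) ∂μ ≤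
        ENNReal.ofReal (2 * D ^ 2) * μ Set.univ + ENNReal.ofReal 2 *
          (ENNReal.ofReal (a ^ 2 * C) * μ Set.univ + ENNReal.ofReal (a * C * 2 ^ n) * I) := by
    refine (setLIntegral_mono' hGm hgood).trans ?_
    rw [lintegral_add_left measurable_const, lintegral_const,
      lintegral_const_mul' _ _ ENNReal.ofReal_ne_top, lintegral_riesz_comp]
    refine add_le_add (mul_le_mul_right (Measure.restrict_le_self _) _) (mul_le_mul_right henergy _)
  have h2 : ∫⁻ x in Gᶜ, ENNReal.ofReal
      (‖∫ y in {y | ε < dist x y}, (‖x - y‖ ^ (n + 1))⁻¹ • (x - y) ∂μ‖ ^ 2) ∂μ ≤ μ Set.univ := by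
    refine (lintegral_mono hbad).trans ?_
    rw [lintegral_const, Measure.restrict_apply_univ, ← hMμ]
    refine (mul_le_mul_right hcompl _).trans ?_
    rw [← ENNReal.ofReal_mul (by positivity)]
    exact ENNReal.ofReal_le_ofReal hBMκ
  have h3 : ENNReal.ofReal (2 * D ^ 2 + 1 + 2 * (a ^ 2 * C)) * μ Set.univ =
      ENNReal.ofReal (2 * D ^ 2) * μ Set.univ +
        ENNReal.ofReal 2 * (ENNReal.ofReal (a ^ 2 * C) * μ Set.univ) + μ Set.univ := by
    rw [ENNReal.ofReal_add (by positivity) (by positivity),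
      ENNReal.ofReal_add (by positivity) (by positivity), ENNReal.ofReal_one,
      ENNReal.ofReal_mul (p := 2) (q := a ^ 2 * C) zero_le_two]
    ring
  have h4 : ENNReal.ofReal (2 * (a * C) * 2 ^ n) * I =
      ENNReal.ofReal 2 * (ENNReal.ofReal (a * C * 2 ^ n) * I) := by
    rw [mul_assoc 2, ENNReal.ofReal_mul zero_le_two, mul_assoc]
  refine (add_le_add h1 h2).trans ?_
  rw [mul_add (ENNReal.ofReal (2 * D ^ 2 + 1 + 2 * (a ^ 2 * C) + _))]
  calc _ = ENNReal.ofReal (2 * D ^ 2 + 1 + 2 * (a ^ 2 * C)) * μ Set.univ +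
        ENNReal.ofReal (2 * (a * C) * 2 ^ n) * I := by
        rw [h3, h4]
        ring
    _ ≤ _ := by
        have h5 : 0 ≤ 2 * (a * C) * 2 ^ n := by positivity
        have h6 : 0 ≤ 2 * D ^ 2 + 1 + 2 * (a ^ 2 * C) := by positivity
        exact add_le_add
          (mul_le_mul_left (ENNReal.ofReal_le_ofReal (le_add_of_nonneg_right h5)) _)
          (mul_le_mul_left (ENNReal.ofReal_le_ofReal (le_add_of_nonneg_left h6)) _)

end Measure

/-- The distance to a subspace is the norm of the projection onto its orthogonal complement. -/
lemma Submodule.infDist_eq_norm_starProjection_orthogonal {E : Type*} [NormedAddCommGroup E]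
    [InnerProductSpace ℝ E] [FiniteDimensional ℝ E] (W : Submodule ℝ E) (x : E) :
    infDist x W = ‖Wᗮ.starProjection x‖ := by
  rw [Submodule.starProjection_orthogonal, _root_.sub_apply,
    ContinuousLinearMap.id_apply, Submodule.starProjection_minimal, infDist_eq_iInf]
  simp_rw [dist_eq_norm]
  rfl

/-- Any subspace of codimension `n` is the kernel of a partial isometry onto `ℝⁿ`. -/
lemma Submodule.exists_norm_eq_infDist {d n : ℕ} (W : Submodule ℝ (EuclideanSpace ℝ (Fin d)))
    (hnd : n ≤ d) (hW : Module.finrank ℝ W = d - n) :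
    ∃ (P : EuclideanSpace ℝ (Fin d) →ₗ[ℝ] EuclideanSpace ℝ (Fin n))
      (J : EuclideanSpace ℝ (Fin n) →ₗ[ℝ] EuclideanSpace ℝ (Fin d)),
      (∀ x, ‖P x‖ = infDist x W) ∧ (∀ v, P (J v) = v) ∧ ∀ v, ‖J v‖ ≤ ‖v‖ := by
  have hdim : Module.finrank ℝ Wᗮ = n := Submodule.finrank_add_finrank_orthogonal' (by
    rw [hW, finrank_euclideanSpace_fin]
    omega)
  let e := ((stdOrthonormalBasis ℝ Wᗮ).reindex (finCongr hdim)).repr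
  refine ⟨e.toLinearEquiv.toLinearMap ∘ₗ Wᗮ.orthogonalProjectionOnto.toLinearMap,
    Wᗮ.subtype ∘ₗ e.symm.toLinearEquiv.toLinearMap, fun x => ?_, fun v => ?_, fun v => ?_⟩
  · rw [W.infDist_eq_norm_starProjection_orthogonal, Submodule.starProjection_apply]
    exact e.norm_map _
  · change e (Wᗮ.orthogonalProjectionOnto (e.symm v : EuclideanSpace ℝ (Fin d))) = v
    rw [Submodule.orthogonalProjectionOnto_mem_subspace_eq_self, e.apply_symm_apply]
  · exact (e.symm.norm_map v).le

/-- Let `0 < n < d`, `V₀ ∈ G(d, d-n)`, `s > 0`, `K = K(V₀,s) ⊆ ℝ^d`, and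
let `μ` be a Borel measure with growth `μ(B(x,r)) ≤ c₀ rⁿ`. Then
`sup_{ε>0} ∫ |R^n_ε μ|² dμ ≤ C (μ(ℝ^d) + ∬_{x-y ∈ K} |x-y|⁻ⁿ dμ dμ)` with
`C = C(d, n, c₀, s)`. -/
theorem statement15 (d n : ℕ) (hn : 0 < n) (hnd : n < d) (c₀ s : ℝ) (hc₀ : 0 < c₀)
    (hs : 0 < s) :
    ∃ C : ℝ, 0 < C ∧
      ∀ V₀ : Submodule ℝ (EuclideanSpace ℝ (Fin d)), Module.finrank ℝ V₀ = d - n →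
      ∀ μ : Measure (EuclideanSpace ℝ (Fin d)),
        (∀ x : EuclideanSpace ℝ (Fin d), ∀ r : ℝ, 0 < r →
          μ (Metric.ball x r) ≤ ENNReal.ofReal (c₀ * r ^ n)) →
        (⨆ (ε : ℝ) (_ : 0 < ε),
            ∫⁻ x, ENNReal.ofReal
              (‖∫ y in {y | ε < dist x y}, (‖x - y‖ ^ (n + 1))⁻¹ • (x - y) ∂μ‖ ^ 2) ∂μ)
          ≤ ENNReal.ofReal C *
            (μ Set.univ + ∫⁻ x, ∫⁻ y,
              Set.indicator {y | x - y ∈ coneK (V₀ : Set (EuclideanSpace ℝ (Fin d))) s}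
                (fun y => ENNReal.ofReal ((‖x - y‖ ^ n)⁻¹)) y ∂μ ∂μ) := by
  obtain ⟨k, rfl⟩ : ∃ k, n = k + 1 := ⟨n - 1, by omega⟩
  set s₀ := min (s / 2) 1 with hs₀
  have hs₀0 : 0 < s₀ := by positivity
  have hs₀1 : s₀ ≤ 1 := min_le_right _ _
  have hs₀s : 2 * s₀ ≤ s := by linarith [min_le_left (s / 2) 1]
  obtain ⟨C, hC, hE⟩ := exists_energyBound (k := k) (V := EuclideanSpace ℝ (Fin (k + 1))) d
    finrank_euclideanSpace_fin hs₀0 hs₀1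
  refine ⟨2 * (2 + 2 * 3 ^ (k + 1) * c₀) ^ 2 + 1 + 2 * ((2 ^ (k + 1) * c₀) ^ 2 * C) +
    2 * (2 ^ (k + 1) * c₀ * C) * 2 ^ (k + 1), by positivity, fun V₀ hV₀ μ hμ => ?_⟩
  obtain ⟨P, J, hP, hPJ, hJ⟩ := V₀.exists_norm_eq_infDist hnd.le hV₀
  have hP' : ∀ x, ‖P x‖ ≤ ‖x‖ := fun x => by
    rw [hP x, ← dist_zero_right]
    exact infDist_le_dist_of_mem V₀.zero_mem
  refine iSup₂_le fun ε hε => ?_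
  rcases eq_or_ne (μ Set.univ) ∞ with htop | htop
  · rw [htop, _root_.top_add, ENNReal.mul_top (ENNReal.ofReal_pos.2 (by positivity)).ne']
    exact le_top
  · have : IsFiniteMeasure μ := ⟨htop.lt_top⟩
    have h := EnergyBound.lintegral_norm_sq_le (s := s) (fun j => hE P J hP' hPJ hJ j) hC hc₀ hs₀0
      hs₀1 hs₀s hP' hμ hε
    simp only [hP] at h
    exact h
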